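/- For every sufficiently large real X, the interval [X − X^{4/5}, X] contains at least two prime numbers. -/

import Mathlib

namespace TP
open Finset

/-- e^{ix} -/
noncomputable def ee (x : ℝ) : ℂ := Complex.exp ((x : ℂ) * Complex.I)

lemma ee_norm (x : ℝ) : ‖ee x‖ = 1 := by
  unfold ee; exact Complex.norm_exp_ofReal_mul_I x

lemma ee_add (x y : ℝ) : ee (x + y) = ee x * ee y := by
  unfold ee; rw [← Complex.exp_add]; congr 1; push_cast; ring

lemma ee_neg (x : ℝ) : ee (-x) = (starRingEnd ℂ) (ee x) := by
  unfold ee; rw [← Complex.exp_conj]; congr 1; simp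

lemma ee_zero : ee 0 = 1 := by simp [ee]

lemma ee_sub_one_ge {g : ℝ} (h0 : 0 ≤ g) (h1 : g ≤ Real.pi) : 2 * g / Real.pi ≤ ‖ee g - 1‖ := by
  unfold ee
  have := Complex.norm_exp_I_mul_ofReal_sub_one g
  rw [mul_comm (g:ℂ)]
  rw [this, Real.norm_eq_abs, abs_mul]
  have h2 := Real.mul_le_sin (x := g/2) (by linarith) (by linarith)
  have h3 := le_abs_self (Real.sin (g/2))
  have h4 : |(2:ℝ)| = 2 := by norm_num
  rw [h4]
  have h5 : 2 / Real.pi * (g/2) = g / Real.pi := by ring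
  have h6 : 2 * g / Real.pi = 2 * (g / Real.pi) := by ring
  rw [h6]; linarith

lemma ee_sub_le (x y : ℝ) : ‖ee x - ee y‖ ≤ |x - y| := by
  have h : ee x - ee y = ee y * (ee (x - y) - 1) := by
    rw [mul_sub, ← ee_add]; simp
  rw [h, norm_mul, ee_norm, one_mul]
  have := Complex.norm_exp_I_mul_ofReal_sub_one (x-y)
  unfold ee
  rw [mul_comm, this, Real.norm_eq_abs, abs_mul]
  have h3 : |Real.sin ((x-y)/2)| ≤ |(x-y)/2| := Real.abs_sin_le_abs
  rw [abs_div] at h3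
  have h4 : |(2:ℝ)| = 2 := by norm_num
  rw [h4] at *; linarith

lemma kl_aux (φ : ℕ → ℝ) (g : ℕ → ℝ) (hg : ∀ n, g n = φ (n+1) - φ n)
    (l : ℝ) (hl : 0 < l) (N : ℕ) (h1 : ∀ n ≤ N, l ≤ g n) (h2 : ∀ n ≤ N, g n ≤ Real.pi)
    (h3 : ∀ n < N, g (n+1) ≤ g n) :
    ‖∑ n ∈ range (N+1), ee (φ n) - ee (φ (N+1)) * (1 / (ee (g N) - 1))‖
      ≤ Real.pi / 2 / g 0 + Real.pi^2/4 * (1 / g N - 1 / g 0) := by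
  have key : ∀ x, l ≤ x → x ≤ Real.pi → ee x - 1 ≠ 0 ∧ ‖1 / (ee x - 1)‖ ≤ Real.pi / 2 / x := by
    intro x hx hx'
    have hx0 : 0 < x := by linarith
    have := ee_sub_one_ge hx0.le hx'
    have hp : 0 < 2 * x / Real.pi := by positivity
    refine ⟨fun h => ?_, ?_⟩
    · rw [h, norm_zero] at this; linarith
    · rw [norm_div, norm_one]
      calc 1 / ‖ee x - 1‖ ≤ 1 / (2 * x / Real.pi) := one_div_le_one_div_of_le hp this
        _ = _ := by field_simp
  have estep : ∀ n, ee (φ (n+1)) = ee (φ n) * ee (g n) := by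
    intro n; rw [← ee_add, hg]; congr 1; ring
  induction N with
  | zero =>
    obtain ⟨k1, k2⟩ := key (g 0) (h1 0 le_rfl) (h2 0 le_rfl)
    have : ∑ n ∈ range (0+1), ee (φ n) - ee (φ (0+1)) * (1 / (ee (g 0) - 1)) = - (ee (φ 0) * (1 / (ee (g 0) - 1))) := by
      rw [estep]; simp; field_simp; ring
    rw [this, norm_neg, norm_mul, ee_norm]; simpa using k2
  | succ N ih =>
    have ih' := ih (fun n hn => h1 n (by omega)) (fun n hn => h2 n (by omega)) (fun n hn => h3 n (by omega))
    obtain ⟨k1, k2⟩ := key (g N) (h1 N (by omega)) (h2 N (by omega))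
    obtain ⟨k3, k4⟩ := key (g (N+1)) (h1 _ le_rfl) (h2 _ le_rfl)
    have e1 : ∑ n ∈ range (N+1+1), ee (φ n) - ee (φ (N+1+1)) * (1 / (ee (g (N+1)) - 1))
        = (∑ n ∈ range (N+1), ee (φ n) - ee (φ (N+1)) * (1 / (ee (g N) - 1)))
          + ee (φ (N+1)) * ((ee (g (N+1)) - ee (g N)) * ((1 / (ee (g N) - 1)) * (1 / (ee (g (N+1)) - 1)))) := by
      rw [sum_range_succ, estep (N+1)]; field_simp; ring
    rw [e1]
    refine (norm_add_le _ _).trans ?_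
    have e2 : ‖ee (φ (N+1)) * ((ee (g (N+1)) - ee (g N)) * ((1 / (ee (g N) - 1)) * (1 / (ee (g (N+1)) - 1))))‖
        ≤ Real.pi^2/4 * (1 / g (N+1) - 1 / g N) := by
      rw [norm_mul, ee_norm, one_mul, norm_mul, norm_mul]
      have hN := h1 N (by omega)
      have hN1 := h1 (N+1) le_rfl
      have hd := h3 N (by omega)
      have p1 : 0 < g N := by linarith
      have p2 : 0 < g (N+1) := by linarith
      have h5 : ‖ee (g (N+1)) - ee (g N)‖ ≤ g N - g (N+1) := by
        refine (ee_sub_le _ _).trans ?_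
        rw [abs_sub_comm, abs_of_nonneg (by linarith)]
      calc _ ≤ (g N - g (N+1)) * ((Real.pi / 2 / g N) * (Real.pi / 2 / g (N+1))) := by
            gcongr
        _ = _ := by field_simp; ring
    have : Real.pi^2/4 * (1 / g (N+1) - 1 / g 0) = Real.pi^2/4 * (1 / g N - 1 / g 0) + Real.pi^2/4 * (1 / g (N+1) - 1 / g N) := by ring
    linarith

lemma kuzmin_landau (φ : ℕ → ℝ) 
    (l : ℝ) (hl : 0 < l) (N : ℕ) (h1 : ∀ n < N, l ≤ φ (n+1) - φ n) (h2 : ∀ n < N, φ (n+1) - φ n ≤ Real.pi)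
    (h3 : ∀ n, n + 1 < N → φ (n+1+1) - φ (n+1) ≤ φ (n+1) - φ n) :
    ‖∑ n ∈ range N, ee (φ n)‖ ≤ 6 / l := by
  cases N with
  | zero => simp; positivity
  | succ N =>
    have h := kl_aux φ (fun n => φ (n+1) - φ n) (fun n => rfl) l hl N (fun n hn => h1 n (by omega))
      (fun n hn => h2 n (by omega)) (fun n hn => h3 n (by omega))
    have hN := h1 N (by omega)
    have hN2 := h2 N (by omega)
    have h0 := h1 0 (by omega)
    set x := φ (N+1) - φ N with hx
    set x0 := φ (0+1) - φ 0 with hx0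
    have hxp : 0 < x := by linarith
    have hx0p : 0 < x0 := by linarith
    have h4 : ‖ee (φ (N+1)) * (1 / (ee x - 1))‖ ≤ Real.pi / 2 / x := by
      rw [norm_mul, ee_norm, one_mul, norm_div, norm_one]
      have hp : 0 < 2 * x / Real.pi := by positivity
      calc 1 / ‖ee x - 1‖ ≤ 1 / (2 * x / Real.pi) := one_div_le_one_div_of_le hp (ee_sub_one_ge hxp.le hN2)
        _ = _ := by field_simp
    have h5 : ‖∑ n ∈ range (N+1), ee (φ n)‖ ≤ ‖∑ n ∈ range (N+1), ee (φ n) - ee (φ (N+1)) * (1 / (ee x - 1))‖ + ‖ee (φ (N+1)) * (1 / (ee x - 1))‖ := by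
      simpa using norm_add_le (∑ n ∈ range (N+1), ee (φ n) - ee (φ (N+1)) * (1 / (ee x - 1))) (ee (φ (N+1)) * (1 / (ee x - 1)))
    have i1 : 1 / x ≤ 1 / l := one_div_le_one_div_of_le hl hN
    have i2 : 1 / x0 ≤ 1 / l := one_div_le_one_div_of_le hl h0
    have i3 : 0 < 1 / x0 := by positivity
    have pi1 := Real.pi_lt_d2
    have pi2 := Real.pi_gt_three
    have j1 : Real.pi / 2 / x0 = Real.pi / 2 * (1 / x0) := by ring
    have j2 : Real.pi / 2 / x = Real.pi / 2 * (1 / x) := by ring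
    have j3 : 6 / l = 6 * (1 / l) := by ring
    rw [j3]
    have k1 : Real.pi / 2 / x0 ≤ 1.6 * (1/l) := by rw [j1]; gcongr; linarith
    have k2 : Real.pi / 2 / x ≤ 1.6 * (1/l) := by rw [j2]; gcongr; linarith
    have k3 : Real.pi^2/4 * (1 / x - 1 / x0) ≤ 2.6 * (1/l) := by
      have : Real.pi^2/4 ≤ 2.6 := by nlinarith
      calc Real.pi^2/4 * (1 / x - 1 / x0) ≤ Real.pi^2/4 * (1/l) := by gcongr; linarith
        _ ≤ _ := by gcongr
    have : 0 < 1 / l := by positivity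
    linarith

/-! van der Corput inequality -/

lemma sum_shift {F : ℕ → ℂ} (h L : ℕ) (h1 : ∀ n < h, F n = 0) (h2 : ∀ n, L ≤ n → F n = 0) :
    ∑ m ∈ range L, F (m + h) = ∑ n ∈ range L, F n := by
  have a := Finset.sum_range_add F L h
  have b := Finset.sum_range_add F h L
  rw [add_comm h L, a] at b
  have c : ∑ x ∈ range h, F (L + x) = 0 := sum_eq_zero fun x _ => h2 _ (by omega)
  have d : ∑ x ∈ range h, F x = 0 := sum_eq_zero fun x hx => h1 _ (by simpa using hx)
  rw [c, d] at b
  simp only [add_zero, zero_add] at b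
  rw [b]; exact sum_congr rfl fun m _ => by rw [add_comm]

lemma vdc (z : ℕ → ℂ) (N H : ℕ) :
    (H:ℝ) * ‖∑ n ∈ range N, z n‖^2 ≤ 2 * (N + H) * ∑ d ∈ range H, ‖∑ n ∈ range (N - d), z (n + d) * (starRingEnd ℂ) (z n)‖ := by
  classical
  set w : ℕ → ℂ := fun n => if H ≤ n ∧ n < N + H then z (n - H) else 0 with hw
  have w1 : ∀ n < H, w n = 0 := fun n hn => by simp [hw]; intro h; omega
  have w2 : ∀ n, N + H ≤ n → w n = 0 := fun n hn => by simp [hw]; intro _ h; omega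
  have w3 : ∀ n < N, w (n + H) = z n := fun n hn => by simp [hw]; intro h; omega
  set S := ∑ n ∈ range N, z n with hS
  set C : ℕ → ℂ := fun d => ∑ n ∈ range (N - d), z (n + d) * (starRingEnd ℂ) (z n) with hC
  have hS' : ∀ h < H, ∑ m ∈ range (N + H), w (m + h) = S := by
    intro h hh
    rw [sum_shift h (N+H) (fun n hn => w1 n (by omega)) w2, add_comm N H, sum_range_add]
    rw [sum_eq_zero (s := range H) (fun n hn => w1 n (by simpa using hn)), zero_add]
    exact sum_congr rfl fun n hn => by rw [add_comm]; exact w3 n (by simpa using hn)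
  have hcor : ∀ d h', h' ≤ H → ∑ m ∈ range (N+H), w (m + h' + d) * (starRingEnd ℂ) (w (m + h')) = C d := by
    intro d h' hh'
    rw [sum_shift (F := fun n => w (n + d) * (starRingEnd ℂ) (w n)) h' (N+H)
      (fun n hn => by simp [w1 n (by omega)]) (fun n hn => by simp [w2 n hn])]
    rw [add_comm N H, sum_range_add]
    rw [sum_eq_zero (s := range H) (fun n hn => by simp [w1 n (by simpa using hn)]), zero_add]
    simp only [hC]
    have : range (N - d) ⊆ range N := by intro x; simp; omega
    rw [← sum_subset this]
    · refine sum_congr rfl fun n hn => ?_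
      have hn' : n < N - d := by simpa using hn
      have e1 : H + n + d = (n + d) + H := by ring
      rw [e1, w3 _ (by omega), add_comm H n, w3 _ (by omega)]
    · intro n hn hn'
      simp at hn hn'
      rw [w2 (H + n + d) (by omega)]; simp
  have hHS : (H:ℂ) * S = ∑ m ∈ range (N+H), ∑ h ∈ range H, w (m + h) := by
    rw [sum_comm, sum_congr rfl (fun h hh => hS' h (by simpa using hh))]; simp
  have hcs : (H:ℝ)^2 * ‖S‖^2 ≤ (N + H) * ∑ m ∈ range (N+H), ‖∑ h ∈ range H, w (m + h)‖^2 := by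
    have : (H:ℝ) * ‖S‖ ≤ ∑ m ∈ range (N+H), ‖∑ h ∈ range H, w (m + h)‖ := by
      have := norm_sum_le (range (N+H)) (fun m => ∑ h ∈ range H, w (m + h))
      rw [← hHS, norm_mul] at this; simpa using this
    calc (H:ℝ)^2 * ‖S‖^2 = ((H:ℝ) * ‖S‖)^2 := by ring
      _ ≤ (∑ m ∈ range (N+H), ‖∑ h ∈ range H, w (m + h)‖)^2 := by gcongr
      _ ≤ _ := by
        have := sq_sum_le_card_mul_sum_sq (s := range (N+H)) (f := fun m => ‖∑ h ∈ range H, w (m + h)‖)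
        simpa using this
  have hexp : ((∑ m ∈ range (N+H), ‖∑ h ∈ range H, w (m + h)‖^2 : ℝ) : ℂ) =
      ∑ h ∈ range H, ∑ h' ∈ range H, ∑ m ∈ range (N+H), w (m + h) * (starRingEnd ℂ) (w (m + h')) := by
    push_cast
    have : ∀ m, ((‖∑ h ∈ range H, w (m + h)‖:ℂ))^2 = ∑ h ∈ range H, ∑ h' ∈ range H, w (m + h) * (starRingEnd ℂ) (w (m + h')) := by
      intro m
      rw [← Complex.mul_conj', map_sum, sum_mul_sum]
    simp_rw [this]
    rw [sum_comm]
    refine sum_congr rfl fun h _ => ?_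
    rw [sum_comm]
  have hb : ∀ h ∈ range H, ∑ h' ∈ range H, ‖∑ m ∈ range (N+H), w (m + h) * (starRingEnd ℂ) (w (m + h'))‖ ≤ 2 * ∑ d ∈ range H, ‖C d‖ := by
    intro h hh
    have hh0 : h < H := by simpa using hh
    have hpt : ∀ h' ∈ range H, ‖∑ m ∈ range (N+H), w (m + h) * (starRingEnd ℂ) (w (m + h'))‖ ≤
        (if h' ≤ h then ‖C (h - h')‖ else 0) + (if h ≤ h' then ‖C (h' - h)‖ else 0) := by
      intro h' hh'
      have hh'0 : h' < H := by simpa using hh'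
      rcases le_total h' h with hle | hle
      · rw [if_pos hle]
        have := hcor (h - h') h' hh'0.le
        have e : ∀ m, m + h' + (h - h') = m + h := fun m => by omega
        simp_rw [e] at this
        rw [this]
        have : 0 ≤ (if h ≤ h' then ‖C (h' - h)‖ else 0) := by split_ifs <;> positivity
        linarith
      · rw [if_pos hle]
        have := hcor (h' - h) h hh0.le
        have e : ∀ m, m + h + (h' - h) = m + h' := fun m => by omega
        simp_rw [e] at this
        have e2 : ‖∑ m ∈ range (N+H), w (m + h) * (starRingEnd ℂ) (w (m + h'))‖ = ‖C (h'-h)‖ := by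
          rw [← this, ← Complex.norm_conj, map_sum]
          congr 1; refine sum_congr rfl fun m _ => ?_
          simp [mul_comm]
        rw [e2]
        have : 0 ≤ (if h' ≤ h then ‖C (h - h')‖ else 0) := by split_ifs <;> positivity
        linarith
    refine (sum_le_sum hpt).trans ?_
    rw [sum_add_distrib, two_mul]
    have inj : ∀ (f : ℕ → ℕ) (P : ℕ → Prop) [DecidablePred P], (∀ x ∈ range H, P x → f x < H) → (∀ x y, P x → P y → f x = f y → x = y) →
        ∑ h' ∈ range H, (if P h' then ‖C (f h')‖ else 0) ≤ ∑ d ∈ range H, ‖C d‖ := by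
      intro f P _ hf hi
      rw [← sum_filter, ← sum_image (f := fun d => ‖C d‖) (g := f)]
      · refine sum_le_sum_of_subset_of_nonneg ?_ (fun _ _ _ => norm_nonneg _)
        intro x hx
        simp only [mem_image, mem_filter] at hx
        obtain ⟨a, ⟨ha, hb⟩, rfl⟩ := hx
        simpa using hf a ha hb
      · intro x hx y hy hxy
        simp at hx hy
        exact hi x y hx.2 hy.2 hxy
    refine add_le_add (inj (fun h' => h - h') (fun h' => h' ≤ h) (fun x _ _ => by omega) (fun x y _ _ _ => by omega))
      (inj (fun h' => h' - h) (fun h' => h ≤ h') (fun x hx _ => by simp at hx; omega) (fun x y _ _ _ => by omega))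
  have hfin : ∑ m ∈ range (N+H), ‖∑ h ∈ range H, w (m + h)‖^2 ≤ 2 * H * ∑ d ∈ range H, ‖C d‖ := by
    have : (∑ m ∈ range (N+H), ‖∑ h ∈ range H, w (m + h)‖^2) = ‖((∑ m ∈ range (N+H), ‖∑ h ∈ range H, w (m + h)‖^2 : ℝ) : ℂ)‖ := by
      rw [Complex.norm_real, Real.norm_of_nonneg]; positivity
    rw [this, hexp]
    calc _ ≤ ∑ h ∈ range H, ∑ h' ∈ range H, ‖∑ m ∈ range (N+H), w (m + h) * (starRingEnd ℂ) (w (m + h'))‖ :=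
          (norm_sum_le _ _).trans (sum_le_sum fun _ _ => norm_sum_le _ _)
      _ ≤ ∑ h ∈ range H, 2 * ∑ d ∈ range H, ‖C d‖ := sum_le_sum hb
      _ = _ := by simp; ring
  rcases Nat.eq_zero_or_pos H with h0 | h0
  · subst h0; simp
  · have hH : (0:ℝ) < H := by exact_mod_cast h0
    have : (H:ℝ) * (H * ‖S‖^2) ≤ H * (2 * (N+H) * ∑ d ∈ range H, ‖C d‖) := by
      calc (H:ℝ) * (H * ‖S‖^2) = (H:ℝ)^2 * ‖S‖^2 := by ring
        _ ≤ (N + H) * (2 * H * ∑ d ∈ range H, ‖C d‖) := hcs.trans (by gcongr)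
        _ = _ := by ring
    exact le_of_mul_le_mul_left this hH

end TP

namespace TP
open Finset

/-- iterated derivatives of log -/
noncomputable def lf : ℕ → ℝ → ℝ
  | 0, x => Real.log x
  | (j+1), x => (-1)^j * (j.factorial : ℝ) * (x^(j+1))⁻¹

lemma lf_deriv (j : ℕ) (x : ℝ) (hx : 0 < x) : HasDerivAt (lf j) (lf (j+1) x) x := by
  cases j with
  | zero =>
    have := Real.hasDerivAt_log hx.ne'
    have e : lf 0 = Real.log := by funext x; rfl
    rw [e]; simpa [lf] using this
  | succ j =>
    have h1 := (hasDerivAt_pow (j+1) x).inv (pow_ne_zero _ hx.ne')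
    have h2 := h1.const_mul ((-1)^j * (j.factorial : ℝ))
    have e : lf (j+1) = fun x => (-1)^j * (j.factorial : ℝ) * (x^(j+1))⁻¹ := by funext x; rfl
    rw [e]
    refine HasDerivAt.congr_deriv (f := fun x => (-1)^j * (j.factorial : ℝ) * (x^(j+1))⁻¹) h2 ?_
    have e3 : lf (j+1+1) x = (-1:ℝ)^(j+1) * (((j+1).factorial : ℕ) : ℝ) * (x^(j+1+1))⁻¹ := rfl
    rw [e3]
    rw [Nat.factorial_succ, Nat.add_sub_cancel]
    push_cast
    have : x^j ≠ 0 := pow_ne_zero _ hx.ne'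
    field_simp
    try ring

def DD : List ℕ → (ℝ → ℝ) → ℝ → ℝ
  | [], f, x => f x
  | (h::hs), f, x => DD hs f (x + h) - DD hs f x

lemma DD_deriv (f f' : ℝ → ℝ) (hf : ∀ x, 0 < x → HasDerivAt f (f' x) x) (hs : List ℕ) :
    ∀ x, 0 < x → HasDerivAt (DD hs f) (DD hs f' x) x := by
  induction hs with
  | nil => exact hf
  | cons h hs ih =>
    intro x hx
    have h1 := ih (x + h) (by positivity)
    have h2 := h1.comp_add_const x h
    exact h2.sub (ih x hx)

lemma DD_mvt (hs : List ℕ) : ∀ (j : ℕ) (x : ℝ), 0 < x →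
    ∃ ξ, x ≤ ξ ∧ ξ ≤ x + hs.sum ∧ DD hs (lf j) x = hs.prod * lf (j + hs.length) ξ := by
  induction hs with
  | nil => intro j x hx; exact ⟨x, le_rfl, by simp, by simp [DD]⟩
  | cons h hs ih =>
    intro j x hx
    rcases Nat.eq_zero_or_pos h with h0 | h0
    · subst h0; exact ⟨x, le_rfl, by linarith [Nat.cast_nonneg (α := ℝ) (0::hs).sum], by simp [DD]⟩
    · have hh : (0:ℝ) < h := by exact_mod_cast h0
      have hd := DD_deriv (lf j) (lf (j+1)) (lf_deriv j) hs
      obtain ⟨c, hc, hc'⟩ := exists_hasDerivAt_eq_slope (DD hs (lf j)) (DD hs (lf (j+1))) (a := x) (b := x + h) (by linarith)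
        (fun y hy => (hd y (lt_of_lt_of_le hx hy.1)).continuousAt.continuousWithinAt)
        (fun y hy => hd y (lt_trans hx hy.1))
      obtain ⟨ξ, h1, h2, h3⟩ := ih (j+1) c (lt_trans hx hc.1)
      refine ⟨ξ, by linarith [hc.1], ?_, ?_⟩
      · simp only [List.sum_cons, Nat.cast_add]; linarith [hc.2]
      · simp only [DD, List.prod_cons, List.length_cons, Nat.cast_mul]
        have e : j + (hs.length + 1) = j + 1 + hs.length := by ring
        rw [e, mul_assoc, ← h3, hc', add_sub_cancel_left]
        field_simp

lemma sum_rpow_le (θ : ℝ) (h0 : 0 ≤ θ) (h1 : θ ≤ 1/2) (H : ℕ) :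
    ∑ d ∈ range H, ((d:ℝ)+1)^(-θ) ≤ 2 * (H:ℝ)^(1-θ) := by
  induction H with
  | zero => simp; positivity
  | succ H ih =>
    rw [sum_range_succ]
    push_cast
    have hp : (0:ℝ) < H + 1 := by positivity
    have b := rpow_one_add_le_one_add_mul_self (s := -1/((H:ℝ)+1)) (p := 1-θ) (by
      rw [neg_div, neg_le_neg_iff, div_le_one hp]; linarith [Nat.cast_nonneg (α := ℝ) H]) (by linarith) (by linarith)
    have e1 : (H:ℝ) = (H+1) * (1 + -1/((H:ℝ)+1)) := by field_simp; ring
    have e2 : (H:ℝ)^(1-θ) = ((H:ℝ)+1)^(1-θ) * (1 + -1/((H:ℝ)+1))^(1-θ) := by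
      rw [← Real.mul_rpow hp.le, ← e1]
      have : 1 + -1/((H:ℝ)+1) = H / (H+1) := by field_simp; ring
      rw [this]; positivity
    have e3 : ((H:ℝ)+1)^(1-θ) = (H+1) * ((H:ℝ)+1)^(-θ) := by
      rw [sub_eq_add_neg, Real.rpow_add hp, Real.rpow_one]
    have hq : 0 < ((H:ℝ)+1)^(-θ) := by positivity
    have : (H:ℝ)^(1-θ) ≤ (H+1) * ((H:ℝ)+1)^(-θ) - (1-θ) * ((H:ℝ)+1)^(-θ) := by
      rw [e2]
      calc _ ≤ ((H:ℝ)+1)^(1-θ) * (1 + (1-θ) * (-1/((H:ℝ)+1))) := by gcongr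
        _ = _ := by rw [e3]; field_simp; ring
    rw [e3]
    nlinarith

lemma vdc_base (k M : ℕ) (hM : 1 ≤ M) (t : ℝ) (ht : 0 < t) (hs : List ℕ) (hlen : hs.length = k)
    (hpos : ∀ h ∈ hs, 1 ≤ h) (H : ℕ) (hH : ∀ h ∈ hs, h < H)
    (hcond : t * k.factorial * (H:ℝ)^k ≤ Real.pi * (M:ℝ)^(k+1))
    (a N : ℕ) (ha : M ≤ a) (hN : a + N + hs.sum ≤ 4 * M) :
    ‖∑ n ∈ range N, ee (t * DD hs (lf 0) (a + n))‖ ≤ 6 / (t * k.factorial * hs.prod / (4*M:ℝ)^(k+1)) := by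
  have hM0 : (0:ℝ) < M := by exact_mod_cast hM
  have hprod : hs.prod ≤ H^k := by
    rw [← hlen]; exact List.prod_le_pow_card _ _ (fun x hx => (hH x hx).le)
  have hprodpos : 0 < hs.prod := by
    apply List.prod_pos; intro x hx; exact hpos x hx
  have hpp : (0:ℝ) < hs.prod := by exact_mod_cast hprodpos
  -- sign
  set s : ℝ := (-1)^k with hs'
  have hss : s * s = 1 := by rw [hs', ← mul_pow]; norm_num
  have hl : 0 < t * k.factorial * hs.prod / (4*M:ℝ)^(k+1) := by positivity
  have hmain := kuzmin_landau (fun n => s * (t * DD hs (lf 0) (a + n))) _ hl N ?_ ?_ ?_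
  · rcases neg_one_pow_eq_or ℝ k with h | h
    · rw [← hs'] at h; rw [h] at hmain; simpa using hmain
    · rw [← hs'] at h; rw [h] at hmain
      simp only [neg_one_mul, ee_neg, ← map_sum, Complex.norm_conj] at hmain
      exact hmain
  all_goals
    have hdiff : ∀ n : ℕ, s * (t * DD hs (lf 0) (a + (n+1 : ℕ))) - s * (t * DD hs (lf 0) (a + n)) = s * t * DD (1::hs) (lf 0) (a + n) := by
      intro n; simp only [DD]; push_cast; rw [← add_assoc]; ring
    have hx0 : ∀ n : ℕ, (0:ℝ) < a + n := fun n => by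
      have h1a : (1:ℝ) ≤ a := by exact_mod_cast (le_trans hM ha)
      exact add_pos_of_pos_of_nonneg (lt_of_lt_of_le one_pos h1a) (Nat.cast_nonneg n)
    have hval : ∀ n : ℕ, ∃ ξ : ℝ, a + n ≤ ξ ∧ ξ ≤ a + n + 1 + hs.sum ∧ s * t * DD (1::hs) (lf 0) (a + n) = t * k.factorial * hs.prod / ξ^(k+1) := by
      intro n
      obtain ⟨ξ, h1, h2, h3⟩ := DD_mvt (1::hs) 0 (a+n) (hx0 n)
      refine ⟨ξ, h1, ?_, ?_⟩
      · rw [List.sum_cons, Nat.cast_add] at h2; push_cast [-Nat.cast_list_sum] at h2; linarith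
      · rw [h3]; simp only [List.length_cons, hlen, zero_add, lf, List.prod_cons, one_mul]
        rw [← hs']
        calc _ = (s * s) * (t * k.factorial * hs.prod / ξ^(k+1)) := by ring
          _ = _ := by rw [hss, one_mul]
  · intro n hn
    simp only [hdiff]
    obtain ⟨ξ, h1, h2, h3⟩ := hval n
    rw [h3]
    have : 0 < ξ := lt_of_lt_of_le (hx0 n) h1
    have : ξ ≤ 4 * M := by
      have : ((a + N + hs.sum : ℕ):ℝ) ≤ (4 * M : ℕ) := by exact_mod_cast hN
      push_cast [-Nat.cast_list_sum] at this
      have : (n:ℝ) + 1 ≤ N := by exact_mod_cast hn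
      linarith
    gcongr
  · intro n hn
    simp only [hdiff]
    obtain ⟨ξ, h1, h2, h3⟩ := hval n
    rw [h3]
    have hξ : (M:ℝ) ≤ ξ := by
      have : (M:ℝ) ≤ a := by exact_mod_cast ha
      linarith [Nat.cast_nonneg (α := ℝ) n]
    rw [div_le_iff₀ (pow_pos (by linarith) _)]
    calc t * k.factorial * hs.prod ≤ t * k.factorial * (H:ℝ)^k := by
          gcongr; exact_mod_cast hprod
      _ ≤ Real.pi * (M:ℝ)^(k+1) := hcond
      _ ≤ _ := by gcongr
  · intro n hn
    simp only [hdiff]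
    obtain ⟨ξ, h1, h2, h3⟩ := DD_mvt (1::1::hs) 0 (a+n) (hx0 n)
    have e : s * t * DD (1::hs) (lf 0) (a + (n+1:ℕ)) - s * t * DD (1::hs) (lf 0) (a + n) = s * t * DD (1::1::hs) (lf 0) (a + n) := by
      conv_rhs => rw [DD]
      push_cast; rw [← add_assoc]; ring
    have hξ : 0 < ξ := lt_of_lt_of_le (hx0 n) h1
    have : s * t * DD (1::1::hs) (lf 0) (a + n) ≤ 0 := by
      rw [h3]; simp only [List.length_cons, hlen, zero_add, lf, List.prod_cons, one_mul]
      rw [pow_succ, ← hs']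
      have : s * t * (hs.prod * (s * -1 * ((k+1).factorial) * (ξ^(k+1+1))⁻¹)) = - ((s * s) * (t * hs.prod * (k+1).factorial * (ξ^(k+1+1))⁻¹)) := by ring
      rw [this, hss]
      have : 0 ≤ (t * hs.prod * (k+1).factorial * (ξ^(k+1+1))⁻¹) := by positivity
      linarith
    linarith

set_option maxHeartbeats 1000000 in
lemma vdc_ind (k M : ℕ) (hM : 1 ≤ M) (t : ℝ) (ht : 0 < t) (H : ℕ) (hH1 : 1 ≤ H) (hHM : H ≤ M)
    (hcond : t * k.factorial * (H:ℝ)^k ≤ Real.pi * (M:ℝ)^(k+1)) (L : ℝ) (hL : L = M * (t * k.factorial / (4*M:ℝ)^(k+1)))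
    (i : ℕ) : ∀ (hs : List ℕ), hs.length + i = k → (∀ h ∈ hs, 1 ≤ h) → (∀ h ∈ hs, h < H) →
    ∀ a N : ℕ, M ≤ a → a + N + hs.sum ≤ 4 * M →
    ‖∑ n ∈ range N, ee (t * DD hs (lf 0) (a + n))‖ ≤ 16 * M * ((H:ℝ)^(-(1/2:ℝ)^i) + (L * (H:ℝ)^i * hs.prod)^(-(1/2:ℝ)^(i+1))) := by
  have hM0 : (0:ℝ) < M := by exact_mod_cast hM
  have hH0 : (0:ℝ) < H := by exact_mod_cast hH1
  have hLp : 0 < L := by rw [hL]; positivity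
  induction i with
  | zero =>
    intro hs hlen hpos hlt a N ha hN
    have hpp : (0:ℝ) < hs.prod := by
      have : 0 < hs.prod := List.prod_pos (fun x hx => hpos x hx)
      exact_mod_cast this
    have hb := vdc_base k M hM t ht hs (by simpa using hlen) hpos H hlt hcond a N ha hN
    have htriv : ‖∑ n ∈ range N, ee (t * DD hs (lf 0) (a + n))‖ ≤ 3 * M := by
      refine (norm_sum_le _ _).trans ?_
      simp only [ee_norm]; simp
      have : N ≤ 3 * M := by omega
      exact_mod_cast this
    set S := ‖∑ n ∈ range N, ee (t * DD hs (lf 0) (a + n))‖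
    have hS0 : 0 ≤ S := norm_nonneg _
    have e : 6 / (t * k.factorial * hs.prod / (4*M:ℝ)^(k+1)) = 6 * M / (L * hs.prod) := by
      rw [hL]; field_simp
    rw [e] at hb
    set Y := L * hs.prod with hY
    have hYp : 0 < Y := mul_pos hLp hpp
    clear_value Y S
    have h2 : S^2 ≤ (16 * M * Y^(-(1/2):ℝ))^2 := by
      have : (Y^(-(1/2):ℝ))^2 = 1 / Y := by
        rw [← Real.rpow_natCast, ← Real.rpow_mul hYp.le]; norm_num [Real.rpow_neg_one]
      rw [mul_pow, this]
      calc S^2 = S * S := by ring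
        _ ≤ (3 * M) * (6 * M / Y) := by gcongr
        _ ≤ _ := by rw [show (3 * (M:ℝ)) * (6 * M / Y) = 18 * M^2 * (1/Y) by ring]; gcongr; nlinarith
    have h3 := le_of_sq_le_sq h2 (by positivity)
    simp only [pow_zero, mul_one, zero_add, pow_one]
    rw [← hY]
    refine h3.trans ?_
    gcongr
    have : (0:ℝ) < (H:ℝ)^(-1:ℝ) := by positivity
    linarith
  | succ i ih =>
    intro hs hlen hpos hlt a N ha hN
    have hpp : (0:ℝ) < hs.prod := by
      have : 0 < hs.prod := List.prod_pos (fun x hx => hpos x hx)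
      exact_mod_cast this
    set q : ℝ := (1/2:ℝ)^i with hq
    have hq0 : 0 < q := by positivity
    have hq1 : q ≤ 1 := pow_le_one₀ (by norm_num) (by norm_num)
    have eq1 : (1/2:ℝ)^(i+1) = q/2 := by rw [pow_succ, ← hq]; ring
    have eq2 : (1/2:ℝ)^(i+1+1) = q/2/2 := by rw [pow_succ, eq1]; ring
    rw [eq1, eq2]
    rw [eq1] at ih
    have hv := vdc (fun n => ee (t * DD hs (lf 0) (a + n))) N H
    set S := ‖∑ n ∈ range N, ee (t * DD hs (lf 0) (a + n))‖ with hS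
    have hC : ∀ d, ∑ n ∈ range (N - d), (fun n : ℕ => ee (t * DD hs (lf 0) (a + n))) (n + d) * (starRingEnd ℂ) ((fun n : ℕ => ee (t * DD hs (lf 0) (a + n))) n)
        = ∑ n ∈ range (N - d), ee (t * DD (d::hs) (lf 0) (a + n)) := by
      intro d
      refine sum_congr rfl fun n _ => ?_
      simp only
      rw [← ee_neg, ← ee_add]; congr 1
      simp only [DD]; push_cast; rw [← add_assoc]; ring
    simp only [hC] at hv
    obtain ⟨H', rfl⟩ : ∃ H', H = H' + 1 := ⟨H - 1, by omega⟩
    rw [sum_range_succ'] at hv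
    set Y := L * ((H'+1:ℕ):ℝ)^i * hs.prod with hY
    have hYp : 0 < Y := mul_pos (mul_pos hLp (pow_pos hH0 _)) hpp
    set h : ℝ := ((H'+1:ℕ):ℝ) with hh
    clear_value S Y h q
    have h0b : ‖∑ n ∈ range (N - 0), ee (t * DD (0::hs) (lf 0) (a + n))‖ ≤ 3 * M := by
      refine (norm_sum_le _ _).trans ?_
      simp only [ee_norm]; simp
      have : N ≤ 3 * M := by omega
      exact_mod_cast this
    have hdb : ∀ d ∈ range H', ‖∑ n ∈ range (N - (d+1)), ee (t * DD ((d+1)::hs) (lf 0) (a + n))‖ ≤ 16 * M * (h^(-q) + Y^(-(q/2)) * ((d:ℝ)+1)^(-(q/2))) := by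
      intro d hd
      have hd' : d < H' := by simpa using hd
      by_cases hdN : d + 1 ≤ N
      · have := ih ((d+1)::hs) (by simp; omega) (by simpa using hpos) (by simp only [List.mem_cons, forall_eq_or_imp]; exact ⟨by omega, hlt⟩) a (N-(d+1)) ha (by simp; omega)
        refine this.trans ?_
        have e : L * h^i * (((d+1)::hs).prod : ℕ) = Y * ((d:ℝ)+1) := by
          rw [hY, List.prod_cons]; push_cast; ring
        rw [e, Real.mul_rpow hYp.le (add_nonneg (Nat.cast_nonneg d) zero_le_one)]
      · rw [Nat.sub_eq_zero_of_le (by omega), range_zero, sum_empty, norm_zero]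
        exact mul_nonneg (mul_nonneg (by norm_num) hM0.le) (add_nonneg (Real.rpow_nonneg hH0.le _)
          (mul_nonneg (Real.rpow_nonneg hYp.le _) (Real.rpow_nonneg (add_nonneg (Nat.cast_nonneg d) zero_le_one) _)))
    have hsum : ∑ d ∈ range H', ‖∑ n ∈ range (N - (d+1)), ee (t * DD ((d+1)::hs) (lf 0) (a + n))‖ ≤ 16 * M * (h * h^(-q) + 2 * (Y^(-(q/2)) * (h * h^(-(q/2))))) := by
      refine (sum_le_sum hdb).trans ?_
      rw [← mul_sum, sum_add_distrib, ← mul_sum]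
      have e1 : ∑ d ∈ range H', ((d:ℝ)+1)^(-(q/2)) ≤ 2 * (h * h^(-(q/2))) := by
        have := sum_rpow_le (q/2) (by positivity) (by linarith) (H'+1)
        rw [sum_range_succ] at this
        have e : ((H'+1:ℕ):ℝ)^(1-q/2) = h * h^(-(q/2)) := by
          rw [← hh, sub_eq_add_neg, Real.rpow_add hH0, Real.rpow_one]
        rw [e] at this
        have : 0 ≤ ((H':ℝ)+1)^(-(q/2)) := Real.rpow_nonneg (add_nonneg (Nat.cast_nonneg H') zero_le_one) _
        linarith
      have e2 : ∑ d ∈ range H', h^(-q) ≤ h * h^(-q) := by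
        simp only [sum_const, card_range, nsmul_eq_mul]; gcongr; rw [hh]; push_cast; linarith
      calc _ ≤ 16 * M * (h * h^(-q) + Y^(-(q/2)) * (2 * (h * h^(-(q/2))))) := by gcongr
        _ = _ := by ring
    have hNH : (N:ℝ) + h ≤ 4 * M := by
      rw [hh]; have : N + (H'+1) ≤ 4 * M := by omega
      exact_mod_cast this
    have hS2 : h * S^2 ≤ h * (256 * M^2 * (h^(-q) + (Y * h)^(-(q/2)))) := by
      calc h * S^2 ≤ _ := hv
        _ ≤ 2 * (4*M) * (16 * M * (h * h^(-q) + 2 * (Y^(-(q/2)) * (h * h^(-(q/2))))) + 3 * M) := by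
          refine mul_le_mul (by linarith) (add_le_add hsum h0b) (add_nonneg (sum_nonneg fun _ _ => norm_nonneg _) (norm_nonneg _)) ?_
          linarith
        _ = h * (M^2 * (128 * h^(-q) + 256 * (Y^(-(q/2)) * h^(-(q/2))))) + 24 * M^2 := by ring
        _ ≤ h * (M^2 * (128 * h^(-q) + 256 * (Y^(-(q/2)) * h^(-(q/2))))) + h * (24 * M^2 * h^(-q)) := by
          have h1 : 1 ≤ h := by rw [hh]; exact_mod_cast hH1
          have : 1 ≤ h * h^(-q) := by
            calc (1:ℝ) ≤ h^(1-q) := Real.one_le_rpow h1 (by linarith)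
              _ = _ := by rw [sub_eq_add_neg, Real.rpow_add hH0, Real.rpow_one]
          have h2 : 24 * (M:ℝ)^2 * 1 ≤ 24 * (M:ℝ)^2 * (h * h^(-q)) := by gcongr
          have h3 : h * (24 * (M:ℝ)^2 * h^(-q)) = 24 * (M:ℝ)^2 * (h * h^(-q)) := by ring
          linarith
        _ ≤ _ := by
          rw [← mul_add, Real.mul_rpow hYp.le hH0.le]
          refine mul_le_mul_of_nonneg_left ?_ hH0.le
          have h4 : (0:ℝ) ≤ M^2 * h^(-q) := by positivity
          have h5 : 256 * (M:ℝ)^2 * (h^(-q) + Y^(-(q/2)) * h^(-(q/2))) - ((M:ℝ)^2 * (128 * h^(-q) + 256 * (Y^(-(q/2)) * h^(-(q/2)))) + 24 * (M:ℝ)^2 * h^(-q)) = 104 * (M^2 * h^(-q)) := by ring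
          linarith
    have hS3 := le_of_mul_le_mul_left hS2 hH0
    have e3 : L * h^(i+1) * hs.prod = Y * h := by rw [hY]; ring
    rw [e3]
    set A := h^(-(q/2)) with hA
    set B := (Y * h)^(-(q/2/2)) with hB
    have hA0 : 0 ≤ A := Real.rpow_nonneg hH0.le _
    have hB0 : 0 ≤ B := Real.rpow_nonneg (mul_pos hYp hH0).le _
    clear_value A B
    have hA2 : A^2 = h^(-q) := by
      rw [hA, ← Real.rpow_natCast, ← Real.rpow_mul hH0.le]; congr 1; push_cast; ring
    have hB2 : B^2 = (Y*h)^(-(q/2)) := by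
      rw [hB, ← Real.rpow_natCast, ← Real.rpow_mul (by positivity)]; congr 1; push_cast; ring
    rw [← hA2, ← hB2] at hS3
    refine le_of_sq_le_sq (hS3.trans ?_) (mul_nonneg (mul_nonneg (by norm_num) hM0.le) (add_nonneg hA0 hB0))
    have h6 : 0 ≤ (M:ℝ)^2 * (A * B) := by positivity
    have h7 : (16 * (M:ℝ) * (A + B))^2 = 256 * (M:ℝ)^2 * (A^2 + B^2) + 512 * ((M:ℝ)^2 * (A * B)) := by ring
    rw [h7]
    linarith

end TP

namespace TP
open Finset

lemma sum_Ioc_ee (t : ℝ) (a b : ℕ) (hab : a ≤ b) :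
    ∑ n ∈ Ioc a b, ee (-(t * Real.log n)) = (starRingEnd ℂ) (∑ n ∈ range (b - a), ee (t * DD [] (lf 0) ((a+1:ℕ) + n))) := by
  rw [map_sum]
  have h1 : Ioc a b = Ico (a+1) (b+1) := by ext x; simp only [mem_Ioc, mem_Ico]; omega
  rw [h1, sum_Ico_eq_sum_range]
  have h2 : b + 1 - (a + 1) = b - a := by omega
  rw [h2]
  refine sum_congr rfl fun n _ => ?_
  rw [← ee_neg]; simp [DD, lf]

lemma exp_k (k : ℕ) (hk : 2 ≤ k) : ∃ δ : ℝ, 0 < δ ∧ δ ≤ 1/2 ∧ ∃ C : ℝ, 0 < C ∧ ∀ M : ℕ, 1 ≤ M → ∀ t : ℝ,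
    (M:ℝ)^(k-1) ≤ t → t ≤ (M:ℝ)^k → ∀ a b : ℕ, M ≤ a → a ≤ b → b + 1 ≤ 4 * M →
    ‖∑ n ∈ Ioc a b, ee (-(t * Real.log n))‖ ≤ C * (M:ℝ)^(1-δ) := by
  set q : ℝ := (1/2:ℝ)^k with hq
  have hq0 : 0 < q := pow_pos (by norm_num) _
  have hq1 : q ≤ 1 := pow_le_one₀ (by norm_num) (by norm_num)
  have hk0 : (0:ℝ) < k := by have : 0 < k := by omega
                             exact_mod_cast this
  have hk2 : (2:ℝ) ≤ k := by exact_mod_cast hk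
  set δ : ℝ := 3 * q / (4 * k) with hδ
  have hδ0 : 0 < δ := by rw [hδ]; positivity
  have hδ1 : δ ≤ 3 * q / 8 := by rw [hδ]; apply div_le_div_of_nonneg_left <;> nlinarith
  have hδ2 : δ ≤ 1/2 := by linarith
  refine ⟨δ, hδ0, hδ2, 16 * (2 + 8^(k+1)) + 3 * (k.factorial:ℝ)^4, by positivity, ?_⟩
  intro M hM t ht1 ht2 a b ha hab hb
  have hM1 : (1:ℝ) ≤ M := by exact_mod_cast hM
  have hM0 : (0:ℝ) < M := by linarith
  have hMδ : (0:ℝ) < (M:ℝ)^(1-δ) := Real.rpow_pos_of_pos hM0 _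
  by_cases hbig : (k.factorial:ℝ)^4 ≤ M
  swap
  · -- small M
    push Not at hbig
    have h1 : ‖∑ n ∈ Ioc a b, ee (-(t * Real.log n))‖ ≤ 3 * M := by
      refine (norm_sum_le _ _).trans ?_
      simp only [ee_norm, sum_const, Nat.card_Ioc, nsmul_eq_mul, mul_one]
      have : b - a ≤ 3 * M := by omega
      exact_mod_cast this
    have h2 : 1 ≤ (M:ℝ)^(1-δ) := Real.one_le_rpow hM1 (by linarith)
    have h3 : (0:ℝ) ≤ 16 * (2 + 8^(k+1)) := by positivity
    calc _ ≤ 3 * (M:ℝ) := h1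
      _ ≤ 3 * (k.factorial:ℝ)^4 := by linarith
      _ ≤ (16 * (2 + 8^(k+1)) + 3 * (k.factorial:ℝ)^4) * 1 := by linarith
      _ ≤ _ := by gcongr
  have ht : 0 < t := lt_of_lt_of_le (pow_pos hM0 _) ht1
  rw [sum_Ioc_ee t a b hab, Complex.norm_conj]
  -- choose H
  set R : ℝ := (M:ℝ)^((k:ℝ) + 3/4) / t with hR
  have hR1 : (M:ℝ)^(3/4:ℝ) ≤ R := by
    rw [hR, le_div_iff₀ ht]
    calc (M:ℝ)^(3/4:ℝ) * t ≤ (M:ℝ)^(3/4:ℝ) * (M:ℝ)^k := by gcongr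
      _ = _ := by rw [add_comm, Real.rpow_add hM0, Real.rpow_natCast]
  have hR0 : 0 < R := lt_of_lt_of_le (Real.rpow_pos_of_pos hM0 _) hR1
  have hR2 : R ≤ (M:ℝ)^(k:ℝ) := by
    rw [hR, div_le_iff₀ ht]
    calc (M:ℝ)^((k:ℝ) + 3/4) ≤ (M:ℝ)^((k:ℝ) + ((k-1:ℕ):ℝ)) := by
          apply Real.rpow_le_rpow_of_exponent_le hM1
          have : (1:ℝ) ≤ ((k-1:ℕ):ℝ) := by have : 1 ≤ k - 1 := by omega
                                           exact_mod_cast this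
          linarith
      _ = (M:ℝ)^(k:ℝ) * (M:ℝ)^(k-1) := by rw [Real.rpow_add hM0, Real.rpow_natCast, Real.rpow_natCast]
      _ ≤ _ := by gcongr
  set Q : ℝ := R^(1/(k:ℝ)) with hQ
  have hQk : Q^k = R := by
    rw [hQ, ← Real.rpow_natCast, ← Real.rpow_mul hR0.le]; field_simp; simp
  have hQ1 : (M:ℝ)^(3/(4*k):ℝ) ≤ Q := by
    calc (M:ℝ)^(3/(4*k):ℝ) = ((M:ℝ)^(3/4:ℝ))^(1/(k:ℝ)) := by
          rw [← Real.rpow_mul hM0.le]; congr 1; field_simp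
      _ ≤ _ := Real.rpow_le_rpow (Real.rpow_nonneg hM0.le _) hR1 (by positivity)
  have hQ2 : Q ≤ M := by
    calc Q ≤ ((M:ℝ)^(k:ℝ))^(1/(k:ℝ)) := Real.rpow_le_rpow hR0.le hR2 (by positivity)
      _ = M := by rw [← Real.rpow_mul hM0.le]; field_simp; simp
  have hQ3 : 1 ≤ Q := le_trans (Real.one_le_rpow hM1 (by positivity)) hQ1
  set H := ⌊Q⌋₊ with hH
  have hH1 : 1 ≤ H := by rw [hH]; exact Nat.le_floor (by simpa using hQ3)
  have hHQ : (H:ℝ) ≤ Q := Nat.floor_le (by linarith)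
  have hHM : H ≤ M := by exact_mod_cast hHQ.trans hQ2
  have hHlow : Q/2 ≤ H := by
    have := Nat.lt_floor_add_one Q
    rw [← hH] at this
    have h1 : (1:ℝ) ≤ H := by exact_mod_cast hH1
    linarith
  have hH0 : (0:ℝ) < H := by exact_mod_cast hH1
  have htR : t * R = (M:ℝ)^k * (M:ℝ)^(3/4:ℝ) := by
    rw [hR, ← Real.rpow_natCast, ← Real.rpow_add hM0]; field_simp
  have hcond : t * k.factorial * (H:ℝ)^k ≤ Real.pi * (M:ℝ)^(k+1) := by
    have e1 : (k.factorial:ℝ) ≤ (M:ℝ)^(1/4:ℝ) := by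
      calc (k.factorial:ℝ) = ((k.factorial:ℝ)^4)^(1/4:ℝ) := by
            rw [← Real.rpow_natCast, ← Real.rpow_mul (Nat.cast_nonneg _)]; norm_num
        _ ≤ _ := Real.rpow_le_rpow (by positivity) hbig (by norm_num)
    calc t * k.factorial * (H:ℝ)^k ≤ t * (M:ℝ)^(1/4:ℝ) * Q^k := by gcongr
      _ = (t * R) * (M:ℝ)^(1/4:ℝ) := by rw [hQk]; ring
      _ = (M:ℝ)^(k+1) := by
        rw [htR, mul_assoc, ← Real.rpow_add hM0]; norm_num; ring
      _ ≤ _ := by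
        have := Real.pi_gt_three
        have h2 : (0:ℝ) < (M:ℝ)^(k+1) := by positivity
        nlinarith
  have hmain := vdc_ind k M hM t ht H hH1 hHM hcond _ rfl k [] (by simp) (by simp) (by simp) (a+1) (b-a) (by omega) (by simp; omega)
  refine hmain.trans ?_
  rw [← hq, pow_succ (1/2:ℝ) k, ← hq]
  have b1 : (H:ℝ)^(-q) ≤ 2 * (M:ℝ)^(-δ) := by
    have e1 : (M:ℝ)^(3/(4*k):ℝ) / 2 ≤ H := by linarith
    calc (H:ℝ)^(-q) ≤ ((M:ℝ)^(3/(4*k):ℝ) / 2)^(-q) :=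
          Real.rpow_le_rpow_of_nonpos (by positivity) e1 (by linarith)
      _ = (M:ℝ)^(-δ) * 2^q := by
        rw [Real.div_rpow (by positivity) (by norm_num), ← Real.rpow_mul hM0.le, div_eq_mul_inv, Real.rpow_neg (by norm_num : (0:ℝ) ≤ 2) q, inv_inv]
        congr 2; rw [hδ]; field_simp
      _ ≤ (M:ℝ)^(-δ) * 2^(1:ℝ) := by gcongr; norm_num
      _ = _ := by rw [Real.rpow_one]; ring
  have b2 : (M * (t * k.factorial / (4*M:ℝ)^(k+1)) * (H:ℝ)^k * (([]:List ℕ).prod:ℕ))^(-(q * (1/2))) ≤ 8^(k+1) * (M:ℝ)^(-δ) := by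
    have e1 : (M:ℝ)^(3/4:ℝ) / 8^(k+1) ≤ M * (t * k.factorial / (4*M:ℝ)^(k+1)) * (H:ℝ)^k * (([]:List ℕ).prod:ℕ) := by
      have f1 : (1:ℝ) ≤ k.factorial := by exact_mod_cast k.factorial_pos
      have f2 : (Q/2)^k ≤ (H:ℝ)^k := by gcongr
      have f3 : t * R = (M:ℝ)^k * (M:ℝ)^(3/4:ℝ) := htR
      calc (M:ℝ)^(3/4:ℝ) / 8^(k+1) ≤ (M:ℝ)^(3/4:ℝ) / (2^k * 4^(k+1)) := by
            gcongr
            calc (2:ℝ)^k * 4^(k+1) ≤ 2^(k+1) * 4^(k+1) := by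
                  gcongr
                  · norm_num
                  · omega
              _ = 8^(k+1) := by rw [← mul_pow]; norm_num
        _ = (t * R) / ((M:ℝ)^k * (2^k * 4^(k+1))) := by rw [htR]; field_simp
        _ = M * (t * 1 / (4*M:ℝ)^(k+1)) * (Q/2)^k := by rw [div_pow, hQk]; field_simp; ring
        _ ≤ M * (t * k.factorial / (4*M:ℝ)^(k+1)) * (H:ℝ)^k := by gcongr
        _ = _ := by simp
    calc _ ≤ ((M:ℝ)^(3/4:ℝ) / 8^(k+1))^(-(q * (1/2))) :=
          Real.rpow_le_rpow_of_nonpos (by positivity) e1 (by linarith)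
      _ = (M:ℝ)^(-(3*q/8)) * ((8:ℝ)^(k+1))^(q * (1/2)) := by
        rw [Real.div_rpow (by positivity) (by positivity), ← Real.rpow_mul hM0.le, div_eq_mul_inv, Real.rpow_neg (by positivity : (0:ℝ) ≤ 8^(k+1)), inv_inv]
        congr 2; ring
      _ ≤ (M:ℝ)^(-δ) * ((8:ℝ)^(k+1))^(1:ℝ) := by
        have : (1:ℝ) ≤ 8^(k+1) := one_le_pow₀ (by norm_num)
        gcongr
        linarith
      _ = _ := by rw [Real.rpow_one]; ring
  calc 16 * (M:ℝ) * ((H:ℝ)^(-q) + (M * (t * k.factorial / (4*M:ℝ)^(k+1)) * (H:ℝ)^k * (([]:List ℕ).prod:ℕ))^(-(q * (1/2))))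
      ≤ 16 * (M:ℝ) * (2 * (M:ℝ)^(-δ) + 8^(k+1) * (M:ℝ)^(-δ)) := by
        refine mul_le_mul_of_nonneg_left (add_le_add b1 b2) (by positivity)
    _ = 16 * (2 + 8^(k+1)) * (M:ℝ)^(1-δ) := by
        rw [sub_eq_add_neg, Real.rpow_add hM0, Real.rpow_one]; ring
    _ ≤ _ := by
        refine mul_le_mul_of_nonneg_right ?_ hMδ.le
        have : (0:ℝ) ≤ 3 * (k.factorial:ℝ)^4 := by positivity
        linarith

lemma hasDerivAt_ee_log (t u : ℝ) (hu : 0 < u) :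
    HasDerivAt (fun u : ℝ => ee (-(t * Real.log u))) (ee (-(t * Real.log u)) * (-(t / u) * Complex.I)) u := by
  have h1 : HasDerivAt (fun u : ℝ => -(t * Real.log u)) (-(t * u⁻¹)) u := ((Real.hasDerivAt_log hu.ne').const_mul t).neg
  have h2 : HasDerivAt (fun u : ℝ => (((-(t * Real.log u) : ℝ) : ℂ)) * Complex.I) ((((-(t * u⁻¹)):ℝ):ℂ) * Complex.I) u :=
    (h1.ofReal_comp).mul_const _
  have h3 := h2.cexp
  unfold ee
  convert h3 using 2
  push_cast; rw [div_eq_mul_inv]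

lemma integral_ee_log (t : ℝ) (ht : t ≠ 0) (a b : ℝ) (ha : 0 < a) (hab : a ≤ b) :
    ‖∫ u in a..b, ee (-(t * Real.log u))‖ ≤ 2 * b / |t| := by
  have hne : (1 - t * Complex.I : ℂ) ≠ 0 := by
    intro h; have := congrArg Complex.re h; simp at this
  have hder : ∀ u ∈ Set.uIcc a b, HasDerivAt (fun u : ℝ => (u:ℂ) * ee (-(t * Real.log u)) / (1 - t * Complex.I)) (ee (-(t * Real.log u))) u := by
    intro u hu
    rw [Set.uIcc_of_le hab] at hu
    have hu0 : 0 < u := lt_of_lt_of_le ha hu.1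
    have h1 : HasDerivAt (fun u : ℝ => (u:ℂ)) 1 u := Complex.ofRealCLM.hasDerivAt
    have h2 := (h1.mul (hasDerivAt_ee_log t u hu0)).div_const (1 - t * Complex.I)
    refine HasDerivAt.congr_deriv (f := fun u : ℝ => (u:ℂ) * ee (-(t * Real.log u)) / (1 - t * Complex.I)) h2 ?_
    have : (u:ℂ) ≠ 0 := by exact_mod_cast hu0.ne'
    field_simp
    ring
  have hcont : ContinuousOn (fun u : ℝ => ee (-(t * Real.log u))) (Set.uIcc a b) := by
    intro u hu
    rw [Set.uIcc_of_le hab] at hu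
    exact (hasDerivAt_ee_log t u (lt_of_lt_of_le ha hu.1)).continuousAt.continuousWithinAt
  rw [intervalIntegral.integral_eq_sub_of_hasDerivAt hder hcont.intervalIntegrable]
  have hn : |t| ≤ ‖(1 - t * Complex.I : ℂ)‖ := by
    have := Complex.abs_im_le_norm (1 - t * Complex.I : ℂ)
    simpa using this
  have ht0 : 0 < |t| := abs_pos.mpr ht
  have hb : ∀ u : ℝ, 0 < u → u ≤ b → ‖(u:ℂ) * ee (-(t * Real.log u)) / (1 - t * Complex.I)‖ ≤ b / |t| := by
    intro u hu hub
    rw [norm_div, norm_mul, ee_norm, mul_one, Complex.norm_real, Real.norm_of_nonneg hu.le]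
    gcongr
    linarith
  calc _ ≤ b / |t| + b / |t| := (norm_sub_le _ _).trans (add_le_add (hb b (by linarith) le_rfl) (hb a ha hab))
    _ = _ := by ring

lemma exp_small (M : ℕ) (hM : 1 ≤ M) (t : ℝ) (a b : ℕ) (ha : M ≤ a) (hab : a ≤ b) (hb : b + 1 ≤ 4 * M) :
    ‖∑ n ∈ Ioc a b, ee (-(t * Real.log n)) - ∫ u in (a:ℝ)..b, ee (-(t * Real.log u))‖ ≤ 3 * |t| := by
  have hM0 : (0:ℝ) < M := by exact_mod_cast hM
  have hcont : ∀ x y : ℝ, 0 < x → x ≤ y → ContinuousOn (fun u : ℝ => ee (-(t * Real.log u))) (Set.uIcc x y) := by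
    intro x y hx hxy u hu
    rw [Set.uIcc_of_le hxy] at hu
    exact (hasDerivAt_ee_log t u (lt_of_lt_of_le hx hu.1)).continuousAt.continuousWithinAt
  have main : ∀ n : ℕ, ‖∑ k ∈ Ioc a (a+n), ee (-(t * Real.log k)) - ∫ u in (a:ℝ)..(a+n:ℕ), ee (-(t * Real.log u))‖ ≤ n * (|t| / M) := by
    intro n
    have ha0 : (0:ℝ) < a := by exact_mod_cast (lt_of_lt_of_le hM ha)
    induction n with
    | zero => simp
    | succ n ih =>
      have e1 : Ioc a (a + (n+1)) = insert (a+n+1) (Ioc a (a+n)) := by ext x; simp; omega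
      rw [e1, sum_insert (by simp)]
      have i1 : IntervalIntegrable (fun u : ℝ => ee (-(t * Real.log u))) MeasureTheory.volume (a:ℝ) (a+n:ℕ) :=
        (hcont _ _ ha0 (by push_cast; linarith [Nat.cast_nonneg (α := ℝ) n])).intervalIntegrable
      have i2 : IntervalIntegrable (fun u : ℝ => ee (-(t * Real.log u))) MeasureTheory.volume (a+n:ℕ) (a+(n+1):ℕ) :=
        (hcont _ _ (by push_cast; linarith [Nat.cast_nonneg (α := ℝ) n]) (by push_cast; linarith)).intervalIntegrable
      rw [← intervalIntegral.integral_add_adjacent_intervals i1 i2]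
      have i3 : ‖ee (-(t * Real.log (a+n+1:ℕ))) - ∫ u in ((a+n:ℕ):ℝ)..(a+(n+1):ℕ), ee (-(t * Real.log u))‖ ≤ |t| / M := by
        have e2 : ee (-(t * Real.log (a+n+1:ℕ))) = ∫ u in ((a+n:ℕ):ℝ)..(a+(n+1):ℕ), ee (-(t * Real.log (a+n+1:ℕ))) := by
          rw [intervalIntegral.integral_const]; push_cast; ring_nf; simp
        rw [e2, ← intervalIntegral.integral_sub (by simp) i2]
        have := intervalIntegral.norm_integral_le_of_norm_le_const (C := |t| / M) (a := ((a+n:ℕ):ℝ)) (b := ((a+(n+1):ℕ):ℝ))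
          (f := fun u => ee (-(t * Real.log (a+n+1:ℕ))) - ee (-(t * Real.log u))) ?_
        · have e3 : |((a+(n+1):ℕ):ℝ) - ((a+n:ℕ):ℝ)| = 1 := by push_cast; ring_nf; simp
          rw [e3, mul_one] at this; exact this
        · intro u hu
          rw [Set.uIoc_of_le (by push_cast; linarith)] at hu
          obtain ⟨hu1, hu2⟩ := hu
          have hun : (0:ℝ) ≤ n := Nat.cast_nonneg n
          have haM : (M:ℝ) ≤ a := by exact_mod_cast ha
          push_cast at hu1 hu2
          have hu0 : 0 < u := by linarith
          refine (ee_sub_le _ _).trans ?_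
          have e4 : -(t * Real.log (a+n+1:ℕ)) - -(t * Real.log u) = -(t * (Real.log (a+n+1:ℕ) - Real.log u)) := by ring
          rw [e4, abs_neg, abs_mul]
          have hlog : |Real.log (a+n+1:ℕ) - Real.log u| ≤ 1 / M := by
            push_cast
            rw [← Real.log_div (by positivity) hu0.ne']
            have h1 : 1 ≤ ((a:ℝ)+n+1)/u := by rw [le_div_iff₀ hu0]; linarith
            rw [abs_of_nonneg (Real.log_nonneg h1)]
            have := Real.log_le_sub_one_of_pos (lt_of_lt_of_le one_pos h1)
            refine this.trans ?_
            rw [div_sub_one hu0.ne', div_le_div_iff₀ hu0 hM0]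
            nlinarith
          calc |t| * |Real.log (a+n+1:ℕ) - Real.log u| ≤ |t| * (1/M) := by gcongr
            _ = _ := by ring
      calc _ = ‖(ee (-(t * Real.log (a+n+1:ℕ))) - ∫ u in ((a+n:ℕ):ℝ)..(a+(n+1):ℕ), ee (-(t * Real.log u))) + (∑ k ∈ Ioc a (a+n), ee (-(t * Real.log k)) - ∫ u in (a:ℝ)..(a+n:ℕ), ee (-(t * Real.log u)))‖ := by
            congr 1; ring
        _ ≤ |t| / M + n * (|t| / M) := (norm_add_le _ _).trans (add_le_add i3 ih)
        _ = _ := by push_cast; ring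
  obtain ⟨n, rfl⟩ := Nat.exists_eq_add_of_le hab
  refine (main n).trans ?_
  have hn : (n:ℝ) ≤ 3 * M := by
    have : n ≤ 3 * M := by omega
    exact_mod_cast this
  calc (n:ℝ) * (|t| / M) ≤ 3 * M * (|t| / M) := by gcongr
    _ = _ := by field_simp

lemma norm_neg_t (t : ℝ) (a b : ℕ) :
    ‖∑ n ∈ Ioc a b, ee (-(-t * Real.log n))‖ = ‖∑ n ∈ Ioc a b, ee (-(t * Real.log n))‖ := by
  rw [← Complex.norm_conj, map_sum]
  congr 1; refine sum_congr rfl fun n _ => ?_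
  rw [← ee_neg]; congr 1; ring

lemma exp_base (M : ℕ) (hM : 1 ≤ M) (t : ℝ) (ht0 : 0 < t) (ht : t ≤ M) (a b : ℕ) (ha : M ≤ a) (hab : a ≤ b) (hb : b + 1 ≤ 4 * M) :
    ‖∑ n ∈ Ioc a b, ee (-(t * Real.log n))‖ ≤ 24 * M / t := by
  rw [sum_Ioc_ee t a b hab, Complex.norm_conj]
  have h := vdc_base 0 M hM t ht0 [] rfl (by simp) 1 (by simp) (by
    simp; have := Real.pi_gt_three; have h0 : (0:ℝ) ≤ M := Nat.cast_nonneg M; nlinarith) (a+1) (b-a) (by omega) (by simp; omega)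
  refine h.trans (le_of_eq ?_)
  simp; field_simp; ring

/-- power saving for `∑ n^{-it}` -/
lemma exp0 (K : ℕ) : ∃ δ : ℝ, 0 < δ ∧ δ ≤ 1/2 ∧ ∃ C : ℝ, 0 < C ∧ ∀ M : ℕ, 1 ≤ M → ∀ t : ℝ,
    |t| ≤ (M:ℝ)^(K+1) → ∀ a b : ℕ, M ≤ a → a ≤ b → b + 1 ≤ 4 * M →
    ‖∑ n ∈ Ioc a b, ee (-(t * Real.log n)) - ∫ u in (a:ℝ)..b, ee (-(t * Real.log u))‖ ≤ C * (M:ℝ)^(1-δ) := by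
  induction K with
  | zero =>
    refine ⟨1/2, by norm_num, le_rfl, 32, by norm_num, ?_⟩
    intro M hM t ht a b ha hab hb
    have hM1 : (1:ℝ) ≤ M := by exact_mod_cast hM
    have hM0 : (0:ℝ) < M := by linarith
    have hs : (M:ℝ)^(1-1/2:ℝ) = Real.sqrt M := by rw [Real.sqrt_eq_rpow]; norm_num
    rw [hs]
    have hs0 : 0 < Real.sqrt M := Real.sqrt_pos.mpr hM0
    by_cases hsm : |t| ≤ Real.sqrt M
    · refine (exp_small M hM t a b ha hab hb).trans ?_
      linarith
    · push Not at hsm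
      have ht0 : 0 < |t| := by linarith
      have h1 := exp_base M hM |t| ht0 (by simpa using ht) a b ha hab hb
      have h1' : ‖∑ n ∈ Ioc a b, ee (-(t * Real.log n))‖ ≤ 24 * M / |t| := by
        rcases abs_choice t with h | h
        · rw [h] at h1 ⊢; exact h1
        · rw [h] at h1 ⊢; rwa [norm_neg_t] at h1
      have h2 := integral_ee_log t (abs_pos.mp ht0) a b (by exact_mod_cast (lt_of_lt_of_le hM ha)) (by exact_mod_cast hab)
      have hb' : (b:ℝ) ≤ 4 * M := by have : b ≤ 4 * M := by omega
                                     exact_mod_cast this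
      calc _ ≤ 24 * M / |t| + 2 * b / |t| := (norm_sub_le _ _).trans (add_le_add h1' h2)
        _ ≤ 24 * M / |t| + 2 * (4 * M) / |t| := by gcongr
        _ = 32 * (M / |t|) := by ring
        _ ≤ 32 * (M / Real.sqrt M) := by gcongr
        _ = _ := by rw [Real.div_sqrt]
  | succ K ih =>
    obtain ⟨δ1, hd1, hd1', C1, hC1, h1⟩ := ih
    obtain ⟨δ2, hd2, hd2', C2, hC2, h2⟩ := exp_k (K+1+1) (by omega)
    refine ⟨min δ1 δ2, lt_min hd1 hd2, (min_le_left _ _).trans hd1', C1 + C2 + 8, by positivity, ?_⟩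
    intro M hM t ht a b ha hab hb
    have hM1 : (1:ℝ) ≤ M := by exact_mod_cast hM
    have hM0 : (0:ℝ) < M := by linarith
    have g1 : (M:ℝ)^(1-δ1) ≤ (M:ℝ)^(1-min δ1 δ2) := Real.rpow_le_rpow_of_exponent_le hM1 (by linarith [min_le_left δ1 δ2])
    have g2 : (M:ℝ)^(1-δ2) ≤ (M:ℝ)^(1-min δ1 δ2) := Real.rpow_le_rpow_of_exponent_le hM1 (by linarith [min_le_right δ1 δ2])
    have g3 : 1 ≤ (M:ℝ)^(1-min δ1 δ2) := Real.one_le_rpow hM1 (by linarith [min_le_left δ1 δ2])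
    set W := (M:ℝ)^(1-min δ1 δ2)
    by_cases hsm : |t| ≤ (M:ℝ)^(K+1)
    · refine (h1 M hM t hsm a b ha hab hb).trans ?_
      nlinarith
    · push Not at hsm
      have ht0 : 0 < |t| := lt_trans (by positivity) hsm
      have h3 := h2 M hM |t| hsm.le ht a b ha hab hb
      have h3' : ‖∑ n ∈ Ioc a b, ee (-(t * Real.log n))‖ ≤ C2 * (M:ℝ)^(1-δ2) := by
        rcases abs_choice t with h | h
        · rw [h] at h3; exact h3
        · rw [h] at h3; rwa [norm_neg_t] at h3
      have h4 := integral_ee_log t (abs_pos.mp ht0) a b (by exact_mod_cast (lt_of_lt_of_le hM ha)) (by exact_mod_cast hab)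
      have hb' : (b:ℝ) ≤ 4 * M := by have : b ≤ 4 * M := by omega
                                     exact_mod_cast this
      have h5 : 2 * (b:ℝ) / |t| ≤ 8 := by
        rw [div_le_iff₀ ht0]
        have : (M:ℝ) ≤ (M:ℝ)^(K+1) := le_self_pow₀ hM1 (by omega)
        linarith
      calc _ ≤ C2 * (M:ℝ)^(1-δ2) + 8 := (norm_sub_le _ _).trans (add_le_add h3' (h4.trans h5))
        _ ≤ C2 * W + 8 * W := by nlinarith
        _ ≤ _ := by nlinarith

end TP

namespace TP
open Finset

/-- truncated elementary symmetric sums -/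
noncomputable def es (x : ℕ → ℝ) (P : Finset ℕ) (j : ℕ) : ℝ := ∑ S ∈ P.powersetCard j, ∏ p ∈ S, x p

lemma es_zero (x : ℕ → ℝ) (P : Finset ℕ) : es x P 0 = 1 := by simp [es]

lemma es_empty (x : ℕ → ℝ) (j : ℕ) : es x ∅ (j+1) = 0 := by
  unfold es; rw [powersetCard_eq_empty.mpr (by simp)]; simp

lemma es_insert (x : ℕ → ℝ) (P : Finset ℕ) (q : ℕ) (hq : q ∉ P) (j : ℕ) :
    es x (insert q P) (j+1) = es x P (j+1) + x q * es x P j := by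
  unfold es
  rw [powersetCard_succ_insert hq, sum_union]
  · congr 1
    rw [sum_image, mul_sum]
    · refine sum_congr rfl fun S hS => ?_
      rw [prod_insert]; intro h; exact hq ((mem_powersetCard.mp hS).1 h)
    · intro S hS T hT h
      have h1 : q ∉ S := fun h => hq ((mem_powersetCard.mp hS).1 h)
      have h2 : q ∉ T := fun h => hq ((mem_powersetCard.mp hT).1 h)
      have := congrArg (fun A => A.erase q) h
      simpa [erase_insert h1, erase_insert h2] using this
  · rw [disjoint_left]
    intro S hS hS'
    simp only [mem_image] at hS'
    obtain ⟨T, _, rfl⟩ := hS'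
    exact hq ((mem_powersetCard.mp hS).1 (mem_insert_self _ _))

lemma es_nonneg (x : ℕ → ℝ) (P : Finset ℕ) (hx : ∀ p ∈ P, 0 ≤ x p) (j : ℕ) : 0 ≤ es x P j :=
  sum_nonneg fun S hS => prod_nonneg fun p hp => hx p ((mem_powersetCard.mp hS).1 hp)

lemma es_le (x : ℕ → ℝ) (P : Finset ℕ) (hx : ∀ p ∈ P, 0 ≤ x p) (j : ℕ) :
    es x P j ≤ (∑ p ∈ P, x p)^j / j.factorial := by
  induction P using Finset.induction_on generalizing j with
  | empty =>
    cases j with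
    | zero => simp [es_zero]
    | succ j => rw [es_empty]; simp
  | insert q P hq ih =>
    cases j with
    | zero => simp [es_zero]
    | succ j =>
      have hx' : ∀ p ∈ P, 0 ≤ x p := fun p hp => hx p (mem_insert_of_mem hp)
      have hq0 := hx q (mem_insert_self _ _)
      rw [es_insert _ _ _ hq, sum_insert hq]
      set s := ∑ p ∈ P, x p with hs
      have hs0 : 0 ≤ s := sum_nonneg hx'
      have h1 := ih hx' (j+1)
      have h2 := ih hx' j
      have h3 : s^(j+1) + (j+1) * (x q * s^j) ≤ (x q + s)^(j+1) := by
        clear_value s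
        clear ih h1 h2 hs hx hx'
        induction j with
        | zero => simp; linarith
        | succ j ih2 =>
          have h4 : 0 ≤ (j+1) * (x q * s^j) * x q := by positivity
          calc s^(j+1+1) + ((j+1:ℕ)+1) * (x q * s^(j+1)) ≤ (s^(j+1) + (j+1) * (x q * s^j)) * (x q + s) := by
                push_cast
                have : (s^(j+1) + (j+1) * (x q * s^j)) * (x q + s) = s^(j+1+1) + ((j+1)+1) * (x q * s^(j+1)) + (j+1) * (x q * s^j) * x q := by ring
                rw [this]; linarith
            _ ≤ (x q + s)^(j+1) * (x q + s) := by gcongr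
            _ = _ := by ring
      have hf : (0:ℝ) < (j+1).factorial := by positivity
      calc es x P (j+1) + x q * es x P j ≤ s^(j+1) / (j+1).factorial + x q * (s^j / j.factorial) := by gcongr
        _ = (s^(j+1) + (j+1) * (x q * s^j)) / (j+1).factorial := by
          rw [Nat.factorial_succ]; push_cast; field_simp
        _ ≤ _ := by gcongr

noncomputable def bs (x : ℕ → ℝ) (P : Finset ℕ) (m : ℕ) : ℝ := ∑ j ∈ range (m+1), (-1)^j * es x P j

lemma bs_insert (x : ℕ → ℝ) (P : Finset ℕ) (q : ℕ) (hq : q ∉ P) (m : ℕ) :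
    bs x (insert q P) (m+1) = bs x P (m+1) - x q * bs x P m := by
  unfold bs
  rw [sum_range_succ' _ (m+1), sum_range_succ' _ (m+1), es_zero, es_zero, mul_sum]
  have : ∀ j ∈ range (m+1), (-1:ℝ)^(j+1) * es x (insert q P) (j+1) = (-1)^(j+1) * es x P (j+1) - x q * ((-1)^j * es x P j) := by
    intro j _; rw [es_insert _ _ _ hq]; ring
  rw [sum_congr rfl this, sum_sub_distrib]; ring

/-- Bonferroni -/
lemma bonferroni (x : ℕ → ℝ) (P : Finset ℕ) (hx : ∀ p ∈ P, 0 ≤ x p ∧ x p ≤ 1) (m : ℕ) :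
    0 ≤ (-1)^m * (bs x P m - ∏ p ∈ P, (1 - x p)) ∧ (-1)^m * (bs x P m - ∏ p ∈ P, (1 - x p)) ≤ es x P (m+1) := by
  induction P using Finset.induction_on generalizing m with
  | empty =>
    have : bs x ∅ m = 1 := by
      unfold bs; rw [sum_range_succ', es_zero, sum_eq_zero]; simp
      intro j _; rw [es_empty]; simp
    rw [this, es_empty]; simp
  | insert q P hq ih =>
    have hx' : ∀ p ∈ P, 0 ≤ x p ∧ x p ≤ 1 := fun p hp => hx p (mem_insert_of_mem hp)
    obtain ⟨hq0, hq1⟩ := hx q (mem_insert_self _ _)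
    rw [prod_insert hq, es_insert _ _ _ hq]
    have hp0 : 0 ≤ ∏ p ∈ P, (1 - x p) := prod_nonneg fun p hp => by linarith [(hx' p hp).2]
    have hp1 : ∏ p ∈ P, (1 - x p) ≤ 1 := prod_le_one (fun p hp => by linarith [(hx' p hp).2]) (fun p hp => by linarith [(hx' p hp).1])
    cases m with
    | zero =>
      have h := ih hx' 0
      have e : ∀ Q, bs x Q 0 = 1 := fun Q => by simp [bs, es_zero]
      rw [e] at h ⊢
      rw [es_zero]
      simp only [pow_zero, one_mul] at h ⊢
      constructor <;> nlinarith
    | succ m =>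
      have h1 := ih hx' (m+1)
      have h2 := ih hx' m
      rw [bs_insert _ _ _ hq]
      have e : (-1:ℝ)^(m+1) * (bs x P (m+1) - x q * bs x P m - (1 - x q) * ∏ p ∈ P, (1 - x p))
        = (-1)^(m+1) * (bs x P (m+1) - ∏ p ∈ P, (1 - x p)) + x q * ((-1)^m * (bs x P m - ∏ p ∈ P, (1 - x p))) := by ring
      rw [e]
      constructor
      · have := mul_nonneg hq0 h2.1; linarith [h1.1]
      · have := mul_le_mul_of_nonneg_left h2.2 hq0; linarith [h1.2]

/-- finite combination of divisibility indicators -/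
structure SF where
  ι : Type
  fi : Fintype ι
  c : ι → ℝ
  d : ι → ℕ

attribute [instance] SF.fi

namespace SF
noncomputable def ev (S : SF) (n : ℕ) : ℝ := ∑ i, S.c i * (if S.d i ∣ n then 1 else 0)
noncomputable def mean (S : SF) : ℝ := ∑ i, S.c i * (1 / (S.d i : ℝ))
noncomputable def nrm (S : SF) : ℝ := ∑ i, |S.c i|
noncomputable def inv (S : SF) : ℝ := ∑ i, |S.c i| * (1 / (S.d i : ℝ))

def mul (S T : SF) : SF := ⟨S.ι × T.ι, inferInstance, fun i => S.c i.1 * T.c i.2, fun i => S.d i.1 * T.d i.2⟩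
def add (S T : SF) : SF := ⟨S.ι ⊕ T.ι, inferInstance, Sum.elim S.c T.c, Sum.elim S.d T.d⟩

lemma add_ev (S T : SF) (n : ℕ) : (S.add T).ev n = S.ev n + T.ev n := Fintype.sum_sum_type _
lemma add_mean (S T : SF) : (S.add T).mean = S.mean + T.mean := Fintype.sum_sum_type _
lemma add_nrm (S T : SF) : (S.add T).nrm = S.nrm + T.nrm := Fintype.sum_sum_type _

lemma mul_mean (S T : SF) : (S.mul T).mean = S.mean * T.mean := by
  unfold mean; rw [sum_mul_sum, ← Fintype.sum_prod_type']
  refine Fintype.sum_congr _ _ fun i => ?_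
  simp only [mul]; push_cast; ring
lemma mul_nrm (S T : SF) : (S.mul T).nrm = S.nrm * T.nrm := by
  unfold nrm; rw [sum_mul_sum, ← Fintype.sum_prod_type']
  refine Fintype.sum_congr _ _ fun i => ?_
  simp only [mul]; rw [abs_mul]
lemma mul_inv (S T : SF) : (S.mul T).inv = S.inv * T.inv := by
  unfold inv; rw [sum_mul_sum, ← Fintype.sum_prod_type']
  refine Fintype.sum_congr _ _ fun i => ?_
  simp only [mul]; rw [abs_mul]; push_cast; ring
lemma mul_ev (S T : SF) (h : ∀ i j, (S.d i).Coprime (T.d j)) (n : ℕ) : (S.mul T).ev n = S.ev n * T.ev n := by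
  unfold ev; rw [sum_mul_sum, ← Fintype.sum_prod_type']
  refine Fintype.sum_congr _ _ fun i => ?_
  simp only [mul]
  have : S.d i.1 * T.d i.2 ∣ n ↔ S.d i.1 ∣ n ∧ T.d i.2 ∣ n :=
    ⟨fun h => ⟨dvd_of_mul_right_dvd h, dvd_of_mul_left_dvd h⟩, fun ⟨h1, h2⟩ => (h i.1 i.2).mul_dvd_of_dvd_of_dvd h1 h2⟩
  by_cases h1 : S.d i.1 ∣ n <;> by_cases h2 : T.d i.2 ∣ n <;> simp [this, h1, h2]

lemma nrm_nonneg (S : SF) : 0 ≤ S.nrm := sum_nonneg fun _ _ => abs_nonneg _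
lemma inv_nonneg (S : SF) : 0 ≤ S.inv := sum_nonneg fun _ _ => by positivity

lemma count (S : SF) (hd : ∀ i, 0 < S.d i) (a b : ℕ) (hab : a ≤ b) :
    |∑ n ∈ Ioc a b, S.ev n - S.mean * ((b:ℝ) - a)| ≤ S.nrm := by
  unfold ev mean nrm
  rw [sum_comm, sum_mul, ← sum_sub_distrib]
  refine (abs_sum_le_sum_abs _ _).trans (sum_le_sum fun i _ => ?_)
  rw [← mul_sum, mul_assoc, ← mul_sub, abs_mul]
  have hdi : (0:ℝ) < S.d i := by exact_mod_cast hd i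
  have e : ∑ n ∈ Ioc a b, (if S.d i ∣ n then (1:ℝ) else 0) = ((b / S.d i : ℕ):ℝ) - ((a / S.d i : ℕ):ℝ) := by
    have key : ∀ m : ℕ, ∑ n ∈ Ioc 0 m, (if S.d i ∣ n then (1:ℝ) else 0) = ((m / S.d i : ℕ):ℝ) := by
      intro m
      rw [← sum_filter, sum_const, nsmul_eq_mul, mul_one, Nat.Ioc_filter_dvd_card_eq_div]
    rw [← key, ← key, ← sum_Ioc_consecutive _ (Nat.zero_le a) hab]; ring
  rw [e]
  have hb1 : ((b / S.d i : ℕ):ℝ) ≤ (b:ℝ) / S.d i := Nat.cast_div_le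
  have ha1 : ((a / S.d i : ℕ):ℝ) ≤ (a:ℝ) / S.d i := Nat.cast_div_le
  have lt : ∀ b : ℕ, (b:ℝ) / S.d i < ((b / S.d i : ℕ):ℝ) + 1 := by
    intro b
    rw [div_lt_iff₀ hdi]
    have := Nat.lt_div_mul_add (a := b) (hd i)
    have h2 : b < (b / S.d i + 1) * S.d i := by linarith
    exact_mod_cast h2
  have hb2 := lt b
  have ha2 := lt a
  have : |((b / S.d i : ℕ):ℝ) - ((a / S.d i : ℕ):ℝ) - 1 / (S.d i:ℝ) * ((b:ℝ) - a)| ≤ 1 := by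
    have e2 : 1 / (S.d i:ℝ) * ((b:ℝ) - a) = (b:ℝ) / S.d i - (a:ℝ) / S.d i := by ring
    rw [e2, abs_le]; constructor <;> linarith
  calc _ ≤ |S.c i| * 1 := by gcongr
    _ = _ := mul_one _

end SF
end TP

namespace TP
open Finset

def Pb (a b : ℕ) : Finset ℕ := (Ioc a b).filter Nat.Prime

lemma mem_Pb {a b p : ℕ} : p ∈ Pb a b ↔ (a < p ∧ p ≤ b) ∧ p.Prime := by simp [Pb]

lemma mertens1 (N : ℕ) (hN : 1 ≤ N) : ∑ p ∈ Pb 0 N, Real.log p / p ≤ Real.log N + Real.log 4 := by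
  have hdvd : ∏ p ∈ Pb 0 N, p ^ (N / p) ∣ N.factorial := by
    apply Finset.prod_dvd_of_isRelPrime
    · intro p hp q hq hpq
      have hp' := (mem_Pb.mp hp).2
      have hq' := (mem_Pb.mp hq).2
      have := Nat.Coprime.pow (N/p) (N/q) ((Nat.coprime_primes hp' hq').mpr hpq)
      exact Nat.coprime_iff_isRelPrime.mp this
    · intro p hp
      have hp' := (mem_Pb.mp hp).2
      rw [hp'.pow_dvd_factorial_iff (b := Nat.log p N + 2) (by omega)]
      have : (1:ℕ) ∈ Ico 1 (Nat.log p N + 2) := by simp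
      have := single_le_sum (f := fun i => N / p ^ i) (fun _ _ => Nat.zero_le _) this
      simpa using this
  have h1 : ∏ p ∈ Pb 0 N, p ^ (N / p) ≤ N ^ N := (Nat.le_of_dvd (Nat.factorial_pos _) hdvd).trans (Nat.factorial_le_pow N)
  have hpos : ∀ p ∈ Pb 0 N, (0:ℝ) < p := fun p hp => by exact_mod_cast (mem_Pb.mp hp).2.pos
  have h2 : ∑ p ∈ Pb 0 N, ((N / p : ℕ):ℝ) * Real.log p ≤ N * Real.log N := by
    have h3 : ((∏ p ∈ Pb 0 N, p ^ (N / p) : ℕ):ℝ) ≤ (N:ℝ)^N := by exact_mod_cast h1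
    have h4 : 0 < ((∏ p ∈ Pb 0 N, p ^ (N / p) : ℕ):ℝ) := by
      push_cast; exact prod_pos fun p hp => pow_pos (hpos p hp) _
    have h5 := Real.log_le_log h4 h3
    rw [Real.log_pow] at h5
    push_cast at h5
    rw [Real.log_prod (fun p hp => (pow_pos (hpos p hp) _).ne')] at h5
    simpa [Real.log_pow] using h5
  have h6 : ∑ p ∈ Pb 0 N, Real.log p ≤ Real.log 4 * N := by
    have := Chebyshev.theta_le_log4_mul_x (x := (N:ℝ)) (by positivity)
    have e : Chebyshev.theta (N:ℝ) = ∑ p ∈ Pb 0 N, Real.log p := by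
      unfold Chebyshev.theta Pb; rw [Nat.floor_natCast]
    rwa [e] at this
  have hN0 : (0:ℝ) < N := by exact_mod_cast hN
  have h7 : ∑ p ∈ Pb 0 N, (N:ℝ) * (Real.log p / p) ≤ ∑ p ∈ Pb 0 N, (((N / p : ℕ):ℝ) * Real.log p + Real.log p) := by
    refine sum_le_sum fun p hp => ?_
    have hp1 : (1:ℝ) ≤ p := by exact_mod_cast (mem_Pb.mp hp).2.one_le
    have hl := Real.log_nonneg hp1
    have h8 : (N:ℝ) / p ≤ ((N / p : ℕ):ℝ) + 1 := by
      rw [div_le_iff₀ (hpos p hp)]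
      have := Nat.lt_div_mul_add (a := N) (mem_Pb.mp hp).2.pos
      have h2 : N ≤ (N / p + 1) * p := by linarith
      exact_mod_cast h2
    calc (N:ℝ) * (Real.log p / p) = (N:ℝ) / p * Real.log p := by ring
      _ ≤ (((N / p : ℕ):ℝ) + 1) * Real.log p := by gcongr
      _ = _ := by ring
  rw [← mul_sum, sum_add_distrib] at h7
  have : (N:ℝ) * ∑ p ∈ Pb 0 N, Real.log p / p ≤ N * (Real.log N + Real.log 4) := by linarith
  exact le_of_mul_le_mul_left this hN0

lemma block_sum (y : ℕ) (hy : 2 ≤ y) : ∑ p ∈ Pb y.sqrt y, 1 / (p:ℝ) ≤ 6 := by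
  have hm := mertens1 y (by omega)
  have hy2 : (2:ℝ) ≤ y := by exact_mod_cast hy
  have hl : 0 < Real.log y := Real.log_pos (by linarith)
  have hl2 : Real.log 2 ≤ Real.log y := Real.log_le_log (by norm_num) hy2
  have h4 : Real.log 4 = 2 * Real.log 2 := by
    rw [show (4:ℝ) = 2^2 by norm_num, Real.log_pow]; norm_num
  have h1 : ∑ p ∈ Pb y.sqrt y, (Real.log y / 2) * (1 / (p:ℝ)) ≤ ∑ p ∈ Pb 0 y, Real.log p / p := by
    calc _ ≤ ∑ p ∈ Pb y.sqrt y, Real.log p / p := by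
          refine sum_le_sum fun p hp => ?_
          obtain ⟨⟨h1, h2⟩, h3⟩ := mem_Pb.mp hp
          have hp0 : (0:ℝ) < p := by exact_mod_cast h3.pos
          have : y ≤ p^2 := by
            have := Nat.lt_succ_sqrt' y
            exact (this.trans_le (Nat.pow_le_pow_left h1 2)).le
          have h5 : Real.log y ≤ 2 * Real.log p := by
            have h6 : (y:ℝ) ≤ (p:ℝ)^2 := by exact_mod_cast this
            have := Real.log_le_log (by linarith) h6
            rwa [Real.log_pow] at this
          rw [mul_one_div]
          gcongr; linarith
      _ ≤ _ := by
          refine sum_le_sum_of_subset_of_nonneg ?_ ?_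
          · intro p hp; obtain ⟨⟨h1, h2⟩, h3⟩ := mem_Pb.mp hp
            exact mem_Pb.mpr ⟨⟨h3.pos, h2⟩, h3⟩
          · intro p hp _
            have : (1:ℝ) ≤ p := by exact_mod_cast (mem_Pb.mp hp).2.one_le
            exact div_nonneg (Real.log_nonneg this) (by linarith)
  rw [← mul_sum] at h1
  have : (Real.log y / 2) * ∑ p ∈ Pb y.sqrt y, 1 / (p:ℝ) ≤ (Real.log y / 2) * 6 := by linarith
  exact le_of_mul_le_mul_left this (by linarith)

/-- rough indicator for primes in a finset -/
noncomputable def rP (P : Finset ℕ) (n : ℕ) : ℝ := ∏ p ∈ P, (1 - if p ∣ n then (1:ℝ) else 0)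
noncomputable def VP (P : Finset ℕ) : ℝ := ∏ p ∈ P, (1 - 1 / (p:ℝ))

lemma rP_nonneg (P : Finset ℕ) (n : ℕ) : 0 ≤ rP P n := prod_nonneg fun p _ => by split_ifs <;> norm_num

lemma block_V (y : ℕ) (hy : 2 ≤ y) : Real.exp (-12) ≤ VP (Pb y.sqrt y) := by
  have h1 : ∀ p ∈ Pb y.sqrt y, Real.exp (-(2 * (1 / (p:ℝ)))) ≤ 1 - 1 / (p:ℝ) := by
    intro p hp
    have h2 : (2:ℝ) ≤ p := by exact_mod_cast (mem_Pb.mp hp).2.two_le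
    set x := 1 / (p:ℝ) with hx
    have hx0 : 0 ≤ x := by positivity
    have hx1 : x ≤ 1/2 := by rw [hx]; exact one_div_le_one_div_of_le (by norm_num) h2
    have h3 : 1 / (1 - x) ≤ Real.exp (2*x) := by
      have : 1 / (1 - x) ≤ 2 * x + 1 := by
        rw [div_le_iff₀ (by linarith)]; nlinarith
      linarith [Real.add_one_le_exp (2*x)]
    rw [Real.exp_neg, ← one_div]
    rw [div_le_iff₀ (by linarith)] at h3
    rw [div_le_iff₀ (Real.exp_pos _)]; linarith
  unfold VP
  calc Real.exp (-12) ≤ Real.exp (∑ p ∈ Pb y.sqrt y, -(2 * (1 / (p:ℝ)))) := by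
        rw [Real.exp_le_exp, sum_neg_distrib, ← mul_sum]; linarith [block_sum y hy]
    _ = ∏ p ∈ Pb y.sqrt y, Real.exp (-(2 * (1 / (p:ℝ)))) := Real.exp_sum _ _
    _ ≤ _ := prod_le_prod (fun _ _ => (Real.exp_pos _).le) h1

/-- subsets of size at most m with sign -/
noncomputable def Ublk (P : Finset ℕ) (m : ℕ) : SF :=
  ⟨(Σ j : Fin (m+1), {S // S ∈ P.powersetCard j}), inferInstance, fun i => (-1)^(i.1:ℕ), fun i => ∏ p ∈ i.2.1, p⟩
noncomputable def Wblk (P : Finset ℕ) (m : ℕ) : SF :=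
  ⟨{S // S ∈ P.powersetCard m}, inferInstance, fun _ => 1, fun i => ∏ p ∈ i.1, p⟩

lemma sum_Ublk (P : Finset ℕ) (m : ℕ) (f : ℕ → Finset ℕ → ℝ) :
    ∑ i : (Ublk P m).ι, f i.1 i.2.1 = ∑ j ∈ range (m+1), ∑ S ∈ P.powersetCard j, f j S := by
  unfold Ublk
  rw [Fintype.sum_sigma, ← Fin.sum_univ_eq_sum_range (fun j => ∑ S ∈ P.powersetCard j, f j S)]
  refine Fintype.sum_congr _ _ fun j => ?_
  exact (sum_coe_sort (P.powersetCard j) (fun S => f j S))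

lemma sum_Wblk (P : Finset ℕ) (m : ℕ) (f : Finset ℕ → ℝ) :
    ∑ i : (Wblk P m).ι, f i.1 = ∑ S ∈ P.powersetCard m, f S :=
  (sum_coe_sort (P.powersetCard m) (fun S => f S))

lemma prod_dvd_ind (S : Finset ℕ) (hS : ∀ p ∈ S, p.Prime) (n : ℕ) :
    (if (∏ p ∈ S, p) ∣ n then (1:ℝ) else 0) = ∏ p ∈ S, (if p ∣ n then (1:ℝ) else 0) := by
  by_cases h : ∀ p ∈ S, p ∣ n
  · rw [if_pos (Finset.prod_primes_dvd n (fun p hp => (hS p hp).prime) h), prod_congr rfl (fun p hp => if_pos (h p hp))]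
    simp
  · push Not at h
    obtain ⟨p, hp, hpn⟩ := h
    rw [if_neg (fun h => hpn ((dvd_prod_of_mem _ hp).trans h)), prod_eq_zero hp (if_neg hpn)]

lemma Ublk_ev (P : Finset ℕ) (hP : ∀ p ∈ P, p.Prime) (m n : ℕ) :
    (Ublk P m).ev n = bs (fun p => if p ∣ n then 1 else 0) P m := by
  unfold SF.ev bs es
  rw [show (∑ i, (Ublk P m).c i * (if (Ublk P m).d i ∣ n then (1:ℝ) else 0)) = _ from
    sum_Ublk P m (fun j S => (-1)^j * (if (∏ p ∈ S, p) ∣ n then (1:ℝ) else 0))]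
  refine sum_congr rfl fun j _ => ?_
  rw [mul_sum]
  refine sum_congr rfl fun S hS => ?_
  rw [prod_dvd_ind S fun p hp => hP p ((mem_powersetCard.mp hS).1 hp)]

lemma Wblk_ev (P : Finset ℕ) (hP : ∀ p ∈ P, p.Prime) (m n : ℕ) :
    (Wblk P m).ev n = es (fun p => if p ∣ n then 1 else 0) P m := by
  unfold SF.ev es
  rw [show (∑ i, (Wblk P m).c i * (if (Wblk P m).d i ∣ n then (1:ℝ) else 0)) = _ from
    sum_Wblk P m (fun S => 1 * (if (∏ p ∈ S, p) ∣ n then (1:ℝ) else 0))]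
  refine sum_congr rfl fun S hS => ?_
  rw [prod_dvd_ind S fun p hp => hP p ((mem_powersetCard.mp hS).1 hp), one_mul]

lemma inv_prod (S : Finset ℕ) : 1 / ((∏ p ∈ S, p : ℕ):ℝ) = ∏ p ∈ S, 1 / (p:ℝ) := by
  push_cast; simp

lemma Ublk_mean (P : Finset ℕ) (m : ℕ) : (Ublk P m).mean = bs (fun p => 1 / (p:ℝ)) P m := by
  unfold SF.mean bs es
  rw [show (∑ i, (Ublk P m).c i * (1 / ((Ublk P m).d i : ℝ))) = _ from
    sum_Ublk P m (fun j S => (-1)^j * (1 / ((∏ p ∈ S, p : ℕ):ℝ)))]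
  refine sum_congr rfl fun j _ => ?_
  rw [mul_sum]
  exact sum_congr rfl fun S hS => by rw [inv_prod]

lemma Wblk_mean (P : Finset ℕ) (m : ℕ) : (Wblk P m).mean = es (fun p => 1 / (p:ℝ)) P m := by
  unfold SF.mean es
  rw [show (∑ i, (Wblk P m).c i * (1 / ((Wblk P m).d i : ℝ))) = _ from
    sum_Wblk P m (fun S => 1 * (1 / ((∏ p ∈ S, p : ℕ):ℝ)))]
  exact sum_congr rfl fun S hS => by rw [inv_prod, one_mul]

lemma Ublk_inv (P : Finset ℕ) (m : ℕ) : (Ublk P m).inv = ∑ j ∈ range (m+1), es (fun p => 1 / (p:ℝ)) P j := by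
  unfold SF.inv es
  rw [show (∑ i, |(Ublk P m).c i| * (1 / ((Ublk P m).d i : ℝ))) = _ from
    sum_Ublk P m (fun j S => |(-1)^j| * (1 / ((∏ p ∈ S, p : ℕ):ℝ)))]
  refine sum_congr rfl fun j _ => sum_congr rfl fun S hS => by rw [inv_prod]; simp

lemma Ublk_nrm (P : Finset ℕ) (m : ℕ) : (Ublk P m).nrm ≤ ((P.card:ℝ)+1)^m := by
  unfold SF.nrm
  rw [show (∑ i, |(Ublk P m).c i|) = _ from sum_Ublk P m (fun j S => |(-1)^j|)]
  simp only [abs_pow, abs_neg, abs_one, one_pow, sum_const, nsmul_eq_mul, mul_one, card_powersetCard]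
  have : ∑ j ∈ range (m+1), ((P.card.choose j : ℕ):ℝ) ≤ ∑ j ∈ range (m+1), (P.card:ℝ)^j := by
    refine sum_le_sum fun j _ => ?_
    exact_mod_cast Nat.choose_le_pow P.card j
  refine this.trans ?_
  have h0 : (0:ℝ) ≤ P.card := by positivity
  clear this
  induction m with
  | zero => simp
  | succ m ih =>
    rw [sum_range_succ]
    have : (P.card:ℝ)^(m+1) ≤ ((P.card:ℝ)+1)^m * P.card := by
      rw [pow_succ]; gcongr; linarith
    calc _ ≤ ((P.card:ℝ)+1)^m + ((P.card:ℝ)+1)^m * P.card := add_le_add ih this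
      _ = _ := by ring

lemma Wblk_nrm (P : Finset ℕ) (m : ℕ) : (Wblk P m).nrm ≤ ((P.card:ℝ)+1)^m := by
  unfold SF.nrm
  rw [show (∑ i, |(Wblk P m).c i|) = _ from sum_Wblk P m (fun S => |1|)]
  simp only [abs_one, sum_const, nsmul_eq_mul, mul_one, card_powersetCard]
  have : ((P.card.choose m : ℕ):ℝ) ≤ (P.card:ℝ)^m := by exact_mod_cast Nat.choose_le_pow P.card m
  refine this.trans ?_
  gcongr; linarith

end TP

namespace TP
open Finset

noncomputable def sk (k : ℕ) : ℝ := Real.exp 36 * (1/16)^k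

lemma sk_pos (k : ℕ) : 0 < sk k := by unfold sk; positivity

structure Sv (y k J : ℕ) (U W : SF) : Prop where
  dU : ∀ i, 0 < U.d i ∧ (U.d i : ℝ) ≤ (y:ℝ)^(4*k+8) ∧ ∀ p : ℕ, p.Prime → p ∣ U.d i → p ≤ y
  dW : ∀ i, 0 < W.d i ∧ ∀ p : ℕ, p.Prime → p ∣ W.d i → p ≤ y
  nU : U.nrm ≤ (y:ℝ)^(4*k+8)
  nW : W.nrm ≤ (y:ℝ)^(4*k+8)
  iU : U.inv ≤ Real.exp (6 * J)
  e1 : ∀ n, rP (Pb 0 y) n ≤ U.ev n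
  e2 : ∀ n, U.ev n - rP (Pb 0 y) n ≤ W.ev n
  m1 : VP (Pb 0 y) ≤ U.mean
  m2 : U.mean ≤ VP (Pb 0 y) * Real.exp (sk k)
  m3 : W.mean ≤ VP (Pb 0 y) * (sk k * Real.exp (sk k))

lemma blk_exists (y k : ℕ) (hy : 2 ≤ y) : ∃ U W : SF,
    (∀ i, 0 < U.d i ∧ (U.d i : ℝ) ≤ (y:ℝ)^(2*k+1) ∧ ∀ p : ℕ, p.Prime → p ∣ U.d i → y.sqrt < p ∧ p ≤ y) ∧
    (∀ i, 0 < W.d i ∧ ∀ p : ℕ, p.Prime → p ∣ W.d i → y.sqrt < p ∧ p ≤ y) ∧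
    U.nrm ≤ (y:ℝ)^(2*k) ∧ W.nrm ≤ (y:ℝ)^(2*k+1) ∧ U.inv ≤ Real.exp 6 ∧
    (∀ n, rP (Pb y.sqrt y) n ≤ U.ev n) ∧ (∀ n, U.ev n - rP (Pb y.sqrt y) n ≤ W.ev n) ∧
    VP (Pb y.sqrt y) ≤ U.mean ∧ U.mean ≤ VP (Pb y.sqrt y) * Real.exp (sk k / 4) ∧
    W.mean ≤ VP (Pb y.sqrt y) * (sk k / 4) := by
  set P := Pb y.sqrt y with hP
  have hpr : ∀ p ∈ P, p.Prime := fun p hp => (mem_Pb.mp hp).2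
  have hx0 : ∀ p ∈ P, 0 ≤ 1 / (p:ℝ) ∧ 1 / (p:ℝ) ≤ 1 := fun p hp => by
    have : (1:ℝ) ≤ p := by exact_mod_cast (hpr p hp).one_le
    exact ⟨by positivity, by rw [div_le_one (by linarith)]; exact this⟩
  have hsum := block_sum y hy
  have hV := block_V y hy
  rw [← hP] at hsum hV
  have hs0 : 0 ≤ ∑ p ∈ P, 1 / (p:ℝ) := sum_nonneg fun p hp => (hx0 p hp).1
  have hy2 : (2:ℝ) ≤ y := by exact_mod_cast hy
  have hcard : (P.card:ℝ) + 1 ≤ y := by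
    have h1 : P.card ≤ (Ioc y.sqrt y).card := card_filter_le _ _
    rw [Nat.card_Ioc] at h1
    have h2 : 0 < y.sqrt := Nat.sqrt_pos.mpr (by omega)
    have : P.card + 1 ≤ y := by omega
    exact_mod_cast this
  have hsub : ∀ S ⊆ P, (0 < ∏ p ∈ S, p) ∧ ∀ p : ℕ, p.Prime → p ∣ ∏ p ∈ S, p → y.sqrt < p ∧ p ≤ y := by
    intro S hS
    refine ⟨prod_pos fun p hp => (hpr p (hS hp)).pos, ?_⟩
    intro p hp hd
    obtain ⟨q, hq, hdq⟩ := (hp.prime.dvd_finsetProd_iff _).mp hd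
    have := (Nat.prime_dvd_prime_iff_eq hp (hpr q (hS hq))).mp hdq
    subst this
    exact (mem_Pb.mp (hS hq)).1
  have hes : es (fun p => 1 / (p:ℝ)) P (2*k+1) ≤ VP P * (sk k / 4) := by
    have h1 := es_le (fun p => 1 / (p:ℝ)) P (fun p hp => (hx0 p hp).1) (2*k+1)
    have h2 : (∑ p ∈ P, 1 / (p:ℝ))^(2*k+1) / (2*k+1).factorial ≤ 6^(2*k+1) / (2*k+1).factorial := by gcongr
    have h3 : (24:ℝ)^(2*k+1) / (2*k+1).factorial ≤ Real.exp 24 := Real.pow_div_factorial_le_exp _ (by norm_num) _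
    have h4 : (6:ℝ)^(2*k+1) / (2*k+1).factorial = ((24:ℝ)^(2*k+1) / (2*k+1).factorial) * ((1/16)^k / 4) := by
      rw [show (24:ℝ) = 6 * 4 by norm_num, mul_pow, show (4:ℝ)^(2*k+1) = 16^k * 4 by rw [pow_succ, pow_mul]; norm_num]
      rw [one_div, inv_pow]; field_simp
    have h5 : Real.exp 24 = Real.exp (-12) * Real.exp 36 := by rw [← Real.exp_add]; norm_num
    calc _ ≤ Real.exp 24 * ((1/16)^k / 4) := by
          refine h1.trans (h2.trans ?_); rw [h4]; gcongr
      _ = Real.exp (-12) * (sk k / 4) := by rw [h5]; unfold sk; ring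
      _ ≤ _ := by have := sk_pos k; gcongr
  have bm := bonferroni (fun p => 1 / (p:ℝ)) P hx0 (2*k)
  have hsgn : (-1:ℝ)^(2*k) = 1 := by rw [pow_mul]; norm_num
  rw [hsgn, one_mul] at bm
  have hVP : ∏ p ∈ P, (1 - 1 / (p:ℝ)) = VP P := rfl
  simp only [hVP] at bm
  have hVpos : 0 < VP P := (Real.exp_pos _).trans_le hV
  refine ⟨Ublk P (2*k), Wblk P (2*k+1), ?_, ?_, ?_, ?_, ?_, ?_, ?_, ?_, ?_, ?_⟩
  · rintro ⟨j, S, hS⟩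
    have hS' := mem_powersetCard.mp hS
    refine ⟨(hsub S hS'.1).1, ?_, (hsub S hS'.1).2⟩
    have hj : (j:ℕ) ≤ 2*k+1 := by have := j.2; omega
    have h1 : ∏ p ∈ S, p ≤ y ^ (2*k+1) := by
      calc ∏ p ∈ S, p ≤ ∏ p ∈ S, y := prod_le_prod' fun p hp => (mem_Pb.mp (hS'.1 hp)).1.2
        _ = y ^ (j:ℕ) := by rw [prod_const, hS'.2]
        _ ≤ _ := Nat.pow_le_pow_right (by omega) hj
    exact_mod_cast h1
  · rintro ⟨S, hS⟩
    exact hsub S (mem_powersetCard.mp hS).1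
  · refine (Ublk_nrm P (2*k)).trans ?_; gcongr
  · refine (Wblk_nrm P (2*k+1)).trans ?_; gcongr
  · rw [Ublk_inv]
    calc _ ≤ ∑ j ∈ range (2*k+1), (6:ℝ)^j / j.factorial := by
          refine sum_le_sum fun j _ => (es_le _ P (fun p hp => (hx0 p hp).1) j).trans ?_
          gcongr
      _ ≤ _ := Real.sum_le_exp_of_nonneg (by norm_num) _
  · intro n
    have := bonferroni (fun p => if p ∣ n then (1:ℝ) else 0) P (fun p _ => by split_ifs <;> norm_num) (2*k)
    rw [hsgn, one_mul] at this
    rw [Ublk_ev P hpr]; unfold rP; linarith [this.1]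
  · intro n
    have := bonferroni (fun p => if p ∣ n then (1:ℝ) else 0) P (fun p _ => by split_ifs <;> norm_num) (2*k)
    rw [hsgn, one_mul] at this
    rw [Ublk_ev P hpr, Wblk_ev P hpr]; unfold rP; linarith [this.2]
  · rw [Ublk_mean]; linarith [bm.1]
  · rw [Ublk_mean]
    have := Real.add_one_le_exp (sk k / 4)
    have := mul_le_mul_of_nonneg_left this hVpos.le
    linarith [bm.2]
  · rw [Wblk_mean]; exact hes

lemma Pb_split (y : ℕ) : Pb 0 y = Pb 0 y.sqrt ∪ Pb y.sqrt y ∧ Disjoint (Pb 0 y.sqrt) (Pb y.sqrt y) := by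
  have := Nat.sqrt_le_self y
  constructor
  · ext p; simp only [mem_union, mem_Pb]; constructor
    · rintro ⟨⟨h1, h2⟩, h3⟩
      by_cases h : p ≤ y.sqrt
      · exact Or.inl ⟨⟨h1, h⟩, h3⟩
      · exact Or.inr ⟨⟨by omega, h2⟩, h3⟩
    · rintro (⟨⟨h1, h2⟩, h3⟩ | ⟨⟨h1, h2⟩, h3⟩)
      · exact ⟨⟨h1, by omega⟩, h3⟩
      · exact ⟨⟨by omega, h2⟩, h3⟩
  · rw [disjoint_left]; intro p h1 h2
    have := mem_Pb.mp h1; have := mem_Pb.mp h2; omega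

lemma VP_pos (y : ℕ) : 0 < VP (Pb 0 y) := prod_pos fun p hp => by
  have : (2:ℝ) ≤ p := by exact_mod_cast (mem_Pb.mp hp).2.two_le
  have : 1 / (p:ℝ) ≤ 1/2 := one_div_le_one_div_of_le (by norm_num) this
  linarith

lemma sieve_exists (J : ℕ) : ∀ y : ℕ, 1 ≤ y → y < 2^(2^J) → ∀ k, ∃ U W, Sv y k J U W := by
  induction J with
  | zero =>
    intro y hy1 hy k
    have hy : y = 1 := by simp at hy; omega
    subst hy
    have hP : Pb 0 1 = ∅ := by
      ext p; simp only [mem_Pb, notMem_empty, iff_false]; rintro ⟨⟨_, h1⟩, h2⟩; have := h2.two_le; omega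
    have hs := sk_pos k
    refine ⟨⟨Unit, inferInstance, fun _ => 1, fun _ => 1⟩, ⟨Empty, inferInstance, fun _ => 1, fun _ => 1⟩, ?_⟩
    constructor
    · intro i; refine ⟨by simp, by simp, ?_⟩
      intro p hp hd; exact Nat.le_of_dvd one_pos hd
    · intro i; exact i.elim
    · simp [SF.nrm]
    · simp [SF.nrm]
    · simp [SF.inv]
    · intro n; rw [hP]; simp [rP, SF.ev]
    · intro n; rw [hP]; simp [rP, SF.ev]
    · rw [hP]; simp [VP, SF.mean]
    · rw [hP]; simp [VP, SF.mean]; exact hs.le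
    · rw [hP]; simp [VP, SF.mean]; positivity
  | succ J ih =>
    intro y hy1 hy k
    rcases Nat.lt_or_ge y 2 with h2 | h2
    · obtain ⟨U, W, h⟩ := ih y hy1 (lt_of_lt_of_le h2 (by
        calc 2 = 2^1 := rfl
          _ ≤ _ := Nat.pow_le_pow_right (by norm_num) Nat.one_le_two_pow)) k
      refine ⟨U, W, { h with iU := h.iU.trans ?_ }⟩
      rw [Real.exp_le_exp]; push_cast; linarith
    have hz : y.sqrt < 2^(2^J) := by
      rw [Nat.sqrt_lt']; rw [← pow_mul, ← pow_succ]; exact hy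
    have hz1 : 1 ≤ y.sqrt := Nat.sqrt_pos.mpr (by omega)
    obtain ⟨U2, W2, h⟩ := ih y.sqrt hz1 hz (k+1)
    obtain ⟨U1, W1, dU1, dW1, nU1, nW1, iU1, e11, e21, m11, m21, m31⟩ := blk_exists y k h2
    obtain ⟨hPs, hPd⟩ := Pb_split y
    set z := y.sqrt with hzdef
    have hzy : z ≤ y := Nat.sqrt_le_self y
    have hz2 : (z:ℝ)^2 ≤ y := by exact_mod_cast Nat.sqrt_le' y
    have hr : ∀ n, rP (Pb 0 y) n = rP (Pb z y) n * rP (Pb 0 z) n := by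
      intro n; rw [hPs]; unfold rP; rw [prod_union hPd, mul_comm]
    have hVe : VP (Pb 0 y) = VP (Pb z y) * VP (Pb 0 z) := by
      rw [hPs]; unfold VP; rw [prod_union hPd, mul_comm]
    have hV2 := VP_pos z
    have hV1 : 0 < VP (Pb z y) := by
      by_contra hc
      have := VP_pos y; rw [hVe] at this
      push Not at hc
      nlinarith
    have cop : ∀ a b : ℕ, (∀ p : ℕ, p.Prime → p ∣ a → z < p ∧ p ≤ y) → (∀ p : ℕ, p.Prime → p ∣ b → p ≤ z) → a.Coprime b := by
      intro a b ha hb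
      refine Nat.Coprime.symm (Nat.coprime_of_dvd fun p hp h1 h2 => ?_)
      have := ha p hp h2; have := hb p hp h1; omega
    have pf : ∀ a b : ℕ, (∀ p : ℕ, p.Prime → p ∣ a → z < p ∧ p ≤ y) → (∀ p : ℕ, p.Prime → p ∣ b → p ≤ z) → ∀ p : ℕ, p.Prime → p ∣ a * b → p ≤ y := by
      intro a b ha hb p hp hd
      rcases hp.dvd_mul.mp hd with h | h
      · exact (ha p hp h).2
      · exact (hb p hp h).trans hzy
    have cUU : ∀ i j, (U1.d i).Coprime (U2.d j) := fun i j => cop _ _ (dU1 i).2.2 (h.dU j).2.2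
    have cWU : ∀ i j, (W1.d i).Coprime (U2.d j) := fun i j => cop _ _ (dW1 i).2 (h.dU j).2.2
    have cUW : ∀ i j, (U1.d i).Coprime (W2.d j) := fun i j => cop _ _ (dU1 i).2.2 (h.dW j).2
    have hy1' : (1:ℝ) ≤ y := by exact_mod_cast hy1
    have hzp : (z:ℝ)^(4*(k+1)+8) ≤ (y:ℝ)^(2*k+6) := by
      rw [show 4*(k+1)+8 = 2*(2*k+6) by ring, pow_mul]; gcongr
    have hs := sk_pos k
    have hs2 : sk (k+1) = sk k / 16 := by unfold sk; rw [pow_succ]; ring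
    have m2' := h.m2
    have m3' := h.m3
    rw [hs2] at m2' m3'
    have ex : Real.exp (sk k / 4) * Real.exp (sk k / 16) ≤ Real.exp (sk k) := by
      rw [← Real.exp_add, Real.exp_le_exp]; linarith
    have ex1 : 1 ≤ Real.exp (sk k / 4) := Real.one_le_exp (by linarith)
    refine ⟨U1.mul U2, (W1.mul U2).add (U1.mul W2), ?_⟩
    constructor
    · rintro ⟨i, j⟩
      refine ⟨Nat.mul_pos (dU1 i).1 (h.dU j).1, ?_, pf _ _ (dU1 i).2.2 (h.dU j).2.2⟩
      show ((U1.d i * U2.d j : ℕ):ℝ) ≤ _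
      push_cast
      calc (U1.d i:ℝ) * U2.d j ≤ (y:ℝ)^(2*k+1) * (y:ℝ)^(2*k+6) :=
            mul_le_mul (dU1 i).2.1 ((h.dU j).2.1.trans hzp) (by positivity) (by positivity)
        _ = (y:ℝ)^(4*k+7) := by rw [← pow_add]; congr 1; ring
        _ ≤ _ := pow_le_pow_right₀ hy1' (by omega)
    · rintro (⟨i, j⟩ | ⟨i, j⟩)
      · exact ⟨Nat.mul_pos (dW1 i).1 (h.dU j).1, pf _ _ (dW1 i).2 (h.dU j).2.2⟩
      · exact ⟨Nat.mul_pos (dU1 i).1 (h.dW j).1, pf _ _ (dU1 i).2.2 (h.dW j).2⟩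
    · rw [SF.mul_nrm]
      calc U1.nrm * U2.nrm ≤ (y:ℝ)^(2*k) * (y:ℝ)^(2*k+6) := mul_le_mul nU1 (h.nU.trans hzp) U2.nrm_nonneg (by positivity)
        _ = (y:ℝ)^(4*k+6) := by rw [← pow_add]; congr 1; ring
        _ ≤ _ := pow_le_pow_right₀ hy1' (by omega)
    · rw [SF.add_nrm, SF.mul_nrm, SF.mul_nrm]
      have hy2 : (2:ℝ) ≤ y := by exact_mod_cast h2
      calc W1.nrm * U2.nrm + U1.nrm * W2.nrm ≤ (y:ℝ)^(2*k+1) * (y:ℝ)^(2*k+6) + (y:ℝ)^(2*k) * (y:ℝ)^(2*k+6) :=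
            add_le_add (mul_le_mul nW1 (h.nU.trans hzp) U2.nrm_nonneg (by positivity)) (mul_le_mul nU1 (h.nW.trans hzp) W2.nrm_nonneg (by positivity))
        _ = (y:ℝ)^(4*k+6) * (y + 1) := by
            rw [show 4*k+6 = 2*k + (2*k+6) by ring, pow_add]; ring
        _ ≤ (y:ℝ)^(4*k+6) * (y^2) := by gcongr; nlinarith
        _ = _ := by rw [← pow_add]
    · rw [SF.mul_inv]
      calc U1.inv * U2.inv ≤ Real.exp 6 * Real.exp (6 * J) := mul_le_mul iU1 h.iU U2.inv_nonneg (Real.exp_pos _).le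
        _ = _ := by rw [← Real.exp_add]; push_cast; ring_nf
    · intro n
      rw [SF.mul_ev _ _ cUU, hr]
      exact mul_le_mul (e11 n) (h.e1 n) (rP_nonneg _ _) ((rP_nonneg _ _).trans (e11 n))
    · intro n
      rw [SF.add_ev, SF.mul_ev _ _ cUU, SF.mul_ev _ _ cWU, SF.mul_ev _ _ cUW, hr]
      have a1 := rP_nonneg (Pb z y) n
      have a2 := rP_nonneg (Pb 0 z) n
      have b1 := e11 n
      have b2 := h.e1 n
      have c1 := e21 n
      have c2 := h.e2 n
      have t1 := mul_le_mul_of_nonneg_right c1 (a2.trans b2)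
      have t2 : rP (Pb z y) n * (U2.ev n - rP (Pb 0 z) n) ≤ U1.ev n * W2.ev n :=
        mul_le_mul b1 c2 (by linarith) (by linarith)
      nlinarith
    · rw [SF.mul_mean, hVe]; exact mul_le_mul m11 h.m1 hV2.le (hV1.le.trans m11)
    · rw [SF.mul_mean, hVe]
      calc U1.mean * U2.mean ≤ (VP (Pb z y) * Real.exp (sk k / 4)) * (VP (Pb 0 z) * Real.exp (sk k / 16)) :=
            mul_le_mul m21 m2' (hV2.le.trans h.m1) (by positivity)
        _ = VP (Pb z y) * VP (Pb 0 z) * (Real.exp (sk k / 4) * Real.exp (sk k / 16)) := by ring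
        _ ≤ _ := by gcongr
    · rw [SF.add_mean, SF.mul_mean, SF.mul_mean, hVe]
      have A : W1.mean * U2.mean ≤ VP (Pb z y) * (sk k / 4) * (VP (Pb 0 z) * Real.exp (sk k / 16)) :=
        mul_le_mul m31 m2' (hV2.le.trans h.m1) (by positivity)
      have B : U1.mean * W2.mean ≤ (VP (Pb z y) * Real.exp (sk k / 4)) * (VP (Pb 0 z) * (sk k / 16 * Real.exp (sk k / 16))) := by
        refine (mul_le_mul_of_nonneg_left m3' (hV1.le.trans m11)).trans ?_
        gcongr
      have e16 : 0 < Real.exp (sk k / 16) := Real.exp_pos _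
      calc _ ≤ _ := add_le_add A B
        _ = VP (Pb z y) * VP (Pb 0 z) * (sk k / 4 * (1 * Real.exp (sk k / 16)) + sk k / 16 * (Real.exp (sk k / 4) * Real.exp (sk k / 16))) := by ring
        _ ≤ VP (Pb z y) * VP (Pb 0 z) * (sk k / 4 * Real.exp (sk k) + sk k / 16 * Real.exp (sk k)) := by
            have : 1 * Real.exp (sk k / 16) ≤ Real.exp (sk k) := le_trans (by gcongr) ex
            gcongr
        _ ≤ _ := by
            have : sk k / 4 * Real.exp (sk k) + sk k / 16 * Real.exp (sk k) ≤ sk k * Real.exp (sk k) := by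
              have := mul_pos hs (Real.exp_pos (sk k)); nlinarith
            gcongr
end TP

namespace TP
open Finset

noncomputable def ro (y n : ℕ) : ℝ := rP (Pb 0 y) n
noncomputable def Vy (y : ℕ) : ℝ := VP (Pb 0 y)

lemma Vy_pos (y : ℕ) : 0 < Vy y := VP_pos y

lemma ro_nonneg (y n : ℕ) : 0 ≤ ro y n := rP_nonneg _ _

lemma ro_one {y n : ℕ} (h : ∀ p : ℕ, p.Prime → p ≤ y → ¬ p ∣ n) : ro y n = 1 := by
  unfold ro rP
  refine prod_eq_one fun p hp => ?_
  have := mem_Pb.mp hp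
  rw [if_neg (h p this.2 this.1.2)]; norm_num

lemma ro_zero {y n p : ℕ} (hp : p.Prime) (hpy : p ≤ y) (hd : p ∣ n) : ro y n = 0 := by
  unfold ro rP
  refine prod_eq_zero (mem_Pb.mpr ⟨⟨hp.pos, hpy⟩, hp⟩) ?_
  rw [if_pos hd]; norm_num

lemma ro_cases (y n : ℕ) : ro y n = 0 ∨ (ro y n = 1 ∧ ∀ p : ℕ, p.Prime → p ≤ y → ¬ p ∣ n) := by
  by_cases h : ∀ p : ℕ, p.Prime → p ≤ y → ¬ p ∣ n
  · exact Or.inr ⟨ro_one h, h⟩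
  · push Not at h
    obtain ⟨p, h1, h2, h3⟩ := h
    exact Or.inl (ro_zero h1 h2 h3)

lemma ro_le_one (y n : ℕ) : ro y n ≤ 1 := by
  rcases ro_cases y n with h | ⟨h, _⟩ <;> rw [h]; norm_num

lemma euler_le (P F : Finset ℕ) (hP : ∀ p ∈ P, p.Prime) (hF : ∀ n ∈ F, n ≠ 0 ∧ ∀ p : ℕ, p.Prime → p ∣ n → p ∈ P) :
    ∑ n ∈ F, 1 / (n:ℝ) ≤ 1 / VP P := by
  let f : ℕ →* ℝ := { toFun := fun n => 1 / (n:ℝ), map_one' := by simp, map_mul' := fun a b => by push_cast; rw [one_div_mul_one_div] }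
  have h : ∀ {p : ℕ}, p.Prime → ‖f p‖ < 1 := by
    intro p hp
    have : (2:ℝ) ≤ p := by exact_mod_cast hp.two_le
    show ‖1 / (p:ℝ)‖ < 1
    rw [Real.norm_of_nonneg (by positivity), div_lt_one (by linarith)]; linarith
  obtain ⟨hs, hh⟩ := EulerProduct.summable_and_hasSum_factoredNumbers_prod_filter_prime_geometric h P
  rw [filter_true_of_mem hP] at hh
  have e : ∏ p ∈ P, (1 - f p)⁻¹ = 1 / VP P := by
    unfold VP; rw [one_div, ← prod_inv_distrib]; rfl
  rw [e] at hh
  have hmem : ∀ n ∈ F, n ∈ Nat.factoredNumbers P := fun n hn => Nat.mem_factoredNumbers'.mpr (hF n hn).2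
  have := sum_le_hasSum (F.attach.map ⟨fun n => (⟨n.1, hmem n.1 n.2⟩ : Nat.factoredNumbers P), fun a b hab => by
    apply Subtype.ext; exact congrArg (fun q : Nat.factoredNumbers P => q.1) hab⟩) (fun n _ => by
      show 0 ≤ 1 / ((n.1:ℕ):ℝ); positivity) hh
  rw [sum_map] at this
  rw [← sum_attach]
  exact this

lemma Vy_le (y : ℕ) (hy : 1 ≤ y) : Vy y * Real.log y ≤ 1 := by
  have h1 := euler_le (Pb 0 y) (Icc 1 y) (fun p hp => (mem_Pb.mp hp).2) (fun n hn => by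
    have := mem_Icc.mp hn
    refine ⟨by omega, fun p hp hd => mem_Pb.mpr ⟨⟨hp.pos, (Nat.le_of_dvd (by omega) hd).trans this.2⟩, hp⟩⟩)
  have h2 := log_add_one_le_harmonic y
  have h3 : ((harmonic y : ℚ):ℝ) = ∑ n ∈ Icc 1 y, 1 / (n:ℝ) := by
    rw [harmonic_eq_sum_Icc]; push_cast; simp
  rw [h3] at h2
  have hV := Vy_pos y
  have h4 : Real.log y ≤ 1 / Vy y := by
    refine le_trans (Real.log_le_log (by exact_mod_cast hy) ?_) (h2.trans h1)
    push_cast; linarith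
  rw [le_div_iff₀ hV] at h4
  linarith

lemma VP_pow (y m : ℕ) (hy : 2 ≤ y) : Real.exp (-(12 * m)) ≤ VP (Pb y (y^(2^m))) := by
  induction m with
  | zero =>
    have : Pb y (y^(2^0)) = ∅ := by ext p; simp [mem_Pb]
    rw [this]; simp [VP]
  | succ m ih =>
    set Q := y^(2^(m+1)) with hQ
    have hsq : Q.sqrt = y^(2^m) := by
      rw [hQ, pow_succ, pow_mul]; exact Nat.sqrt_eq' _
    have hQ2 : 2 ≤ Q := hy.trans (by rw [hQ]; exact Nat.le_self_pow (by positivity) y)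
    have hb := block_V Q hQ2
    rw [hsq] at hb
    have h1 : y ≤ y^(2^m) := Nat.le_self_pow (by positivity) y
    have h2 : y^(2^m) ≤ Q := by rw [hQ]; exact Nat.pow_le_pow_right (by omega) (Nat.pow_le_pow_right (by norm_num) (by omega))
    have hu : Pb y Q = Pb y (y^(2^m)) ∪ Pb (y^(2^m)) Q := by
      ext p; simp only [mem_union, mem_Pb]; constructor
      · rintro ⟨⟨h3, h4⟩, h5⟩
        by_cases h : p ≤ y^(2^m)
        · exact Or.inl ⟨⟨h3, h⟩, h5⟩
        · exact Or.inr ⟨⟨by omega, h4⟩, h5⟩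
      · rintro (⟨⟨h3, h4⟩, h5⟩ | ⟨⟨h3, h4⟩, h5⟩)
        · exact ⟨⟨h3, by omega⟩, h5⟩
        · exact ⟨⟨by omega, h4⟩, h5⟩
    have hd : Disjoint (Pb y (y^(2^m))) (Pb (y^(2^m)) Q) := by
      rw [disjoint_left]; intro p h1 h2
      have := mem_Pb.mp h1; have := mem_Pb.mp h2; omega
    have e : VP (Pb y Q) = VP (Pb y (y^(2^m))) * VP (Pb (y^(2^m)) Q) := by
      rw [hu]; unfold VP; rw [prod_union hd]
    rw [e]
    calc Real.exp (-(12 * ((m+1:ℕ):ℝ))) = Real.exp (-(12*m)) * Real.exp (-12) := by rw [← Real.exp_add]; push_cast; ring_nf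
      _ ≤ _ := mul_le_mul ih hb (Real.exp_pos _).le ((Real.exp_pos _).le.trans ih)

lemma rsum (y m N : ℕ) (hy : 2 ≤ y) (hN : N ≤ y^(2^m)) : ∑ n ∈ Ioc 0 N, ro y n * (1 / (n:ℝ)) ≤ Real.exp (12 * m) := by
  have h0 : ∑ n ∈ Ioc 0 N, ro y n * (1 / (n:ℝ)) = ∑ n ∈ (Ioc 0 N).filter (fun n => ro y n = 1), 1 / (n:ℝ) := by
    rw [sum_filter]
    refine sum_congr rfl fun n _ => ?_
    rcases ro_cases y n with h | ⟨h, _⟩ <;> rw [h] <;> simp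
  rw [h0]
  have h1 := euler_le (Pb y (y^(2^m))) ((Ioc 0 N).filter (fun n => ro y n = 1)) (fun p hp => (mem_Pb.mp hp).2) (fun n hn => by
    obtain ⟨h1, h2⟩ := mem_filter.mp hn
    have h3 := mem_Ioc.mp h1
    refine ⟨by omega, fun p hp hd => mem_Pb.mpr ⟨⟨?_, ?_⟩, hp⟩⟩
    · by_contra hc
      have := ro_zero (y := y) hp (by omega) hd
      rw [this] at h2; norm_num at h2
    · exact (Nat.le_of_dvd (by omega) hd).trans (h3.2.trans hN))
  refine h1.trans ?_
  have h2 := VP_pow y m hy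
  calc 1 / VP (Pb y (y^(2^m))) ≤ 1 / Real.exp (-(12*m)) := one_div_le_one_div_of_le (Real.exp_pos _) h2
    _ = _ := by rw [Real.exp_neg]; simp

lemma sk_le_one (k : ℕ) (hk : 18 ≤ k) : sk k ≤ 1 := by
  unfold sk
  have h1 : Real.exp 36 ≤ 3^36 := by
    have : Real.exp 1 ≤ 3 := by linarith [Real.exp_one_lt_d9]
    calc Real.exp 36 = (Real.exp 1)^36 := by rw [← Real.exp_nat_mul]; norm_num
      _ ≤ _ := by gcongr
  have h2 : (1/16:ℝ)^k ≤ (1/16)^18 := pow_le_pow_of_le_one (by norm_num) (by norm_num) hk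
  calc _ ≤ (3:ℝ)^36 * (1/16)^18 := by gcongr
    _ ≤ 1 := by norm_num

lemma exp_sk (k : ℕ) (hk : 18 ≤ k) : sk k * Real.exp (sk k) ≤ 3 * sk k ∧ Real.exp (sk k) - 1 ≤ 3 * sk k := by
  have h1 := sk_le_one k hk
  have h0 := sk_pos k
  have h2 : Real.exp (sk k) ≤ 3 := (Real.exp_le_exp.mpr h1).trans (by linarith [Real.exp_one_lt_d9])
  refine ⟨by nlinarith, ?_⟩
  have h3 : 1 - sk k ≤ Real.exp (-sk k) := by linarith [Real.add_one_le_exp (-sk k)]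
  have h4 : Real.exp (sk k) * Real.exp (-sk k) = 1 := by rw [← Real.exp_add]; simp
  have h5 := mul_le_mul_of_nonneg_left h3 (Real.exp_pos (sk k)).le
  nlinarith

lemma J_exists (y : ℕ) : ∃ J : ℕ, y < 2^(2^J) := by
  refine ⟨y, ?_⟩
  exact (Nat.lt_two_pow_self (n := y)).trans (Nat.pow_lt_pow_right (by norm_num) Nat.lt_two_pow_self)

lemma fl_count (y k a b : ℕ) (hy : 1 ≤ y) (hk : 18 ≤ k) (hab : a ≤ b) :
    |∑ n ∈ Ioc a b, ro y n - Vy y * ((b:ℝ) - a)| ≤ 3 * sk k * Vy y * ((b:ℝ) - a) + 2 * (y:ℝ)^(4*k+8) := by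
  obtain ⟨J, hJ⟩ := J_exists y
  obtain ⟨U, W, h⟩ := sieve_exists J y hy hJ k
  have hU := U.count (fun i => (h.dU i).1) a b hab
  have hW := W.count (fun i => (h.dW i).1) a b hab
  have m1 := h.m1
  have m2 := h.m2
  have m3 := h.m3
  have nU := h.nU
  have nW := h.nW
  have hV := Vy_pos y
  have hVd : VP (Pb 0 y) = Vy y := rfl
  rw [hVd] at m1 m2 m3
  obtain ⟨x1, x2⟩ := exp_sk k hk
  have hab' : (0:ℝ) ≤ (b:ℝ) - a := by have : (a:ℝ) ≤ b := by exact_mod_cast hab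
                                      linarith
  have l1 : ∑ n ∈ Ioc a b, ro y n ≤ ∑ n ∈ Ioc a b, U.ev n := sum_le_sum fun n _ => h.e1 n
  have l2 : ∑ n ∈ Ioc a b, U.ev n - ∑ n ∈ Ioc a b, ro y n ≤ ∑ n ∈ Ioc a b, W.ev n := by
    rw [← sum_sub_distrib]; exact sum_le_sum fun n _ => h.e2 n
  rw [abs_le] at hU hW
  have t1 : U.mean * ((b:ℝ) - a) ≤ Vy y * (1 + 3 * sk k) * ((b:ℝ) - a) := by
    refine mul_le_mul_of_nonneg_right (m2.trans ?_) hab'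
    exact mul_le_mul_of_nonneg_left (by linarith) hV.le
  have t2 : W.mean * ((b:ℝ) - a) ≤ Vy y * (3 * sk k) * ((b:ℝ) - a) := by
    refine mul_le_mul_of_nonneg_right (m3.trans ?_) hab'
    exact mul_le_mul_of_nonneg_left x1 hV.le
  have t3 : Vy y * ((b:ℝ) - a) ≤ U.mean * ((b:ℝ) - a) := mul_le_mul_of_nonneg_right m1 hab'
  have p0 : (0:ℝ) ≤ (y:ℝ)^(4*k+8) := by positivity
  rw [abs_le]
  constructor <;> nlinarith

end TP

namespace TP
open Finset

noncomputable def el (t u : ℝ) : ℂ := ee (-(t * Real.log u))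

lemma el_norm (t u : ℝ) : ‖el t u‖ = 1 := ee_norm _

lemma el_cont (t x y : ℝ) (hx : 0 < x) (hy : 0 < y) : ContinuousOn (el t) (Set.uIcc x y) := by
  intro u hu
  have : 0 < u := (lt_min hx hy).trans_le (Set.mem_uIcc.mp hu |>.elim (fun h => (min_le_left _ _).trans h.1) (fun h => (min_le_right _ _).trans h.1))
  exact (hasDerivAt_ee_log t u this).continuousAt.continuousWithinAt

lemma el_int (t x y : ℝ) (hx : 0 < x) (hy : 0 < y) : IntervalIntegrable (el t) MeasureTheory.volume x y :=
  (el_cont t x y hx hy).intervalIntegrable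

lemma el_int_norm (t x y : ℝ) : ‖∫ u in x..y, el t u‖ ≤ |y - x| := by
  have := intervalIntegral.norm_integral_le_of_norm_le_const (a := x) (b := y) (f := el t) (C := 1) (fun u _ => (el_norm t u).le)
  linarith

lemma el_mul (t u v : ℝ) (hu : 0 < u) (hv : 0 < v) : el t (u * v) = el t u * el t v := by
  unfold el; rw [← ee_add, Real.log_mul hu.ne' hv.ne']; congr 1; ring

lemma exp_long (K : ℕ) : ∃ δ : ℝ, 0 < δ ∧ δ ≤ 1/2 ∧ ∃ C : ℝ, 0 < C ∧ ∀ a : ℕ, 1 ≤ a → ∀ t : ℝ,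
    |t| ≤ (a:ℝ)^(K+1) → ∀ b : ℕ, a ≤ b →
    ‖∑ n ∈ Ioc a b, el t n - ∫ u in (a:ℝ)..b, el t u‖ ≤ C * (b:ℝ)^(1-δ) := by
  obtain ⟨δ, hδ, hδ2, C0, hC0, H⟩ := exp0 K
  refine ⟨δ, hδ, hδ2, 10 * C0, by linarith, ?_⟩
  intro a ha t ht b
  have ha0 : (0:ℝ) < a := by exact_mod_cast ha
  induction b using Nat.strong_induction_on with
  | _ b ih =>
    intro hab
    have hab' : (a:ℝ) ≤ b := by exact_mod_cast hab
    have hb0 : (0:ℝ) < b := ha0.trans_le hab'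
    by_cases h4 : b + 1 ≤ 4 * a
    · refine (H a ha t ht a b le_rfl hab h4).trans ?_
      have : (a:ℝ)^(1-δ) ≤ (b:ℝ)^(1-δ) := Real.rpow_le_rpow ha0.le hab' (by linarith)
      have := Real.rpow_nonneg hb0.le (1-δ)
      nlinarith
    · set c := (b+1)/2 with hc
      have hac : a ≤ c := by omega
      have hcb : c < b := by omega
      have hac' : (a:ℝ) ≤ c := by exact_mod_cast hac
      have hc0 : (0:ℝ) < c := ha0.trans_le hac'
      have h1 := ih c hcb hac
      have h2 := H c (by omega) t (ht.trans (by gcongr)) c b le_rfl hcb.le (by omega)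
      rw [← sum_Ioc_consecutive _ hac hcb.le, ← intervalIntegral.integral_add_adjacent_intervals (el_int t a c ha0 hc0) (el_int t c b hc0 hb0)]
      have h3 : (c:ℝ)^(1-δ) ≤ 0.8 * (b:ℝ)^(1-δ) := by
        have h5 : (c:ℝ) ≤ 5/8 * b := by
          have : 8 * c ≤ 5 * b := by omega
          have : (8:ℝ) * c ≤ 5 * b := by exact_mod_cast this
          linarith
        calc (c:ℝ)^(1-δ) ≤ (5/8 * b)^(1-δ) := Real.rpow_le_rpow hc0.le h5 (by linarith)
          _ = (5/8)^(1-δ) * (b:ℝ)^(1-δ) := Real.mul_rpow (by norm_num) hb0.le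
          _ ≤ 0.8 * (b:ℝ)^(1-δ) := by
            gcongr
            calc (5/8:ℝ)^(1-δ) ≤ (5/8:ℝ)^(1/2:ℝ) := Real.rpow_le_rpow_of_exponent_ge (by norm_num) (by norm_num) (by linarith)
              _ ≤ 0.8 := by
                rw [← Real.sqrt_eq_rpow, Real.sqrt_le_left (by norm_num)]; norm_num
      have h6 := Real.rpow_nonneg hb0.le (1-δ)
      have e : ∀ A B I J : ℂ, A + B - (I + J) = (A - I) + (B - J) := by intros; ring
      rw [e]
      refine (norm_add_le _ _).trans ?_
      have h7 : C0 * (c:ℝ)^(1-δ) ≤ C0 * (0.8 * (b:ℝ)^(1-δ)) := mul_le_mul_of_nonneg_left h3 hC0.le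
      have h2' : ‖∑ n ∈ Ioc c b, el t n - ∫ u in (c:ℝ)..b, el t u‖ ≤ C0 * (c:ℝ)^(1-δ) := h2
      nlinarith

lemma el_subst (t a b d : ℝ) (ha : 0 < a) (hb : 0 < b) (hd : 0 < d) :
    el t d * ∫ u in a/d..b/d, el t u = ((1/d : ℝ):ℂ) * ∫ u in a..b, el t u := by
  have h := intervalIntegral.integral_comp_div (a := a) (b := b) (fun u => el t u) hd.ne'
  have h2 : ∫ u in a..b, el t u = el t d * ∫ u in a..b, el t (u / d) := by
    rw [← intervalIntegral.integral_const_mul]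
    refine intervalIntegral.integral_congr fun u hu => ?_
    have hu0 : 0 < u := (lt_min ha hb).trans_le (Set.mem_uIcc.mp hu |>.elim (fun h => (min_le_left _ _).trans h.1) (fun h => (min_le_right _ _).trans h.1))
    show el t u = el t d * el t (u/d)
    rw [← el_mul t d (u/d) hd (by positivity), mul_div_cancel₀ _ hd.ne']
  rw [h2, h, Complex.real_smul]
  push_cast
  have : (d:ℂ) ≠ 0 := by exact_mod_cast hd.ne'
  field_simp

lemma sum_dvd (a b d : ℕ) (hd : 0 < d) (f : ℕ → ℂ) :
    ∑ n ∈ Ioc a b, (if d ∣ n then f n else 0) = ∑ m ∈ Ioc (a/d) (b/d), f (d * m) := by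
  rw [← sum_filter]
  symm
  refine sum_bij (fun m _ => d * m) ?_ ?_ ?_ ?_
  · intro m hm
    obtain ⟨h1, h2⟩ := mem_Ioc.mp hm
    refine mem_filter.mpr ⟨mem_Ioc.mpr ⟨?_, ?_⟩, dvd_mul_right _ _⟩
    · rw [Nat.div_lt_iff_lt_mul hd] at h1; linarith
    · rw [Nat.le_div_iff_mul_le hd] at h2; linarith
  · intro m _ m' _ h; exact Nat.eq_of_mul_eq_mul_left hd h
  · intro n hn
    obtain ⟨h1, m, rfl⟩ := mem_filter.mp hn
    obtain ⟨h1, h2⟩ := mem_Ioc.mp h1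
    refine ⟨m, mem_Ioc.mpr ⟨?_, ?_⟩, rfl⟩
    · rw [Nat.div_lt_iff_lt_mul hd]; linarith
    · rw [Nat.le_div_iff_mul_le hd]; linarith
  · intro m _; rfl

/-- one divisor -/
lemma one_div_exp (K : ℕ) : ∃ δ : ℝ, 0 < δ ∧ δ ≤ 1/2 ∧ ∃ C : ℝ, 0 < C ∧ ∀ a d b: ℕ, 1 ≤ d → d ≤ a → ∀ t : ℝ,
    |t| ≤ ((a/d:ℕ):ℝ)^(K+1) → a ≤ b →
    ‖∑ n ∈ Ioc a b, (if d ∣ n then el t n else 0) - ((1/(d:ℝ) : ℝ):ℂ) * ∫ u in (a:ℝ)..b, el t u‖ ≤ C * ((b:ℝ)/d)^(1-δ) + 2 := by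
  obtain ⟨δ, hδ, hδ2, C, hC, H⟩ := exp_long K
  refine ⟨δ, hδ, hδ2, C, hC, ?_⟩
  intro a d b hd hda t ht hab
  have hd0 : (0:ℝ) < d := by exact_mod_cast hd
  have ha0 : (0:ℝ) < a := by exact_mod_cast hd.trans hda
  have hb0 : (0:ℝ) < b := ha0.trans_le (by exact_mod_cast hab)
  have h1 : 1 ≤ a/d := (Nat.one_le_div_iff (by omega)).mpr hda
  have h2 : a/d ≤ b/d := Nat.div_le_div_right hab
  have h3 := H (a/d) h1 t ht (b/d) h2
  have h10 : (0:ℝ) < ((a/d:ℕ):ℝ) := by exact_mod_cast h1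
  have h20 : (0:ℝ) < ((b/d:ℕ):ℝ) := h10.trans_le (by exact_mod_cast h2)
  rw [sum_dvd a b d hd, ← el_subst t a b d ha0 hb0 hd0]
  have e1 : ∑ m ∈ Ioc (a/d) (b/d), el t ((d * m : ℕ):ℝ) = el t d * ∑ m ∈ Ioc (a/d) (b/d), el t m := by
    rw [mul_sum]; refine sum_congr rfl fun m hm => ?_
    have : (0:ℝ) < m := by have := (mem_Ioc.mp hm).1; exact_mod_cast (by omega : 0 < m)
    push_cast; exact el_mul t d m hd0 this
  rw [e1, ← mul_sub, norm_mul, el_norm, one_mul]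
  have i1 := el_int t _ _ h10 h20
  have i2 := el_int t (a/d) ((a/d:ℕ):ℝ) (by positivity) h10
  have i3 := el_int t ((b/d:ℕ):ℝ) (b/d) h20 (by positivity)
  have e2 : ∫ u in (a:ℝ)/d..(b:ℝ)/d, el t u = (∫ u in (a:ℝ)/d..((a/d:ℕ):ℝ), el t u) + (∫ u in ((a/d:ℕ):ℝ)..((b/d:ℕ):ℝ), el t u) + ∫ u in ((b/d:ℕ):ℝ)..(b:ℝ)/d, el t u := by
    rw [intervalIntegral.integral_add_adjacent_intervals i2 i1, intervalIntegral.integral_add_adjacent_intervals (i2.trans i1) i3]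
  have fl : ∀ c : ℕ, |(c:ℝ)/d - ((c/d:ℕ):ℝ)| ≤ 1 := by
    intro c
    have g1 : ((c / d : ℕ):ℝ) ≤ (c:ℝ) / d := Nat.cast_div_le
    have g2 : (c:ℝ) / d ≤ ((c / d : ℕ):ℝ) + 1 := by
      rw [div_le_iff₀ hd0]
      have := Nat.lt_div_mul_add (a := c) hd
      have h2 : c ≤ (c / d + 1) * d := by linarith
      exact_mod_cast h2
    rw [abs_le]; constructor <;> linarith
  have n1 := (el_int_norm t ((a:ℝ)/d) ((a/d:ℕ):ℝ)).trans ((abs_sub_comm _ _).le.trans (fl a))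
  have n2 := (el_int_norm t ((b/d:ℕ):ℝ) ((b:ℝ)/d)).trans (fl b)
  rw [e2]
  have e3 : ∀ S X Y Z : ℂ, S - (X + Y + Z) = (S - Y) - X - Z := by intros; ring
  rw [e3]
  refine (norm_sub_le _ _).trans ?_
  have := norm_sub_le (∑ m ∈ Ioc (a/d) (b/d), el t m - ∫ u in ((a/d:ℕ):ℝ)..((b/d:ℕ):ℝ), el t u) (∫ u in (a:ℝ)/d..((a/d:ℕ):ℝ), el t u)
  have h5 : C * ((b/d:ℕ):ℝ)^(1-δ) ≤ C * ((b:ℝ)/d)^(1-δ) :=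
    mul_le_mul_of_nonneg_left (Real.rpow_le_rpow h20.le Nat.cast_div_le (by linarith)) hC.le
  linarith

lemma Vy_le_one (y : ℕ) : Vy y ≤ 1 := by
  unfold Vy VP
  exact prod_le_one (fun p hp => by
      have : (2:ℝ) ≤ p := by exact_mod_cast (mem_Pb.mp hp).2.two_le
      have : 1 / (p:ℝ) ≤ 1/2 := one_div_le_one_div_of_le (by norm_num) this
      linarith) (fun p _ => by have : 0 ≤ 1 / (p:ℝ) := by positivity
                               linarith)

lemma C1a (K : ℕ) : ∃ δ : ℝ, 0 < δ ∧ δ ≤ 1/2 ∧ ∃ C : ℝ, 0 < C ∧ ∀ y k J x : ℕ, 2 ≤ y → 18 ≤ k → y < 2^(2^J) →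
    (y^(4*k+8))^4 ≤ x → ∀ t : ℝ, |t| ≤ (y:ℝ)^K →
    ‖∑ n ∈ Ioc 0 x, (ro y n : ℂ) * el t n - (Vy y : ℂ) * ∫ u in (1:ℝ)..x, el t u‖ ≤
      6 * sk k * Vy y * x + C * Real.exp (6 * J) * (x:ℝ)^(1 - 3*δ/4) := by
  obtain ⟨δ, hδ, hδ2, C, hC, H⟩ := one_div_exp K
  refine ⟨δ, hδ, hδ2, C + 5, by linarith, ?_⟩
  intro y k J x hy hk hJ hx t ht
  obtain ⟨U, W, h⟩ := sieve_exists J y (by omega) hJ k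
  set D := y^(4*k+8) with hD
  have hyD : y ≤ D := Nat.le_self_pow (by omega) y
  have hD1 : 2 ≤ D := hy.trans hyD
  set a := x.sqrt with ha
  have haD : D^2 ≤ a := by
    rw [ha, Nat.le_sqrt']; rw [← pow_mul]; exact hx
  have hax : a ≤ x := Nat.sqrt_le_self x
  have ha2 : (a:ℝ)^2 ≤ x := by exact_mod_cast Nat.sqrt_le' x
  have ha1 : 1 ≤ a := by nlinarith
  have ha0 : (0:ℝ) < a := by exact_mod_cast ha1
  have hx0 : (0:ℝ) < x := ha0.trans_le (by exact_mod_cast hax)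
  have hx1 : (1:ℝ) ≤ x := by exact_mod_cast ha1.trans hax
  have hax' : (a:ℝ) ≤ x := by exact_mod_cast hax
  have hDr : (D:ℝ) = (y:ℝ)^(4*k+8) := by rw [hD]; push_cast; rfl
  have hD0 : (0:ℝ) < D := by exact_mod_cast (by omega : 0 < D)
  have hV := Vy_pos y
  have hs := sk_pos k
  set Int := ∫ u in (a:ℝ)..x, el t u with hInt
  have hIn : ‖Int‖ ≤ x := by
    refine (el_int_norm t a x).trans ?_
    rw [abs_of_nonneg (by linarith)]; linarith
  clear_value D a
  -- sum of U
  have hUe : ∑ n ∈ Ioc a x, (U.ev n : ℂ) * el t n - (U.mean : ℂ) * Int =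
      ∑ i, (U.c i : ℂ) * (∑ n ∈ Ioc a x, (if U.d i ∣ n then el t n else 0) - ((1/(U.d i:ℝ) : ℝ):ℂ) * Int) := by
    unfold SF.ev SF.mean
    simp only [mul_sub]
    rw [sum_sub_distrib]
    congr 1
    · simp only [mul_sum]
      rw [sum_comm]
      refine sum_congr rfl fun n _ => ?_
      push_cast
      rw [sum_mul]
      refine sum_congr rfl fun i _ => ?_
      split_ifs <;> simp
    · push_cast; rw [sum_mul]; refine sum_congr rfl fun i _ => by ring
  have hUn : ‖∑ n ∈ Ioc a x, (U.ev n : ℂ) * el t n - (U.mean : ℂ) * Int‖ ≤ C * (x:ℝ)^(1-3*δ/4) * Real.exp (6*J) + 2 * D := by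
    rw [hUe]
    have key : ∀ i, ‖(U.c i : ℂ) * (∑ n ∈ Ioc a x, (if U.d i ∣ n then el t n else 0) - ((1/(U.d i:ℝ) : ℝ):ℂ) * Int)‖
        ≤ C * (x:ℝ)^(1-3*δ/4) * (|U.c i| * (1/(U.d i:ℝ))) + 2 * |U.c i| := by
      intro i
      obtain ⟨d1, d2, _⟩ := h.dU i
      rw [← hDr] at d2
      have d2' : U.d i ≤ D := by exact_mod_cast d2
      have d0 : (0:ℝ) < U.d i := by exact_mod_cast d1
      have hda : U.d i ≤ a := by nlinarith
      have hq : y ≤ a / U.d i := by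
        rw [Nat.le_div_iff_mul_le d1]
        calc y * U.d i ≤ D * D := Nat.mul_le_mul hyD d2'
          _ ≤ a := by rw [← sq]; exact haD
      have ht' : |t| ≤ ((a / U.d i:ℕ):ℝ)^(K+1) := by
        have q1 : (y:ℝ) ≤ ((a / U.d i:ℕ):ℝ) := by exact_mod_cast hq
        have q2 : (1:ℝ) ≤ y := by exact_mod_cast (by omega : 1 ≤ y)
        calc |t| ≤ (y:ℝ)^K := ht
          _ ≤ ((a / U.d i:ℕ):ℝ)^K := by gcongr
          _ ≤ _ := pow_le_pow_right₀ (q2.trans q1) (by omega)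
      have := H a (U.d i) x d1 hda t ht' hax
      rw [norm_mul, Complex.norm_real, Real.norm_eq_abs]
      refine (mul_le_mul_of_nonneg_left this (abs_nonneg _)).trans ?_
      have hr : ((x:ℝ)/U.d i)^(1-δ) ≤ (x:ℝ)^(1-3*δ/4) * (1/(U.d i:ℝ)) := by
        have r1 : ((x:ℝ)/U.d i)^(1-δ) = (x:ℝ)^(1-δ) * ((U.d i:ℝ)^δ * (1/(U.d i:ℝ))) := by
          rw [Real.div_rpow hx0.le d0.le, Real.rpow_sub d0, Real.rpow_one]
          have := Real.rpow_pos_of_pos d0 δ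
          field_simp
        have r2 : (U.d i:ℝ)^δ ≤ (x:ℝ)^(δ/4) := by
          have r3 : (U.d i:ℝ)^4 ≤ x := by
            have : (U.d i)^4 ≤ x := (Nat.pow_le_pow_left d2' 4).trans hx
            exact_mod_cast this
          calc (U.d i:ℝ)^δ = ((U.d i:ℝ)^(4:ℝ))^(δ/4) := by rw [← Real.rpow_mul d0.le]; congr 1; ring
            _ ≤ _ := by
              refine Real.rpow_le_rpow (by positivity) ?_ (by linarith)
              exact_mod_cast r3
        rw [r1, ← mul_assoc]
        refine mul_le_mul_of_nonneg_right ?_ (by positivity)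
        calc (x:ℝ)^(1-δ) * (U.d i:ℝ)^δ ≤ (x:ℝ)^(1-δ) * (x:ℝ)^(δ/4) := by gcongr
          _ = _ := by rw [← Real.rpow_add hx0]; congr 1; ring
      have := mul_le_mul_of_nonneg_left (mul_le_mul_of_nonneg_left hr hC.le) (abs_nonneg (U.c i))
      linarith
    refine (norm_sum_le _ _).trans ((sum_le_sum fun i _ => key i).trans ?_)
    rw [sum_add_distrib, ← mul_sum, ← mul_sum]
    have q1 : U.inv ≤ _ := h.iU
    have q2 : U.nrm ≤ _ := h.nU
    rw [← hDr] at q2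
    unfold SF.inv at q1
    unfold SF.nrm at q2
    have q3 : 0 ≤ C * (x:ℝ)^(1-3*δ/4) := by positivity
    exact add_le_add (mul_le_mul_of_nonneg_left q1 q3) (by linarith)
  -- W
  have hW := W.count (fun i => (h.dW i).1) a x hax
  rw [abs_le] at hW
  obtain ⟨x1, x2⟩ := exp_sk k hk
  have hWs : ∑ n ∈ Ioc a x, W.ev n ≤ 3 * sk k * Vy y * x + D := by
    have w1 : W.mean ≤ Vy y * (3 * sk k) := h.m3.trans (mul_le_mul_of_nonneg_left x1 hV.le)
    have w2 : W.nrm ≤ D := by rw [hDr]; exact h.nW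
    have w3 : W.mean * ((x:ℝ) - a) ≤ Vy y * (3 * sk k) * ((x:ℝ) - a) := mul_le_mul_of_nonneg_right w1 (by linarith)
    have w4 : Vy y * (3 * sk k) * ((x:ℝ) - a) ≤ Vy y * (3 * sk k) * x := mul_le_mul_of_nonneg_left (by linarith) (by positivity)
    linarith [hW.2]
  have hdiff : ‖∑ n ∈ Ioc a x, (ro y n : ℂ) * el t n - ∑ n ∈ Ioc a x, (U.ev n : ℂ) * el t n‖ ≤ 3 * sk k * Vy y * x + D := by
    rw [← sum_sub_distrib]
    refine (norm_sum_le _ _).trans (le_trans (sum_le_sum fun n _ => ?_) hWs)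
    rw [← sub_mul, norm_mul, el_norm, mul_one, ← Complex.ofReal_sub, Complex.norm_real, Real.norm_eq_abs, abs_sub_comm]
    have := h.e1 n
    have := h.e2 n
    unfold ro
    rw [abs_of_nonneg (by linarith)]; linarith
  have hmean : ‖(U.mean:ℂ) * Int - (Vy y:ℂ) * Int‖ ≤ 3 * sk k * Vy y * x := by
    rw [← sub_mul, norm_mul, ← Complex.ofReal_sub, Complex.norm_real, Real.norm_eq_abs]
    have u1 : Vy y ≤ U.mean := h.m1
    have u2 : U.mean ≤ Vy y * Real.exp (sk k) := h.m2
    have u3 := mul_le_mul_of_nonneg_left x2 hV.le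
    rw [abs_of_nonneg (by linarith)]
    exact mul_le_mul (by linarith) hIn (norm_nonneg _) (by positivity)
  have hlow : ‖∑ n ∈ Ioc 0 a, (ro y n : ℂ) * el t n‖ ≤ a := by
    refine (norm_sum_le _ _).trans ?_
    calc ∑ n ∈ Ioc 0 a, ‖(ro y n : ℂ) * el t n‖ ≤ ∑ n ∈ Ioc 0 a, (1:ℝ) := by
          refine sum_le_sum fun n _ => ?_
          rw [norm_mul, el_norm, mul_one, Complex.norm_real, Real.norm_of_nonneg (ro_nonneg _ _)]; exact ro_le_one _ _
      _ = a := by simp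
  have hV1 : Vy y ≤ 1 := Vy_le_one y
  have hlowI : ‖(Vy y:ℂ) * ∫ u in (1:ℝ)..a, el t u‖ ≤ a := by
    rw [norm_mul, Complex.norm_real, Real.norm_of_nonneg hV.le]
    have i1 := el_int_norm t 1 a
    have : (1:ℝ) ≤ a := by exact_mod_cast ha1
    rw [abs_of_nonneg (by linarith)] at i1
    calc Vy y * _ ≤ 1 * ((a:ℝ) - 1) := mul_le_mul hV1 i1 (norm_nonneg _) zero_le_one
      _ ≤ a := by linarith
  have e1 : ∑ n ∈ Ioc 0 x, (ro y n : ℂ) * el t n = ∑ n ∈ Ioc 0 a, (ro y n : ℂ) * el t n + ∑ n ∈ Ioc a x, (ro y n : ℂ) * el t n :=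
    (sum_Ioc_consecutive _ (Nat.zero_le a) hax).symm
  have e2 : ∫ u in (1:ℝ)..x, el t u = (∫ u in (1:ℝ)..a, el t u) + Int :=
    (intervalIntegral.integral_add_adjacent_intervals (el_int t 1 a one_pos ha0) (el_int t a x ha0 hx0)).symm
  rw [e1, e2]
  have small : (2:ℝ) * a + 3 * D ≤ 5 * Real.exp (6*J) * (x:ℝ)^(1-3*δ/4) := by
    have s1 : (a:ℝ) ≤ (x:ℝ)^(1-3*δ/4) := by
      calc (a:ℝ) ≤ Real.sqrt x := Real.le_sqrt_of_sq_le ha2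
        _ = (x:ℝ)^(1/2:ℝ) := Real.sqrt_eq_rpow _
        _ ≤ _ := Real.rpow_le_rpow_of_exponent_le hx1 (by linarith)
    have s2 : (D:ℝ) ≤ a := by
      have : D ≤ a := by nlinarith
      exact_mod_cast this
    have s3 : 1 ≤ Real.exp (6*J) := Real.one_le_exp (by positivity)
    have := Real.rpow_nonneg hx0.le (1-3*δ/4)
    nlinarith
  generalize ∑ n ∈ Ioc 0 a, (ro y n : ℂ) * el t n = A1 at *
  generalize ∑ n ∈ Ioc a x, (ro y n : ℂ) * el t n = A2 at *
  generalize ∑ n ∈ Ioc a x, (U.ev n : ℂ) * el t n = A3 at *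
  generalize (∫ u in (1:ℝ)..a, el t u) = I1 at *
  have e3 : A1 + A2 - (Vy y:ℂ) * (I1 + Int) = A1 - (Vy y:ℂ) * I1 + ((A2 - A3) + (A3 - (U.mean:ℂ) * Int) + ((U.mean:ℂ) * Int - (Vy y:ℂ) * Int)) := by ring
  rw [e3]
  have n1 := norm_sub_le A1 ((Vy y:ℂ) * I1)
  have n2 := norm_add₃_le (a := A2 - A3) (b := A3 - (U.mean:ℂ) * Int) (c := (U.mean:ℂ) * Int - (Vy y:ℂ) * Int)
  have n3 := norm_add_le (A1 - (Vy y:ℂ) * I1) ((A2 - A3) + (A3 - (U.mean:ℂ) * Int) + ((U.mean:ℂ) * Int - (Vy y:ℂ) * Int))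
  linarith

end TP

namespace TP
open Finset

lemma J_small (y : ℕ) (hy : 2 ≤ y) : ∃ J : ℕ, y < 2^(2^J) ∧ Real.exp (6*J) ≤ (4 * Real.log y)^9 := by
  classical
  have hex := J_exists y
  have hs := Nat.find_spec hex
  have hm := fun j => Nat.find_min (H := hex) (m := j)
  generalize Nat.find hex = J at hs hm
  refine ⟨J, hs, ?_⟩
  have hJ : J ≠ 0 := by
    rintro rfl
    norm_num at hs; omega
  obtain ⟨j, rfl⟩ := Nat.exists_eq_succ_of_ne_zero hJ
  have h1 := hm j (Nat.lt_succ_self j)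
  push Not at h1
  have h2 : ((2:ℝ)^(2^j)) ≤ y := by exact_mod_cast h1
  have h3 := Real.log_le_log (by positivity) h2
  rw [Real.log_pow] at h3
  have hl2 := Real.log_two_gt_d9
  have h4 : ((2:ℝ)^(j+1)) ≤ 4 * Real.log y := by
    push_cast at h3
    have : (0:ℝ) < 2^j := by positivity
    rw [pow_succ]; nlinarith
  have h5 : Real.exp 6 ≤ 512 := by
    have := Real.exp_one_lt_d9
    have e : Real.exp 6 = (Real.exp 1)^6 := by rw [← Real.exp_nat_mul]; norm_num
    rw [e]
    calc (Real.exp 1)^6 ≤ 2.8^6 := pow_le_pow_left₀ (Real.exp_pos _).le (by linarith) 6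
      _ ≤ 512 := by norm_num
  calc Real.exp (6 * ((j.succ : ℕ):ℝ)) = (Real.exp 6)^(j+1) := by rw [← Real.exp_nat_mul]; push_cast; ring_nf
    _ ≤ 512^(j+1) := pow_le_pow_left₀ (Real.exp_pos _).le h5 _
    _ = ((2:ℝ)^(j+1))^9 := by rw [← pow_mul, mul_comm, pow_mul]; norm_num
    _ ≤ _ := pow_le_pow_left₀ (by positivity) h4 9

lemma log_pow_small (C a : ℝ) (n : ℕ) (ha : 0 < a) : ∃ y0 : ℕ, 3 ≤ y0 ∧ ∀ y : ℕ, y0 ≤ y → C * (Real.log y)^n ≤ (y:ℝ)^a := by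
  have h := (isLittleO_log_rpow_rpow_atTop (n:ℝ) ha)
  have h2 := (h.const_mul_left C).bound (c := 1) one_pos
  have h3 := (tendsto_natCast_atTop_atTop (R := ℝ)).eventually h2
  obtain ⟨y0, hy0⟩ := Filter.eventually_atTop.mp h3
  refine ⟨max y0 3, le_max_right _ _, fun y hy => ?_⟩
  have := hy0 y ((le_max_left _ _).trans hy)
  rw [Real.rpow_natCast, one_mul, Real.norm_of_nonneg (by positivity : (0:ℝ) ≤ (y:ℝ)^a)] at this
  exact (le_abs_self _).trans this

noncomputable def CA : ℝ := 6 * Real.exp 42 + 1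

lemma CA_pos : 0 < CA := by unfold CA; positivity

/-- Exponential sums over rough numbers. -/
lemma C1 (K : ℕ) : ∃ y0 : ℕ, 3 ≤ y0 ∧ ∀ y x : ℕ, y0 ≤ y → y^320 ≤ x → ∀ t : ℝ, |t| ≤ (y:ℝ)^K →
    ‖∑ n ∈ Ioc 0 x, (ro y n : ℂ) * el t n - (Vy y : ℂ) * ∫ u in (1:ℝ)..x, el t u‖
      ≤ CA / Real.log y * (x:ℝ)^(1 - 1 / (8 * Real.log y)) := by
  obtain ⟨δ, hδ, hδ2, C, hC, H⟩ := C1a K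
  obtain ⟨y1, hy1, H1⟩ := log_pow_small (C * 4^9) (120*δ) 10 (by linarith)
  obtain ⟨y2, hy2⟩ := exists_nat_ge (Real.exp (1/(3*δ)))
  refine ⟨max y1 y2, hy1.trans (le_max_left _ _), ?_⟩
  intro y x hy hx t ht
  have hyy1 : y1 ≤ y := (le_max_left _ _).trans hy
  have hyy2 : y2 ≤ y := (le_max_right _ _).trans hy
  have hy3 : 3 ≤ y := hy1.trans hyy1
  have hyR : (3:ℝ) ≤ y := by exact_mod_cast hy3
  have hl1 : 1 ≤ Real.log y := by
    rw [Real.le_log_iff_exp_le (by linarith)]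
    linarith [Real.exp_one_lt_d9]
  have hlδ : 1/(3*δ) ≤ Real.log y := by
    rw [Real.le_log_iff_exp_le (by linarith)]
    exact hy2.trans (by exact_mod_cast hyy2)
  generalize hL : Real.log y = L at *
  have hx1 : 1 ≤ x := le_trans (Nat.one_le_pow _ _ (by omega)) hx
  have hx1R : (1:ℝ) ≤ x := by exact_mod_cast hx1
  have hx0 : (0:ℝ) < x := by linarith
  -- choose k
  obtain ⟨k, hk1, hk2, hk3⟩ : ∃ k : ℕ, 18 ≤ k ∧ (y^(4*k+8))^4 ≤ x ∧ x < (y^(4*(k+1)+8))^4 := by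
    classical
    have hex : ∃ m : ℕ, x < (y^(4*(18+m+1)+8))^4 := by
      refine ⟨x, ?_⟩
      calc x < 2^x := Nat.lt_two_pow_self
        _ ≤ y^x := Nat.pow_le_pow_left (by omega) _
        _ ≤ (y^(4*(18+x+1)+8))^4 := by rw [← pow_mul]; exact Nat.pow_le_pow_right (by omega) (by omega)
    have hs := Nat.find_spec hex
    have hm := fun j => Nat.find_min (H := hex) (m := j)
    generalize Nat.find hex = m at hs hm
    refine ⟨18 + m, by omega, ?_, hs⟩
    rcases Nat.eq_zero_or_pos m with rfl | hm0
    · rw [← pow_mul]; exact hx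
    · have := hm (m-1) (by omega)
      push Not at this
      have e : 18 + (m-1) + 1 = 18 + m := by omega
      rwa [e] at this
  obtain ⟨J, hJ1, hJ2⟩ := J_small y (by omega)
  rw [hL] at hJ2
  have hmain := H y k J x (by omega) hk1 hJ1 hk2 t ht
  refine hmain.trans ?_
  have hV : Vy y ≤ 1 / L := by
    rw [le_div_iff₀ (by linarith), ← hL]; exact Vy_le y (by omega)
  have hlx : Real.log x ≤ (16*k+48) * L := by
    have : (x:ℝ) ≤ ((y:ℝ)^(4*(k+1)+8))^4 := by exact_mod_cast hk3.le
    have := Real.log_le_log hx0 this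
    rw [← pow_mul, Real.log_pow, hL] at this
    push_cast at this
    linarith
  have hxl : 320 * L ≤ Real.log x := by
    have : ((y:ℝ)^320) ≤ x := by exact_mod_cast hx
    have := Real.log_le_log (by positivity) this
    rw [Real.log_pow, hL] at this
    exact_mod_cast this
  have hsk : sk k ≤ Real.exp 42 * (x:ℝ)^(-(1/(8*L))) := by
    unfold sk
    rw [Real.rpow_def_of_pos hx0, ← Real.exp_add]
    have e1 : ((1:ℝ)/16)^k ≤ Real.exp (-2*k) := by
      have : (1:ℝ)/16 ≤ Real.exp (-2) := by
        rw [Real.exp_neg, one_div]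
        apply inv_anti₀ (Real.exp_pos _)
        have e : Real.exp 2 = (Real.exp 1)^2 := by rw [← Real.exp_nat_mul]; norm_num
        rw [e]; have := Real.exp_one_lt_d9
        calc (Real.exp 1)^2 ≤ 2.8^2 := pow_le_pow_left₀ (Real.exp_pos _).le (by linarith) 2
          _ ≤ 16 := by norm_num
      calc ((1:ℝ)/16)^k ≤ (Real.exp (-2))^k := pow_le_pow_left₀ (by norm_num) this k
        _ = Real.exp (-2*k) := by rw [← Real.exp_nat_mul]; ring_nf
    calc Real.exp 36 * (1/16)^k ≤ Real.exp 36 * Real.exp (-2*k) := mul_le_mul_of_nonneg_left e1 (Real.exp_pos _).le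
      _ = Real.exp (36 + -2*k) := by rw [Real.exp_add]
      _ ≤ _ := by
        apply Real.exp_le_exp.mpr
        have : Real.log x * (1/(8*L)) ≤ 2*k+6 := by
          rw [mul_one_div, div_le_iff₀ (by linarith)]; nlinarith
        linarith
  have hfac : (x:ℝ)^(1 - 1/(8*L)) = x * (x:ℝ)^(-(1/(8*L))) := by
    rw [sub_eq_add_neg, Real.rpow_add hx0, Real.rpow_one]
  have hp0 : 0 < (x:ℝ)^(-(1/(8*L))) := Real.rpow_pos_of_pos hx0 _
  have t1 : 6 * sk k * Vy y * x ≤ 6 * Real.exp 42 / L * (x:ℝ)^(1 - 1/(8*L)) := by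
    rw [hfac]
    have := mul_le_mul hsk hV (Vy_pos y).le (by positivity)
    have := mul_le_mul_of_nonneg_right this hx0.le
    calc 6 * sk k * Vy y * x = 6 * (sk k * Vy y * x) := by ring
      _ ≤ 6 * (Real.exp 42 * (x:ℝ)^(-(1/(8*L))) * (1/L) * x) := by linarith
      _ = _ := by ring
  have t2 : C * Real.exp (6*J) * (x:ℝ)^(1-3*δ/4) ≤ 1 / L * (x:ℝ)^(1 - 1/(8*L)) := by
    have a1 : (x:ℝ)^(1-3*δ/4) = x * (x:ℝ)^(-(3*δ/8)) * (x:ℝ)^(-(3*δ/8)) := by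
      nth_rewrite 2 [← Real.rpow_one (x:ℝ)]
      rw [← Real.rpow_add hx0, ← Real.rpow_add hx0]; congr 1; ring
    have a2 : (x:ℝ)^(-(3*δ/8)) ≤ (x:ℝ)^(-(1/(8*L))) := by
      apply Real.rpow_le_rpow_of_exponent_le hx1R
      rw [div_le_iff₀ (by linarith)] at hlδ
      have : 1/(8*L) ≤ 3*δ/8 := by rw [div_le_iff₀ (by linarith)]; nlinarith
      linarith
    have a3 : (x:ℝ)^(-(3*δ/8)) ≤ (y:ℝ)^(-(120*δ)) := by
      rw [Real.rpow_def_of_pos hx0, Real.rpow_def_of_pos (by linarith), hL]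
      apply Real.exp_le_exp.mpr
      nlinarith
    have a4 := H1 y hyy1
    rw [hL] at a4
    have hy0 : 0 < (y:ℝ)^(-(120*δ)) := Real.rpow_pos_of_pos (by linarith) _
    have a5 : C * Real.exp (6*J) * (y:ℝ)^(-(120*δ)) ≤ 1 / L := by
      rw [le_div_iff₀ (by linarith)]
      have hL0 : 0 < L := by linarith
      calc C * Real.exp (6*J) * (y:ℝ)^(-(120*δ)) * L ≤ C * (4*L)^9 * (y:ℝ)^(-(120*δ)) * L := by
            have := mul_le_mul_of_nonneg_left hJ2 (mul_nonneg (mul_nonneg hC.le hy0.le) hL0.le)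
            linarith
        _ = (C * 4^9 * L^10) * (y:ℝ)^(-(120*δ)) := by ring
        _ ≤ (y:ℝ)^(120*δ) * (y:ℝ)^(-(120*δ)) := mul_le_mul_of_nonneg_right a4 hy0.le
        _ = 1 := by rw [← Real.rpow_add (by linarith)]; simp
    have hq0 : 0 < (x:ℝ)^(-(3*δ/8)) := Real.rpow_pos_of_pos hx0 _
    rw [a1, hfac]
    calc C * Real.exp (6*J) * (x * (x:ℝ)^(-(3*δ/8)) * (x:ℝ)^(-(3*δ/8)))
        = (C * Real.exp (6*J) * (x:ℝ)^(-(3*δ/8))) * (x * (x:ℝ)^(-(3*δ/8))) := by ring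
      _ ≤ (1/L) * (x * (x:ℝ)^(-(1/(8*L)))) := by
        refine mul_le_mul ((mul_le_mul_of_nonneg_left a3 (by positivity)).trans a5) (mul_le_mul_of_nonneg_left a2 hx0.le) (by positivity) (by positivity)
  calc _ ≤ 6 * Real.exp 42 / L * (x:ℝ)^(1 - 1/(8*L)) + 1 / L * (x:ℝ)^(1 - 1/(8*L)) := add_le_add t1 t2
    _ = _ := by unfold CA; ring

end TP

namespace TP
open Finset

lemma abel_bd (a : ℕ → ℂ) (φ E : ℕ → ℝ) (N0 : ℕ) (hφ0 : ∀ n, N0 ≤ n → 0 ≤ φ n)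
    (hφ : ∀ n, N0 ≤ n → φ (n+1) ≤ φ n)
    (hA : ∀ n, N0 ≤ n → ‖∑ m ∈ Ioc 0 n, a m‖ ≤ E n) (N : ℕ) (hN : N0 ≤ N) :
    ‖∑ n ∈ Ioc N0 N, a n * (φ n : ℂ)‖ ≤ 2 * (E N0 * φ N0) + ∑ n ∈ Ico N0 N, (E (n+1) - E n) * φ (n+1) := by
  have key : ‖∑ n ∈ Ioc N0 N, a n * (φ n : ℂ) - (∑ m ∈ Ioc 0 N, a m) * (φ N : ℂ)‖ ≤
      2 * (E N0 * φ N0) + ∑ n ∈ Ico N0 N, (E (n+1) - E n) * φ (n+1) - E N * φ N := by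
    induction N, hN using Nat.le_induction with
    | base =>
      simp only [Ioc_self, sum_empty, zero_sub, norm_neg, norm_mul, Ico_self, Complex.norm_real,
        Real.norm_of_nonneg (hφ0 N0 le_rfl)]
      have := mul_le_mul_of_nonneg_right (hA N0 le_rfl) (hφ0 N0 le_rfl)
      linarith
    | succ N hN ih =>
      rw [sum_Ioc_succ_top (by omega), sum_Ioc_succ_top (by omega : 0 ≤ N), sum_Ico_succ_top hN]
      have e : ∑ n ∈ Ioc N0 N, a n * (φ n : ℂ) + a (N+1) * (φ (N+1) : ℂ) - (∑ m ∈ Ioc 0 N, a m + a (N+1)) * (φ (N+1) : ℂ)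
        = (∑ n ∈ Ioc N0 N, a n * (φ n : ℂ) - (∑ m ∈ Ioc 0 N, a m) * (φ N : ℂ)) + (∑ m ∈ Ioc 0 N, a m) * ((φ N - φ (N+1) : ℝ) : ℂ) := by
        push_cast; ring
      rw [e]
      refine (norm_add_le _ _).trans ?_
      rw [norm_mul, Complex.norm_real, Real.norm_of_nonneg (by linarith [hφ N hN])]
      have := mul_le_mul_of_nonneg_right (hA N hN) (by linarith [hφ N hN] : 0 ≤ φ N - φ (N+1))
      nlinarith
  have h2 : ‖(∑ m ∈ Ioc 0 N, a m) * (φ N : ℂ)‖ ≤ E N * φ N := by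
    rw [norm_mul, Complex.norm_real, Real.norm_of_nonneg (hφ0 N hN)]
    exact mul_le_mul_of_nonneg_right (hA N hN) (hφ0 N hN)
  have h3 := norm_add_le (∑ n ∈ Ioc N0 N, a n * (φ n : ℂ) - (∑ m ∈ Ioc 0 N, a m) * (φ N : ℂ)) ((∑ m ∈ Ioc 0 N, a m) * (φ N : ℂ))
  rw [sub_add_cancel] at h3
  linarith

lemma sum_rpow_le2 (a : ℝ) (ha : 0 < a) (N : ℕ) : ∑ n ∈ Ico 1 N, (n:ℝ)^(-1-a) ≤ 1 + 1/a := by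
  have key : ∀ N : ℕ, ∑ n ∈ Ico 1 (N+2), (n:ℝ)^(-1-a) ≤ 1 + 1/a - 1/a * ((N+1:ℕ):ℝ)^(-a) := by
    intro N
    induction N with
    | zero => simp
    | succ N ih =>
      rw [sum_Ico_succ_top (by omega)]
      have hn : (0:ℝ) < ((N+1:ℕ):ℝ) := by positivity
      have hm : (0:ℝ) < ((N+1+1:ℕ):ℝ) := by positivity
      have e : ((N+1+1:ℕ):ℝ) = ((N+1:ℕ):ℝ) + 1 := by push_cast; ring
      have h1 : ((N+1+1:ℕ):ℝ)^(-a) * (1 + a / ((N+1+1:ℕ):ℝ)) ≤ ((N+1:ℕ):ℝ)^(-a) := by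
        rw [Real.rpow_def_of_pos hm, Real.rpow_def_of_pos hn]
        have h2 : Real.log ((N+1:ℕ):ℝ) ≤ Real.log ((N+1+1:ℕ):ℝ) - 1 / ((N+1+1:ℕ):ℝ) := by
          have := Real.log_le_sub_one_of_pos (div_pos hn hm)
          rw [Real.log_div hn.ne' hm.ne'] at this
          have h3 : ((N+1:ℕ):ℝ) / ((N+1+1:ℕ):ℝ) - 1 = - (1 / ((N+1+1:ℕ):ℝ)) := by
            rw [e]; field_simp; ring
          linarith
        have h4 := Real.add_one_le_exp (a / ((N+1+1:ℕ):ℝ))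
        calc _ ≤ Real.exp (Real.log ((N+1+1:ℕ):ℝ) * -a) * Real.exp (a / ((N+1+1:ℕ):ℝ)) :=
              mul_le_mul_of_nonneg_left (by linarith) (Real.exp_pos _).le
          _ = Real.exp (Real.log ((N+1+1:ℕ):ℝ) * -a + a / ((N+1+1:ℕ):ℝ)) := by rw [Real.exp_add]
          _ ≤ _ := by
            apply Real.exp_le_exp.mpr
            have : a / ((N+1+1:ℕ):ℝ) = a * (1 / ((N+1+1:ℕ):ℝ)) := by ring
            rw [this]; nlinarith
      have h5 : ((N+1+1:ℕ):ℝ)^(-1-a) = ((N+1+1:ℕ):ℝ)^(-a) / ((N+1+1:ℕ):ℝ) := by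
        rw [show -1-a = -a - 1 by ring, Real.rpow_sub_one hm.ne']
      have h6 : (N + 2 : ℕ) = N+1+1 := rfl
      rw [h6, h5]
      have h7 : 1/a * (((N+1+1:ℕ):ℝ)^(-a) * (1 + a / ((N+1+1:ℕ):ℝ))) ≤ 1/a * ((N+1:ℕ):ℝ)^(-a) :=
        mul_le_mul_of_nonneg_left h1 (by positivity)
      have h8 : 1/a * (((N+1+1:ℕ):ℝ)^(-a) * (1 + a / ((N+1+1:ℕ):ℝ))) = 1/a * ((N+1+1:ℕ):ℝ)^(-a) + ((N+1+1:ℕ):ℝ)^(-a) / ((N+1+1:ℕ):ℝ) := by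
        field_simp
      linarith
  have h1 := key N
  have h2 : 0 ≤ 1/a * ((N+1:ℕ):ℝ)^(-a) := by positivity
  refine le_trans (sum_le_sum_of_subset_of_nonneg (Ico_subset_Ico le_rfl (by omega : N ≤ N+2)) fun i _ _ => by positivity) (h1.trans (by linarith))

/-- Abel summation for error with power saving. -/
lemma abel_pow (a : ℕ → ℂ) (φ : ℕ → ℝ) (N0 : ℕ) (B κ D F : ℝ) (hB : 0 ≤ B) (hκ : 0 < κ) (hD : 0 ≤ D) (hN0 : 1 ≤ N0)
    (hφ0 : ∀ n, N0 ≤ n → 0 ≤ φ n) (hφ : ∀ n, N0 ≤ n → φ (n+1) ≤ φ n)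
    (hφ1 : ∀ n, N0 ≤ n → φ n ≤ D * (n:ℝ)^(-1 + κ/2)) (hF : φ N0 * N0 ≤ F)
    (hA : ∀ n, N0 ≤ n → ‖∑ m ∈ Ioc 0 n, a m‖ ≤ B * (n:ℝ)^(1-κ)) (N : ℕ) (hN : N0 ≤ N) :
    ‖∑ n ∈ Ioc N0 N, a n * (φ n : ℂ)‖ ≤ B * (2 * F + D * (1 + 2/κ)) := by
  refine (abel_bd a φ (fun n => B * (n:ℝ)^(1-κ)) N0 hφ0 hφ hA N hN).trans ?_
  have h1 : B * (N0:ℝ)^(1-κ) * φ N0 ≤ B * F := by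
    have hp : (1:ℝ) ≤ N0 := by exact_mod_cast hN0
    have : (N0:ℝ)^(1-κ) ≤ N0 := by
      conv_rhs => rw [← Real.rpow_one (N0:ℝ)]
      exact Real.rpow_le_rpow_of_exponent_le hp (by linarith)
    rw [mul_assoc]
    refine mul_le_mul_of_nonneg_left ?_ hB
    have := mul_le_mul_of_nonneg_right this (hφ0 N0 le_rfl)
    linarith
  have h2 : ∑ n ∈ Ico N0 N, (B * ((n+1:ℕ):ℝ)^(1-κ) - B * (n:ℝ)^(1-κ)) * φ (n+1) ≤ B * D * ∑ n ∈ Ico 1 N, (n:ℝ)^(-1-κ/2) := by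
    rw [mul_sum]
    refine (sum_le_sum fun n hn => ?_).trans (sum_le_sum_of_subset_of_nonneg (Ico_subset_Ico hN0 le_rfl) fun i _ _ => by positivity)
    have hn0 : N0 ≤ n := (mem_Ico.mp hn).1
    have hnp : (0:ℝ) < n := by exact_mod_cast (show 0 < n by omega)
    have hnp1 : (0:ℝ) < ((n+1:ℕ):ℝ) := by positivity
    have e1 : ((n+1:ℕ):ℝ)^(1-κ) - (n:ℝ)^(1-κ) ≤ (n:ℝ)^(-κ) := by
      have a1 : ((n+1:ℕ):ℝ)^(1-κ) = ((n+1:ℕ):ℝ) * ((n+1:ℕ):ℝ)^(-κ) := by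
        rw [sub_eq_add_neg, Real.rpow_add hnp1, Real.rpow_one]
      have a2 : (n:ℝ)^(1-κ) = (n:ℝ) * (n:ℝ)^(-κ) := by
        rw [sub_eq_add_neg, Real.rpow_add hnp, Real.rpow_one]
      have a3 : ((n+1:ℕ):ℝ)^(-κ) ≤ (n:ℝ)^(-κ) :=
        Real.rpow_le_rpow_of_nonpos hnp (by push_cast; linarith) (by linarith)
      rw [a1, a2]; 
      have := mul_le_mul_of_nonneg_left a3 hnp1.le
      have e : ((n+1:ℕ):ℝ) * (n:ℝ)^(-κ) = (n:ℝ) * (n:ℝ)^(-κ) + (n:ℝ)^(-κ) := by push_cast; ring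
      linarith
    have e2 : φ (n+1) ≤ D * (n:ℝ)^(-1 + κ/2) := (hφ n hn0).trans (hφ1 n hn0)
    have e3 : (n:ℝ)^(-κ) * (n:ℝ)^(-1 + κ/2) = (n:ℝ)^(-1-κ/2) := by
      rw [← Real.rpow_add hnp]; congr 1; ring
    calc _ = B * ((((n+1:ℕ):ℝ)^(1-κ) - (n:ℝ)^(1-κ)) * φ (n+1)) := by ring
      _ ≤ B * ((n:ℝ)^(-κ) * (D * (n:ℝ)^(-1 + κ/2))) := by
        refine mul_le_mul_of_nonneg_left ?_ hB
        exact mul_le_mul e1 e2 (hφ0 _ (by omega)) (by positivity)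
      _ = B * D * ((n:ℝ)^(-κ) * (n:ℝ)^(-1 + κ/2)) := by ring
      _ = _ := by rw [e3]
  have h3 := mul_le_mul_of_nonneg_left (sum_rpow_le2 (κ/2) (by linarith) N) (mul_nonneg hB hD)
  have e : 1/(κ/2) = 2/κ := by field_simp
  rw [e] at h3
  calc _ ≤ 2 * (B * F) + B * D * (1 + 2/κ) := add_le_add (by linarith) (h2.trans h3)
    _ = _ := by ring

/-- Riemann sum comparison for antitone weight. -/
lemma riem (t : ℝ) (φ : ℝ → ℝ) (N0 : ℕ) (hN0 : 1 ≤ N0) (hφ : AntitoneOn φ (Set.Ici (N0:ℝ))) (hc : ContinuousOn φ (Set.Ici (N0:ℝ)))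
    (hφ0 : ∀ u, (N0:ℝ) ≤ u → 0 ≤ φ u) (N : ℕ) (hN : N0 ≤ N) :
    ‖∑ n ∈ Ico N0 N, (φ ((n+1:ℕ):ℝ) : ℂ) * (∫ u in (n:ℝ)..((n+1:ℕ):ℝ), el t u) - ∫ u in (N0:ℝ)..N, (φ u : ℂ) * el t u‖ ≤ φ N0 := by
  have key : ‖∑ n ∈ Ico N0 N, (φ ((n+1:ℕ):ℝ) : ℂ) * (∫ u in (n:ℝ)..((n+1:ℕ):ℝ), el t u) - ∫ u in (N0:ℝ)..N, (φ u : ℂ) * el t u‖ ≤ φ N0 - φ N := by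
    have hIvl : ∀ a b : ℕ, N0 ≤ a → N0 ≤ b → IntervalIntegrable (fun u => (φ u : ℂ) * el t u) MeasureTheory.volume a b := by
      intro a b ha hb
      have ha' : (N0:ℝ) ≤ a := by exact_mod_cast ha
      have hb' : (N0:ℝ) ≤ b := by exact_mod_cast hb
      have h1 : (0:ℝ) < N0 := by exact_mod_cast hN0
      apply ContinuousOn.intervalIntegrable
      refine ContinuousOn.mul ?_ (el_cont t a b (by linarith) (by linarith))
      refine Complex.continuous_ofReal.comp_continuousOn (hc.mono ?_)
      intro u hu
      exact (le_min ha' hb').trans hu.1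
    induction N, hN using Nat.le_induction with
    | base => simp
    | succ N hN ih =>
      have hN' : (N0:ℝ) ≤ N := by exact_mod_cast hN
      have h1 : (0:ℝ) < N0 := by exact_mod_cast hN0
      rw [sum_Ico_succ_top hN, ← intervalIntegral.integral_add_adjacent_intervals (hIvl N0 N le_rfl hN) (hIvl N (N+1) hN (by omega)), add_sub_add_comm]
      refine (norm_add_le _ _).trans ?_
      have hlast : ‖(φ ((N+1:ℕ):ℝ) : ℂ) * (∫ u in (N:ℝ)..((N+1:ℕ):ℝ), el t u) - ∫ u in (N:ℝ)..((N+1:ℕ):ℝ), (φ u : ℂ) * el t u‖ ≤ φ N - φ ((N+1:ℕ):ℝ) := by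
        have hlt : (N:ℝ) ≤ ((N+1:ℕ):ℝ) := by push_cast; linarith
        rw [← intervalIntegral.integral_const_mul, ← intervalIntegral.integral_sub
          ((el_int t N (N+1:ℕ) (by linarith) (by positivity)).const_mul _) (hIvl N (N+1) hN (by omega))]
        refine (intervalIntegral.norm_integral_le_of_norm_le_const (C := φ N - φ ((N+1:ℕ):ℝ)) ?_).trans ?_
        · intro u hu
          rw [Set.uIoc_of_le hlt] at hu
          rw [← sub_mul, norm_mul, el_norm, mul_one, ← Complex.ofReal_sub, Complex.norm_real, Real.norm_eq_abs, abs_sub_comm]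
          have hu0 : (N0:ℝ) ≤ u := by linarith [hu.1]
          have a1 : φ u ≤ φ N := hφ hN' hu0 hu.1.le
          have a2 : φ ((N+1:ℕ):ℝ) ≤ φ u := hφ hu0 (by simpa using hN'.trans hlt) hu.2
          rw [abs_of_nonneg (by linarith)]; linarith
        · push_cast; simp
      linarith
  linarith [hφ0 N (by exact_mod_cast hN)]

lemma cpow_el (u σ t : ℝ) (hu : 0 < u) : (u:ℂ)^(-((σ:ℂ) + t * Complex.I)) = ((u^(-σ) : ℝ):ℂ) * el t u := by
  have h0 : (u:ℂ) ≠ 0 := by exact_mod_cast hu.ne'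
  rw [neg_add, Complex.cpow_add _ _ h0, Complex.ofReal_cpow hu.le]
  push_cast
  congr 1
  rw [Complex.cpow_def_of_ne_zero h0, ← Complex.ofReal_log hu.le]
  unfold el ee
  congr 1; push_cast; ring

end TP

namespace TP
open Finset

noncomputable def ww (σ t : ℝ) : ℂ := ((1 - σ : ℝ) : ℂ) - t * Complex.I

lemma ww_ne (σ t : ℝ) (h : 1 < σ) : ww σ t ≠ 0 := by
  intro h0
  have := congrArg Complex.re h0
  simp [ww] at this
  linarith

lemma norm_cpow_ww (u σ t : ℝ) (hu : 0 < u) : ‖(u:ℂ)^(ww σ t)‖ = u^(1-σ) := by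
  rw [Complex.norm_cpow_eq_rpow_re_of_pos hu]; simp [ww]

lemma int0 (σ t : ℝ) (h : 1 < σ) (a b : ℝ) (ha : 0 < a) (hab : a ≤ b) :
    ∫ u in a..b, ((u^(-σ):ℝ):ℂ) * el t u = (b:ℂ)^(ww σ t) / ww σ t - (a:ℂ)^(ww σ t) / ww σ t := by
  have hpos : ∀ u ∈ Set.uIcc a b, 0 < u := fun u hu => by
    rw [Set.uIcc_of_le hab] at hu; exact ha.trans_le hu.1
  refine intervalIntegral.integral_eq_sub_of_hasDerivAt (f := fun u : ℝ => (u:ℂ)^(ww σ t) / ww σ t) ?_ ?_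
  · intro u hu
    have hu0 := hpos u hu
    have h1 := (hasDerivAt_ofReal_cpow_const hu0.ne' (ww_ne σ t h)).div_const (ww σ t)
    refine h1.congr_deriv ?_
    rw [mul_div_assoc, mul_comm, div_mul_cancel₀ _ (ww_ne σ t h), ← cpow_el u σ t hu0]
    congr 1; simp [ww]; ring
  · apply ContinuousOn.intervalIntegrable
    refine ContinuousOn.mul ?_ (el_cont t a b ha (by linarith))
    refine Complex.continuous_ofReal.comp_continuousOn ?_
    exact fun u hu => (Real.continuousAt_rpow_const u _ (Or.inl (hpos u hu).ne')).continuousWithinAt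

lemma int1 (σ t : ℝ) (h : 1 < σ) (a b : ℝ) (ha : 0 < a) (hab : a ≤ b) :
    ∫ u in a..b, ((u^(-σ) * Real.log u:ℝ):ℂ) * el t u = (b:ℂ)^(ww σ t) * (((Real.log b:ℝ):ℂ) / ww σ t - 1 / (ww σ t)^2)
      - (a:ℂ)^(ww σ t) * (((Real.log a:ℝ):ℂ) / ww σ t - 1 / (ww σ t)^2) := by
  have hpos : ∀ u ∈ Set.uIcc a b, 0 < u := fun u hu => by
    rw [Set.uIcc_of_le hab] at hu; exact ha.trans_le hu.1
  refine intervalIntegral.integral_eq_sub_of_hasDerivAt (f := fun u : ℝ => (u:ℂ)^(ww σ t) * (((Real.log u:ℝ):ℂ) / ww σ t - 1 / (ww σ t)^2)) ?_ ?_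
  · intro u hu
    have hu0 := hpos u hu
    have hu1 : (u:ℂ) ≠ 0 := by exact_mod_cast hu0.ne'
    have h1 := hasDerivAt_ofReal_cpow_const hu0.ne' (ww_ne σ t h)
    have h2 := (((Real.hasDerivAt_log hu0.ne').ofReal_comp).div_const (ww σ t)).sub_const (1 / (ww σ t)^2)
    refine (h1.mul h2).congr_deriv ?_
    have e : (((u^(-σ) * Real.log u:ℝ):ℂ)) * el t u = (u:ℂ)^(ww σ t - 1) * ((Real.log u:ℝ):ℂ) := by
      have := cpow_el u σ t hu0
      rw [show -((σ:ℂ) + t * Complex.I) = ww σ t - 1 by simp [ww]; ring] at this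
      rw [this]; push_cast; ring
    rw [e, Complex.cpow_sub _ _ hu1, Complex.cpow_one]
    have hw := ww_ne σ t h
    generalize (u:ℂ)^(ww σ t) = A
    push_cast
    generalize ww σ t = w at *
    field_simp
    ring
  · apply ContinuousOn.intervalIntegrable
    refine ContinuousOn.mul ?_ (el_cont t a b ha (by linarith))
    refine Complex.continuous_ofReal.comp_continuousOn ?_
    exact fun u hu => ((Real.continuousAt_rpow_const u _ (Or.inl (hpos u hu).ne')).mul (Real.continuousAt_log (hpos u hu).ne')).continuousWithinAt

lemma tele_int (t : ℝ) (V : ℂ) (f : ℕ → ℂ) (N : ℕ) (hN : 1 ≤ N) :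
    ∑ n ∈ Ioc 0 N, (f n - V * ∫ u in ((max (n-1) 1 : ℕ):ℝ)..n, el t u) = ∑ n ∈ Ioc 0 N, f n - V * ∫ u in (1:ℝ)..N, el t u := by
  induction N, hN using Nat.le_induction with
  | base => simp
  | succ N hN ih =>
    have hN0 : (0:ℝ) < N := by exact_mod_cast hN
    rw [sum_Ioc_succ_top (by omega), sum_Ioc_succ_top (by omega : 0 ≤ N), ih]
    rw [show max (N+1-1) 1 = N by omega]
    rw [← intervalIntegral.integral_add_adjacent_intervals (el_int t 1 N one_pos hN0) (el_int t N (N+1:ℕ) hN0 (by positivity))]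
    ring

lemma C2gen (K : ℕ) : ∃ y0 : ℕ, 3 ≤ y0 ∧ ∀ y : ℕ, y0 ≤ y → ∀ t : ℝ, |t| ≤ (y:ℝ)^K → ∀ (φ : ℝ → ℝ) (D F : ℝ), 0 ≤ D →
    ∀ N0 : ℕ, N0 = y^320 →
    AntitoneOn φ (Set.Ici (N0:ℝ)) → ContinuousOn φ (Set.Ici (N0:ℝ)) → (∀ u, (N0:ℝ) ≤ u → 0 ≤ φ u) →
    (∀ n : ℕ, N0 ≤ n → φ n ≤ D * (n:ℝ)^(-1 + 1 / (16 * Real.log y))) → φ N0 * N0 ≤ F →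
    ∀ N : ℕ, N0 ≤ N →
    ‖∑ n ∈ Ioc N0 N, (ro y n : ℂ) * el t n * (φ n : ℂ) - (Vy y : ℂ) * ∫ u in (N0:ℝ)..N, (φ u : ℂ) * el t u‖
      ≤ CA / Real.log y * (2 * F + D * (1 + 16 * Real.log y)) + φ N0 := by
  obtain ⟨y0, hy0, H⟩ := C1 K
  refine ⟨y0, hy0, ?_⟩
  intro y hy t ht φ D F hD N0 hN0 hφ hφc hφ0 hφ1 hF N hN
  have hy3 : (3:ℝ) ≤ y := by exact_mod_cast hy0.trans hy
  have hl1 : 1 ≤ Real.log y := by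
    rw [Real.le_log_iff_exp_le (by linarith)]
    linarith [Real.exp_one_lt_d9]
  have h1N : 1 ≤ N0 := by rw [hN0]; exact Nat.one_le_pow _ _ (by omega)
  set a : ℕ → ℂ := fun n => (ro y n : ℂ) * el t n - (Vy y:ℂ) * ∫ u in ((max (n-1) 1 : ℕ):ℝ)..n, el t u with ha
  have hA : ∀ n, N0 ≤ n → ‖∑ m ∈ Ioc 0 n, a m‖ ≤ CA / Real.log y * (n:ℝ)^(1 - 1/(8*Real.log y)) := by
    intro n hn
    rw [ha, tele_int t (Vy y:ℂ) (fun n => (ro y n : ℂ) * el t n) n (h1N.trans hn)]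
    exact H y n hy (hN0 ▸ hn) t ht
  have h1 := abel_pow a (fun n => φ n) N0 (CA / Real.log y) (1/(8*Real.log y)) D F (div_nonneg CA_pos.le (by linarith)) (by positivity) hD h1N
    (fun n hn => hφ0 n (by exact_mod_cast hn)) (fun n hn => hφ (by simpa using hn) (by simp; exact_mod_cast (by omega : N0 ≤ n + 1)) (by simp))
    (fun n hn => (hφ1 n hn).trans_eq (by congr 3; field_simp; norm_num)) hF hA N hN
  have e2 : 2 / (1/(8*Real.log y)) = 16 * Real.log y := by field_simp; norm_num
  rw [e2] at h1
  have h2 := riem t φ N0 h1N hφ hφc hφ0 N hN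
  have h3 : ∑ n ∈ Ioc N0 N, a n * (φ n : ℂ) = ∑ n ∈ Ioc N0 N, (ro y n : ℂ) * el t n * (φ n : ℂ)
      - (Vy y:ℂ) * ∑ n ∈ Ico N0 N, (φ ((n+1:ℕ):ℝ) : ℂ) * (∫ u in (n:ℝ)..((n+1:ℕ):ℝ), el t u) := by
    rw [mul_sum]
    have : ∑ n ∈ Ico N0 N, (Vy y:ℂ) * ((φ ((n+1:ℕ):ℝ) : ℂ) * (∫ u in (n:ℝ)..((n+1:ℕ):ℝ), el t u))
      = ∑ n ∈ Ioc N0 N, (Vy y:ℂ) * ((φ n : ℂ) * (∫ u in ((max (n-1) 1 : ℕ):ℝ)..n, el t u)) := by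
      rw [show Ioc N0 N = (Ico N0 N).image (fun n => n+1) by
        ext m; simp only [mem_Ioc, mem_image, mem_Ico]
        constructor
        · intro h; exact ⟨m-1, by omega, by omega⟩
        · rintro ⟨b, hb, rfl⟩; omega]
      rw [sum_image (fun a _ b _ h => by simpa using h)]
      refine sum_congr rfl fun n hn => ?_
      have := (mem_Ico.mp hn).1
      rw [show max (n+1-1) 1 = n by omega]
    rw [this, ← sum_sub_distrib]
    refine sum_congr rfl fun n _ => ?_
    rw [ha]; ring
  have h4 : ∑ n ∈ Ioc N0 N, (ro y n : ℂ) * el t n * (φ n : ℂ) - (Vy y : ℂ) * ∫ u in (N0:ℝ)..N, (φ u : ℂ) * el t u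
      = ∑ n ∈ Ioc N0 N, a n * (φ n : ℂ) + (Vy y:ℂ) * (∑ n ∈ Ico N0 N, (φ ((n+1:ℕ):ℝ) : ℂ) * (∫ u in (n:ℝ)..((n+1:ℕ):ℝ), el t u) - ∫ u in (N0:ℝ)..N, (φ u : ℂ) * el t u) := by
    rw [h3]; ring
  rw [h4]
  refine (norm_add_le _ _).trans (add_le_add h1 ?_)
  rw [norm_mul, Complex.norm_real, Real.norm_of_nonneg (Vy_pos y).le]
  calc _ ≤ 1 * φ N0 := mul_le_mul (Vy_le_one y) h2 (norm_nonneg _) zero_le_one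
    _ = _ := one_mul _

end TP

namespace TP
open Finset

noncomputable def CB : ℝ := 320 * Real.exp 108 + 912 * CA + 320

lemma CB_ge : 1 ≤ CB := by
  unfold CB; have := CA_pos; have := Real.exp_pos 108; linarith

lemma logy_ge (y : ℕ) (hy : 3 ≤ y) : 1 ≤ Real.log y := by
  have hy3 : (3:ℝ) ≤ y := by exact_mod_cast hy
  rw [Real.le_log_iff_exp_le (by linarith)]
  linarith [Real.exp_one_lt_d9]

lemma log_N0 (y : ℕ) : Real.log ((y^320 : ℕ):ℝ) = 320 * Real.log y := by
  rw [Nat.cast_pow, Real.log_pow]; norm_num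

lemma small_part (y : ℕ) (hy : 3 ≤ y) (t : ℝ) (σ : ℝ) (hσ : 1 < σ) (g : ℝ → ℝ) (M : ℝ) (hM : 0 ≤ M) (N0 : ℕ) (hN0 : N0 = y^320)
    (hg : ∀ n : ℕ, 1 ≤ n → n ≤ N0 → |g n| ≤ M) :
    ‖∑ n ∈ Ioc 0 N0, (ro y n : ℂ) * el t n * (((n:ℝ)^(-σ) * g n : ℝ) : ℂ)‖ ≤ Real.exp 108 * M := by
  have h9 : N0 ≤ y^(2^9) := by
    rw [hN0]
    generalize he : (2:ℕ)^9 = e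
    exact Nat.pow_le_pow_right (by omega) (by rw [← he]; norm_num)
  have h := rsum y 9 N0 (by omega) h9
  refine (norm_sum_le _ _).trans ?_
  calc _ ≤ ∑ n ∈ Ioc 0 N0, ro y n * (1/(n:ℝ)) * M := by
        refine sum_le_sum fun n hn => ?_
        have hn1 : 1 ≤ n := (mem_Ioc.mp hn).1
        have hnR : (1:ℝ) ≤ n := by exact_mod_cast hn1
        rw [norm_mul, norm_mul, el_norm, mul_one, Complex.norm_real, Complex.norm_real, Real.norm_of_nonneg (ro_nonneg _ _), norm_mul, mul_assoc]
        refine mul_le_mul_of_nonneg_left ?_ (ro_nonneg _ _)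
        refine mul_le_mul ?_ (hg n hn1 (mem_Ioc.mp hn).2) (norm_nonneg _) (by positivity)
        rw [Real.norm_of_nonneg (by positivity), one_div, ← Real.rpow_neg_one]
        exact Real.rpow_le_rpow_of_exponent_le hnR (by linarith)
    _ = (∑ n ∈ Ioc 0 N0, ro y n * (1/(n:ℝ))) * M := by rw [sum_mul]
    _ ≤ _ := by
      refine mul_le_mul_of_nonneg_right (h.trans_eq ?_) hM
      norm_num

lemma Vy_le' (y : ℕ) (hy : 3 ≤ y) : Vy y ≤ 1 / Real.log y := by
  rw [le_div_iff₀ (by linarith [logy_ge y hy])]; exact Vy_le y (by omega)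

lemma C2_0 (K : ℕ) : ∃ y0 : ℕ, 3 ≤ y0 ∧ ∀ y : ℕ, y0 ≤ y → ∀ t : ℝ, |t| ≤ (y:ℝ)^K → ∀ σ : ℝ, 1 < σ → ∀ N : ℕ, y^320 ≤ N →
    ‖∑ n ∈ Ioc 0 N, (ro y n : ℂ) * el t n * (((n:ℝ)^(-σ) : ℝ) : ℂ)‖ ≤ CB + 2 / (Real.log y * ‖ww σ t‖) := by
  obtain ⟨y0, hy0, H⟩ := C2gen K
  refine ⟨y0, hy0, ?_⟩
  intro y hy t ht σ hσ N hN
  have hy3 : 3 ≤ y := hy0.trans hy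
  have hL := logy_ge y hy3
  have hV := Vy_le' y hy3
  have h1N : 1 ≤ y^320 := Nat.one_le_pow _ _ (by omega)
  have sm := small_part y hy3 t σ hσ (fun _ => 1) 1 zero_le_one (y^320) rfl (by simp)
  generalize hN0 : y^320 = N0 at *
  have h1R : (1:ℝ) ≤ N0 := by exact_mod_cast h1N
  have hanti : AntitoneOn (fun u : ℝ => u^(-σ)) (Set.Ici (N0:ℝ)) := by
    intro a ha b hb hab
    exact Real.rpow_le_rpow_of_nonpos (by linarith [Set.mem_Ici.mp ha]) hab (by linarith)
  have hcont : ContinuousOn (fun u : ℝ => u^(-σ)) (Set.Ici (N0:ℝ)) := fun u hu =>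
    (Real.continuousAt_rpow_const u _ (Or.inl (by linarith [Set.mem_Ici.mp hu]))).continuousWithinAt
  have hG := H y hy t ht (fun u => u^(-σ)) 1 1 zero_le_one N0 hN0.symm hanti hcont (fun u hu => by
      have : 0 ≤ u := by linarith
      positivity)
    (fun n hn => by
      rw [one_mul]
      have : (1:ℝ) ≤ n := by exact_mod_cast h1N.trans hn
      refine Real.rpow_le_rpow_of_exponent_le this ?_
      have : 0 ≤ 1 / (16 * Real.log y) := by positivity
      linarith)
    (by
      rw [← Real.rpow_add_one (by linarith)]
      exact Real.rpow_le_one_of_one_le_of_nonpos h1R (by linarith)) N hN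
  beta_reduce at hG
  have hφ1 : (N0:ℝ)^(-σ) ≤ 1 := Real.rpow_le_one_of_one_le_of_nonpos h1R (by linarith)
  have hNR : (N0:ℝ) ≤ N := by exact_mod_cast hN
  rw [int0 σ t hσ N0 N (by linarith) hNR] at hG
  have hw := norm_pos_iff.mpr (ww_ne σ t hσ)
  have hm : ‖(Vy y:ℂ) * ((N:ℂ)^(ww σ t) / ww σ t - (N0:ℂ)^(ww σ t) / ww σ t)‖ ≤ 2 / (Real.log y * ‖ww σ t‖) := by
    have b1 : ‖(N:ℂ)^(ww σ t) / ww σ t‖ ≤ 1 / ‖ww σ t‖ := by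
      have := norm_cpow_ww N σ t (by linarith)
      rw [Complex.ofReal_natCast] at this
      rw [norm_div, this]
      gcongr
      exact Real.rpow_le_one_of_one_le_of_nonpos (by linarith) (by linarith)
    have b2 : ‖(N0:ℂ)^(ww σ t) / ww σ t‖ ≤ 1 / ‖ww σ t‖ := by
      have := norm_cpow_ww N0 σ t (by linarith)
      rw [Complex.ofReal_natCast] at this
      rw [norm_div, this]
      gcongr
      exact Real.rpow_le_one_of_one_le_of_nonpos (by linarith) (by linarith)
    have b3 := (norm_sub_le ((N:ℂ)^(ww σ t) / ww σ t) ((N0:ℂ)^(ww σ t) / ww σ t)).trans (add_le_add b1 b2)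
    rw [norm_mul, Complex.norm_real, Real.norm_of_nonneg (Vy_pos y).le]
    calc _ ≤ 1 / Real.log y * (1 / ‖ww σ t‖ + 1 / ‖ww σ t‖) := mul_le_mul hV b3 (norm_nonneg _) (by positivity)
      _ = _ := by field_simp; norm_num
  simp only [mul_one] at sm
  push_cast at hG sm hm
  rw [← sum_Ioc_consecutive _ (Nat.zero_le N0) hN]
  have hA := CA_pos
  have hfin : CA / Real.log y * (2 * 1 + 1 * (1 + 16 * Real.log y)) ≤ 19 * CA := by
    rw [div_mul_eq_mul_div, div_le_iff₀ (by linarith)]; nlinarith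
  push_cast
  generalize ∑ n ∈ Ioc 0 N0, (ro y n : ℂ) * el t n * (((n:ℝ)^(-σ) : ℝ) : ℂ) = S1 at *
  generalize ∑ n ∈ Ioc N0 N, (ro y n : ℂ) * el t n * (((n:ℝ)^(-σ) : ℝ) : ℂ) = S2 at *
  generalize (Vy y:ℂ) * ((N:ℂ)^(ww σ t) / ww σ t - (N0:ℂ)^(ww σ t) / ww σ t) = S3 at *
  have e : S1 + S2 = S1 + (S2 - S3) + S3 := by ring
  rw [e]
  have n1 := norm_add_le (S1 + (S2 - S3)) S3
  have n2 := norm_add_le S1 (S2 - S3)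
  have := Real.exp_pos 108
  unfold CB; linarith

lemma C2_1 (K : ℕ) : ∃ y0 : ℕ, 3 ≤ y0 ∧ ∀ y : ℕ, y0 ≤ y → ∀ t : ℝ, |t| ≤ (y:ℝ)^K → ∀ σ : ℝ, 1 < σ → ∀ N : ℕ, y^320 ≤ N →
    ‖∑ n ∈ Ioc 0 N, (ro y n : ℂ) * el t n * (((n:ℝ)^(-σ) * Real.log n : ℝ) : ℂ)‖ ≤ CB * Real.log y + 320 / ‖ww σ t‖ + 2 / (Real.log y * ‖ww σ t‖^2)
       + (N:ℝ)^(1-σ) * Real.log N / ‖ww σ t‖ := by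
  obtain ⟨y0, hy0, H⟩ := C2gen K
  refine ⟨y0, hy0, ?_⟩
  intro y hy t ht σ hσ N hN
  have hy3 : 3 ≤ y := hy0.trans hy
  have hL := logy_ge y hy3
  have hV := Vy_le' y hy3
  have hl0 := log_N0 y
  have h3N : 3 ≤ y^320 := hy3.trans (Nat.le_self_pow (by norm_num) y)
  have sm := small_part y hy3 t σ hσ Real.log (320 * Real.log y) (by linarith) (y^320) rfl (fun n hn1 hn2 => by
    have : (1:ℝ) ≤ n := by exact_mod_cast hn1
    rw [abs_of_nonneg (Real.log_nonneg this), ← hl0]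
    exact Real.log_le_log (by linarith) (by exact_mod_cast hn2))
  generalize hN0 : y^320 = N0 at *
  have h1R : (3:ℝ) ≤ N0 := by exact_mod_cast h3N
  have he := Real.exp_one_lt_d9
  have hdec : ∀ u : ℝ, 0 < u → u^(-σ) * Real.log u = Real.log u / u * u^(1-σ) := by
    intro u hu
    rw [sub_eq_add_neg, Real.rpow_add hu, Real.rpow_one]; field_simp
  have hanti : AntitoneOn (fun u : ℝ => u^(-σ) * Real.log u) (Set.Ici (N0:ℝ)) := by
    intro a ha b hb hab
    have ha3 : (3:ℝ) ≤ a := h1R.trans ha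
    have hb3 : (3:ℝ) ≤ b := h1R.trans hb
    beta_reduce
    rw [hdec a (by linarith), hdec b (by linarith)]
    refine mul_le_mul ?_ (Real.rpow_le_rpow_of_nonpos (by linarith) hab (by linarith)) (by positivity) ?_
    · exact Real.log_div_self_antitoneOn (by simp; linarith) (by simp; linarith) hab
    · exact div_nonneg (Real.log_nonneg (by linarith)) (by linarith)
  have hcont : ContinuousOn (fun u : ℝ => u^(-σ) * Real.log u) (Set.Ici (N0:ℝ)) := fun u hu => by
    have : u ≠ 0 := by linarith [Set.mem_Ici.mp hu]
    exact ((Real.continuousAt_rpow_const u _ (Or.inl this)).mul (Real.continuousAt_log this)).continuousWithinAt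
  have hG := H y hy t ht (fun u => u^(-σ) * Real.log u) (16 * Real.log y) (320 * Real.log y) (by linarith) N0 hN0.symm hanti hcont (fun u hu => by
      have : 0 ≤ u := by linarith
      exact mul_nonneg (by positivity) (Real.log_nonneg (by linarith)))
    (fun n hn => by
      have hn1 : (1:ℝ) ≤ n := by exact_mod_cast (by omega : 1 ≤ n)
      have hn0 : (0:ℝ) < n := by linarith
      have q := Real.log_le_rpow_div hn0.le (by positivity : 0 < 1 / (16 * Real.log y))
      have r : (n:ℝ)^(-σ) ≤ (n:ℝ)^(-1:ℝ) := Real.rpow_le_rpow_of_exponent_le hn1 (by linarith)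
      rw [Real.rpow_add hn0]
      have := mul_le_mul r q (Real.log_nonneg hn1) (by positivity)
      refine this.trans_eq ?_
      field_simp)
    (by
      rw [hdec _ (by linarith), ← hl0]
      have : (N0:ℝ)^(1-σ) ≤ 1 := Real.rpow_le_one_of_one_le_of_nonpos (by linarith) (by linarith)
      have l0 : 0 ≤ Real.log N0 := Real.log_nonneg (by linarith)
      calc _ = Real.log N0 * (N0:ℝ)^(1-σ) := by field_simp
        _ ≤ Real.log N0 * 1 := mul_le_mul_of_nonneg_left this l0
        _ = _ := mul_one _) N hN
  beta_reduce at hG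
  have hNR : (N0:ℝ) ≤ N := by exact_mod_cast hN
  have hφ1 : (N0:ℝ)^(-σ) * Real.log N0 ≤ 320 * Real.log y := by
    rw [hl0]
    have : (N0:ℝ)^(-σ) ≤ 1 := Real.rpow_le_one_of_one_le_of_nonpos (by linarith) (by linarith)
    nlinarith
  rw [int1 σ t hσ N0 N (by linarith) hNR] at hG
  have hw := norm_pos_iff.mpr (ww_ne σ t hσ)
  have hm : ‖(Vy y:ℂ) * ((N:ℂ)^(ww σ t) * (((Real.log N:ℝ):ℂ) / ww σ t - 1 / (ww σ t)^2)
      - (N0:ℂ)^(ww σ t) * (((Real.log N0:ℝ):ℂ) / ww σ t - 1 / (ww σ t)^2))‖ ≤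
      320 / ‖ww σ t‖ + 2 / (Real.log y * ‖ww σ t‖^2) + (N:ℝ)^(1-σ) * Real.log N / ‖ww σ t‖ := by
    have nb : ∀ M : ℕ, 3 ≤ M → ‖(M:ℂ)^(ww σ t) * (((Real.log M:ℝ):ℂ) / ww σ t - 1 / (ww σ t)^2)‖ ≤ (M:ℝ)^(1-σ) * Real.log M / ‖ww σ t‖ + 1 / ‖ww σ t‖^2 := by
      intro M hM
      have hMR : (3:ℝ) ≤ M := by exact_mod_cast hM
      have := norm_cpow_ww M σ t (by linarith)
      rw [Complex.ofReal_natCast] at this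
      rw [norm_mul, this]
      have l0 : 0 ≤ Real.log M := Real.log_nonneg (by linarith)
      have q := norm_sub_le (((Real.log M:ℝ):ℂ) / ww σ t) (1 / (ww σ t)^2)
      rw [norm_div, norm_div, norm_pow, Complex.norm_real, Real.norm_of_nonneg l0, norm_one] at q
      have p1 : (M:ℝ)^(1-σ) ≤ 1 := Real.rpow_le_one_of_one_le_of_nonpos (by linarith) (by linarith)
      have p0 : 0 ≤ (M:ℝ)^(1-σ) := by positivity
      calc _ ≤ (M:ℝ)^(1-σ) * (Real.log M / ‖ww σ t‖ + 1 / ‖ww σ t‖^2) := mul_le_mul_of_nonneg_left q p0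
        _ = (M:ℝ)^(1-σ) * Real.log M / ‖ww σ t‖ + (M:ℝ)^(1-σ) * (1 / ‖ww σ t‖^2) := by ring
        _ ≤ _ := by
          have := mul_le_mul_of_nonneg_right p1 (by positivity : 0 ≤ 1 / ‖ww σ t‖^2)
          linarith
    have b1 := nb N (h3N.trans hN)
    have b2 := nb N0 h3N
    have b3 : (N0:ℝ)^(1-σ) * Real.log N0 / ‖ww σ t‖ ≤ 320 * Real.log y / ‖ww σ t‖ := by
      rw [hl0]
      have p1 : (N0:ℝ)^(1-σ) ≤ 1 := Real.rpow_le_one_of_one_le_of_nonpos (by linarith) (by linarith)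
      exact div_le_div_of_nonneg_right (by nlinarith) hw.le
    rw [norm_mul, Complex.norm_real, Real.norm_of_nonneg (Vy_pos y).le]
    have b4 := (norm_sub_le _ _).trans (add_le_add b1 b2)
    have lN : 0 ≤ Real.log N := Real.log_nonneg (by linarith)
    have z0 : 0 ≤ (N:ℝ)^(1-σ) * Real.log N / ‖ww σ t‖ := by positivity
    calc _ ≤ Vy y * (((N:ℝ)^(1-σ) * Real.log N / ‖ww σ t‖ + 1 / ‖ww σ t‖^2) + (320 * Real.log y / ‖ww σ t‖ + 1 / ‖ww σ t‖^2)) :=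
          mul_le_mul_of_nonneg_left (b4.trans (by linarith)) (Vy_pos y).le
      _ = Vy y * ((N:ℝ)^(1-σ) * Real.log N / ‖ww σ t‖) + Vy y * (2 / ‖ww σ t‖^2 + 320 * Real.log y / ‖ww σ t‖) := by ring
      _ ≤ 1 * ((N:ℝ)^(1-σ) * Real.log N / ‖ww σ t‖) + 1 / Real.log y * (2 / ‖ww σ t‖^2 + 320 * Real.log y / ‖ww σ t‖) :=
          add_le_add (mul_le_mul_of_nonneg_right (Vy_le_one y) z0) (mul_le_mul_of_nonneg_right hV (by positivity))
      _ = _ := by field_simp; ring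
  rw [← sum_Ioc_consecutive _ (Nat.zero_le N0) hN]
  have hA := CA_pos
  have hfin : CA / Real.log y * (2 * (320 * Real.log y) + 16 * Real.log y * (1 + 16 * Real.log y)) ≤ 912 * CA * Real.log y := by
    rw [div_mul_eq_mul_div, div_le_iff₀ (by linarith)]
    have : 0 ≤ CA * Real.log y * (Real.log y - 1) := mul_nonneg (by positivity) (by linarith)
    nlinarith
  simp only [Complex.ofReal_natCast] at hG
  generalize ∑ n ∈ Ioc 0 N0, (ro y n : ℂ) * el t n * (((n:ℝ)^(-σ) * Real.log n : ℝ) : ℂ) = S1 at *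
  generalize ∑ n ∈ Ioc N0 N, (ro y n : ℂ) * el t n * (((n:ℝ)^(-σ) * Real.log n : ℝ) : ℂ) = S2 at *
  generalize (Vy y:ℂ) * ((N:ℂ)^(ww σ t) * (((Real.log N:ℝ):ℂ) / ww σ t - 1 / (ww σ t)^2)
      - (N0:ℂ)^(ww σ t) * (((Real.log N0:ℝ):ℂ) / ww σ t - 1 / (ww σ t)^2)) = S3 at *
  have e : S1 + S2 = S1 + (S2 - S3) + S3 := by ring
  rw [e]
  have n1 := norm_add_le (S1 + (S2 - S3)) S3
  have n2 := norm_add_le S1 (S2 - S3)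
  unfold CB; linarith

end TP

namespace TP
open Finset

noncomputable def rc (y : ℕ) : ℕ → ℂ := fun n => (ro y n : ℂ)

lemma rc_eq (y : ℕ) (hy : 3 ≤ y) : (fun n : ℕ => (1 : DirichletCharacter ℂ (y.factorial)) (n : ZMod (y.factorial))) = rc y := by
  funext n
  unfold rc
  rcases ro_cases y n with h | ⟨h, h'⟩
  · have hn : ¬ IsUnit (n : ZMod (y.factorial)) := by
      rw [ZMod.isUnit_iff_coprime]
      intro hc
      have : ro y n = 1 := ro_one fun p hp hpy hd => by
        have h1 : p ∣ y.factorial := (Nat.Prime.dvd_factorial hp).mpr hpy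
        have := Nat.dvd_gcd hd h1
        rw [hc] at this
        exact hp.one_lt.ne' (Nat.dvd_one.mp this)
      linarith
    rw [MulChar.map_nonunit _ hn, h]; simp
  · have hn : IsUnit (n : ZMod (y.factorial)) := by
      rw [ZMod.isUnit_iff_coprime]
      refine Nat.Coprime.symm (Nat.coprime_of_dvd fun p hp hd hdn => ?_)
      exact h' p hp ((Nat.Prime.dvd_factorial hp).mp hd) hdn
    rw [MulChar.one_apply hn, h]; simp

noncomputable def sp (σ t : ℝ) : ℂ := (σ:ℂ) + t * Complex.I

lemma sp_re (σ t : ℝ) : (sp σ t).re = σ := by simp [sp]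
lemma sp_im (σ t : ℝ) : (sp σ t).im = t := by simp [sp]

lemma term_sp (f : ℕ → ℂ) (σ t : ℝ) (n : ℕ) (hn : 1 ≤ n) : LSeries.term f (sp σ t) n = f n * el t n * (((n:ℝ)^(-σ) : ℝ) : ℂ) := by
  have h := cpow_el n σ t (by exact_mod_cast hn)
  rw [LSeries.term_of_ne_zero (by omega), div_eq_mul_inv, ← Complex.cpow_neg]
  unfold sp
  rw [Complex.ofReal_natCast] at h
  rw [h]; ring

lemma LSeries_lim (f : ℕ → ℂ) (s : ℂ) (h : LSeriesSummable f s) :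
    Filter.Tendsto (fun N : ℕ => ∑ n ∈ Ioc 0 N, LSeries.term f s n) Filter.atTop (nhds (LSeries f s)) := by
  have h1 := h.hasSum.tendsto_sum_nat
  have h2 := h1.comp (Filter.tendsto_add_atTop_nat 1)
  refine h2.congr fun N => ?_
  simp only [Function.comp]
  rw [range_eq_Ico, sum_eq_sum_Ico_succ_bot (by omega), LSeries.term_zero, zero_add]
  rfl

lemma rc_summable (y : ℕ) (hy : 3 ≤ y) (s : ℂ) (hs : 1 < s.re) : LSeriesSummable (rc y) s := by
  rw [← rc_eq y hy]
  exact (DirichletCharacter.LSeriesSummable_iff (Nat.factorial_ne_zero y) _).mpr hs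

lemma rc_absc (y : ℕ) (hy : 3 ≤ y) (s : ℂ) (hs : 1 < s.re) : LSeries.abscissaOfAbsConv (rc y) < s.re := by
  rw [← rc_eq y hy, DirichletCharacter.absicssaOfAbsConv_eq_one (Nat.factorial_ne_zero y)]
  exact_mod_cast hs

lemma Z0 (K : ℕ) : ∃ y0 : ℕ, 3 ≤ y0 ∧ ∀ y : ℕ, y0 ≤ y → ∀ t : ℝ, |t| ≤ (y:ℝ)^K → ∀ σ : ℝ, 1 < σ →
    ‖LSeries (rc y) (sp σ t)‖ ≤ CB + 2 / (Real.log y * ‖ww σ t‖) := by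
  obtain ⟨y0, hy0, H⟩ := C2_0 K
  refine ⟨y0, hy0, fun y hy t ht σ hσ => ?_⟩
  have hl := (LSeries_lim (rc y) (sp σ t) (rc_summable y (hy0.trans hy) _ (by rwa [sp_re]))).norm
  refine le_of_tendsto hl (Filter.eventually_atTop.mpr ⟨y^320, fun N hN => ?_⟩)
  refine le_trans (le_of_eq ?_) (H y hy t ht σ hσ N hN)
  congr 1
  exact sum_congr rfl fun n hn => term_sp _ _ _ _ (mem_Ioc.mp hn).1

lemma Z1 (K : ℕ) : ∃ y0 : ℕ, 3 ≤ y0 ∧ ∀ y : ℕ, y0 ≤ y → ∀ t : ℝ, |t| ≤ (y:ℝ)^K → ∀ σ : ℝ, 1 < σ →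
    ‖LSeries (LSeries.logMul (rc y)) (sp σ t)‖ ≤ CB * Real.log y + 320 / ‖ww σ t‖ + 2 / (Real.log y * ‖ww σ t‖^2) := by
  obtain ⟨y0, hy0, H⟩ := C2_1 K
  refine ⟨y0, hy0, fun y hy t ht σ hσ => ?_⟩
  have hl := (LSeries_lim (LSeries.logMul (rc y)) (sp σ t) (LSeriesSummable_logMul_of_lt_re (rc_absc y (hy0.trans hy) _ (by rwa [sp_re])))).norm
  have hz : Filter.Tendsto (fun N : ℕ => CB * Real.log y + 320 / ‖ww σ t‖ + 2 / (Real.log y * ‖ww σ t‖^2) + (N:ℝ)^(1-σ) * Real.log N / ‖ww σ t‖) Filter.atTop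
      (nhds (CB * Real.log y + 320 / ‖ww σ t‖ + 2 / (Real.log y * ‖ww σ t‖^2))) := by
    have h1 : Filter.Tendsto (fun u : ℝ => u^(1-σ) * Real.log u) Filter.atTop (nhds 0) := by
      have := (isLittleO_log_rpow_atTop (by linarith : 0 < σ - 1)).tendsto_div_nhds_zero
      refine this.congr' ?_
      filter_upwards [Filter.eventually_gt_atTop 0] with u hu
      rw [show 1 - σ = -(σ-1) by ring, Real.rpow_neg hu.le, div_eq_inv_mul]
    have h2 := ((h1.comp (tendsto_natCast_atTop_atTop (R := ℝ))).div_const ‖ww σ t‖).const_add (CB * Real.log y + 320 / ‖ww σ t‖ + 2 / (Real.log y * ‖ww σ t‖^2))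
    simpa using h2
  refine le_of_tendsto_of_tendsto hl hz (Filter.eventually_atTop.mpr ⟨y^320, fun N hN => ?_⟩)
  refine le_trans (le_of_eq ?_) (H y hy t ht σ hσ N hN)
  refine congrArg norm (sum_congr rfl fun n hn => ?_)
  rw [term_sp _ _ _ _ (mem_Ioc.mp hn).1]
  unfold LSeries.logMul rc
  rw [← Complex.natCast_log]; push_cast; ring

lemma ww_norm1 (σ t : ℝ) : |t| ≤ ‖ww σ t‖ := by
  have := Complex.abs_im_le_norm (ww σ t)
  simpa [ww] using this

lemma ww_norm0 (σ t : ℝ) (h : 1 < σ) : σ - 1 ≤ ‖ww σ t‖ := by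
  have := Complex.abs_re_le_norm (ww σ t)
  have e : (ww σ t).re = 1 - σ := by simp [ww]
  rw [e, abs_of_neg (by linarith)] at this
  linarith

noncomputable def CD : ℝ := CB + 322
lemma CD_ge : 1 ≤ CD := by unfold CD; linarith [CB_ge]

lemma Zup (K : ℕ) : ∃ y0 : ℕ, 3 ≤ y0 ∧ ∀ y : ℕ, y0 ≤ y → ∀ t : ℝ, |t| ≤ (y:ℝ)^K → ∀ σ : ℝ, 1 < σ → 1 / Real.log y ≤ |t| →
    ‖LSeries (rc y) (sp σ t)‖ ≤ CD ∧ ‖LSeries (LSeries.logMul (rc y)) (sp σ t)‖ ≤ CD * Real.log y := by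
  obtain ⟨y0, hy0, H⟩ := Z0 K
  obtain ⟨y1, hy1, H1⟩ := Z1 K
  refine ⟨max y0 y1, hy0.trans (le_max_left _ _), fun y hy t ht σ hσ htl => ?_⟩
  have a := H y ((le_max_left _ _).trans hy) t ht σ hσ
  have b := H1 y ((le_max_right _ _).trans hy) t ht σ hσ
  have hL := logy_ge y (hy0.trans ((le_max_left _ _).trans hy))
  have hw : 1 / Real.log y ≤ ‖ww σ t‖ := htl.trans (ww_norm1 σ t)
  have hw0 : 0 < ‖ww σ t‖ := norm_pos_iff.mpr (ww_ne σ t hσ)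
  rw [div_le_iff₀ (by linarith)] at hw
  generalize ‖ww σ t‖ = W at *
  generalize Real.log y = L at *
  have hL0 : 0 < L := by linarith
  have c1 : 2 / (L * W) ≤ 2 := by rw [div_le_iff₀ (by positivity)]; nlinarith
  have c2 : 320 / W ≤ 320 * L := by rw [div_le_iff₀ hw0]; nlinarith
  have c3 : 2 / (L * W^2) ≤ 2 * L := by
    rw [div_le_iff₀ (by positivity)]
    nlinarith [mul_le_mul hw hw zero_le_one (by positivity)]
  constructor
  · unfold CD; linarith
  · unfold CD; nlinarith

lemma C3 : ∃ C : ℝ, 0 < C ∧ ∀ K : ℕ, ∃ y0 : ℕ, 3 ≤ y0 ∧ ∀ y : ℕ, y0 ≤ y → ∀ t : ℝ, |t| ≤ (y:ℝ)^K → 1 / Real.log y ≤ |t| → ∀ σ : ℝ, 1 < σ →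
    ‖LSeries (fun n => (ro y n : ℂ) * (ArithmeticFunction.vonMangoldt n : ℂ)) (sp σ t)‖ ≤ C * Real.log y := by
  have hD1 := CD_ge
  have hD0 : 0 < CD := by linarith
  refine ⟨16 * CD^8, by positivity, fun K => ?_⟩
  obtain ⟨y0, hy0, H⟩ := Zup (K+1)
  obtain ⟨y1, hy1, H1⟩ := Z0 0
  refine ⟨max y0 y1, hy0.trans (le_max_left _ _), fun y hy t ht htl σ hσ => ?_⟩
  have hyy0 := (le_max_left _ _).trans hy
  have hyy1 := (le_max_right _ _).trans hy
  have hy3 : 3 ≤ y := hy0.trans hyy0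
  have hy3R : (3:ℝ) ≤ y := by exact_mod_cast hy3
  have hL := logy_ge y hy3
  have hL0 : 0 < Real.log y := by linarith
  have ht1 : |t| ≤ (y:ℝ)^(K+1) := ht.trans (pow_le_pow_right₀ (by linarith) (by omega))
  have ht2 : |2*t| ≤ (y:ℝ)^(K+1) := by
    rw [abs_mul, abs_two, pow_succ]
    nlinarith [abs_nonneg t]
  have htl2 : 1 / Real.log y ≤ |2*t| := by
    rw [abs_mul, abs_two]; linarith [abs_nonneg t]
  set b : ℝ := 1 / (2 * CD^2) with hb
  have hb0 : 0 < b := by positivity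
  have hb1 : b ≤ 1 := by
    rw [hb, div_le_one (by positivity)]; nlinarith
  have hbD : b * CD^2 = 1/2 := by rw [hb]; field_simp
  -- lower bound from 3-4-1
  have low : ∀ σ : ℝ, 1 + b^4 / Real.log y ≤ σ → b^3 / CD ≤ ‖LSeries (rc y) (sp σ t)‖ := by
    intro σ hs
    have hq : 0 < b^4 / Real.log y := by positivity
    have hs1 : 1 < σ := by linarith
    have h341 := DirichletCharacter.norm_LSeries_product_ge_one (1 : DirichletCharacter ℂ (y.factorial)) (x := σ - 1) (by linarith) t
    rw [one_pow, rc_eq y hy3, show (1:ℂ) + ((σ-1:ℝ):ℂ) + Complex.I * t = sp σ t by simp [sp]; ring,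
      show (1:ℂ) + ((σ-1:ℝ):ℂ) + 2 * Complex.I * t = sp σ (2*t) by simp [sp]; ring,
      show (1:ℂ) + ((σ-1:ℝ):ℂ) = sp σ 0 by simp [sp], norm_mul, norm_mul, norm_pow, norm_pow] at h341
    have z2 := (H y hyy0 (2*t) ht2 σ hs1 htl2).1
    have z0 := H1 y hyy1 0 (by simp) σ hs1
    have z0' : ‖LSeries (rc y) (sp σ 0)‖ ≤ CD / b^4 := by
      refine z0.trans ?_
      have w0 : b^4 / Real.log y ≤ ‖ww σ 0‖ := by linarith [ww_norm0 σ 0 hs1]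
      rw [div_le_iff₀ hL0] at w0
      have p : 0 < b^4 := by positivity
      have p1 : b^4 ≤ 1 := pow_le_one₀ hb0.le hb1
      have c1 : 2 / (Real.log y * ‖ww σ 0‖) ≤ 2 / b^4 := by
        apply div_le_div_of_nonneg_left (by norm_num) p; linarith
      have c2 : CB ≤ CB / b^4 := by rw [le_div_iff₀ p]; nlinarith [CB_ge]
      have c3 : (CB + 2) / b^4 ≤ CD / b^4 := by
        apply div_le_div_of_nonneg_right _ p.le; unfold CD; linarith
      rw [add_div] at c3; linarith
    by_contra hcon
    push Not at hcon
    have n0 := norm_nonneg (LSeries (rc y) (sp σ t))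
    have m1 : ‖LSeries (rc y) (sp σ 0)‖^3 ≤ (CD/b^4)^3 := pow_le_pow_left₀ (norm_nonneg _) z0' 3
    have m2 : ‖LSeries (rc y) (sp σ t)‖^4 < (b^3/CD)^4 := pow_lt_pow_left₀ hcon n0 (by norm_num)
    have m3 : ‖LSeries (rc y) (sp σ 0)‖^3 * ‖LSeries (rc y) (sp σ t)‖^4 * ‖LSeries (rc y) (sp σ (2*t))‖ ≤ (CD/b^4)^3 * ‖LSeries (rc y) (sp σ t)‖^4 * CD := by
      refine mul_le_mul (mul_le_mul_of_nonneg_right m1 (by positivity)) z2 (norm_nonneg _) (by positivity)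
    have m4 : (CD/b^4)^3 * ‖LSeries (rc y) (sp σ t)‖^4 * CD < (CD/b^4)^3 * (b^3/CD)^4 * CD := by
      have : 0 < (CD/b^4)^3 := by positivity
      exact mul_lt_mul_of_pos_right (mul_lt_mul_of_pos_left m2 this) hD0
    have m5 : (CD/b^4)^3 * (b^3/CD)^4 * CD = 1 := by field_simp
    linarith
  have low2 : b^3 / (2 * CD) ≤ ‖LSeries (rc y) (sp σ t)‖ := by
    rcases le_total (1 + b^4 / Real.log y) σ with h | h
    · refine le_trans ?_ (low σ h)
      apply div_le_div_of_nonneg_left (by positivity) hD0; linarith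
    · set σ0 := 1 + b^4 / Real.log y with hσ0
      have l0 := low σ0 le_rfl
      let S : Set ℂ := {z | 1 < z.re} ∩ {z | z.im = t}
      have hS : Convex ℝ S := (convex_halfSpace_re_gt 1).inter (convex_hyperplane (f := Complex.imLm) (LinearMap.isLinear _) t)
      have hder : ∀ z ∈ S, HasDerivWithinAt (LSeries (rc y)) (-LSeries (LSeries.logMul (rc y)) z) S z := fun z hz =>
        (LSeries_hasDerivAt (rc_absc y hy3 z hz.1)).hasDerivWithinAt
      have hbd : ∀ z ∈ S, ‖-LSeries (LSeries.logMul (rc y)) z‖ ≤ CD * Real.log y := by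
        intro z hz
        have e : z = sp z.re t := by
          have := hz.2
          apply Complex.ext <;> simp [sp]
          exact this
        rw [norm_neg, e]
        exact (H y hyy0 t ht1 z.re hz.1 htl).2
      have hmv := hS.norm_image_sub_le_of_norm_hasDerivWithin_le hder hbd
        (x := sp σ t) (y := sp σ0 t) ⟨by simp [sp_re, hσ], by simp [sp_im]⟩ ⟨by simp [sp_re]; linarith, by simp [sp_im]⟩
      have e2 : ‖sp σ0 t - sp σ t‖ ≤ b^4 / Real.log y := by
        have : sp σ0 t - sp σ t = ((σ0 - σ : ℝ):ℂ) := by simp [sp]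
        rw [this, Complex.norm_real, Real.norm_of_nonneg (by linarith)]; linarith
      have e3 : CD * Real.log y * ‖sp σ0 t - sp σ t‖ ≤ CD * b^4 := by
        calc _ ≤ CD * Real.log y * (b^4 / Real.log y) := mul_le_mul_of_nonneg_left e2 (by positivity)
          _ = _ := by field_simp
      have e4 := norm_sub_norm_le (LSeries (rc y) (sp σ0 t)) (LSeries (rc y) (sp σ t))
      have e5 : CD * b^4 = b^3 / (2*CD) := by
        have : CD * b^4 = b^3 * (b * CD^2) / CD := by field_simp
        rw [this, hbD]; field_simp
      have e6 : b^3 / CD = b^3 / (2*CD) + b^3/(2*CD) := by field_simp; norm_num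
      linarith
  have hP := DirichletCharacter.LSeries_twist_vonMangoldt_eq (1 : DirichletCharacter ℂ (y.factorial)) (s := sp σ t) (by rwa [sp_re])
  rw [rc_eq y hy3, LSeries_deriv (rc_absc y hy3 _ (by rwa [sp_re])), neg_neg] at hP
  have e : (rc y * fun n => ((ArithmeticFunction.vonMangoldt n : ℝ) : ℂ)) = fun n => (ro y n : ℂ) * (ArithmeticFunction.vonMangoldt n : ℂ) := rfl
  rw [e] at hP
  rw [hP, norm_div]
  have up := (H y hyy0 t ht1 σ hσ htl).2
  have lp : 0 < b^3 / (2*CD) := by positivity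
  calc _ ≤ CD * Real.log y / (b^3 / (2*CD)) := div_le_div₀ (by positivity) up lp low2
    _ = _ := by rw [hb]; field_simp; ring

end TP

namespace TP
open Finset
open scoped FourierTransform

noncomputable def tri (v : ℝ) : ℝ := max 0 (1 - |v|)

lemma tri_nonneg (v : ℝ) : 0 ≤ tri v := le_max_left _ _
lemma tri_le_one (v : ℝ) : tri v ≤ 1 := max_le zero_le_one (by linarith [abs_nonneg v])
lemma tri_cont : Continuous tri := by unfold tri; fun_prop
lemma tri_zero {v : ℝ} (h : 1 ≤ |v|) : tri v = 0 := by unfold tri; exact max_eq_left (by linarith)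
lemma tri_of_le {v : ℝ} (h : |v| ≤ 1) : tri v = 1 - |v| := by unfold tri; exact max_eq_right (by linarith)
lemma tri_lip (u v : ℝ) : |tri u - tri v| ≤ |u - v| := by
  unfold tri
  rw [max_comm 0, max_comm 0]
  refine (abs_max_sub_max_le_abs _ _ _).trans ?_
  rw [show (1 - |u|) - (1 - |v|) = |v| - |u| by ring, abs_sub_comm u v]
  exact abs_abs_sub_abs_le _ _

noncomputable def kn (τ t : ℝ) : ℝ := (Real.sinc (t/(2*τ)))^2

lemma kn_nonneg (τ t : ℝ) : 0 ≤ kn τ t := sq_nonneg _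
lemma kn_le_one (τ t : ℝ) : kn τ t ≤ 1 := by
  unfold kn
  rw [← sq_abs]
  exact pow_le_one₀ (abs_nonneg _) (Real.abs_sinc_le_one _)
lemma kn_cont (τ : ℝ) : Continuous (kn τ) := by
  unfold kn
  exact (Real.continuous_sinc.comp (by fun_prop)).pow 2

lemma sinc_mul (x : ℝ) : Real.sinc x * x = Real.sin x := by
  rcases eq_or_ne x 0 with rfl | h
  · simp
  · rw [Real.sinc_of_ne_zero h]; field_simp

lemma kn_le (τ t : ℝ) (hτ : 0 < τ) (ht : t ≠ 0) : kn τ t ≤ 4 * τ^2 / t^2 := by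
  rw [le_div_iff₀ (by positivity)]
  unfold kn
  have h := sinc_mul (t/(2*τ))
  have h2 : (Real.sinc (t/(2*τ)))^2 * t^2 = 4 * τ^2 * (Real.sinc (t/(2*τ)) * (t/(2*τ)))^2 := by field_simp; ring
  rw [h2, h]
  have := Real.sin_sq_le_one (t/(2*τ))
  nlinarith [sq_nonneg τ]

lemma one_sub_kn (τ t : ℝ) (hτ : 1 ≤ τ) (ht : |t| ≤ 1) : 1 - kn τ t ≤ t^2 := by
  rcases eq_or_ne t 0 with rfl | h0
  · simp [kn]
  have key : ∀ x : ℝ, 0 < x → x ≤ 1 → 1 - x^2/2 ≤ (Real.sinc x)^2 := by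
    intro x hx hx1
    have := Real.sin_gt_sub_cube hx
    have h2 : 1 - x^2/4 ≤ Real.sinc x := by
      rw [Real.sinc_of_ne_zero hx.ne', le_div_iff₀ hx]; nlinarith [pow_pos hx 3]
    nlinarith [sq_nonneg (x^2), sq_nonneg x]
  have e : kn τ t = kn τ |t| := by
    rcases abs_choice t with h | h
    · rw [h]
    · rw [h]; unfold kn; rw [neg_div, Real.sinc_neg]
  have ht0 : 0 < |t| := abs_pos.mpr h0
  have hx : |t|/(2*τ) ≤ |t| := by rw [div_le_iff₀ (by linarith)]; nlinarith
  have := key (|t|/(2*τ)) (by positivity) (by linarith)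
  rw [e]
  unfold kn
  have h3 : (|t|/(2*τ))^2 ≤ |t|^2 := pow_le_pow_left₀ (by positivity) hx 2
  rw [sq_abs] at h3
  nlinarith [sq_nonneg t]

lemma sinc_sq_int : MeasureTheory.Integrable (fun x : ℝ => (Real.sinc x)^2) := by
  refine (integrable_inv_one_add_sq.const_mul 2).mono' ((Real.continuous_sinc.pow 2).aestronglyMeasurable) (Filter.Eventually.of_forall fun x => ?_)
  rw [Real.norm_of_nonneg (sq_nonneg _), ← div_eq_mul_inv, le_div_iff₀ (by positivity)]
  have h := sinc_mul x
  have h1 : (Real.sinc x)^2 * (1 + x^2) = (Real.sinc x)^2 + (Real.sinc x * x)^2 := by ring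
  rw [h1, h]
  have h2 : (Real.sinc x)^2 ≤ 1 := by rw [← sq_abs]; exact pow_le_one₀ (abs_nonneg _) (Real.abs_sinc_le_one _)
  linarith [Real.sin_sq_le_one x]

lemma kn_int (τ : ℝ) (hτ : 0 < τ) : MeasureTheory.Integrable (kn τ) := by
  have := sinc_sq_int.comp_mul_left' (R := (2*τ)⁻¹) (by positivity)
  refine this.congr (Filter.Eventually.of_forall fun t => ?_)
  simp only [kn]; rw [div_eq_inv_mul]

lemma fourier_tri (ξ : ℝ) : 𝓕 (fun v : ℝ => (tri v : ℂ)) ξ = ((Real.sinc (Real.pi * ξ))^2 : ℝ) := by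
  rw [Real.fourier_real_eq_integral_exp_smul]
  set c : ℂ := ((-2 * Real.pi * ξ : ℝ) : ℂ) * Complex.I with hc
  have e0 : (fun v : ℝ => Complex.exp (((-2 * Real.pi * v * ξ : ℝ) : ℂ) * Complex.I) • (tri v : ℂ)) = fun v : ℝ => Complex.exp (c * v) * (tri v : ℂ) := by
    funext v
    rw [smul_eq_mul, hc]; congr 2; push_cast; ring
  rw [e0]
  have hcont : Continuous (fun v : ℝ => Complex.exp (c * v) * (tri v : ℂ)) := by
    have := tri_cont
    fun_prop
  have hsupp : Function.support (fun v : ℝ => Complex.exp (c * v) * (tri v : ℂ)) ⊆ Set.Ioc (-1) 1 := by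
    intro v hv
    by_contra hn
    apply hv
    have : 1 ≤ |v| := by
      by_contra h
      push Not at h
      have := abs_lt.mp h
      exact hn ⟨this.1, this.2.le⟩
    simp [tri_zero this]
  rw [← intervalIntegral.integral_eq_integral_of_support_subset hsupp,
    ← intervalIntegral.integral_add_adjacent_intervals (b := 0) (hcont.intervalIntegrable _ _) (hcont.intervalIntegrable _ _)]
  have i1 : ∫ v in (-1:ℝ)..0, Complex.exp (c * v) * (tri v : ℂ) = ∫ v in (-1:ℝ)..0, Complex.exp (c * v) * (1 + (v:ℂ)) := by
    apply intervalIntegral.integral_congr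
    intro v hv
    rw [Set.uIcc_of_le (by norm_num)] at hv
    beta_reduce
    rw [tri_of_le (by rw [abs_of_nonpos hv.2]; linarith [hv.1]), abs_of_nonpos hv.2]; push_cast; ring
  have i2 : ∫ v in (0:ℝ)..1, Complex.exp (c * v) * (tri v : ℂ) = ∫ v in (0:ℝ)..1, Complex.exp (c * v) * (1 - (v:ℂ)) := by
    apply intervalIntegral.integral_congr
    intro v hv
    rw [Set.uIcc_of_le (by norm_num)] at hv
    beta_reduce
    rw [tri_of_le (by rw [abs_of_nonneg hv.1]; linarith [hv.2]), abs_of_nonneg hv.1]; push_cast; ring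
  rw [i1, i2]
  rcases eq_or_ne ξ 0 with h0 | h0
  · have c0 : c = 0 := by rw [hc, h0]; simp
    rw [c0, h0]
    simp only [zero_mul, Complex.exp_zero, one_mul, mul_zero, Real.sinc_zero]
    rw [intervalIntegral.integral_eq_sub_of_hasDerivAt (f := fun v : ℝ => (v:ℂ) + (v:ℂ)^2/2) (f' := fun v : ℝ => 1 + (v:ℂ)) ?_ (Continuous.intervalIntegrable (by fun_prop) _ _),
      intervalIntegral.integral_eq_sub_of_hasDerivAt (f := fun v : ℝ => (v:ℂ) - (v:ℂ)^2/2) (f' := fun v : ℝ => 1 - (v:ℂ)) ?_ (Continuous.intervalIntegrable (by fun_prop) _ _)]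
    · norm_num
    · intro v _
      have h1 : HasDerivAt (fun v : ℝ => (v:ℂ)) 1 v := (hasDerivAt_id v).ofReal_comp
      refine (h1.sub ((h1.pow 2).div_const 2)).congr_deriv ?_
      simp
    · intro v _
      have h1 : HasDerivAt (fun v : ℝ => (v:ℂ)) 1 v := (hasDerivAt_id v).ofReal_comp
      refine (h1.add ((h1.pow 2).div_const 2)).congr_deriv ?_
      simp
  · have hpi := Real.pi_pos
    have hc0 : c ≠ 0 := by
      rw [hc]; refine mul_ne_zero ?_ Complex.I_ne_zero
      exact_mod_cast mul_ne_zero (mul_ne_zero (by norm_num) hpi.ne') h0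
    rw [intervalIntegral.integral_eq_sub_of_hasDerivAt (f := fun v : ℝ => Complex.exp (c*v) * ((1 + (v:ℂ))/c - 1/c^2)) (f' := fun v : ℝ => Complex.exp (c*v) * (1 + (v:ℂ))) ?_ (Continuous.intervalIntegrable (by fun_prop) _ _),
      intervalIntegral.integral_eq_sub_of_hasDerivAt (f := fun v : ℝ => Complex.exp (c*v) * ((1 - (v:ℂ))/c + 1/c^2)) (f' := fun v : ℝ => Complex.exp (c*v) * (1 - (v:ℂ))) ?_ (Continuous.intervalIntegrable (by fun_prop) _ _)]
    · have hcos : Complex.exp c + Complex.exp (-c) = 2 * (Real.cos (2 * (Real.pi * ξ)) : ℂ) := by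
        rw [Complex.ofReal_cos, Complex.two_cos, hc, add_comm]; congr 2 <;> push_cast <;> ring
      have hc2 : c^2 = -((2 * (Real.pi * ξ))^2 : ℝ) := by
        rw [hc, mul_pow, Complex.I_sq]; push_cast; ring
      have hs : (Real.sinc (Real.pi * ξ))^2 = (2 - 2 * Real.cos (2 * (Real.pi * ξ))) / (2 * (Real.pi * ξ))^2 := by
        rw [Real.sinc_of_ne_zero (mul_ne_zero hpi.ne' h0), Real.cos_two_mul, Real.cos_sq']
        field_simp; ring
      have hgoal : (Complex.exp c + Complex.exp (-c) - 2) / c^2 = (((Real.sinc (Real.pi * ξ))^2 : ℝ) : ℂ) := by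
        rw [hcos, hc2, hs]; push_cast
        rw [div_neg, ← neg_div]; congr 1; ring
      rw [← hgoal]
      simp only [Complex.ofReal_neg, Complex.ofReal_one, Complex.ofReal_zero, mul_zero, Complex.exp_zero, mul_one, mul_neg]
      field_simp
      ring
    · intro v _
      have h1 : HasDerivAt (fun v : ℝ => (v:ℂ)) 1 v := (hasDerivAt_id v).ofReal_comp
      refine (((h1.const_mul c).cexp).mul (((h1.const_sub 1).div_const c).add_const (1/c^2))).congr_deriv ?_
      field_simp; ring
    · intro v _
      have h1 : HasDerivAt (fun v : ℝ => (v:ℂ)) 1 v := (hasDerivAt_id v).ofReal_comp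
      refine (((h1.const_mul c).cexp).mul (((h1.const_add 1).div_const c).sub_const (1/c^2))).congr_deriv ?_
      field_simp; ring

lemma tri_int : MeasureTheory.Integrable (fun v : ℝ => (tri v : ℂ)) := by
  apply Continuous.integrable_of_hasCompactSupport (Complex.continuous_ofReal.comp tri_cont)
  refine HasCompactSupport.of_support_subset_isCompact (isCompact_Icc (a := (-1:ℝ)) (b := 1)) ?_
  intro v hv
  by_contra hn
  apply hv
  have : 1 ≤ |v| := by
    by_contra h
    push Not at h
    have := abs_lt.mp h
    exact hn ⟨this.1.le, this.2.le⟩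
  simp [tri_zero this]

/-- Fejer kernel inversion. -/
lemma kn_fourier (τ v : ℝ) (hτ : 0 < τ) : ∫ t : ℝ, (kn τ t : ℂ) * ee (t * v) = ((2 * Real.pi * (τ * tri (τ * v)) : ℝ) : ℂ) := by
  have hF : 𝓕 (fun v : ℝ => (tri v : ℂ)) = fun ξ => (((Real.sinc (Real.pi * ξ))^2 : ℝ) : ℂ) := funext fourier_tri
  have hFi : MeasureTheory.Integrable (𝓕 (fun v : ℝ => (tri v : ℂ))) := by
    rw [hF]
    exact (sinc_sq_int.comp_mul_left' Real.pi_pos.ne').ofReal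
  have h := congrFun (Continuous.fourierInv_fourier_eq (Complex.continuous_ofReal.comp tri_cont) tri_int hFi) (τ * v)
  change 𝓕⁻ (𝓕 (fun v : ℝ => (tri v : ℂ))) (τ * v) = (tri (τ * v) : ℂ) at h
  rw [hF, Real.fourierInv_eq'] at h
  have h2 := MeasureTheory.Measure.integral_comp_mul_left (fun t : ℝ => (kn τ t : ℂ) * ee (t * v)) (2 * Real.pi * τ)
  have hpi := Real.pi_pos
  have e : ∫ ξ : ℝ, (fun t : ℝ => (kn τ t : ℂ) * ee (t * v)) (2 * Real.pi * τ * ξ) = (tri (τ * v) : ℂ) := by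
    rw [← h]
    congr 1
    funext ξ
    unfold kn ee
    simp only [smul_eq_mul]
    rw [mul_comm, show 2 * Real.pi * τ * ξ / (2 * τ) = Real.pi * ξ by field_simp]
    congr 3
    simp
    ring
  rw [e, abs_of_pos (by positivity)] at h2
  rw [Complex.real_smul] at h2
  push_cast at h2 ⊢
  rw [h2]
  have : (Real.pi:ℂ) ≠ 0 := by exact_mod_cast hpi.ne'
  have : (τ:ℂ) ≠ 0 := by exact_mod_cast hτ.ne'
  field_simp
  simp only [mul_comm v]

end TP

namespace TP
open Finset

lemma abel_lip (c g : ℕ → ℝ) (a b : ℕ) (hab : a ≤ b) (B L : ℝ) (hc : ∀ n, a ≤ n → n ≤ b → |∑ m ∈ Ioc a n, c m| ≤ B)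
    (hg : ∀ n, a ≤ n → n < b → |g (n+1) - g n| ≤ L) : |∑ n ∈ Ioc a b, c n * g n - (∑ m ∈ Ioc a b, c m) * g b| ≤ B * L * ((b:ℝ) - a) := by
  induction b, hab using Nat.le_induction with
  | base => simp
  | succ b hb ih =>
    have h1 := ih (fun n h h' => hc n h (by omega)) (fun n h h' => hg n h (by omega))
    have hA := hc b hb (by omega)
    have hL := hg b hb (by omega)
    rw [sum_Ioc_succ_top hb, sum_Ioc_succ_top hb, add_comm _ (c (b+1) * g (b+1)), add_comm _ (c (b+1))]
    have e : c (b+1) * g (b+1) + ∑ n ∈ Ioc a b, c n * g n - (c (b+1) + ∑ m ∈ Ioc a b, c m) * g (b+1)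
        = (∑ n ∈ Ioc a b, c n * g n - (∑ m ∈ Ioc a b, c m) * g b) - (∑ m ∈ Ioc a b, c m) * (g (b+1) - g b) := by ring
    rw [e]
    refine (abs_sub _ _).trans ?_
    rw [abs_mul]
    have h2 : |∑ m ∈ Ioc a b, c m| * |g (b+1) - g b| ≤ B * L := mul_le_mul hA hL (abs_nonneg _) ((abs_nonneg _).trans hA)
    push_cast
    have : B * L * ((b:ℝ) + 1 - a) = B * L * ((b:ℝ) - a) + B * L := by ring
    linarith

lemma riem_lip (g : ℝ → ℝ) (a b : ℕ) (hab : a ≤ b) (L : ℝ) (hgc : ContinuousOn g (Set.Icc (a:ℝ) b))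
    (hg : ∀ u v : ℝ, (a:ℝ) ≤ u → u ≤ b → (a:ℝ) ≤ v → v ≤ b → |u - v| ≤ 1 → |g u - g v| ≤ L) :
    |∑ n ∈ Ioc a b, g n - ∫ u in (a:ℝ)..b, g u| ≤ L * ((b:ℝ) - a) := by
  induction b, hab using Nat.le_induction with
  | base => simp
  | succ b hb ih =>
    have hb' : (a:ℝ) ≤ b := by exact_mod_cast hb
    have hbb : ((b+1:ℕ):ℝ) = (b:ℝ) + 1 := by push_cast; ring
    rw [hbb] at hgc hg ⊢
    have h1 := ih (hgc.mono (Set.Icc_subset_Icc le_rfl (by linarith))) (fun u v h1 h2 h3 h4 => hg u v h1 (by linarith) h3 (by linarith))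
    rw [sum_Ioc_succ_top hb, add_comm _ (g ((b+1:ℕ):ℝ))]
    have i1 : IntervalIntegrable g MeasureTheory.volume a b := (hgc.mono (by rw [Set.uIcc_of_le hb']; exact Set.Icc_subset_Icc le_rfl (by linarith))).intervalIntegrable
    have i2 : IntervalIntegrable g MeasureTheory.volume b ((b:ℝ)+1) := (hgc.mono (by rw [Set.uIcc_of_le (by linarith)]; exact Set.Icc_subset_Icc hb' le_rfl)).intervalIntegrable
    rw [← intervalIntegral.integral_add_adjacent_intervals i1 i2]
    have h2 : |g ((b:ℝ)+1) - ∫ u in (b:ℝ)..((b:ℝ)+1), g u| ≤ L := by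
      have e : g ((b:ℝ)+1) - ∫ u in (b:ℝ)..((b:ℝ)+1), g u = ∫ u in (b:ℝ)..((b:ℝ)+1), (g ((b:ℝ)+1) - g u) := by
        rw [intervalIntegral.integral_sub (by simp) i2]; simp
      rw [e, ← Real.norm_eq_abs]
      refine (intervalIntegral.norm_integral_le_of_norm_le_const (C := L) ?_).trans (by simp)
      intro u hu
      rw [Set.uIoc_of_le (by linarith)] at hu
      exact hg _ _ (by linarith) le_rfl (by linarith [hu.1]) hu.2 (by rw [abs_le]; constructor <;> linarith [hu.1, hu.2])
    have e : g ((b+1:ℕ):ℝ) + ∑ n ∈ Ioc a b, g n - ((∫ u in (a:ℝ)..b, g u) + ∫ u in (b:ℝ)..((b:ℝ)+1), g u)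
       = (∑ n ∈ Ioc a b, g n - ∫ u in (a:ℝ)..b, g u) + (g ((b:ℝ)+1) - ∫ u in (b:ℝ)..((b:ℝ)+1), g u) := by rw [hbb]; ring
    refine (le_of_eq (congrArg abs e)).trans ((abs_add_le _ _).trans ?_)
    nlinarith

lemma tri_integral (a b : ℝ) (ha : a ≤ -1) (hb : 1 ≤ b) : ∫ v in a..b, tri v = 1 := by
  have hi : ∀ p q : ℝ, IntervalIntegrable tri MeasureTheory.volume p q := fun p q => tri_cont.intervalIntegrable _ _
  have z1 : ∫ v in a..(-1), tri v = 0 := by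
    rw [intervalIntegral.integral_congr (g := fun _ => (0:ℝ))]; · simp
    intro v hv
    rw [Set.uIcc_of_le ha] at hv
    exact tri_zero (by rw [abs_of_nonpos (by linarith [hv.2])]; linarith [hv.2])
  have z2 : ∫ v in (1:ℝ)..b, tri v = 0 := by
    rw [intervalIntegral.integral_congr (g := fun _ => (0:ℝ))]; · simp
    intro v hv
    rw [Set.uIcc_of_le hb] at hv
    exact tri_zero (by rw [abs_of_nonneg (by linarith [hv.1])]; linarith [hv.1])
  have z3 : ∫ v in (-1:ℝ)..0, tri v = 1/2 := by
    rw [intervalIntegral.integral_congr (g := fun v => 1 + v)]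
    · rw [intervalIntegral.integral_add (by simp) (by simp)]; simp; norm_num
    intro v hv
    rw [Set.uIcc_of_le (by norm_num)] at hv
    beta_reduce
    rw [tri_of_le (by rw [abs_of_nonpos hv.2]; linarith [hv.1]), abs_of_nonpos hv.2]; ring
  have z4 : ∫ v in (0:ℝ)..1, tri v = 1/2 := by
    rw [intervalIntegral.integral_congr (g := fun v => 1 - v)]
    · rw [intervalIntegral.integral_sub (by simp) (by simp)]; simp; norm_num
    intro v hv
    rw [Set.uIcc_of_le (by norm_num)] at hv
    beta_reduce
    rw [tri_of_le (by rw [abs_of_nonneg hv.1]; linarith [hv.2]), abs_of_nonneg hv.1]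
  rw [← intervalIntegral.integral_add_adjacent_intervals (hi a (-1)) (hi _ b), ← intervalIntegral.integral_add_adjacent_intervals (hi (-1) 0) (hi _ b),
    ← intervalIntegral.integral_add_adjacent_intervals (hi 0 1) (hi _ b), z1, z2, z3, z4]; norm_num

/-- the smooth weight -/
noncomputable def gg (w τ u : ℝ) : ℝ := u⁻¹ * (τ * tri (τ * Real.log (u / w)))

lemma gg_nonneg (w τ u : ℝ) (hτ : 0 ≤ τ) (hu : 0 ≤ u) : 0 ≤ gg w τ u := by
  unfold gg; have := tri_nonneg (τ * Real.log (u/w)); positivity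

lemma gg_zero_low (w τ u : ℝ) (hw : 0 < w) (hτ : 0 < τ) (hu : 0 < u) (h : u ≤ w * Real.exp (-(1/τ))) : gg w τ u = 0 := by
  unfold gg
  have : Real.log (u/w) ≤ -(1/τ) := by
    rw [Real.log_le_iff_le_exp (by positivity), div_le_iff₀ hw]; linarith
  have h2 : τ * Real.log (u/w) ≤ -1 := by
    have := mul_le_mul_of_nonneg_left this hτ.le
    rwa [mul_neg, mul_one_div_cancel hτ.ne'] at this
  rw [tri_zero (by rw [abs_of_nonpos (by linarith)]; linarith)]; simp

lemma gg_zero_high (w τ u : ℝ) (hw : 0 < w) (hτ : 0 < τ) (hu : 0 < u) (h : w * Real.exp (1/τ) ≤ u) : gg w τ u = 0 := by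
  unfold gg
  have : 1/τ ≤ Real.log (u/w) := by
    rw [Real.le_log_iff_exp_le (by positivity), le_div_iff₀ hw]; linarith
  have h2 : 1 ≤ τ * Real.log (u/w) := by
    have := mul_le_mul_of_nonneg_left this hτ.le
    rwa [mul_one_div_cancel hτ.ne'] at this
  rw [tri_zero (by rw [abs_of_nonneg (by linarith)]; linarith)]; simp

lemma gg_lip (w τ c u v : ℝ) (hw : 0 < w) (hτ : 1 ≤ τ) (hc : 0 < c) (hu : c ≤ u) (hv : c ≤ v) : |gg w τ u - gg w τ v| ≤ 2 * τ^2 / c^2 * |u - v| := by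
  have hu0 : 0 < u := by linarith
  have hv0 : 0 < v := by linarith
  unfold gg
  have e : u⁻¹ * (τ * tri (τ * Real.log (u / w))) - v⁻¹ * (τ * tri (τ * Real.log (v / w))) =
    τ * ((u⁻¹ - v⁻¹) * tri (τ * Real.log (u / w)) + v⁻¹ * (tri (τ * Real.log (u / w)) - tri (τ * Real.log (v/w)))) := by ring
  rw [e, abs_mul, abs_of_pos (by linarith : 0 < τ)]
  have h1 : |u⁻¹ - v⁻¹| ≤ |u - v| / c^2 := by
    rw [inv_sub_inv hu0.ne' hv0.ne', abs_div, abs_sub_comm v u, abs_of_pos (mul_pos hu0 hv0)]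
    exact div_le_div_of_nonneg_left (abs_nonneg _) (by positivity) (by rw [sq]; exact mul_le_mul hu hv hc.le hu0.le)
  have h2 : |Real.log u - Real.log v| ≤ |u - v| / c := by
    have key : ∀ p q : ℝ, c ≤ p → p ≤ q → Real.log q - Real.log p ≤ (q - p)/c := by
      intro p q hp hpq
      have hp0 : 0 < p := by linarith
      rw [← Real.log_div (by linarith) hp0.ne']
      refine (Real.log_le_sub_one_of_pos (by apply div_pos <;> linarith)).trans ?_
      rw [div_sub_one hp0.ne']
      exact div_le_div_of_nonneg_left (by linarith) hc hp
    rcases le_total u v with h | h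
    · rw [abs_sub_comm, abs_sub_comm u v, abs_of_nonneg (by linarith : 0 ≤ v - u), abs_of_nonneg (by linarith [Real.log_le_log hu0 h])]
      exact key _ _ hu h
    · rw [abs_of_nonneg (by linarith : 0 ≤ u - v), abs_of_nonneg (by linarith [Real.log_le_log hv0 h])]
      exact key _ _ hv h
  have h3 : |tri (τ * Real.log (u / w)) - tri (τ * Real.log (v/w))| ≤ τ * (|u - v| / c) := by
    refine (tri_lip _ _).trans ?_
    rw [← mul_sub, abs_mul, abs_of_pos (by linarith : 0 < τ), Real.log_div hu0.ne' hw.ne', Real.log_div hv0.ne' hw.ne']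
    refine mul_le_mul_of_nonneg_left ?_ (by linarith)
    rwa [sub_sub_sub_cancel_right]
  have h4 : |(u⁻¹ - v⁻¹) * tri (τ * Real.log (u / w)) + v⁻¹ * (tri (τ * Real.log (u / w)) - tri (τ * Real.log (v/w)))|
     ≤ |u - v| / c^2 + c⁻¹ * (τ * (|u - v| / c)) := by
    refine (abs_add_le _ _).trans (add_le_add ?_ ?_)
    · rw [abs_mul, abs_of_nonneg (tri_nonneg _)]
      exact (mul_le_of_le_one_right (abs_nonneg _) (tri_le_one _)).trans h1
    · rw [abs_mul, abs_of_pos (inv_pos.mpr hv0)]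
      exact mul_le_mul (inv_anti₀ hc hv) h3 (abs_nonneg _) (inv_pos.mpr hc).le
  refine (mul_le_mul_of_nonneg_left h4 (by linarith)).trans ?_
  have h5 : 0 ≤ |u-v|/c^2 := by positivity
  have e2 : τ * (|u - v| / c^2 + c⁻¹ * (τ * (|u - v| / c))) = (τ + τ^2) * (|u-v|/c^2) := by field_simp
  have e3 : 2 * τ^2 / c^2 * |u - v| = 2 * τ^2 * (|u-v|/c^2) := by ring
  rw [e2, e3]
  exact mul_le_mul_of_nonneg_right (by nlinarith) h5

lemma gg_integral (w τ d a b : ℝ) (hw : 0 < w) (hτ : 0 < τ) (hd : 0 < d) (ha : 0 < a) (hab : a ≤ b) (h1 : d * a ≤ w * Real.exp (-(1/τ)))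
    (h2 : w * Real.exp (1/τ) ≤ d * b) : ∫ u in a..b, gg w τ (d*u) = 1 / d := by
  have hb : 0 < b := by linarith
  have hder : ∀ u ∈ Set.uIcc a b, HasDerivAt (fun u => (1/d) * ∫ v in (0:ℝ)..(τ * Real.log (d*u/w)), tri v) (gg w τ (d*u)) u := by
    intro u hu
    rw [Set.uIcc_of_le hab] at hu
    have hu0 : 0 < u := by linarith [hu.1]
    have i1 : HasDerivAt (fun u => τ * Real.log (d*u/w)) (τ * (1/u)) u := by
      have := (((hasDerivAt_id u).const_mul d).div_const w).log (by simp; exact ⟨⟨hd.ne', hu0.ne'⟩, hw.ne'⟩)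
      refine (this.const_mul τ).congr_deriv ?_
      simp only [id]; field_simp
    have i2 : HasDerivAt (fun x => ∫ v in (0:ℝ)..x, tri v) (tri (τ * Real.log (d*u/w))) (τ * Real.log (d*u/w)) :=
      intervalIntegral.integral_hasDerivAt_right (tri_cont.intervalIntegrable _ _) (tri_cont.stronglyMeasurableAtFilter _ _) tri_cont.continuousAt
    refine ((i2.comp u i1).const_mul (1/d)).congr_deriv ?_
    unfold gg; field_simp
  rw [intervalIntegral.integral_eq_sub_of_hasDerivAt hder]
  · rw [← mul_sub, intervalIntegral.integral_interval_sub_left (tri_cont.intervalIntegrable _ _) (tri_cont.intervalIntegrable _ _), tri_integral, mul_one]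
    · have : Real.log (d*a/w) ≤ -(1/τ) := by
        rw [Real.log_le_iff_le_exp (by positivity), div_le_iff₀ hw]; linarith
      have := mul_le_mul_of_nonneg_left this hτ.le
      rwa [mul_neg, mul_one_div_cancel hτ.ne'] at this
    · have : 1/τ ≤ Real.log (d*b/w) := by
        rw [Real.le_log_iff_exp_le (by positivity), le_div_iff₀ hw]; linarith
      have := mul_le_mul_of_nonneg_left this hτ.le
      rwa [mul_one_div_cancel hτ.ne'] at this
  · apply ContinuousOn.intervalIntegrable
    rw [Set.uIcc_of_le hab]
    unfold gg
    have hne : ∀ u ∈ Set.Icc a b, d * u ≠ 0 := fun u hu => (mul_pos hd (by linarith [hu.1])).ne'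
    refine ContinuousOn.mul (ContinuousOn.inv₀ (by fun_prop) hne) (continuousOn_const.mul (tri_cont.comp_continuousOn (continuousOn_const.mul (ContinuousOn.log (by fun_prop) ?_))))
    intro u hu
    exact div_ne_zero (hne u hu) hw.ne'

lemma T1 (z k W : ℕ) (d : ℕ) (w τ : ℝ) (hz : 1 ≤ z) (hk : 18 ≤ k) (hd : 1 ≤ d) (hτ : 1 ≤ τ) (hw : 12 * τ * d ≤ w) (hW : 3 * w ≤ W) :
    |∑ r ∈ Ioc 0 W, ro z r * gg w τ ((d:ℝ) * r) - Vy z / d| ≤ 1536 * sk k * Vy z / d + 384 * ((z:ℝ)^(4*k+8) * τ / w) := by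
  have hd1 : (1:ℝ) ≤ d := by exact_mod_cast hd
  have hw0 : 0 < w := by nlinarith
  obtain ⟨w', hw'⟩ : ∃ w' : ℝ, w' = w / d := ⟨_, rfl⟩
  have ew : w = d * w' := by rw [hw']; field_simp
  have hw12 : 12 * τ ≤ w' := by rw [hw', le_div_iff₀ (by linarith)]; exact hw
  have hww : w' ≤ w := by rw [hw']; exact div_le_self hw0.le hd1
  have hτ0 : 0 < 1/τ := by positivity
  have hτ1 : 1/τ ≤ 1 := by rw [div_le_one (by linarith)]; exact hτ
  have E1 : 1 - 1/τ ≤ Real.exp (-(1/τ)) := by linarith [Real.add_one_le_exp (-(1/τ))]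
  have E2 : Real.exp (1/τ) ≤ 1 + 2 * (1/τ) := by
    have := convexOn_exp.2 (Set.mem_univ 0) (Set.mem_univ 1) (by linarith : 0 ≤ 1 - 1/τ) hτ0.le (by ring)
    simp only [smul_eq_mul, mul_zero, mul_one, zero_add, Real.exp_zero] at this
    nlinarith [Real.exp_one_lt_d9]
  have E3 : (1:ℝ)/3 ≤ Real.exp (-(1/τ)) := by
    have h1 : Real.exp (-1) ≤ Real.exp (-(1/τ)) := Real.exp_le_exp.mpr (by linarith)
    have h2 : (1:ℝ)/3 ≤ Real.exp (-1) := by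
      rw [Real.exp_neg, ← one_div]; exact one_div_le_one_div_of_le (Real.exp_pos _) (by linarith [Real.exp_one_lt_d9])
    linarith
  have E4 : Real.exp (1/τ) ≤ 2.72 := by
    have h1 : Real.exp (1/τ) ≤ Real.exp 1 := Real.exp_le_exp.mpr hτ1
    linarith [Real.exp_one_lt_d9]
  obtain ⟨a, ha⟩ : ∃ a : ℕ, a = ⌊w' * Real.exp (-(1/τ))⌋₊ := ⟨_, rfl⟩
  obtain ⟨b, hb⟩ : ∃ b : ℕ, b = ⌈w' * Real.exp (1/τ)⌉₊ := ⟨_, rfl⟩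
  have hw'0 : 0 < w' := by linarith
  have ha1 : (a:ℝ) ≤ w' * Real.exp (-(1/τ)) := by rw [ha]; exact Nat.floor_le (by positivity)
  have ha2 : w' * Real.exp (-(1/τ)) < a + 1 := by rw [ha]; exact Nat.lt_floor_add_one _
  have hb1 : w' * Real.exp (1/τ) ≤ b := by rw [hb]; exact Nat.le_ceil _
  have hb2 : (b:ℝ) < w' * Real.exp (1/τ) + 1 := by rw [hb]; exact Nat.ceil_lt_add_one (by positivity)
  have hac : w'/4 ≤ a := by nlinarith
  have hab' : (a:ℝ) ≤ b := by
    have : w' * Real.exp (-(1/τ)) ≤ w' * Real.exp (1/τ) := mul_le_mul_of_nonneg_left (Real.exp_le_exp.mpr (by linarith)) hw'0.le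
    linarith
  have hab : a ≤ b := by exact_mod_cast hab'
  have hbW : b ≤ W := by
    have : (b:ℝ) ≤ W := by nlinarith
    exact_mod_cast this
  have hlen : (b:ℝ) - a ≤ 4 * (w'/τ) := by
    have h1 : w' * Real.exp (1/τ) ≤ w' + 2 * (w'/τ) := by
      have := mul_le_mul_of_nonneg_left E2 hw'0.le
      have e : w' * (1 + 2 * (1/τ)) = w' + 2 * (w'/τ) := by ring
      linarith
    have h2 : w' - w'/τ ≤ w' * Real.exp (-(1/τ)) := by
      have := mul_le_mul_of_nonneg_left E1 hw'0.le
      have e : w' * (1 - 1/τ) = w' - w'/τ := by ring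
      linarith
    have h3 : 12 ≤ w'/τ := by rw [le_div_iff₀ (by linarith)]; exact hw12
    linarith
  have ha0 : (0:ℝ) < a := by linarith
  -- restrict the sum
  have hsum : ∀ f : ℕ → ℝ, ∑ r ∈ Ioc 0 W, f r * gg w τ ((d:ℝ) * r) = ∑ r ∈ Ioc a b, f r * gg w τ ((d:ℝ) * r) := by
    intro f
    symm
    refine sum_subset (Ioc_subset_Ioc (Nat.zero_le _) hbW) ?_
    intro r hr hr2
    rw [mem_Ioc] at hr
    have hr0 : (0:ℝ) < r := by exact_mod_cast hr.1
    by_cases h : r ≤ a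
    · have h' : (r:ℝ) ≤ a := by exact_mod_cast h
      rw [gg_zero_low w τ _ hw0 (by linarith) (by positivity), mul_zero]
      rw [ew, mul_assoc]; exact mul_le_mul_of_nonneg_left (by linarith) (by linarith)
    · have h2 : b < r := by by_contra h3; exact hr2 (mem_Ioc.mpr ⟨by omega, by omega⟩)
      have h' : (b:ℝ) ≤ r := by exact_mod_cast h2.le
      rw [gg_zero_high w τ _ hw0 (by linarith) (by positivity), mul_zero]
      rw [ew, mul_assoc]; exact mul_le_mul_of_nonneg_left (by linarith) (by linarith)
  rw [hsum]
  obtain ⟨L, hLdef⟩ : ∃ L : ℝ, L = 32 * τ^2 / (d * w'^2) := ⟨_, rfl⟩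
  have hL0 : 0 ≤ L := by rw [hLdef]; positivity
  have hlip : ∀ u v : ℝ, (a:ℝ) ≤ u → u ≤ b → (a:ℝ) ≤ v → v ≤ b → |u - v| ≤ 1 → |gg w τ (d*u) - gg w τ (d*v)| ≤ L := by
    intro u v hu _ hv _ huv
    refine (gg_lip w τ (d * (w'/4)) _ _ hw0 hτ (by positivity) (mul_le_mul_of_nonneg_left (by linarith) (by linarith)) (mul_le_mul_of_nonneg_left (by linarith) (by linarith))).trans ?_
    rw [← mul_sub, abs_mul, abs_of_pos (by linarith : (0:ℝ) < d)]
    have e : 2 * τ^2 / (d * (w'/4))^2 * (d * |u - v|) = L * |u-v| := by rw [hLdef]; field_simp; norm_num; ring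
    rw [e]
    exact mul_le_of_le_one_right hL0 huv
  have hLlen : L * ((b:ℝ) - a) ≤ 128 * (τ / w) := by
    refine (mul_le_mul_of_nonneg_left hlen hL0).trans (le_of_eq ?_)
    rw [hLdef, ew]; field_simp; norm_num
  have hgb : gg w τ ((d:ℝ) * b) = 0 := by
    refine gg_zero_high w τ _ hw0 (by linarith) (mul_pos (by linarith) (by linarith)) ?_
    rw [ew, mul_assoc]; exact mul_le_mul_of_nonneg_left (by linarith) (by linarith)
  have hV := Vy_pos z
  have hs := sk_pos k
  obtain ⟨B, hB⟩ : ∃ B : ℝ, B = 3 * sk k * Vy z * ((b:ℝ) - a) + 2 * (z:ℝ)^(4*k+8) := ⟨_, rfl⟩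
  have hz1 : (1:ℝ) ≤ z := by exact_mod_cast hz
  have hq : (1:ℝ) ≤ (z:ℝ)^(4*k+8) := one_le_pow₀ hz1
  have hB0 : 0 ≤ B := by rw [hB]; have : 0 ≤ (b:ℝ) - a := by linarith
                         positivity
  have ab := abel_lip (fun n => ro z n - Vy z) (fun n => gg w τ ((d:ℝ) * n)) a b hab B L (by
    intro n hn hnb
    have h1 := fl_count z k a n hz hk hn
    have hn' : (n:ℝ) ≤ b := by exact_mod_cast hnb
    rw [sum_sub_distrib]
    simp only [sum_const, Nat.card_Ioc, nsmul_eq_mul]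
    rw [Nat.cast_sub hn, mul_comm _ (Vy z)]
    refine h1.trans ?_
    rw [hB]
    have : 3 * sk k * Vy z * ((n:ℝ) - a) ≤ 3 * sk k * Vy z * ((b:ℝ) - a) := mul_le_mul_of_nonneg_left (by linarith) (by positivity)
    linarith) (by
    intro n hn hnb
    have hn' : (a:ℝ) ≤ n := by exact_mod_cast hn
    have hn2 : (n:ℝ) + 1 ≤ b := by exact_mod_cast hnb
    have := hlip ((n+1:ℕ):ℝ) n (by push_cast; linarith) (by push_cast; linarith) hn' (by linarith) (by push_cast; simp)
    exact this)
  rw [hgb, mul_zero, sub_zero] at ab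
  have hcont : ContinuousOn (fun u => gg w τ ((d:ℝ) * u)) (Set.Icc (a:ℝ) b) := by
    unfold gg
    have hne : ∀ u ∈ Set.Icc (a:ℝ) b, (d:ℝ) * u ≠ 0 := fun u hu => (mul_pos (by linarith) (by linarith [hu.1])).ne'
    refine ContinuousOn.mul (ContinuousOn.inv₀ (by fun_prop) hne) (continuousOn_const.mul (tri_cont.comp_continuousOn (continuousOn_const.mul (ContinuousOn.log (by fun_prop) ?_))))
    intro u hu
    exact div_ne_zero (hne u hu) hw0.ne'
  have rm := riem_lip (fun u => gg w τ ((d:ℝ) * u)) a b hab L hcont hlip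
  rw [gg_integral w τ d a b hw0 (by linarith) (by linarith) ha0 hab' (by rw [ew, mul_assoc]; exact mul_le_mul_of_nonneg_left ha1 (by linarith))
    (by rw [ew, mul_assoc]; exact mul_le_mul_of_nonneg_left hb1 (by linarith))] at rm
  have e : ∑ r ∈ Ioc a b, ro z r * gg w τ ((d:ℝ) * r) - Vy z / d =
     ∑ n ∈ Ioc a b, (ro z n - Vy z) * gg w τ ((d:ℝ) * n) + Vy z * (∑ n ∈ Ioc a b, gg w τ ((d:ℝ) * n) - 1/d) := by
    simp only [sub_mul, sum_sub_distrib, mul_sub, ← mul_sum]; ring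
  rw [e]
  refine (abs_add_le _ _).trans ?_
  rw [abs_mul, abs_of_pos hV]
  have f1 : B * L * ((b:ℝ) - a) ≤ 1536 * sk k * Vy z / d + 256 * ((z:ℝ)^(4*k+8) * τ / w) := by
    have g1 : B ≤ 12 * sk k * Vy z * (w'/τ) + 2 * (z:ℝ)^(4*k+8) := by
      rw [hB]
      have := mul_le_mul_of_nonneg_left hlen (by positivity : 0 ≤ 3 * sk k * Vy z)
      linarith
    rw [mul_assoc]
    refine (mul_le_mul g1 hLlen (mul_nonneg hL0 (by linarith)) (by positivity)).trans (le_of_eq ?_)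
    rw [ew]; field_simp; ring
  have f2 : Vy z * |∑ n ∈ Ioc a b, gg w τ ((d:ℝ) * n) - 1/d| ≤ 128 * ((z:ℝ)^(4*k+8) * τ / w) := by
    have g1 := rm.trans hLlen
    refine (mul_le_mul (Vy_le_one z) g1 (abs_nonneg _) zero_le_one).trans ?_
    have : τ / w ≤ (z:ℝ)^(4*k+8) * τ / w := by
      rw [mul_div_assoc]; exact le_mul_of_one_le_left (by positivity) hq
    linarith
  linarith [ab]

end TP

namespace TP
open Finset

noncomputable def hh (σ w τ u : ℝ) : ℝ := u^(1-σ) * gg w τ u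

lemma hh_nonneg (σ w τ u : ℝ) (hτ : 0 ≤ τ) (hu : 0 ≤ u) : 0 ≤ hh σ w τ u :=
  mul_nonneg (Real.rpow_nonneg hu _) (gg_nonneg w τ u hτ hu)

lemma hh_le (σ w τ u : ℝ) (hσ : 1 ≤ σ) (hτ : 0 ≤ τ) (hu : 1 ≤ u) : hh σ w τ u ≤ gg w τ u :=
  mul_le_of_le_one_left (gg_nonneg w τ u hτ (by linarith)) (Real.rpow_le_one_of_one_le_of_nonpos hu (by linarith))

lemma gg_supp (w τ u : ℝ) (hτ : 1 ≤ τ) (h : gg w τ u ≠ 0) : |Real.log (u/w)| ≤ 1 / τ := by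
  by_contra hn
  push Not at hn
  apply h
  unfold gg
  rw [tri_zero, mul_zero, mul_zero]
  rw [abs_mul, abs_of_pos (by linarith)]
  rw [div_lt_iff₀ (by linarith)] at hn
  linarith

lemma hh_approx (σ w τ u : ℝ) (hσ : 1 ≤ σ) (hσ2 : σ ≤ 2) (hτ : 1 ≤ τ) (hu : 1 ≤ u) (hw : 1 ≤ w) :
    |hh σ w τ u - w^(1-σ) * gg w τ u| ≤ 2 * (σ - 1) * gg w τ u := by
  by_cases h0 : gg w τ u = 0
  · unfold hh; simp [h0]
  have hs := gg_supp w τ u hτ h0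
  have hs1 : |Real.log (u/w)| ≤ 1 := hs.trans (by rw [div_le_one (by linarith)]; exact hτ)
  have hg := gg_nonneg w τ u (by linarith) (by linarith)
  unfold hh
  rw [← sub_mul, abs_mul, abs_of_nonneg hg]
  refine mul_le_mul_of_nonneg_right ?_ hg
  have e : u^(1-σ) = w^(1-σ) * Real.exp ((1-σ) * Real.log (u/w)) := by
    rw [Real.rpow_def_of_pos (by linarith), Real.rpow_def_of_pos (by linarith), ← Real.exp_add, Real.log_div (by linarith) (by linarith)]
    congr 1; ring
  have hb : |(1-σ) * Real.log (u/w)| ≤ σ - 1 := by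
    rw [abs_mul, abs_of_nonpos (by linarith)]
    nlinarith [abs_nonneg (Real.log (u/w))]
  have hx := Real.abs_exp_sub_one_le (x := (1-σ) * Real.log (u/w)) (by linarith)
  rw [e, ← mul_sub_one, abs_mul, abs_of_pos (Real.rpow_pos_of_pos (by linarith) _)]
  have hw1 : w^(1-σ) ≤ 1 := Real.rpow_le_one_of_one_le_of_nonpos hw (by linarith)
  calc w^(1-σ) * |Real.exp ((1-σ) * Real.log (u/w)) - 1| ≤ 1 * (2 * |(1-σ) * Real.log (u/w)|) := mul_le_mul hw1 hx (abs_nonneg _) zero_le_one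
    _ ≤ _ := by linarith

/-- basic parameters -/
structure Pt (z k W : ℕ) (x T σ : ℝ) : Prop where
  hz : 3 ≤ z
  hk : 18 ≤ k
  hx : 1 ≤ x
  hW : 3 * x ≤ W
  hT : 1 ≤ T
  hσ : 1 < σ
  hσk : σ - 1 ≤ sk k

def adm (z k : ℕ) (x T : ℝ) (d : ℝ) : Prop := (z:ℝ)^(4*k+8) * T * d * Real.log z ≤ sk k * x

lemma logz_ge {z : ℕ} (hz : 3 ≤ z) : 1 ≤ Real.log z := logy_ge z hz

lemma Tgg (z k W : ℕ) (w τ T : ℝ) (d : ℕ) (hz : 3 ≤ z) (hk : 18 ≤ k) (hw : 0 < w) (hW : 3 * w ≤ W) (hd : 1 ≤ d) (hτ : 1 ≤ τ) (hτT : τ ≤ T) (ha : adm z k w T d) :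
    |∑ r ∈ Ioc 0 W, ro z r * gg w τ ((d:ℝ) * r) - Vy z / d| ≤ 1920 * sk k / (d * Real.log z) ∧
    ∑ r ∈ Ioc 0 W, ro z r * gg w τ ((d:ℝ) * r) ≤ 1921 / (d * Real.log z) := by
  have hz1 : (3:ℝ) ≤ z := by exact_mod_cast hz
  have hq : (27:ℝ) ≤ (z:ℝ)^(4*k+8) := by
    calc (27:ℝ) = 3^3 := by norm_num
      _ ≤ (z:ℝ)^3 := pow_le_pow_left₀ (by norm_num) hz1 3
      _ ≤ _ := pow_le_pow_right₀ (by linarith) (by omega)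
  have hL := logz_ge hz
  have hd1 : (1:ℝ) ≤ d := by exact_mod_cast hd
  have hs := sk_pos k
  have hs1 := sk_le_one k hk
  unfold adm at ha
  generalize hqq : (z:ℝ)^(4*k+8) = q at *
  have h0 : q * τ * d * Real.log z ≤ sk k * w := by
    refine le_trans ?_ ha
    exact mul_le_mul_of_nonneg_right (mul_le_mul_of_nonneg_right (mul_le_mul_of_nonneg_left hτT (by linarith)) (by linarith)) (by linarith)
  have h12 : 12 * τ * d ≤ w := by
    have h1 : 12 * τ * d ≤ q * τ * d * Real.log z := by
      have a1 : 12 * τ * d ≤ q * τ * d := mul_le_mul_of_nonneg_right (mul_le_mul_of_nonneg_right (by linarith) (by linarith)) (by linarith)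
      have a2 : q * τ * d ≤ q * τ * d * Real.log z := le_mul_of_one_le_right (by positivity) hL
      linarith
    nlinarith
  have t := T1 z k W d w τ (by omega) hk hd hτ h12 hW
  rw [hqq] at t
  have hV := Vy_le' z hz
  have hVp := Vy_pos z
  have v1 : Vy z / d ≤ 1 / (d * Real.log z) := by
    calc Vy z / d ≤ (1 / Real.log z) / d := div_le_div_of_nonneg_right hV (by linarith)
      _ = _ := by rw [div_div, mul_comm]
  have v2 : q * τ / w ≤ sk k * (1 / (d * Real.log z)) := by
    rw [mul_one_div, div_le_div_iff₀ hw (by positivity)]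
    calc q * τ * (d * Real.log z) = q * τ * d * Real.log z := by ring
      _ ≤ _ := h0
  have v3 : sk k * (Vy z / d) ≤ sk k * (1 / (d * Real.log z)) := mul_le_mul_of_nonneg_left v1 hs.le
  have m : |∑ r ∈ Ioc 0 W, ro z r * gg w τ ((d:ℝ) * r) - Vy z / d| ≤ 1920 * (sk k * (1 / (d * Real.log z))) := by
    refine t.trans ?_
    have : 1536 * sk k * Vy z / d = 1536 * (sk k * (Vy z / d)) := by ring
    rw [this]; linarith
  refine ⟨m.trans (le_of_eq (by ring)), ?_⟩
  have m2 := (abs_le.mp m).2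
  have m3 : sk k * (1 / (d * Real.log z)) ≤ 1 / (d * Real.log z) := mul_le_of_le_one_left (by positivity) hs1
  have e : 1921 / (d * Real.log z) = 1921 * (1 / (d * Real.log z)) := by ring
  rw [e]; linarith

lemma Tb {z k W : ℕ} {x T σ : ℝ} (P : Pt z k W x T σ) (d : ℕ) (hd : 1 ≤ d) (ha : adm z k x T d) :
    ∑ r ∈ Ioc 0 W, ro z r * (gg x T ((d:ℝ) * r) + gg x 1 ((d:ℝ)*r)) ≤ 4000 / (d * Real.log z) := by
  have a := (Tgg z k W x T T d P.hz P.hk (by linarith [P.hx]) P.hW hd P.hT le_rfl ha).2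
  have b := (Tgg z k W x 1 T d P.hz P.hk (by linarith [P.hx]) P.hW hd le_rfl P.hT ha).2
  simp only [mul_add, sum_add_distrib]
  have hd1 : (1:ℝ) ≤ d := by exact_mod_cast hd
  have : 0 ≤ 1 / (d * Real.log z) := by have := logz_ge P.hz; positivity
  have e1 : 1921 / (d * Real.log z) = 1921 * (1 / (d * Real.log z)) := by ring
  have e2 : 4000 / (d * Real.log z) = 4000 * (1 / (d * Real.log z)) := by ring
  rw [e1] at a b; rw [e2]; linarith

lemma Ta {z k W : ℕ} {x T σ : ℝ} (P : Pt z k W x T σ) (d : ℕ) (hd : 1 ≤ d) (ha : adm z k x T d) :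
    |∑ r ∈ Ioc 0 W, ro z r * (hh σ x T ((d:ℝ) * r) - hh σ x 1 ((d:ℝ)*r))| ≤ 12000 * sk k / (d * Real.log z) := by
  have hx0 : 0 < x := by linarith [P.hx]
  have a := (Tgg z k W x T T d P.hz P.hk hx0 P.hW hd P.hT le_rfl ha).1
  have b := (Tgg z k W x 1 T d P.hz P.hk hx0 P.hW hd le_rfl P.hT ha).1
  have c := Tb P d hd ha
  have hs := sk_pos k
  have hs1 := sk_le_one k P.hk
  have hσ := P.hσ
  have hσk := P.hσk
  have hd1 : (1:ℝ) ≤ d := by exact_mod_cast hd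
  have hL := logz_ge P.hz
  have key : |∑ r ∈ Ioc 0 W, ro z r * (hh σ x T ((d:ℝ) * r) - hh σ x 1 ((d:ℝ)*r)) -
      x^(1-σ) * (∑ r ∈ Ioc 0 W, ro z r * gg x T ((d:ℝ) * r) - ∑ r ∈ Ioc 0 W, ro z r * gg x 1 ((d:ℝ) * r))| ≤
      2 * (σ - 1) * ∑ r ∈ Ioc 0 W, ro z r * (gg x T ((d:ℝ) * r) + gg x 1 ((d:ℝ)*r)) := by
    rw [← sum_sub_distrib, mul_sum, mul_sum, ← sum_sub_distrib]
    refine (abs_sum_le_sum_abs _ _).trans (sum_le_sum fun r hr => ?_)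
    rw [mem_Ioc] at hr
    have hr1 : (1:ℝ) ≤ r := by exact_mod_cast hr.1
    have hdr : 1 ≤ (d:ℝ) * r := by nlinarith
    have h1 := hh_approx σ x T ((d:ℝ)*r) hσ.le (by linarith) P.hT hdr P.hx
    have h2 := hh_approx σ x 1 ((d:ℝ)*r) hσ.le (by linarith) le_rfl hdr P.hx
    have hro := ro_nonneg z r
    have e : ro z r * (hh σ x T ((d:ℝ) * r) - hh σ x 1 ((d:ℝ)*r)) - x^(1-σ) * (ro z r * gg x T ((d:ℝ) * r) - ro z r * gg x 1 ((d:ℝ) * r))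
      = ro z r * ((hh σ x T ((d:ℝ) * r) - x^(1-σ) * gg x T ((d:ℝ) * r)) - (hh σ x 1 ((d:ℝ) * r) - x^(1-σ) * gg x 1 ((d:ℝ) * r))) := by ring
    rw [e, abs_mul, abs_of_nonneg hro]
    calc ro z r * _ ≤ ro z r * (2 * (σ-1) * gg x T ((d:ℝ)*r) + 2 * (σ-1) * gg x 1 ((d:ℝ)*r)) :=
          mul_le_mul_of_nonneg_left ((abs_sub _ _).trans (add_le_add h1 h2)) hro
      _ = _ := by ring
  generalize (∑ r ∈ Ioc 0 W, ro z r * gg x T ((d:ℝ) * r)) = A at *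
  generalize (∑ r ∈ Ioc 0 W, ro z r * gg x 1 ((d:ℝ) * r)) = B at *
  generalize (∑ r ∈ Ioc 0 W, ro z r * (gg x T ((d:ℝ) * r) + gg x 1 ((d:ℝ)*r))) = S at *
  generalize (∑ r ∈ Ioc 0 W, ro z r * (hh σ x T ((d:ℝ) * r) - hh σ x 1 ((d:ℝ)*r))) = Z at *
  have hw1 : x^(1-σ) ≤ 1 := Real.rpow_le_one_of_one_le_of_nonpos P.hx (by linarith)
  have hw0 : 0 ≤ x^(1-σ) := Real.rpow_nonneg hx0.le _
  obtain ⟨I, hI⟩ : ∃ I : ℝ, I = 1 / (d * Real.log z) := ⟨_, rfl⟩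
  have hI0 : 0 < I := by rw [hI]; positivity
  have e1 : 1920 * sk k / (d * Real.log z) = 1920 * (sk k * I) := by rw [hI]; ring
  have e2 : 4000 / (d * Real.log z) = 4000 * I := by rw [hI]; ring
  have e3 : 12000 * sk k / (d * Real.log z) = 12000 * (sk k * I) := by rw [hI]; ring
  rw [e1] at a b; rw [e2] at c; rw [e3]
  have hAB : |A - B| ≤ 3840 * (sk k * I) := by
    have : A - B = (A - Vy z / d) - (B - Vy z / d) := by ring
    rw [this]; refine (abs_sub _ _).trans ?_; linarith
  have h5 : |x^(1-σ) * (A - B)| ≤ 3840 * (sk k * I) := by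
    rw [abs_mul, abs_of_nonneg hw0]
    exact (mul_le_of_le_one_left (abs_nonneg _) hw1).trans hAB
  have h6 : 2 * (σ - 1) * S ≤ 8000 * (sk k * I) := by
    have h7 : (σ - 1) * S ≤ (σ - 1) * (4000 * I) := mul_le_mul_of_nonneg_left c (by linarith)
    have h8 : (σ - 1) * (4000 * I) ≤ sk k * (4000 * I) := mul_le_mul_of_nonneg_right hσk (by positivity)
    linarith
  have e : Z = (Z - x^(1-σ) * (A - B)) + x^(1-σ) * (A - B) := by ring
  rw [e]
  refine (abs_add_le _ _).trans ?_
  have := mul_pos hs hI0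
  linarith

end TP

namespace TP
open Finset
open ArithmeticFunction (pmul)

abbrev AF := ArithmeticFunction ℝ

noncomputable def rA (z : ℕ) : ArithmeticFunction ℝ := ⟨fun n => if n = 0 then 0 else ro z n, by simp⟩
lemma rA_apply (z n : ℕ) (hn : n ≠ 0) : rA z n = ro z n := by
  change (if n = 0 then 0 else ro z n) = _
  rw [if_neg hn]
lemma rA_nonneg (z n : ℕ) : 0 ≤ rA z n := by
  change 0 ≤ (if n = 0 then 0 else ro z n)
  split_ifs
  · exact le_rfl
  · exact ro_nonneg _ _

/-- the linear functional -/
noncomputable def Df (W : ℕ) (h : ℕ → ℝ) (f : AF) : ℝ := ∑ n ∈ Ioc 0 W, f n * h n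
/-- the log weighted norm -/
noncomputable def Sn (W : ℕ) (f : AF) : ℝ := ∑ n ∈ Ioc 0 W, |f n| * (1 / (n:ℝ))
noncomputable def ab (f : AF) : AF := ⟨fun n => |f n|, by simp⟩
lemma ab_apply (f : AF) (n : ℕ) : ab f n = |f n| := rfl
noncomputable def lg (f : AF) : AF := pmul f ArithmeticFunction.log
lemma lg_apply (f : AF) (n : ℕ) : lg f n = f n * Real.log n := by
  simp [lg, ArithmeticFunction.log_apply]

lemma Sn_nonneg (W : ℕ) (f : AF) : 0 ≤ Sn W f := sum_nonneg fun n _ => by positivity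

lemma Df_add (W h f g) : Df W h (f + g) = Df W h f + Df W h g := by
  simp [Df, add_mul, sum_add_distrib]
lemma Df_sub (W h) (f g : AF) : Df W h (f - g) = Df W h f - Df W h g := by
  rw [eq_sub_iff_add_eq, ← Df_add, sub_add_cancel]

lemma Df_conv (W : ℕ) (h : ℕ → ℝ) (hh0 : ∀ n, W < n → h n = 0) (f g : AF) :
    Df W h (f * g) = ∑ d ∈ Ioc 0 W, f d * ∑ r ∈ Ioc 0 W, g r * h (d * r) := by
  unfold Df
  simp only [ArithmeticFunction.mul_apply]
  trans ∑ n ∈ Ioc 0 W, ∑ x ∈ Ioc 0 W ×ˢ Ioc 0 W with x.1 * x.2 = n, f x.1 * g x.2 * h n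
  · refine sum_congr rfl fun n hn ↦ ?_
    simp only [mem_Ioc] at hn
    rw [Nat.divisorsAntidiagonal_eq_prod_filter_of_le hn.1.ne' hn.2, sum_mul]
  · simp_rw [sum_filter]
    rw [sum_comm, sum_product]
    refine sum_congr rfl fun d hd => ?_
    rw [mul_sum]
    refine sum_congr rfl fun r hr => ?_
    rw [mem_Ioc] at hd hr
    rw [sum_ite_eq]
    split_ifs with hm
    · ring
    · rw [hh0]; · ring
      rw [mem_Ioc] at hm
      by_contra hc
      exact hm ⟨Nat.mul_pos hd.1 hr.1, not_lt.mp hc⟩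

lemma abs_conv_le (f g : AF) (n : ℕ) : |(f * g) n| ≤ (ab f * ab g) n := by
  rw [ArithmeticFunction.mul_apply, ArithmeticFunction.mul_apply]
  refine (abs_sum_le_sum_abs _ _).trans (le_of_eq (sum_congr rfl fun p _ => ?_))
  rw [abs_mul]; rfl

lemma Sn_mul (W : ℕ) (f g : AF) : Sn W (f * g) ≤ Sn W f * Sn W g := by
  have h1 : Sn W (f * g) ≤ Df W (fun n => if n ≤ W then 1 / (n:ℝ) else 0) (ab f * ab g) := by
    unfold Sn Df
    refine sum_le_sum fun n hn => ?_
    rw [mem_Ioc] at hn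
    beta_reduce
    rw [if_pos hn.2]
    exact mul_le_mul_of_nonneg_right (abs_conv_le f g n) (by positivity)
  refine h1.trans ?_
  rw [Df_conv W _ (fun n hn => if_neg (by omega))]
  unfold Sn
  rw [sum_mul]
  refine sum_le_sum fun d _ => ?_
  rw [mul_assoc]
  refine mul_le_mul_of_nonneg_left ?_ (abs_nonneg _)
  rw [mul_sum]
  refine sum_le_sum fun r _ => ?_
  change |g r| * _ ≤ _
  have : (if d * r ≤ W then 1 / ((d * r : ℕ):ℝ) else 0) ≤ 1 / (d:ℝ) * (1 / (r:ℝ)) := by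
    split_ifs
    · rw [one_div_mul_one_div, Nat.cast_mul]
    · positivity
  calc |g r| * _ ≤ |g r| * (1 / (d:ℝ) * (1 / (r:ℝ))) := mul_le_mul_of_nonneg_left this (abs_nonneg _)
    _ = _ := by ring

lemma lg_mul (f g : AF) : lg (f * g) = lg f * g + f * lg g := by
  ext n
  rw [lg_apply, ArithmeticFunction.add_apply, ArithmeticFunction.mul_apply, ArithmeticFunction.mul_apply, ArithmeticFunction.mul_apply, sum_mul, ← sum_add_distrib]
  refine sum_congr rfl fun p hp => ?_
  rw [Nat.mem_divisorsAntidiagonal] at hp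
  have h1 : p.1 ≠ 0 := fun h => hp.2 (by rw [← hp.1, h, zero_mul])
  have h2 : p.2 ≠ 0 := fun h => hp.2 (by rw [← hp.1, h, mul_zero])
  rw [lg_apply, lg_apply, ← hp.1, Nat.cast_mul, Real.log_mul (by exact_mod_cast h1) (by exact_mod_cast h2)]; ring

def Sp (D : ℝ) (f : AF) : Prop := ∀ n, f n ≠ 0 → (n:ℝ) ≤ D

lemma Sp_mul {D E : ℝ} {f g : AF} (hD : 0 ≤ D) (hf : Sp D f) (hg : Sp E g) : Sp (D * E) (f * g) := by
  intro n hn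
  rw [ArithmeticFunction.mul_apply] at hn
  obtain ⟨p, hp, h⟩ := exists_ne_zero_of_sum_ne_zero hn
  rw [Nat.mem_divisorsAntidiagonal] at hp
  rw [← hp.1, Nat.cast_mul]
  exact mul_le_mul (hf _ (left_ne_zero_of_mul h)) (hg _ (right_ne_zero_of_mul h)) (Nat.cast_nonneg _) hD

lemma Sp_lg {D : ℝ} {f : AF} (hf : Sp D f) : Sp D (lg f) := by
  intro n hn
  rw [lg_apply] at hn
  exact hf n (left_ne_zero_of_mul hn)

lemma Sp_ab {D : ℝ} {f : AF} (hf : Sp D f) : Sp D (ab f) := by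
  intro n hn
  rw [ab_apply] at hn
  exact hf n (abs_ne_zero.mp hn)

lemma Sn_lg (W : ℕ) (f : AF) : Sn W (lg f) ≤ Real.log W * Sn W f := by
  unfold Sn
  rw [mul_sum]
  refine sum_le_sum fun n hn => ?_
  rw [mem_Ioc] at hn
  have h1 : (1:ℝ) ≤ n := by exact_mod_cast hn.1
  have h2 : (n:ℝ) ≤ W := by exact_mod_cast hn.2
  rw [lg_apply, abs_mul, abs_of_nonneg (Real.log_nonneg h1)]
  have := mul_le_mul_of_nonneg_left (Real.log_le_log (by linarith) h2) (by positivity : 0 ≤ |f n| * (1/(n:ℝ)))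
  linarith

noncomputable def hd (σ x T : ℝ) (n : ℕ) : ℝ := hh σ x T n - hh σ x 1 n
noncomputable def hp (x T : ℝ) (n : ℕ) : ℝ := gg x T n + gg x 1 n

section

lemma gg_W {z k W : ℕ} {x T σ : ℝ} (P : Pt z k W x T σ) (τ : ℝ) (hτ : 1 ≤ τ) (n : ℕ) (hn : 3 * x ≤ n) : gg x τ n = 0 := by
  have hx := P.hx
  refine gg_zero_high x τ n (by linarith) (by linarith) (by linarith) ?_
  have : Real.exp (1/τ) ≤ Real.exp 1 := Real.exp_le_exp.mpr (by rw [div_le_one (by linarith)]; exact hτ)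
  nlinarith [Real.exp_one_lt_d9]

lemma gg_L {z k W : ℕ} {x T σ : ℝ} (P : Pt z k W x T σ) (τ : ℝ) (hτ : 1 ≤ τ) (n : ℕ) (hn0 : n ≠ 0) (hn : (n:ℝ) ≤ x / 3) : gg x τ n = 0 := by
  have hx := P.hx
  refine gg_zero_low x τ n (by linarith) (by linarith) (by positivity) ?_
  have h1 : Real.exp (-1) ≤ Real.exp (-(1/τ)) := Real.exp_le_exp.mpr (by rw [neg_le_neg_iff, div_le_one (by linarith)]; exact hτ)
  have h2 : (1:ℝ)/3 ≤ Real.exp (-1) := by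
    rw [Real.exp_neg, ← one_div]; exact one_div_le_one_div_of_le (Real.exp_pos _) (by linarith [Real.exp_one_lt_d9])
  nlinarith

lemma hp_nonneg {z k W : ℕ} {x T σ : ℝ} (P : Pt z k W x T σ) (n : ℕ) : 0 ≤ hp x T n := by
  have := P.hT
  exact add_nonneg (gg_nonneg _ _ _ (by linarith) (Nat.cast_nonneg _)) (gg_nonneg _ _ _ (by linarith) (Nat.cast_nonneg _))

lemma hp_W {z k W : ℕ} {x T σ : ℝ} (P : Pt z k W x T σ) (n : ℕ) (hn : 3 * x ≤ n) : hp x T n = 0 := by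
  unfold hp; rw [gg_W P T P.hT n hn, gg_W P 1 le_rfl n hn, add_zero]

lemma hp_W' {z k W : ℕ} {x T σ : ℝ} (P : Pt z k W x T σ) (n : ℕ) (hn : W < n) : hp x T n = 0 :=
  hp_W P n (P.hW.trans (by exact_mod_cast hn.le))

lemma hp_L {z k W : ℕ} {x T σ : ℝ} (P : Pt z k W x T σ) (n : ℕ) (hn0 : n ≠ 0) (hn : (n:ℝ) ≤ x/3) : hp x T n = 0 := by
  unfold hp; rw [gg_L P T P.hT n hn0 hn, gg_L P 1 le_rfl n hn0 hn, add_zero]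

lemma hd_le {z k W : ℕ} {x T σ : ℝ} (P : Pt z k W x T σ) (n : ℕ) (hn : n ≠ 0) : |hd σ x T n| ≤ hp x T n := by
  have hn1 : (1:ℝ) ≤ n := by exact_mod_cast Nat.one_le_iff_ne_zero.mpr hn
  have hT := P.hT
  unfold hd hp
  refine (abs_sub _ _).trans ?_
  rw [abs_of_nonneg (hh_nonneg _ _ _ _ (by linarith) (by linarith)), abs_of_nonneg (hh_nonneg _ _ _ _ (by linarith) (by linarith))]
  exact add_le_add (hh_le _ _ _ _ P.hσ.le (by linarith) hn1) (hh_le _ _ _ _ P.hσ.le (by linarith) hn1)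

lemma hd_W' {z k W : ℕ} {x T σ : ℝ} (P : Pt z k W x T σ) (n : ℕ) (hn : W < n) : hd σ x T n = 0 := by
  have := hd_le P n (by omega)
  rw [hp_W' P n hn] at this
  exact abs_eq_zero.mp (le_antisymm this (abs_nonneg _))

lemma adm_mono {z k W : ℕ} {x T σ : ℝ} (P : Pt z k W x T σ) {d D : ℝ} (hdD : d ≤ D) (h : adm z k x T D) : adm z k x T d := by
  unfold adm at *
  refine le_trans ?_ h
  have := P.hT
  exact mul_le_mul_of_nonneg_right (mul_le_mul_of_nonneg_left hdD (by positivity)) (by linarith [logz_ge P.hz])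

lemma in_a {z k W : ℕ} {x T σ : ℝ} (P : Pt z k W x T σ) (d : ℕ) (hd1 : d ≠ 0) (ha : adm z k x T d) : |∑ r ∈ Ioc 0 W, rA z r * hd σ x T (d * r)| ≤ 12000 * sk k / Real.log z * (1/(d:ℝ)) := by
  have := Ta P d (Nat.one_le_iff_ne_zero.mpr hd1) ha
  have e : 12000 * sk k / Real.log z * (1/(d:ℝ)) = 12000 * sk k / (d * Real.log z) := by ring
  rw [e]
  refine le_trans (le_of_eq (congrArg abs (sum_congr rfl fun r hr => ?_))) this
  rw [mem_Ioc] at hr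
  rw [rA_apply z r (by omega)]; unfold hd; rw [Nat.cast_mul]

lemma in_b {z k W : ℕ} {x T σ : ℝ} (P : Pt z k W x T σ) (d : ℕ) (hd1 : d ≠ 0) (ha : adm z k x T d) : ∑ r ∈ Ioc 0 W, rA z r * hp x T (d * r) ≤ 4000 / Real.log z * (1/(d:ℝ)) := by
  have := Tb P d (Nat.one_le_iff_ne_zero.mpr hd1) ha
  have e : 4000 / Real.log z * (1/(d:ℝ)) = 4000 / (d * Real.log z) := by ring
  rw [e]
  refine le_trans (le_of_eq (sum_congr rfl fun r hr => ?_)) this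
  rw [mem_Ioc] at hr
  rw [rA_apply z r (by omega)]; unfold hp; rw [Nat.cast_mul]

lemma I1 {z k W : ℕ} {x T σ : ℝ} (P : Pt z k W x T σ) {D : ℝ} (f : AF) (hf : Sp D f) (ha : adm z k x T D) : |Df W (hd σ x T) (f * rA z)| ≤ 12000 * sk k / Real.log z * Sn W f := by
  rw [Df_conv W _ (hd_W' P), Sn, mul_sum]
  refine (abs_sum_le_sum_abs _ _).trans (sum_le_sum fun d hd => ?_)
  rw [mem_Ioc] at hd
  by_cases h0 : f d = 0
  · simp [h0]
  rw [abs_mul]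
  have := mul_le_mul_of_nonneg_left (in_a P d (by omega) (adm_mono P (hf d h0) ha)) (abs_nonneg (f d))
  linarith

lemma I1p {z k W : ℕ} {x T σ : ℝ} (P : Pt z k W x T σ) {D : ℝ} (f : AF) (hf : Sp D f) (ha : adm z k x T D) : Df W (hp x T) (ab f * rA z) ≤ 4000 / Real.log z * Sn W f := by
  rw [Df_conv W _ (hp_W' P), Sn, mul_sum]
  refine sum_le_sum fun d hd => ?_
  rw [mem_Ioc] at hd
  rw [ab_apply]
  by_cases h0 : f d = 0
  · simp [h0]
  have := mul_le_mul_of_nonneg_left (in_b P d (by omega) (adm_mono P (hf d h0) ha)) (abs_nonneg (f d))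
  linarith

lemma Df_lg {z k W : ℕ} {x T σ : ℝ} (P : Pt z k W x T σ) (F : AF) : |Df W (hd σ x T) (lg F)| ≤ Real.log W * |Df W (hd σ x T) F| + Df W (hp x T) (ab F) := by
  have hx := P.hx
  have hW := P.hW
  have e : Df W (hd σ x T) (lg F) = Real.log x * Df W (hd σ x T) F + ∑ n ∈ Ioc 0 W, F n * (Real.log (n/x) * hd σ x T n) := by
    unfold Df
    rw [mul_sum, ← sum_add_distrib]
    refine sum_congr rfl fun n hn => ?_
    rw [mem_Ioc] at hn
    have hn0 : (n:ℝ) ≠ 0 := by exact_mod_cast hn.1.ne'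
    rw [lg_apply, Real.log_div hn0 (by linarith)]; ring
  rw [e]
  refine (abs_add_le _ _).trans (add_le_add ?_ ?_)
  · rw [abs_mul, abs_of_nonneg (Real.log_nonneg hx)]
    exact mul_le_mul_of_nonneg_right (Real.log_le_log (by linarith) (by linarith)) (abs_nonneg _)
  · unfold Df
    refine (abs_sum_le_sum_abs _ _).trans (sum_le_sum fun n hn => ?_)
    rw [mem_Ioc] at hn
    rw [abs_mul, ab_apply]
    refine mul_le_mul_of_nonneg_left ?_ (abs_nonneg _)
    rw [abs_mul]
    have h1 := hd_le P n (by omega)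
    by_cases h0 : hp x T n = 0
    · rw [h0] at h1 ⊢
      rw [le_antisymm h1 (abs_nonneg _), mul_zero]
    · have h2 : |Real.log (n/x)| ≤ 1 := by
        by_cases g1 : gg x T n = 0
        · have g2 : gg x 1 n ≠ 0 := fun g2 => h0 (by unfold hp; rw [g1, g2, add_zero])
          simpa using gg_supp x 1 n le_rfl g2
        · refine (gg_supp x T n P.hT g1).trans ?_
          rw [div_le_one (by linarith [P.hT])]; exact P.hT
      calc |Real.log (n/x)| * |hd σ x T n| ≤ 1 * hp x T n := mul_le_mul h2 h1 (abs_nonneg _) zero_le_one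
        _ = _ := one_mul _

lemma Dp_mono {z k W : ℕ} {x T σ : ℝ} (P : Pt z k W x T σ) (F G : AF) (h : ∀ n, F n ≤ G n) : Df W (hp x T) F ≤ Df W (hp x T) G :=
  sum_le_sum fun n _ => mul_le_mul_of_nonneg_right (h n) (hp_nonneg P n)

lemma logW_nonneg {z k W : ℕ} {x T σ : ℝ} (P : Pt z k W x T σ) : 0 ≤ Real.log W := by
  have := P.hx; have := P.hW
  exact Real.log_nonneg (by linarith)

lemma ab_rA {z k W : ℕ} {x T σ : ℝ} (P : Pt z k W x T σ) : ab (rA z) = rA z := by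
  ext n; rw [ab_apply, abs_of_nonneg (rA_nonneg z n)]

lemma J1 {z k W : ℕ} {x T σ : ℝ} (P : Pt z k W x T σ) {D : ℝ} (c : AF) (hc : Sp D c) (ha : adm z k x T D) :
    |Df W (hd σ x T) (lg (rA z) * c)| ≤ Sn W c * (2 * (Real.log W * (12000 * sk k / Real.log z)) + 4000 / Real.log z) := by
  have e : lg (rA z) * c = lg (c * rA z) - lg c * rA z := by
    rw [lg_mul]; ring
  rw [e, Df_sub]
  have h1 := Df_lg P (c * rA z)
  have h2 := I1 P c hc ha
  have h3 := I1 P (lg c) (Sp_lg hc) ha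
  have h4 := Sn_lg W c
  have h5 := I1p P c hc ha
  have h6 : Df W (hp x T) (ab (c * rA z)) ≤ Df W (hp x T) (ab c * rA z) := Dp_mono P _ _ fun n => by
    have := abs_conv_le c (rA z) n
    rwa [ab_rA P] at this
  have hs := sk_pos k
  have hL := logz_ge P.hz
  have hB : 0 ≤ 12000 * sk k / Real.log z := by positivity
  generalize 12000 * sk k / Real.log z = B at *
  have h7 := mul_le_mul_of_nonneg_left h4 hB
  have h8 := mul_le_mul_of_nonneg_left h2 (logW_nonneg P)
  refine (abs_sub _ _).trans ?_
  have : Sn W c * (2 * (Real.log W * B) + 4000 / Real.log z) = Real.log W * (B * Sn W c) + B * (Real.log W * Sn W c) + 4000 / Real.log z * Sn W c := by ring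
  rw [this]
  linarith

end
end TP

namespace TP
open Finset
open ArithmeticFunction (pmul)

section

lemma hd_W {z k W : ℕ} {x T σ : ℝ} (P : Pt z k W x T σ) (n : ℕ) (hn0 : n ≠ 0) (hn : 3 * x ≤ n) : hd σ x T n = 0 := by
  have := hd_le P n hn0
  rw [hp_W P n hn] at this
  exact abs_eq_zero.mp (le_antisymm this (abs_nonneg _))

lemma hyp_split {z k W : ℕ} {x T σ : ℝ} (P : Pt z k W x T σ) (h : ℕ → ℝ) (hh0 : ∀ n : ℕ, n ≠ 0 → 3 * x ≤ (n:ℝ) → h n = 0) (d : ℕ) (hd0 : d ≠ 0) (Y : ℝ) (hY0 : 0 ≤ Y) (hY : (d:ℝ) * Y^2 = 3 * x) :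
    ∑ r ∈ Ioc 0 W, rA z r * ∑ s ∈ Ioc 0 W, rA z s * h (d * (r * s)) =
    2 * (∑ r ∈ Ioc 0 W, (if (r:ℝ) ≤ Y then rA z r else 0) * ∑ s ∈ Ioc 0 W, rA z s * h (d * r * s)) -
      ∑ r ∈ Ioc 0 W, (if (r:ℝ) ≤ Y then rA z r else 0) * ∑ s ∈ Ioc 0 W, (if (s:ℝ) ≤ Y then rA z s else 0) * h (d * r * s) := by
  have e1 : ∑ r ∈ Ioc 0 W, (if (r:ℝ) ≤ Y then rA z r else 0) * ∑ s ∈ Ioc 0 W, rA z s * h (d * r * s) =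
     ∑ r ∈ Ioc 0 W, ∑ s ∈ Ioc 0 W, rA z r * ((if (s:ℝ) ≤ Y then rA z s else 0) * h (d * (r * s))) := by
    simp only [mul_sum]
    rw [sum_comm]
    refine sum_congr rfl fun r _ => sum_congr rfl fun s _ => ?_
    rw [show d * s * r = d * (r * s) by ring]; ring
  rw [two_mul]
  nth_rewrite 1 [e1]
  simp only [mul_sum]
  rw [← sum_add_distrib, ← sum_sub_distrib]
  refine sum_congr rfl fun r hr => ?_
  rw [← sum_add_distrib, ← sum_sub_distrib]
  refine sum_congr rfl fun s hs => ?_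
  rw [mem_Ioc] at hr hs
  rw [mul_assoc d r s]
  by_cases h1 : (r:ℝ) ≤ Y
  · simp only [if_pos h1]; ring
  · by_cases h2 : (s:ℝ) ≤ Y
    · simp only [if_pos h2, if_neg h1]; ring
    · have : h (d * (r * s)) = 0 := by
        apply hh0
        · exact mul_ne_zero hd0 (mul_ne_zero hr.1.ne' hs.1.ne')
        · push Not at h1 h2
          push_cast
          rw [← hY]
          refine mul_le_mul_of_nonneg_left ?_ (Nat.cast_nonneg _)
          rw [sq]; exact mul_le_mul h1.le h2.le hY0 (Nat.cast_nonneg _)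
      simp only [this, mul_zero, sub_zero, add_zero]

lemma rough_short {z k W : ℕ} {x T σ : ℝ} (P : Pt z k W x T σ) (Y : ℝ) (hY : (z:ℝ)^(4*k+8) * Real.log z ≤ Y) :
    ∑ r ∈ Ioc 0 W, (if (r:ℝ) ≤ Y ∧ Y / 9 < r then rA z r else 0) * (1 / (r:ℝ)) ≤ 54 / Real.log z := by
  have hL := logz_ge P.hz
  have hz1 : (1:ℝ) ≤ z := by exact_mod_cast (by linarith [P.hz] : 1 ≤ z)
  have hq : (1:ℝ) ≤ (z:ℝ)^(4*k+8) := one_le_pow₀ hz1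
  have hY0 : 0 < Y := by nlinarith
  have h1 : ∑ r ∈ Ioc 0 W, (if (r:ℝ) ≤ Y ∧ Y / 9 < r then rA z r else 0) * (1 / (r:ℝ)) ≤ ∑ r ∈ Ioc 0 ⌊Y⌋₊, ro z r * (9 / Y) := by
    have h2 : ∑ r ∈ Ioc 0 W, (if (r:ℝ) ≤ Y ∧ Y / 9 < r then rA z r else 0) * (1 / (r:ℝ)) ≤ ∑ r ∈ Ioc 0 W, (if r ≤ ⌊Y⌋₊ then ro z r * (9/Y) else 0) := by
      refine sum_le_sum fun r hr => ?_
      rw [mem_Ioc] at hr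
      have hr0 : (0:ℝ) < r := by exact_mod_cast hr.1
      have hro := ro_nonneg z r
      split_ifs with a b b
      · rw [rA_apply z r (by omega)]
        refine mul_le_mul_of_nonneg_left ?_ hro
        rw [div_le_div_iff₀ hr0 hY0]; linarith [a.2]
      · exact absurd (Nat.le_floor a.1) b
      · rw [zero_mul]; positivity
      · simp
    refine h2.trans ?_
    rw [← sum_filter]
    refine sum_le_sum_of_subset_of_nonneg ?_ (fun r _ _ => mul_nonneg (ro_nonneg _ _) (by positivity))
    intro r hr
    rw [mem_filter, mem_Ioc] at hr
    exact mem_Ioc.mpr ⟨hr.1.1, hr.2⟩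
  refine h1.trans ?_
  rw [← sum_mul]
  have h3 := (abs_le.mp (fl_count z k 0 ⌊Y⌋₊ (by linarith [P.hz]) P.hk (Nat.zero_le _))).2
  simp only [Nat.cast_zero, sub_zero] at h3
  have h4 : ((⌊Y⌋₊:ℕ):ℝ) ≤ Y := Nat.floor_le hY0.le
  have hs := sk_le_one k P.hk
  have hs0 := sk_pos k
  have hV := Vy_le' z P.hz
  have hV0 := Vy_pos z
  have h5 : Vy z * (⌊Y⌋₊:ℝ) ≤ Y * (1/Real.log z) := by
    rw [mul_comm]; exact mul_le_mul h4 hV hV0.le hY0.le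
  have h6 : sk k * (Vy z * (⌊Y⌋₊:ℝ)) ≤ Vy z * (⌊Y⌋₊:ℝ) := mul_le_of_le_one_left (by positivity) hs
  have h7 : (z:ℝ)^(4*k+8) ≤ Y * (1/Real.log z) := by rw [mul_one_div, le_div_iff₀ (by linarith)]; exact hY
  have h8 : ∑ r ∈ Ioc 0 ⌊Y⌋₊, ro z r ≤ 6 * (Y * (1/Real.log z)) := by
    have : 3 * sk k * Vy z * (⌊Y⌋₊:ℝ) = 3 * (sk k * (Vy z * (⌊Y⌋₊:ℝ))) := by ring
    rw [this] at h3
    linarith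
  calc _ ≤ 6 * (Y * (1/Real.log z)) * (9 / Y) := mul_le_mul_of_nonneg_right h8 (by positivity)
    _ = _ := by field_simp; norm_num

lemma Ydata {z k W : ℕ} {x T σ : ℝ} (P : Pt z k W x T σ) (d : ℕ) (hd0 : d ≠ 0) {D D2 : ℝ} (hdD : (d:ℝ) ≤ D) (hD2 : 3 * x * D ≤ D2^2) (hD20 : 0 ≤ D2) (ha : adm z k x T D2) :
    ∃ Y : ℝ, 0 < Y ∧ (d:ℝ) * Y^2 = 3 * x ∧ (d:ℝ) * Y ≤ D2 ∧ (z:ℝ)^(4*k+8) * Real.log z ≤ Y := by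
  have hx := P.hx
  have hd1 : (1:ℝ) ≤ d := by exact_mod_cast Nat.one_le_iff_ne_zero.mpr hd0
  have hL := logz_ge P.hz
  have hT := P.hT
  refine ⟨√(3*x/d), by positivity, ?_, ?_, ?_⟩
  · rw [Real.sq_sqrt (by positivity)]; field_simp
  · refine abs_le_of_sq_le_sq' ?_ hD20 |>.2
    rw [mul_pow, Real.sq_sqrt (by positivity)]
    have : (d:ℝ)^2 * (3*x/d) = 3 * x * d := by field_simp
    rw [this]; nlinarith
  · have hYD : (d:ℝ) * √(3*x/d) ≤ D2 := by
      refine abs_le_of_sq_le_sq' ?_ hD20 |>.2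
      rw [mul_pow, Real.sq_sqrt (by positivity)]
      have : (d:ℝ)^2 * (3*x/d) = 3 * x * d := by field_simp
      rw [this]; nlinarith
    have hY : (d:ℝ) * √(3*x/d)^2 = 3 * x := by rw [Real.sq_sqrt (by positivity)]; field_simp
    have hYp : 0 < √(3*x/d) := by positivity
    generalize √(3*x/d) = Y at *
    have ha' := adm_mono P hYD ha
    unfold adm at ha'
    have hs := sk_le_one k P.hk
    have hz1 : (1:ℝ) ≤ z := by exact_mod_cast (by linarith [P.hz] : 1 ≤ z)
    have hq : (1:ℝ) ≤ (z:ℝ)^(4*k+8) := one_le_pow₀ hz1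
    generalize (z:ℝ)^(4*k+8) = q at *
    have hA : 0 < q * Real.log z := by positivity
    have h1 : q * Real.log z * (d * Y) ≤ d * Y^2 := by
      have h2 : q * Real.log z * (d * Y) ≤ q * T * (d * Y) * Real.log z := by
        have : q * T * (d * Y) * Real.log z = T * (q * Real.log z * (d * Y)) := by ring
        rw [this]; exact le_mul_of_one_le_left (by positivity) hT
      have h3 : sk k * x ≤ 3 * x := by nlinarith
      linarith
    have h4 : 0 < (d:ℝ) * Y := by positivity
    have : (q * Real.log z) * (d * Y) ≤ Y * (d * Y) := by rw [show Y * (d*Y) = d * Y^2 by ring]; exact h1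
    exact le_of_mul_le_mul_right this h4

lemma Sn_cut {z k W : ℕ} {x T σ : ℝ} (P : Pt z k W x T σ) (c : ℝ) (Y : ℝ) (hc : 0 ≤ c) :
    ∑ r ∈ Ioc 0 W, (if (r:ℝ) ≤ Y then rA z r else 0) * (c * (1/(r:ℝ))) ≤ c * Sn W (rA z) := by
  unfold Sn
  rw [mul_sum]
  refine sum_le_sum fun r _ => ?_
  have h := rA_nonneg z r
  rw [abs_of_nonneg h]
  have hr : 0 ≤ c * (1/(r:ℝ)) := by positivity
  split_ifs
  · linarith
  · have := mul_nonneg h hr; linarith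

lemma cut_nonneg {z k W : ℕ} {x T σ : ℝ} (P : Pt z k W x T σ) (Y : ℝ) (r : ℕ) : 0 ≤ (if (r:ℝ) ≤ Y then rA z r else 0) := by
  split_ifs
  · exact rA_nonneg z r
  · exact le_rfl

lemma cut_le {z k W : ℕ} {x T σ : ℝ} (P : Pt z k W x T σ) (Y : ℝ) (r : ℕ) : (if (r:ℝ) ≤ Y then rA z r else 0) ≤ rA z r := by
  split_ifs
  · exact le_rfl
  · exact rA_nonneg z r

lemma in_a2 {z k W : ℕ} {x T σ : ℝ} (P : Pt z k W x T σ) (d : ℕ) (hd0 : d ≠ 0) {D D2 : ℝ} (hdD : (d:ℝ) ≤ D) (hD2 : 3 * x * D ≤ D2^2) (hD20 : 0 ≤ D2) (ha : adm z k x T D2) :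
    |∑ r ∈ Ioc 0 W, rA z r * ∑ s ∈ Ioc 0 W, rA z s * hd σ x T (d * (r * s))| ≤
      (24000 * sk k / Real.log z * Sn W (rA z) + 216000 / (Real.log z)^2) * (1 / (d:ℝ)) ∧
    ∑ r ∈ Ioc 0 W, rA z r * ∑ s ∈ Ioc 0 W, rA z s * hp x T (d * (r * s)) ≤ 8000 / Real.log z * Sn W (rA z) * (1 / (d:ℝ)) := by
  obtain ⟨Y, hY0, hY, hYD, hqY⟩ := Ydata P d hd0 hdD hD2 hD20 ha
  have hL := logz_ge P.hz
  have hs := sk_pos k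
  have hd1 : (1:ℝ) ≤ d := by exact_mod_cast Nat.one_le_iff_ne_zero.mpr hd0
  have had : ∀ r : ℕ, r ≠ 0 → (r:ℝ) ≤ Y → adm z k x T ((d * r : ℕ):ℝ) := fun r _ hrY => by
    refine adm_mono P ?_ ha
    push_cast
    exact (mul_le_mul_of_nonneg_left hrY (by linarith)).trans hYD
  have hB : ∀ r ∈ Ioc 0 W, (if (r:ℝ) ≤ Y then rA z r else 0) * ∑ s ∈ Ioc 0 W, rA z s * hp x T (d * r * s) ≤
      (if (r:ℝ) ≤ Y then rA z r else 0) * (4000 / Real.log z * (1/(d:ℝ)) * (1/(r:ℝ))) := by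
    intro r hr
    rw [mem_Ioc] at hr
    split_ifs with h
    · refine mul_le_mul_of_nonneg_left ?_ (rA_nonneg z r)
      refine (in_b P (d*r) (mul_ne_zero hd0 (by omega)) (had r (by omega) h)).trans (le_of_eq ?_)
      push_cast; field_simp
    · simp
  constructor
  · rw [hyp_split P (hd σ x T) (hd_W P) d hd0 Y hY0.le hY]
    refine (abs_sub _ _).trans ?_
    have t1 : |2 * (∑ r ∈ Ioc 0 W, (if (r:ℝ) ≤ Y then rA z r else 0) * ∑ s ∈ Ioc 0 W, rA z s * hd σ x T (d * r * s))| ≤ 2 * (12000 * sk k / Real.log z * (1/(d:ℝ)) * Sn W (rA z)) := by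
      rw [abs_mul, abs_two]
      refine mul_le_mul_of_nonneg_left ?_ (by norm_num)
      refine le_trans ?_ (Sn_cut P _ Y (by positivity))
      refine (abs_sum_le_sum_abs _ _).trans (sum_le_sum fun r hr => ?_)
      rw [mem_Ioc] at hr
      rw [abs_mul, abs_of_nonneg (cut_nonneg P Y r)]
      split_ifs with h
      · refine mul_le_mul_of_nonneg_left ?_ (rA_nonneg z r)
        refine (in_a P (d*r) (mul_ne_zero hd0 (by omega)) (had r (by omega) h)).trans (le_of_eq ?_)
        push_cast; field_simp
      · simp
    have t2 : |∑ r ∈ Ioc 0 W, (if (r:ℝ) ≤ Y then rA z r else 0) * ∑ s ∈ Ioc 0 W, (if (s:ℝ) ≤ Y then rA z s else 0) * hd σ x T (d * r * s)| ≤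
        4000 / Real.log z * (1/(d:ℝ)) * (54 / Real.log z) := by
      refine le_trans ?_ (mul_le_mul_of_nonneg_left (rough_short P Y hqY) (by positivity))
      rw [mul_sum]
      refine (abs_sum_le_sum_abs _ _).trans (sum_le_sum fun r hr => ?_)
      have hr' := hr
      rw [mem_Ioc] at hr
      have hr0 : (0:ℝ) < r := by exact_mod_cast hr.1
      rw [abs_mul, abs_of_nonneg (cut_nonneg P Y r)]
      have g1 : |∑ s ∈ Ioc 0 W, (if (s:ℝ) ≤ Y then rA z s else 0) * hd σ x T (d * r * s)| ≤ ∑ s ∈ Ioc 0 W, (if (s:ℝ) ≤ Y then rA z s else 0) * hp x T (d * r * s) := by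
        refine (abs_sum_le_sum_abs _ _).trans (sum_le_sum fun s hs => ?_)
        rw [mem_Ioc] at hs
        rw [abs_mul, abs_of_nonneg (cut_nonneg P Y s)]
        exact mul_le_mul_of_nonneg_left (hd_le P _ (mul_ne_zero (mul_ne_zero hd0 (by omega)) (by omega))) (cut_nonneg P Y s)
      by_cases h9 : Y / 9 < r
      · have g2 : ∑ s ∈ Ioc 0 W, (if (s:ℝ) ≤ Y then rA z s else 0) * hp x T (d * r * s) ≤ ∑ s ∈ Ioc 0 W, rA z s * hp x T (d * r * s) :=
          sum_le_sum fun s _ => mul_le_mul_of_nonneg_right (cut_le P Y s) (hp_nonneg P _)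
        have g3 := (mul_le_mul_of_nonneg_left (g1.trans g2) (cut_nonneg P Y r)).trans (hB r hr')
        refine g3.trans (le_of_eq ?_)
        by_cases h : (r:ℝ) ≤ Y
        · simp only [h, h9, and_self, if_true]; ring
        · simp [h]
      · have g4 : ∑ s ∈ Ioc 0 W, (if (s:ℝ) ≤ Y then rA z s else 0) * hp x T (d * r * s) = 0 := by
          refine sum_eq_zero fun s hs => ?_
          rw [mem_Ioc] at hs
          split_ifs with hsY
          · rw [hp_L P _ (mul_ne_zero (mul_ne_zero hd0 (by omega)) (by omega)), mul_zero]
            push Not at h9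
            push_cast
            have : (r:ℝ) * s ≤ Y/9 * Y := mul_le_mul h9 hsY (Nat.cast_nonneg _) (by positivity)
            have h10 := mul_le_mul_of_nonneg_left this (by linarith : (0:ℝ) ≤ d)
            have h11 : (d:ℝ) * (Y/9 * Y) = x / 3 := by rw [show (d:ℝ) * (Y/9*Y) = (d * Y^2) / 9 by ring, hY]; ring
            linarith
          · simp
        rw [g4] at g1
        rw [le_antisymm g1 (abs_nonneg _), mul_zero]
        refine mul_nonneg (by positivity) (mul_nonneg ?_ (by positivity))
        split_ifs
        · exact rA_nonneg z r
        · exact le_rfl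
    refine (add_le_add t1 t2).trans (le_of_eq ?_)
    field_simp; ring
  · rw [hyp_split P (hp x T) (fun (n:ℕ) _ hn => hp_W P n hn) d hd0 Y hY0.le hY]
    have t3 : 0 ≤ ∑ r ∈ Ioc 0 W, (if (r:ℝ) ≤ Y then rA z r else 0) * ∑ s ∈ Ioc 0 W, (if (s:ℝ) ≤ Y then rA z s else 0) * hp x T (d * r * s) :=
      sum_nonneg fun r _ => mul_nonneg (cut_nonneg P Y r) (sum_nonneg fun s _ => mul_nonneg (cut_nonneg P Y s) (hp_nonneg P _))
    have t4 := (sum_le_sum hB).trans (Sn_cut P _ Y (by positivity))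
    have e : 8000 / Real.log z * Sn W (rA z) * (1 / (d:ℝ)) = 2 * (4000 / Real.log z * (1/(d:ℝ)) * Sn W (rA z)) := by ring
    rw [e]; linarith

lemma Df_conv2 {z k W : ℕ} {x T σ : ℝ} (P : Pt z k W x T σ) (h : ℕ → ℝ) (hh0 : ∀ n, W < n → h n = 0) (f : AF) :
    Df W h (f * (rA z * rA z)) = ∑ d ∈ Ioc 0 W, f d * ∑ r ∈ Ioc 0 W, rA z r * ∑ s ∈ Ioc 0 W, rA z s * h (d * (r * s)) := by
  rw [Df_conv W h hh0]
  refine sum_congr rfl fun d hd => ?_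
  rw [mem_Ioc] at hd
  rw [← Df_conv W (fun n => h (d * n)) (fun n hn => hh0 _ (lt_of_lt_of_le hn (Nat.le_mul_of_pos_left _ hd.1)))]
  rfl

lemma I2 {z k W : ℕ} {x T σ : ℝ} (P : Pt z k W x T σ) {D D2 : ℝ} (hD2 : 3 * x * D ≤ D2^2) (hD20 : 0 ≤ D2) (ha : adm z k x T D2) (f : AF) (hf : Sp D f) :
    |Df W (hd σ x T) (f * (rA z * rA z))| ≤ (24000 * sk k / Real.log z * Sn W (rA z) + 216000 / (Real.log z)^2) * Sn W f := by
  rw [Df_conv2 P _ (hd_W' P)]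
  rw [show Sn W f = ∑ n ∈ Ioc 0 W, |f n| * (1/(n:ℝ)) from rfl, mul_sum]
  refine (abs_sum_le_sum_abs _ _).trans (sum_le_sum fun d hd => ?_)
  rw [mem_Ioc] at hd
  by_cases h0 : f d = 0
  · simp [h0]
  rw [abs_mul]
  have := mul_le_mul_of_nonneg_left (in_a2 P d (by omega) (hf d h0) hD2 hD20 ha).1 (abs_nonneg (f d))
  linarith

lemma I2p {z k W : ℕ} {x T σ : ℝ} (P : Pt z k W x T σ) {D D2 : ℝ} (hD2 : 3 * x * D ≤ D2^2) (hD20 : 0 ≤ D2) (ha : adm z k x T D2) (f : AF) (hf : Sp D f) :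
    Df W (hp x T) (ab f * (rA z * rA z)) ≤ 8000 / Real.log z * Sn W (rA z) * Sn W f := by
  rw [Df_conv2 P _ (hp_W' P)]
  rw [show Sn W f = ∑ n ∈ Ioc 0 W, |f n| * (1/(n:ℝ)) from rfl, mul_sum]
  refine sum_le_sum fun d hd => ?_
  rw [mem_Ioc] at hd
  rw [ab_apply]
  by_cases h0 : f d = 0
  · simp [h0]
  have := mul_le_mul_of_nonneg_left (in_a2 P d (by omega) (hf d h0) hD2 hD20 ha).2 (abs_nonneg (f d))
  linarith

lemma J2 {z k W : ℕ} {x T σ : ℝ} (P : Pt z k W x T σ) {D D2 : ℝ} (hD2 : 3 * x * D ≤ D2^2) (hD20 : 0 ≤ D2) (ha : adm z k x T D2) (c : AF) (hc : Sp D c) :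
    |Df W (hd σ x T) (lg (rA z) * rA z * c)| ≤ Sn W c * (Real.log W * (24000 * sk k / Real.log z * Sn W (rA z) + 216000 / (Real.log z)^2) + 4000 / Real.log z * Sn W (rA z)) := by
  have e : lg (rA z) * rA z * c + lg (rA z) * rA z * c = lg (c * (rA z * rA z)) - lg c * (rA z * rA z) := by
    rw [lg_mul, lg_mul]; ring
  have e2 := congrArg (Df W (hd σ x T)) e
  rw [Df_add, Df_sub] at e2
  have h1 := Df_lg P (c * (rA z * rA z))
  have h2 := I2 P hD2 hD20 ha c hc
  have h3 := I2 P hD2 hD20 ha (lg c) (Sp_lg hc)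
  have h4 := Sn_lg W c
  have h5 := I2p P hD2 hD20 ha c hc
  have h6 : Df W (hp x T) (ab (c * (rA z * rA z))) ≤ Df W (hp x T) (ab c * (rA z * rA z)) := Dp_mono P _ _ fun n => by
    have := abs_conv_le c (rA z * rA z) n
    have e3 : ab (rA z * rA z) = rA z * rA z := by
      ext m
      rw [ab_apply, abs_of_nonneg]
      rw [ArithmeticFunction.mul_apply]
      exact sum_nonneg fun p _ => mul_nonneg (rA_nonneg _ _) (rA_nonneg _ _)
    rwa [e3] at this
  have hs := sk_pos k
  have hL := logz_ge P.hz
  have hSr := Sn_nonneg W (rA z)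
  have hB : 0 ≤ 24000 * sk k / Real.log z * Sn W (rA z) + 216000 / (Real.log z)^2 := by positivity
  generalize 24000 * sk k / Real.log z * Sn W (rA z) + 216000 / (Real.log z)^2 = B at *
  have h7 := mul_le_mul_of_nonneg_left h4 hB
  have h8 := mul_le_mul_of_nonneg_left h2 (logW_nonneg P)
  generalize Df W (hd σ x T) (lg (rA z) * rA z * c) = Z at *
  have h9 : |Z + Z| = 2 * |Z| := by rw [← two_mul, abs_mul, abs_two]
  rw [e2] at h9
  have h10 := (abs_sub (Df W (hd σ x T) (lg (c * (rA z * rA z)))) (Df W (hd σ x T) (lg c * (rA z * rA z))))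
  have : Sn W c * (Real.log W * B + 4000 / Real.log z * Sn W (rA z)) = (Real.log W * (B * Sn W c) + B * (Real.log W * Sn W c) + 8000 / Real.log z * Sn W (rA z) * Sn W c) / 2 := by ring
  rw [this]
  linarith

end
end TP

namespace TP
open Finset
open ArithmeticFunction (pmul)

lemma ro_mul (z a b : ℕ) : ro z (a * b) = ro z a * ro z b := by
  rcases ro_cases z (a*b) with h | ⟨h, h'⟩
  · rcases ro_cases z a with h1 | ⟨h1, h1'⟩
    · rw [h, h1, zero_mul]
    · rcases ro_cases z b with h2 | ⟨h2, h2'⟩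
      · rw [h, h2, mul_zero]
      · have : ro z (a*b) = 1 := ro_one fun p hp hpz hd => by
          rcases hp.dvd_mul.mp hd with h3 | h3
          · exact h1' p hp hpz h3
          · exact h2' p hp hpz h3
        rw [this, h1, h2]; norm_num
  · rw [h, ro_one fun p hp hpz hd => h' p hp hpz (hd.mul_right _), ro_one fun p hp hpz hd => h' p hp hpz (hd.mul_left _)]; norm_num

lemma rA_mul (z a b : ℕ) : rA z (a * b) = rA z a * rA z b := by
  by_cases ha : a = 0
  · simp [ha]
  by_cases hb : b = 0
  · simp [hb]
  rw [rA_apply _ _ ha, rA_apply _ _ hb, rA_apply _ _ (mul_ne_zero ha hb), ro_mul]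

lemma rA_one (z : ℕ) : rA z 1 = 1 := by
  rw [rA_apply _ _ one_ne_zero, ro_one fun p hp _ hd => hp.one_lt.ne' (Nat.dvd_one.mp hd)]

lemma rA_le_one (z n : ℕ) : rA z n ≤ 1 := by
  by_cases hn : n = 0
  · simp [hn]
  rw [rA_apply _ _ hn]; exact ro_le_one _ _

noncomputable def Lz (z : ℕ) : AF := pmul (rA z) ArithmeticFunction.vonMangoldt
lemma Lz_apply (z n : ℕ) : Lz z n = rA z n * ArithmeticFunction.vonMangoldt n := by simp [Lz]
lemma Lz_nonneg (z n : ℕ) : 0 ≤ Lz z n := by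
  rw [Lz_apply]; exact mul_nonneg (rA_nonneg _ _) ArithmeticFunction.vonMangoldt_nonneg

lemma lg_rA (z : ℕ) : lg (rA z) = Lz z * rA z := by
  ext n
  rw [lg_apply, ArithmeticFunction.mul_apply]
  have : ∀ p ∈ n.divisorsAntidiagonal, Lz z p.1 * rA z p.2 = rA z n * ArithmeticFunction.vonMangoldt p.1 := by
    intro p hp
    rw [Nat.mem_divisorsAntidiagonal] at hp
    rw [Lz_apply, ← hp.1, rA_mul]; ring
  rw [sum_congr rfl this, ← mul_sum, Nat.sum_divisorsAntidiagonal (fun a _ => ArithmeticFunction.vonMangoldt a), ArithmeticFunction.vonMangoldt_sum]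

noncomputable def Mz (z : ℕ) (U : ℝ) : AF := ⟨fun n => if (n:ℝ) ≤ U then rA z n * (ArithmeticFunction.moebius n : ℝ) else 0, by simp⟩
lemma Mz_apply (z : ℕ) (U : ℝ) (n : ℕ) : Mz z U n = if (n:ℝ) ≤ U then rA z n * (ArithmeticFunction.moebius n : ℝ) else 0 := rfl
lemma Mz_abs (z : ℕ) (U : ℝ) (n : ℕ) : |Mz z U n| ≤ rA z n := by
  rw [Mz_apply]
  split_ifs
  · rw [abs_mul, abs_of_nonneg (rA_nonneg z n)]
    have : |((ArithmeticFunction.moebius n : ℤ):ℝ)| ≤ 1 := by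
      rw [← Int.cast_abs]; exact_mod_cast ArithmeticFunction.abs_moebius_le_one
    nlinarith [rA_nonneg z n]
  · rw [abs_zero]; exact rA_nonneg z n
lemma Mz_Sp (z : ℕ) (U : ℝ) : Sp U (Mz z U) := by
  intro n hn
  rw [Mz_apply] at hn
  by_contra h
  exact hn (if_neg h)

noncomputable def Rz (y z : ℕ) : AF := ⟨fun n => if n.Prime ∧ y < n ∧ n ≤ z then Real.log n else 0, by simp⟩
lemma Rz_apply (y z n : ℕ) : Rz y z n = if n.Prime ∧ y < n ∧ n ≤ z then Real.log n else 0 := rfl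
lemma Rz_nonneg (y z n : ℕ) : 0 ≤ Rz y z n := by
  rw [Rz_apply]; split_ifs
  · exact Real.log_natCast_nonneg n
  · exact le_rfl
lemma Rz_Sp (y z : ℕ) : Sp z (Rz y z) := by
  intro n hn
  rw [Rz_apply] at hn
  by_contra h
  refine hn (if_neg fun h' => h ?_)
  exact_mod_cast h'.2.2

noncomputable def Ez (z : ℕ) (U : ℝ) : AF := 1 - rA z * Mz z U
noncomputable def Gz (y z : ℕ) : AF := Lz z + Rz y z
noncomputable def tr (W : ℕ) (f : AF) : AF := ⟨fun n => if n ≤ W then f n else 0, by simp⟩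
lemma tr_apply (W : ℕ) (f : AF) (n : ℕ) : tr W f n = if n ≤ W then f n else 0 := rfl

lemma GEE (y z : ℕ) (U : ℝ) (W : ℕ) (h : ℕ → ℝ) :
    Df W h (Lz z) = Df W h (Gz y z * Ez z U * Ez z U) + 2 * Df W h (lg (rA z) * Mz z U) - Df W h (lg (rA z) * rA z * (Mz z U * Mz z U))
      - Df W h (Rz y z) + 2 * Df W h (Rz y z * Mz z U * rA z) - Df W h (Rz y z * (Mz z U * Mz z U) * (rA z * rA z)) := by
  have e : Lz z + Lz z * rA z * rA z * (Mz z U * Mz z U) + Rz y z + Rz y z * (Mz z U * Mz z U) * (rA z * rA z)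
     = Gz y z * Ez z U * Ez z U + Lz z * rA z * Mz z U + Lz z * rA z * Mz z U + Rz y z * Mz z U * rA z + Rz y z * Mz z U * rA z := by
    unfold Gz Ez; ring
  rw [← lg_rA] at e
  have e2 := congrArg (Df W h) e
  simp only [Df_add] at e2
  linarith

lemma mul_tr (W : ℕ) (f g : AF) (n : ℕ) (hn : n ≤ W) : (f * g) n = (f * tr W g) n := by
  rw [ArithmeticFunction.mul_apply, ArithmeticFunction.mul_apply]
  refine sum_congr rfl fun p hp => ?_
  rw [Nat.mem_divisorsAntidiagonal] at hp
  rw [tr_apply, if_pos]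
  exact (Nat.le_of_dvd (Nat.pos_of_ne_zero hp.2) ⟨p.1, by rw [← hp.1, mul_comm]⟩).trans hn

lemma mul_tr' (W : ℕ) (f g : AF) (n : ℕ) (hn : n ≤ W) : (f * g * g) n = (f * tr W g * tr W g) n := by
  rw [mul_tr W _ _ n hn, mul_right_comm, mul_tr W _ _ n hn, mul_right_comm]

lemma Df_tr (W : ℕ) (h : ℕ → ℝ) (f g : AF) : Df W h (f * g * g) = Df W h (f * tr W g * tr W g) := by
  unfold Df
  refine sum_congr rfl fun n hn => ?_
  rw [mem_Ioc] at hn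
  rw [mul_tr' W f g n hn.2]

lemma Ez_eq (z : ℕ) (U : ℝ) (n : ℕ) : Ez z U n = (1 : AF) n - (rA z * Mz z U) n := by
  have : Ez z U + rA z * Mz z U = 1 := by unfold Ez; ring
  rw [← this]; simp

lemma Ez_zero (z : ℕ) (U : ℝ) (n : ℕ) (hn : (n:ℝ) ≤ U) : Ez z U n = 0 := by
  rw [Ez_eq]
  have h1 : (rA z * Mz z U) n = rA z n * (1 : AF) n := by
    have h2 : ∀ p ∈ n.divisorsAntidiagonal, rA z p.1 * Mz z U p.2 = rA z n * (ArithmeticFunction.moebius p.2 : ℝ) := by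
      intro p hp
      rw [Nat.mem_divisorsAntidiagonal] at hp
      have : p.2 ≤ n := Nat.le_of_dvd (Nat.pos_of_ne_zero hp.2) ⟨p.1, by rw [← hp.1, mul_comm]⟩
      have h3 : (p.2:ℝ) ≤ U := le_trans (by exact_mod_cast this) hn
      rw [Mz_apply, if_pos h3, ← hp.1, rA_mul]; ring
    rw [ArithmeticFunction.mul_apply, sum_congr rfl h2, ← mul_sum]
    congr 1
    have h3 := congrArg (fun f => f n) (ArithmeticFunction.coe_zeta_mul_coe_moebius (R := ℝ))
    beta_reduce at h3
    rw [← h3, ArithmeticFunction.coe_zeta_mul_apply, Nat.sum_divisorsAntidiagonal' (fun _ a => ((ArithmeticFunction.moebius a : ℤ):ℝ))]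
    simp
  rw [h1]
  by_cases h : n = 1
  · rw [h, rA_one]; simp
  · simp [ArithmeticFunction.one_apply_ne h]

lemma card_div (z : ℕ) (J : ℕ) : ∀ n : ℕ, n ≠ 0 → (∀ p : ℕ, p.Prime → p ≤ z → ¬ p ∣ n) → n < z^J → n.divisors.card ≤ 2^J := by
  induction J with
  | zero => intro n h0 _ h; rw [pow_zero] at h; omega
  | succ J ih =>
    intro n h0 hr h
    by_cases h1 : n = 1
    · rw [h1]; simp; exact Nat.one_le_two_pow
    have hp := Nat.minFac_prime h1
    obtain ⟨m, hm⟩ := Nat.minFac_dvd n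
    have hpz : z < n.minFac := by
      by_contra hc
      exact hr _ hp (not_lt.mp hc) (Nat.minFac_dvd n)
    have hm0 : m ≠ 0 := by rintro rfl; rw [mul_zero] at hm; exact h0 hm
    have h2 : m < z^J := by
      by_contra hc
      push Not at hc
      have : z^(J+1) ≤ n := by
        rw [hm, pow_succ, mul_comm]; exact Nat.mul_le_mul hpz.le hc
      omega
    have h3 := ih m hm0 (fun p hp' hpz' hd => hr p hp' hpz' (by rw [hm]; exact hd.mul_left _)) h2
    rw [hm, Nat.divisors_mul]
    refine (Finset.card_mul_le).trans ?_
    rw [hp.divisors, card_pair hp.one_lt.ne, pow_succ, mul_comm]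
    exact Nat.mul_le_mul_right _ h3

lemma Ez_le (z : ℕ) (U : ℝ) (hU : 1 ≤ U) (J n : ℕ) (hn : n < z^J) : |Ez z U n| ≤ 2^J * rA z n := by
  by_cases h : (n:ℝ) ≤ U
  · rw [Ez_zero z U n h, abs_zero]; exact mul_nonneg (by positivity) (rA_nonneg _ _)
  have hn0 : n ≠ 0 := by rintro rfl; apply h; push_cast; linarith
  have hn1 : n ≠ 1 := by rintro rfl; apply h; push_cast; linarith
  rw [Ez_eq, ArithmeticFunction.one_apply_ne hn1, zero_sub, abs_neg, ArithmeticFunction.mul_apply]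
  have h1 : ∀ p ∈ n.divisorsAntidiagonal, |rA z p.1 * Mz z U p.2| ≤ rA z n := by
    intro p hp
    rw [Nat.mem_divisorsAntidiagonal] at hp
    rw [abs_mul, abs_of_nonneg (rA_nonneg _ _), ← hp.1, rA_mul]
    exact mul_le_mul_of_nonneg_left (Mz_abs z U _) (rA_nonneg _ _)
  refine (abs_sum_le_sum_abs _ _).trans ((sum_le_sum h1).trans ?_)
  rw [sum_const, nsmul_eq_mul, ← Nat.map_div_right_divisors, card_map]
  rcases ro_cases z n with h2 | ⟨h2, h3⟩
  · rw [rA_apply _ _ hn0, h2]; simp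
  · refine mul_le_mul_of_nonneg_right ?_ (rA_nonneg _ _)
    exact_mod_cast card_div z J n hn0 h3 hn

/-- bounds for the norms -/
lemma Sn_rA (z m W : ℕ) (hz : 2 ≤ z) (hW : W ≤ z^(2^m)) : Sn W (rA z) ≤ Real.exp (12 * m) := by
  refine le_trans (le_of_eq ?_) (rsum z m W hz hW)
  refine sum_congr rfl fun n hn => ?_
  rw [mem_Ioc] at hn
  rw [abs_of_nonneg (rA_nonneg _ _), rA_apply _ _ (by omega)]

lemma Sn_Mz (z m W : ℕ) (U : ℝ) (hz : 2 ≤ z) (hW : W ≤ z^(2^m)) : Sn W (Mz z U) ≤ Real.exp (12 * m) := by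
  refine le_trans (sum_le_sum fun n _ => ?_) (Sn_rA z m W hz hW)
  rw [abs_of_nonneg (rA_nonneg z n)]
  exact mul_le_mul_of_nonneg_right (Mz_abs z U n) (by positivity)

lemma Sn_Rz (y z W : ℕ) (hz : 3 ≤ z) : Sn W (Rz y z) ≤ 3 * Real.log z := by
  have h1 := mertens1 z (by omega)
  have h2 : Sn W (Rz y z) ≤ ∑ p ∈ Pb 0 z, Real.log p / p := by
    unfold Sn
    have : ∀ n ∈ Ioc 0 W, |Rz y z n| * (1/(n:ℝ)) = if n.Prime ∧ y < n ∧ n ≤ z then Real.log n / n else 0 := by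
      intro n _
      rw [abs_of_nonneg (Rz_nonneg _ _ _), Rz_apply]
      split_ifs <;> ring
    rw [sum_congr rfl this, ← sum_filter]
    refine sum_le_sum_of_subset_of_nonneg ?_ fun n _ _ => div_nonneg (Real.log_natCast_nonneg n) (Nat.cast_nonneg n)
    intro n hn
    rw [mem_filter, mem_Ioc] at hn
    exact mem_Pb.mpr ⟨⟨hn.1.1, hn.2.2.2⟩, hn.2.1⟩
  have h3 := logz_ge hz
  have h4 : Real.log 4 ≤ 2 * 1 := by
    rw [show (4:ℝ) = 2^2 by norm_num, Real.log_pow]; push_cast; linarith [Real.log_two_lt_d9]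
  linarith

end TP

namespace TP
open Finset
open MeasureTheory (Integrable)

lemma ee_cont : Continuous ee := by unfold ee; fun_prop
lemma el_contt (u : ℝ) : Continuous (fun t => el t u) := by
  unfold el
  exact ee_cont.comp (by fun_prop)

lemma kint (τ : ℝ) (hτ : 0 < τ) (F : ℝ → ℂ) (hc : Continuous F) (B : ℝ) (hB : ∀ t, ‖F t‖ ≤ B) :
    Integrable (fun t => (kn τ t : ℂ) * F t) :=
  MeasureTheory.Integrable.mul_bdd (kn_int τ hτ).ofReal hc.aestronglyMeasurable (Filter.Eventually.of_forall hB)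

noncomputable def Pc (c : ℕ → ℝ) (t : ℝ) : ℂ := ∑' a : ℕ, (c a : ℂ) * el t a

lemma Pc_term (c : ℕ → ℝ) (h0 : ∀ a, 0 ≤ c a) (a : ℕ) (t : ℝ) : ‖(c a : ℂ) * el t a‖ = c a := by
  rw [norm_mul, el_norm, mul_one, Complex.norm_real, Real.norm_of_nonneg (h0 a)]

lemma Pc_cont (c : ℕ → ℝ) (h0 : ∀ a, 0 ≤ c a) (hs : Summable c) : Continuous (Pc c) := by
  unfold Pc
  exact continuous_tsum (fun a => continuous_const.mul (el_contt a)) hs (fun a t => (Pc_term c h0 a t).le)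

lemma Pc_le (c : ℕ → ℝ) (h0 : ∀ a, 0 ≤ c a) (hs : Summable c) (t : ℝ) : ‖Pc c t‖ ≤ ∑' a, c a := by
  unfold Pc
  exact tsum_of_norm_bounded hs.hasSum (fun a => (Pc_term c h0 a t).le)

lemma four1 (c : ℕ → ℝ) (h0 : ∀ a, 0 ≤ c a) (hs : Summable c) (τ : ℝ) (hτ : 0 < τ) (v : ℝ) :
    ∫ t : ℝ, (kn τ t : ℂ) * (Pc c t * ee (t * v)) = ((2 * Real.pi * ∑' a : ℕ, c a * (τ * tri (τ * (v - Real.log a))) : ℝ) : ℂ) := by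
  have hF : ∀ a : ℕ, ∀ t : ℝ, (kn τ t : ℂ) * ((c a : ℂ) * el t a * ee (t * v)) = (c a : ℂ) * ((kn τ t : ℂ) * ee (t * (v - Real.log a))) := by
    intro a t
    have : ee (t * (v - Real.log a)) = el t a * ee (t * v) := by
      unfold el; rw [← ee_add]; congr 1; ring
    rw [this]; ring
  have key := MeasureTheory.hasSum_integral_of_summable_integral_norm (μ := MeasureTheory.volume) (F := fun (a:ℕ) (t:ℝ) => (kn τ t : ℂ) * ((c a : ℂ) * el t a * ee (t * v)))
    (fun a => kint τ hτ _ ((continuous_const.mul (el_contt a)).mul (ee_cont.comp (by fun_prop))) (c a) (fun t => by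
      rw [norm_mul, Pc_term c h0, ee_norm, mul_one]))
    (by
      have : ∀ a : ℕ, ∫ t : ℝ, ‖(kn τ t : ℂ) * ((c a : ℂ) * el t a * ee (t * v))‖ = c a * ∫ t : ℝ, kn τ t := by
        intro a
        rw [← MeasureTheory.integral_const_mul]
        congr 1; funext t
        rw [norm_mul, norm_mul, Pc_term c h0, ee_norm, mul_one, Complex.norm_real, Real.norm_of_nonneg (kn_nonneg τ t), mul_comm]
      simp_rw [this]
      exact hs.mul_right _)
  have e1 : ∀ t : ℝ, (kn τ t : ℂ) * (Pc c t * ee (t * v)) = ∑' a : ℕ, (kn τ t : ℂ) * ((c a : ℂ) * el t a * ee (t * v)) := by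
    intro t
    rw [tsum_mul_left, tsum_mul_right]; rfl
  simp_rw [e1]
  rw [← key.tsum_eq]
  have e2 : ∀ a : ℕ, ∫ t : ℝ, (kn τ t : ℂ) * ((c a : ℂ) * el t a * ee (t * v)) = ((2 * Real.pi * (c a * (τ * tri (τ * (v - Real.log a)))) : ℝ) : ℂ) := by
    intro a
    simp_rw [hF a]
    rw [MeasureTheory.integral_const_mul, kn_fourier τ _ hτ]
    push_cast; ring
  simp_rw [e2]
  rw [← Complex.ofReal_tsum, tsum_mul_left]

noncomputable def Ep (W : ℕ) (e : ℕ → ℝ) (t : ℝ) : ℂ := ∑ m ∈ Ioc 0 W, (e m : ℂ) * el t m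

lemma Ep_cont (W : ℕ) (e : ℕ → ℝ) : Continuous (Ep W e) := by
  unfold Ep
  exact continuous_finsetSum _ fun m _ => continuous_const.mul (el_contt m)

lemma Ep_le (W : ℕ) (e : ℕ → ℝ) (t : ℝ) : ‖Ep W e t‖ ≤ ∑ m ∈ Ioc 0 W, |e m| := by
  unfold Ep
  refine (norm_sum_le _ _).trans (le_of_eq (sum_congr rfl fun m _ => ?_))
  rw [norm_mul, el_norm, mul_one, Complex.norm_real, Real.norm_eq_abs]

lemma four2 (c : ℕ → ℝ) (h0 : ∀ a, 0 ≤ c a) (hs : Summable c) (τ : ℝ) (hτ : 0 < τ) (v : ℝ) (W : ℕ) (e : ℕ → ℝ) :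
    ∫ t : ℝ, (kn τ t : ℂ) * (Pc c t * ee (t * v) * Ep W e t * Ep W e t) =
     ((2 * Real.pi * ∑ m ∈ Ioc 0 W, ∑ m' ∈ Ioc 0 W, e m * (e m' * ∑' a : ℕ, c a * (τ * tri (τ * (v - Real.log m - Real.log m' - Real.log a)))) : ℝ) : ℂ) := by
  have e1 : ∀ t : ℝ, (kn τ t : ℂ) * (Pc c t * ee (t * v) * Ep W e t * Ep W e t) =
      ∑ m ∈ Ioc 0 W, ∑ m' ∈ Ioc 0 W, ((e m * e m' : ℝ) : ℂ) * ((kn τ t : ℂ) * (Pc c t * ee (t * (v - Real.log m - Real.log m')))) := by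
    intro t
    have : ∀ m m' : ℕ, ee (t * (v - Real.log m - Real.log m')) = ee (t * v) * (el t m * el t m') := by
      intro m m'
      unfold el
      rw [← ee_add, ← ee_add]; congr 1; ring
    simp_rw [this]
    rw [mul_assoc (Pc c t * _)]
    unfold Ep
    rw [sum_mul_sum, mul_sum, mul_sum]
    refine sum_congr rfl fun m _ => ?_
    rw [mul_sum, mul_sum]
    refine sum_congr rfl fun m' _ => ?_
    push_cast; ring
  have hi : ∀ m m' : ℕ, Integrable (fun t => ((e m * e m' : ℝ) : ℂ) * ((kn τ t : ℂ) * (Pc c t * ee (t * (v - Real.log m - Real.log m'))))) := by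
    intro m m'
    refine Integrable.const_mul (kint τ hτ _ ((Pc_cont c h0 hs).mul (ee_cont.comp (by fun_prop))) (∑' a, c a) fun t => ?_) _
    change ‖Pc c t * ee _‖ ≤ _
    rw [norm_mul, ee_norm, mul_one]; exact Pc_le c h0 hs t
  simp_rw [e1]
  rw [MeasureTheory.integral_finsetSum _ (fun m _ => MeasureTheory.integrable_finsetSum _ fun m' _ => hi m m'), mul_sum, Complex.ofReal_sum]
  refine sum_congr rfl fun m _ => ?_
  rw [MeasureTheory.integral_finsetSum _ (fun m' _ => hi m m'), mul_sum, Complex.ofReal_sum]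
  refine sum_congr rfl fun m' _ => ?_
  rw [MeasureTheory.integral_const_mul, four1 c h0 hs τ hτ]
  push_cast; ring

lemma four3 (τ : ℝ) (hτ : 0 < τ) (W : ℕ) (e : ℕ → ℝ) :
    ∫ t : ℝ, kn τ t * ‖Ep W e t‖^2 = 2 * Real.pi * ∑ m ∈ Ioc 0 W, ∑ m' ∈ Ioc 0 W, e m * (e m' * (τ * tri (τ * (Real.log m' - Real.log m)))) := by
  have e1 : ∀ t : ℝ, ((kn τ t * ‖Ep W e t‖^2 : ℝ) : ℂ) = ∑ m ∈ Ioc 0 W, ∑ m' ∈ Ioc 0 W, ((e m * e m' : ℝ) : ℂ) * ((kn τ t : ℂ) * ee (t * (Real.log m' - Real.log m))) := by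
    intro t
    have h1 : ((‖Ep W e t‖^2 : ℝ) : ℂ) = Ep W e t * (starRingEnd ℂ) (Ep W e t) := by
      rw [Complex.mul_conj, Complex.normSq_eq_norm_sq]
    have h2 : (starRingEnd ℂ) (Ep W e t) = ∑ m' ∈ Ioc 0 W, (e m' : ℂ) * ee (t * Real.log m') := by
      unfold Ep
      rw [map_sum]
      refine sum_congr rfl fun m _ => ?_
      rw [map_mul, Complex.conj_ofReal]
      unfold el
      rw [← ee_neg, neg_neg]
    rw [Complex.ofReal_mul, h1, h2]
    unfold Ep
    rw [sum_mul_sum, mul_sum]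
    refine sum_congr rfl fun m _ => ?_
    rw [mul_sum]
    refine sum_congr rfl fun m' _ => ?_
    have : ee (t * (Real.log m' - Real.log m)) = el t m * ee (t * Real.log m') := by
      unfold el
      rw [← ee_add]; congr 1; ring
    rw [this]; push_cast; ring
  have hi : ∀ m m' : ℕ, Integrable (fun t => ((e m * e m' : ℝ) : ℂ) * ((kn τ t : ℂ) * ee (t * (Real.log m' - Real.log m)))) := by
    intro m m'
    exact Integrable.const_mul (kint τ hτ _ (ee_cont.comp (by fun_prop)) 1 fun t => (ee_norm _).le) _
  apply Complex.ofReal_injective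
  rw [← integral_complex_ofReal]
  simp_rw [e1]
  rw [MeasureTheory.integral_finsetSum _ (fun m _ => MeasureTheory.integrable_finsetSum _ fun m' _ => hi m m'), mul_sum, Complex.ofReal_sum]
  refine sum_congr rfl fun m _ => ?_
  rw [MeasureTheory.integral_finsetSum _ (fun m' _ => hi m m'), mul_sum, Complex.ofReal_sum]
  refine sum_congr rfl fun m' _ => ?_
  rw [MeasureTheory.integral_const_mul, kn_fourier τ _ hτ]
  push_cast; ring

lemma kEp_int (τ : ℝ) (hτ : 0 < τ) (W : ℕ) (e : ℕ → ℝ) : Integrable (fun t => kn τ t * ‖Ep W e t‖^2) := by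
  refine MeasureTheory.Integrable.mul_bdd (kn_int τ hτ) ((Ep_cont W e).norm.pow 2).aestronglyMeasurable (c := (∑ m ∈ Ioc 0 W, |e m|)^2) (Filter.Eventually.of_forall fun t => ?_)
  rw [Real.norm_of_nonneg (sq_nonneg _)]
  exact pow_le_pow_left₀ (norm_nonneg _) (Ep_le W e t) 2

lemma cauchy_int (A : ℝ) (hA : 0 < A) : Integrable (fun t : ℝ => (1 + (t/A)^2)⁻¹) ∧ ∫ t : ℝ, (1 + (t/A)^2)⁻¹ = A * Real.pi := by
  refine ⟨integrable_inv_one_add_sq.comp_div hA.ne', ?_⟩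
  rw [MeasureTheory.Measure.integral_comp_div (fun t : ℝ => (1 + t^2)⁻¹) A, integral_univ_inv_one_add_sq, abs_of_pos hA, smul_eq_mul]

/-- pointwise majorant -/
lemma ptw (c : ℕ → ℝ) (W : ℕ) (e : ℕ → ℝ) (T A B P0 P1 E0 : ℝ) (hT : 1 ≤ T) (hA : 0 < A) (hA1 : A ≤ 1) (hB : 0 < B)
    (hP0 : ∀ t, ‖Pc c t‖ ≤ P0) (hP1 : 0 ≤ P1) (hP : ∀ t, A ≤ |t| → |t| ≤ B → ‖Pc c t‖ ≤ P1) (hE : ∀ t, ‖Ep W e t‖ ≤ E0) (t : ℝ) :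
    |kn T t - kn 1 t| * (‖Pc c t‖ * ‖Ep W e t‖^2) ≤ 2 * A^2 * (P0 * E0^2) * (1 + (t/A)^2)⁻¹ + (P1 * (kn T t * ‖Ep W e t‖^2) + P1 * (kn 1 t * ‖Ep W e t‖^2))
      + 16 * T^2 / B^2 * (P0 * E0^2) * (1 + (t/B)^2)⁻¹ := by
  have k1 := kn_nonneg T t
  have k2 := kn_nonneg 1 t
  have k3 := kn_le_one T t
  have k4 := kn_le_one 1 t
  have p0 : 0 ≤ P0 := (norm_nonneg _).trans (hP0 t)
  have e2 : ‖Ep W e t‖^2 ≤ E0^2 := pow_le_pow_left₀ (norm_nonneg _) (hE t) 2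
  have hP0t := hP0 t
  have q : ‖Pc c t‖ * ‖Ep W e t‖^2 ≤ P0 * E0^2 := mul_le_mul hP0t e2 (sq_nonneg _) p0
  have q0 : 0 ≤ ‖Pc c t‖ * ‖Ep W e t‖^2 := by positivity
  have pe : 0 ≤ P0 * E0^2 := by positivity
  have es : 0 ≤ ‖Ep W e t‖^2 := sq_nonneg _
  have n1 : 0 ≤ 2 * A^2 * (P0 * E0^2) * (1 + (t/A)^2)⁻¹ := by
    generalize P0 * E0^2 = Q at *; positivity
  have n2 : 0 ≤ P1 * (kn T t * ‖Ep W e t‖^2) + P1 * (kn 1 t * ‖Ep W e t‖^2) :=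
    add_nonneg (mul_nonneg hP1 (mul_nonneg k1 es)) (mul_nonneg hP1 (mul_nonneg k2 es))
  have n3 : 0 ≤ 16 * T^2 / B^2 * (P0 * E0^2) * (1 + (t/B)^2)⁻¹ := by
    generalize P0 * E0^2 = Q at *; positivity
  by_cases h1 : A ≤ |t|
  · by_cases h2 : |t| ≤ B
    · have h3 : |kn T t - kn 1 t| ≤ kn T t + kn 1 t := by rw [abs_le]; constructor <;> linarith
      have h4 : ‖Pc c t‖ * ‖Ep W e t‖^2 ≤ P1 * ‖Ep W e t‖^2 := mul_le_mul_of_nonneg_right (hP t h1 h2) es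
      have := mul_le_mul h3 h4 q0 (by linarith)
      nlinarith
    · push Not at h2
      have ht : t ≠ 0 := by rintro rfl; rw [abs_zero] at h2; linarith
      have a1 := kn_le T t (by linarith) ht
      have a2 := kn_le 1 t one_pos ht
      have ht2 : B^2 ≤ t^2 := by rw [← sq_abs t]; exact pow_le_pow_left₀ hB.le h2.le 2
      have htp : 0 < t^2 := by positivity
      have h3 : |kn T t - kn 1 t| ≤ 16 * T^2 / B^2 * (1 + (t/B)^2)⁻¹ := by
        have b0 : |kn T t - kn 1 t| ≤ kn T t + kn 1 t := by rw [abs_le]; constructor <;> linarith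
        have b1 : 4 * 1^2 / t^2 ≤ 4 * T^2 / t^2 := by gcongr
        have b2 : 16 * T^2 / B^2 * (1 + (t/B)^2)⁻¹ = 16 * T^2 / (B^2 + t^2) := by field_simp
        have b3 : 16 * T^2 / (t^2 + t^2) ≤ 16 * T^2 / (B^2 + t^2) := by gcongr
        have b4 : 16 * T^2 / (t^2 + t^2) = 4 * T^2/t^2 + 4 * T^2/t^2 := by field_simp; ring
        rw [b2]; linarith
      have := mul_le_mul h3 q q0 (le_trans (abs_nonneg _) h3)
      nlinarith
  · push Not at h1
    have a1 := one_sub_kn T t hT (by linarith)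
    have a2 := one_sub_kn 1 t le_rfl (by linarith)
    have ht2 : t^2 ≤ A^2 := by rw [← sq_abs t]; exact pow_le_pow_left₀ (abs_nonneg t) h1.le 2
    have h3 : |kn T t - kn 1 t| ≤ 2 * A^2 * (1 + (t/A)^2)⁻¹ := by
      have b1 : (2:ℝ)⁻¹ ≤ (1 + (t/A)^2)⁻¹ := by
        apply inv_anti₀ (by positivity)
        have : (t/A)^2 ≤ 1 := by rw [div_pow, div_le_one (by positivity)]; exact ht2
        linarith
      have b2 := mul_le_mul_of_nonneg_left b1 (by positivity : 0 ≤ 2 * A^2)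
      refine le_trans ?_ b2
      rw [abs_le]; constructor <;> linarith
    have := mul_le_mul h3 q q0 (le_trans (abs_nonneg _) h3)
    nlinarith

lemma typeII (c : ℕ → ℝ) (h0 : ∀ a, 0 ≤ c a) (hs : Summable c) (W : ℕ) (e : ℕ → ℝ) (v T A B P0 P1 E0 Q : ℝ) (hT : 1 ≤ T) (hA : 0 < A) (hA1 : A ≤ 1) (hB : 0 < B)
    (hP0 : ∀ t, ‖Pc c t‖ ≤ P0) (hP1 : 0 ≤ P1) (hP : ∀ t, A ≤ |t| → |t| ≤ B → ‖Pc c t‖ ≤ P1) (hE : ∀ t, ‖Ep W e t‖ ≤ E0)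
    (hQ : ∀ τ, 1 ≤ τ → τ ≤ T → ∑ m ∈ Ioc 0 W, ∑ m' ∈ Ioc 0 W, e m * (e m' * (τ * tri (τ * (Real.log m' - Real.log m)))) ≤ Q) :
    |∑ m ∈ Ioc 0 W, ∑ m' ∈ Ioc 0 W, e m * (e m' * ∑' a : ℕ, c a * (T * tri (T * (v - Real.log m - Real.log m' - Real.log a))))
     - ∑ m ∈ Ioc 0 W, ∑ m' ∈ Ioc 0 W, e m * (e m' * ∑' a : ℕ, c a * (1 * tri (1 * (v - Real.log m - Real.log m' - Real.log a))))|
     ≤ A^3 * (P0 * E0^2) + 2 * P1 * Q + 8 * T^2 / B * (P0 * E0^2) := by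
  have f1 := four2 c h0 hs T (by linarith) v W e
  have f2 := four2 c h0 hs 1 one_pos v W e
  have g1 := four3 T (by linarith) W e
  have g2 := four3 1 one_pos W e
  have q1 := hQ T hT le_rfl
  have q2 := hQ 1 le_rfl hT
  generalize ∑ m ∈ Ioc 0 W, ∑ m' ∈ Ioc 0 W, e m * (e m' * ∑' a : ℕ, c a * (T * tri (T * (v - Real.log m - Real.log m' - Real.log a)))) = S1 at *
  generalize ∑ m ∈ Ioc 0 W, ∑ m' ∈ Ioc 0 W, e m * (e m' * ∑' a : ℕ, c a * (1 * tri (1 * (v - Real.log m - Real.log m' - Real.log a)))) = S2 at *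
  generalize ∑ m ∈ Ioc 0 W, ∑ m' ∈ Ioc 0 W, e m * (e m' * (T * tri (T * (Real.log m' - Real.log m)))) = Q1 at *
  generalize ∑ m ∈ Ioc 0 W, ∑ m' ∈ Ioc 0 W, e m * (e m' * (1 * tri (1 * (Real.log m' - Real.log m)))) = Q2 at *
  have p0 : 0 ≤ P0 := (norm_nonneg _).trans (hP0 0)
  have hFc : Continuous (fun t => Pc c t * ee (t * v) * Ep W e t * Ep W e t) :=
    (((Pc_cont c h0 hs).mul (ee_cont.comp (by fun_prop))).mul (Ep_cont W e)).mul (Ep_cont W e)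
  have hFn : ∀ t, ‖Pc c t * ee (t * v) * Ep W e t * Ep W e t‖ = ‖Pc c t‖ * ‖Ep W e t‖^2 := by
    intro t
    rw [norm_mul, norm_mul, norm_mul, ee_norm]; ring
  have hFb : ∀ t, ‖Pc c t * ee (t * v) * Ep W e t * Ep W e t‖ ≤ P0 * E0^2 := by
    intro t
    rw [hFn]
    exact mul_le_mul (hP0 t) (pow_le_pow_left₀ (norm_nonneg _) (hE t) 2) (sq_nonneg _) p0
  have i1 := kint T (by linarith) _ hFc _ hFb
  have i2 := kint 1 one_pos _ hFc _ hFb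
  have d := MeasureTheory.integral_sub i1 i2
  rw [f1, f2] at d
  have c1 := cauchy_int A hA
  have c2 := cauchy_int B hB
  have j1 := (kEp_int T (by linarith) W e).const_mul P1
  have j2 := (kEp_int 1 one_pos W e).const_mul P1
  have m1 := c1.1.const_mul (2 * A^2 * (P0 * E0^2))
  have m2 := c2.1.const_mul (16 * T^2 / B^2 * (P0 * E0^2))
  have bound := MeasureTheory.norm_integral_le_of_norm_le ((m1.add (j1.add j2)).add m2)
    (f := fun t => (kn T t : ℂ) * (Pc c t * ee (t * v) * Ep W e t * Ep W e t) - (kn 1 t : ℂ) * (Pc c t * ee (t * v) * Ep W e t * Ep W e t))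
    (Filter.Eventually.of_forall fun t => by
      rw [← sub_mul, norm_mul, hFn, ← Complex.ofReal_sub, Complex.norm_real, Real.norm_eq_abs]
      exact ptw c W e T A B P0 P1 E0 hT hA hA1 hB hP0 hP1 hP hE t)
  rw [d, ← Complex.ofReal_sub, Complex.norm_real, Real.norm_eq_abs, MeasureTheory.integral_add' (m1.add (j1.add j2)) m2, MeasureTheory.integral_add' m1 (j1.add j2),
    MeasureTheory.integral_add' j1 j2] at bound
  rw [MeasureTheory.integral_const_mul, MeasureTheory.integral_const_mul, MeasureTheory.integral_const_mul, MeasureTheory.integral_const_mul, c1.2, c2.2, g1, g2, ← mul_sub, abs_mul, abs_of_pos (by positivity : 0 < 2 * Real.pi)] at bound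
  have q3 := mul_le_mul_of_nonneg_left q1 hP1
  have q4 := mul_le_mul_of_nonneg_left q2 hP1
  have hpi := Real.pi_pos
  generalize P0 * E0^2 = R at *
  have e9 : 2 * A^2 * R * (A * Real.pi) + (P1 * (2 * Real.pi * Q1) + P1 * (2 * Real.pi * Q2)) + 16 * T^2 / B^2 * R * (B * Real.pi)
    = 2 * Real.pi * (A^3 * R + (P1 * Q1 + P1 * Q2) + 8 * T^2 / B * R) := by field_simp; ring
  rw [e9] at bound
  have := le_of_mul_le_mul_left bound (by positivity)
  linarith

end TP

namespace TP
open Finset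

lemma tri_neg (v : ℝ) : tri (-v) = tri v := by unfold tri; rw [abs_neg]

noncomputable def cG (y z : ℕ) (σ : ℝ) (a : ℕ) : ℝ := Gz y z a * (a:ℝ)^(-σ)
noncomputable def eE (z : ℕ) (U : ℝ) (W : ℕ) (σ : ℝ) (m : ℕ) : ℝ := tr W (Ez z U) m * (m:ℝ)^(-σ)

lemma hh_W {z k W : ℕ} {x T σ : ℝ} (P : Pt z k W x T σ) (τ : ℝ) (hτ : 1 ≤ τ) (n : ℕ) (hn : W < n) : hh σ x τ n = 0 := by
  unfold hh
  rw [gg_W P τ hτ n (P.hW.trans (by exact_mod_cast hn.le)), mul_zero]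

lemma Df_hd (W : ℕ) (σ x T : ℝ) (f : AF) : Df W (hd σ x T) f = Df W (fun n => hh σ x T n) f - Df W (fun n => hh σ x 1 n) f := by
  unfold Df hd
  rw [← sum_sub_distrib]
  exact sum_congr rfl fun n _ => by ring

lemma hh_tri (σ x τ : ℝ) (a m m' : ℕ) (hx : 0 < x) (ha : 0 < a) (hm : 0 < m) (hm' : 0 < m') :
    hh σ x τ ((m * (m' * a) : ℕ):ℝ) = (a:ℝ)^(-σ) * (m:ℝ)^(-σ) * (m':ℝ)^(-σ) * (τ * tri (τ * (Real.log x - Real.log m - Real.log m' - Real.log a))) := by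
  have h1 : (0:ℝ) < a := by exact_mod_cast ha
  have h2 : (0:ℝ) < m := by exact_mod_cast hm
  have h3 : (0:ℝ) < m' := by exact_mod_cast hm'
  unfold hh gg
  push_cast
  have h4 : (0:ℝ) < m * (m' * a) := by positivity
  have e1 : ((m:ℝ) * (m' * a))^(1-σ) * ((m:ℝ) * (m' * a))⁻¹ = (a:ℝ)^(-σ) * (m:ℝ)^(-σ) * (m':ℝ)^(-σ) := by
    rw [← Real.rpow_neg_one ((m:ℝ) * (m' * a)), ← Real.rpow_add h4, show 1 - σ + -1 = -σ by ring, Real.mul_rpow h2.le (by positivity), Real.mul_rpow h3.le h1.le]; ring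
  have e2 : Real.log ((m:ℝ) * (m' * a) / x) = -(Real.log x - Real.log m - Real.log m' - Real.log a) := by
    rw [Real.log_div h4.ne' hx.ne', Real.log_mul h2.ne' (by positivity), Real.log_mul h3.ne' h1.ne']; ring
  rw [← mul_assoc, e1, e2, mul_neg, tri_neg]

lemma link {z k W : ℕ} {x T σ : ℝ} (P : Pt z k W x T σ) (y : ℕ) (U : ℝ) (τ : ℝ) (hτ : 1 ≤ τ) :
    Df W (fun n => hh σ x τ n) (Gz y z * Ez z U * Ez z U) =
    ∑ m ∈ Ioc 0 W, ∑ m' ∈ Ioc 0 W, eE z U W σ m * (eE z U W σ m' * ∑' a : ℕ, cG y z σ a * (τ * tri (τ * (Real.log x - Real.log m - Real.log m' - Real.log a)))) := by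
  have hx := P.hx
  rw [Df_tr, show Gz y z * tr W (Ez z U) * tr W (Ez z U) = tr W (Ez z U) * (tr W (Ez z U) * Gz y z) by ring, Df_conv W _ (fun n hn => hh_W P τ hτ n hn)]
  refine sum_congr rfl fun m hm => ?_
  rw [mem_Ioc] at hm
  have e1 := Df_conv W (fun n => hh σ x τ ((m * n : ℕ):ℝ)) (fun n hn => hh_W P τ hτ _ (lt_of_lt_of_le hn (Nat.le_mul_of_pos_left _ hm.1))) (tr W (Ez z U)) (Gz y z)
  unfold Df at e1
  rw [e1, mul_sum]
  refine sum_congr rfl fun m' hm' => ?_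
  rw [mem_Ioc] at hm'
  have h2 : (1:ℝ) ≤ m := by exact_mod_cast hm.1
  have h3 : (1:ℝ) ≤ m' := by exact_mod_cast hm'.1
  have e2 : ∑' a : ℕ, cG y z σ a * (τ * tri (τ * (Real.log x - Real.log m - Real.log m' - Real.log a))) = ∑ a ∈ Ioc 0 W, cG y z σ a * (τ * tri (τ * (Real.log x - Real.log m - Real.log m' - Real.log a))) := by
    refine tsum_eq_sum fun a ha => ?_
    by_cases h0 : a = 0
    · rw [h0]; unfold cG; simp
    have h1 : W < a := by
      by_contra hc
      exact ha (mem_Ioc.mpr ⟨by omega, by omega⟩)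
    rw [tri_zero, mul_zero, mul_zero]
    have h4 : 3 * x ≤ (a:ℝ) := P.hW.trans (by exact_mod_cast h1.le)
    have h5 : Real.log x + 1 ≤ Real.log a := by
      rw [Real.le_log_iff_exp_le (by linarith), Real.exp_add, Real.exp_log (by linarith)]
      nlinarith [Real.exp_one_lt_d9]
    have h6 := Real.log_nonneg h2
    have h7 := Real.log_nonneg h3
    rw [abs_mul, abs_of_nonneg (by linarith : 0 ≤ τ), abs_of_nonpos (by linarith)]
    nlinarith
  rw [e2, mul_sum, mul_sum, mul_sum, mul_sum]
  refine sum_congr rfl fun a ha => ?_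
  rw [mem_Ioc] at ha
  have := hh_tri σ x τ a m m' (by linarith) ha.1 hm.1 hm'.1
  rw [this]
  unfold eE cG; ring

lemma eE_le (z : ℕ) (U : ℝ) (W : ℕ) (σ H : ℝ) (hσ : 1 < σ) (hH : ∀ n ≤ W, |Ez z U n| ≤ H * rA z n) (m : ℕ) (hm : m ∈ Ioc 0 W) :
    |eE z U W σ m| ≤ H * (rA z m * (1/(m:ℝ))) := by
  rw [mem_Ioc] at hm
  have h1 : (1:ℝ) ≤ m := by exact_mod_cast hm.1
  unfold eE
  rw [tr_apply, if_pos hm.2, abs_mul, abs_of_nonneg (Real.rpow_nonneg (by linarith) _)]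
  have h2 : (m:ℝ)^(-σ) ≤ 1/(m:ℝ) := by
    rw [one_div, ← Real.rpow_neg_one]
    exact Real.rpow_le_rpow_of_exponent_le h1 (by linarith)
  have := mul_le_mul (hH m hm.2) h2 (Real.rpow_nonneg (by linarith) _) (le_trans (abs_nonneg _) (hH m hm.2))
  linarith

lemma eE_sum (z : ℕ) (U : ℝ) (W : ℕ) (σ H : ℝ) (hσ : 1 < σ) (hH : ∀ n ≤ W, |Ez z U n| ≤ H * rA z n) :
    ∑ m ∈ Ioc 0 W, |eE z U W σ m| ≤ H * Sn W (rA z) := by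
  unfold Sn
  rw [mul_sum]
  refine sum_le_sum fun m hm => ?_
  rw [abs_of_nonneg (rA_nonneg z m)]
  exact eE_le z U W σ H hσ hH m hm

lemma Qbound {z k W : ℕ} {x T σ : ℝ} (P : Pt z k W x T σ) (U H : ℝ) (hU : 0 < U) (hH0 : 0 ≤ H) (hH : ∀ n ≤ W, |Ez z U n| ≤ H * rA z n) (ha : adm z k U T 1)
    (τ : ℝ) (hτ : 1 ≤ τ) (hτT : τ ≤ T) :
    ∑ m ∈ Ioc 0 W, ∑ m' ∈ Ioc 0 W, eE z U W σ m * (eE z U W σ m' * (τ * tri (τ * (Real.log m' - Real.log m)))) ≤ H^2 * Sn W (rA z) * (1921 / Real.log z) := by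
  have hL := logz_ge P.hz
  have key : ∀ m ∈ Ioc 0 W, ∑ m' ∈ Ioc 0 W, eE z U W σ m * (eE z U W σ m' * (τ * tri (τ * (Real.log m' - Real.log m)))) ≤ |eE z U W σ m| * (H * (1921 / Real.log z)) := by
    intro m hm
    by_cases h0 : eE z U W σ m = 0
    · simp [h0]
    have hmU : U < m := by
      by_contra hc
      push Not at hc
      rw [mem_Ioc] at hm
      apply h0
      unfold eE
      rw [tr_apply, if_pos hm.2, Ez_zero z U m hc, zero_mul]
    have hm1 := (mem_Ioc.mp hm).1
    have hmp : (0:ℝ) < m := by exact_mod_cast hm1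
    have hmW : (m:ℝ) ≤ W := by exact_mod_cast (mem_Ioc.mp hm).2
    have t := (Tgg z k (3*W) m τ T 1 P.hz P.hk hmp (by push_cast; linarith) le_rfl hτ hτT (by
      unfold adm at ha ⊢
      push_cast
      exact ha.trans (mul_le_mul_of_nonneg_left hmU.le (sk_pos k).le))).2
    rw [← mul_sum]
    refine (le_abs_self _).trans ?_
    rw [abs_mul]
    refine mul_le_mul_of_nonneg_left ?_ (abs_nonneg _)
    refine (abs_sum_le_sum_abs _ _).trans ?_
    calc ∑ m' ∈ Ioc 0 W, |eE z U W σ m' * (τ * tri (τ * (Real.log m' - Real.log m)))| ≤ ∑ m' ∈ Ioc 0 W, H * (ro z m' * gg m τ ((1:ℕ) * (m':ℝ))) := by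
          refine sum_le_sum fun m' hm' => ?_
          have hp' : (0:ℝ) < m' := by exact_mod_cast (mem_Ioc.mp hm').1
          have n1 : 0 ≤ τ * tri (τ * (Real.log m' - Real.log m)) := mul_nonneg (by linarith) (tri_nonneg _)
          rw [abs_mul, abs_of_nonneg n1]
          refine (mul_le_mul_of_nonneg_right (eE_le z U W σ H P.hσ hH m' hm') n1).trans (le_of_eq ?_)
          unfold gg
          rw [rA_apply _ _ (by have := (mem_Ioc.mp hm').1; omega), Nat.cast_one, one_mul, Real.log_div hp'.ne' hmp.ne']
          ring
      _ ≤ ∑ m' ∈ Ioc 0 (3*W), H * (ro z m' * gg m τ ((1:ℕ) * (m':ℝ))) := by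
          refine sum_le_sum_of_subset_of_nonneg (Ioc_subset_Ioc_right (by omega)) fun m' _ _ => ?_
          exact mul_nonneg hH0 (mul_nonneg (ro_nonneg _ _) (gg_nonneg _ _ _ (by linarith) (by positivity)))
      _ = H * ∑ m' ∈ Ioc 0 (3*W), (ro z m' * gg m τ ((1:ℕ) * (m':ℝ))) := by rw [mul_sum]
      _ ≤ _ := by
          refine mul_le_mul_of_nonneg_left ?_ hH0
          refine t.trans (le_of_eq ?_)
          rw [Nat.cast_one, one_mul]
  refine (sum_le_sum key).trans ?_
  rw [← sum_mul]
  refine (mul_le_mul_of_nonneg_right (eE_sum z U W σ H P.hσ hH) (by positivity)).trans (le_of_eq (by ring))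

lemma sum_log (f : ℕ → ℝ) (δ : ℝ) (hδ : 0 < δ) (h0 : ∀ n, 0 ≤ f n) (hf : ∀ n, f n ≤ 2 * Real.log n) :
    Summable (fun n : ℕ => f n * (n:ℝ)^(-(1+δ))) ∧ ∑' n : ℕ, f n * (n:ℝ)^(-(1+δ)) ≤ 4/δ * (1 + 2/δ) := by
  have h1 : ∀ n : ℕ, 0 ≤ f n * (n:ℝ)^(-(1+δ)) := fun n => mul_nonneg (h0 n) (Real.rpow_nonneg (Nat.cast_nonneg n) _)
  have h2 : ∀ N : ℕ, ∑ n ∈ range N, f n * (n:ℝ)^(-(1+δ)) ≤ 4/δ * (1 + 2/δ) := by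
    intro N
    have s := sum_rpow_le2 (δ/2) (by linarith) (N+1)
    have e : ∑ n ∈ range N, f n * (n:ℝ)^(-(1+δ)) ≤ ∑ n ∈ range (N+1), f n * (n:ℝ)^(-(1+δ)) :=
      sum_le_sum_of_subset_of_nonneg (range_mono (by omega)) fun n _ _ => h1 n
    refine e.trans ?_
    rw [range_eq_Ico, sum_eq_sum_Ico_succ_bot (by omega)]
    have hf0 : f 0 = 0 := le_antisymm (by have := hf 0; simpa using this) (h0 0)
    rw [hf0, zero_mul, zero_add, zero_add]
    calc ∑ n ∈ Ico 1 (N+1), f n * (n:ℝ)^(-(1+δ)) ≤ ∑ n ∈ Ico 1 (N+1), 4/δ * (n:ℝ)^(-1-δ/2) := by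
          refine sum_le_sum fun n hn => ?_
          rw [mem_Ico] at hn
          have hn1 : (0:ℝ) < n := by exact_mod_cast hn.1
          have l := Real.log_le_rpow_div hn1.le (by linarith : 0 < δ/2)
          have : (n:ℝ)^(-1-δ/2) = (n:ℝ)^(δ/2) * (n:ℝ)^(-(1+δ)) := by rw [← Real.rpow_add hn1]; congr 1; ring
          rw [this, ← mul_assoc]
          refine mul_le_mul_of_nonneg_right ?_ (Real.rpow_nonneg hn1.le _)
          have e3 : 2 * ((n:ℝ)^(δ/2) / (δ/2)) = 4/δ * (n:ℝ)^(δ/2) := by field_simp; ring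
          linarith [hf n]
      _ ≤ _ := by
          rw [← mul_sum]
          refine mul_le_mul_of_nonneg_left (s.trans (le_of_eq ?_)) (by positivity)
          field_simp
  exact ⟨summable_of_sum_range_le h1 h2, Real.tsum_le_of_sum_range_le h1 h2⟩

lemma Lz_le (z n : ℕ) : Lz z n ≤ Real.log n := by
  rw [Lz_apply]
  have := rA_le_one z n
  have h2 : 0 ≤ ArithmeticFunction.vonMangoldt n := ArithmeticFunction.vonMangoldt_nonneg
  have h3 := ArithmeticFunction.vonMangoldt_le_log (n := n)
  nlinarith [rA_nonneg z n]

lemma Gz_apply (y z n : ℕ) : Gz y z n = Lz z n + Rz y z n := by unfold Gz; rfl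
lemma Gz_nonneg (y z n : ℕ) : 0 ≤ Gz y z n := by rw [Gz_apply]; exact add_nonneg (Lz_nonneg _ _) (Rz_nonneg _ _ _)
lemma Gz_le (y z n : ℕ) : Gz y z n ≤ 2 * Real.log n := by
  rw [Gz_apply]
  have : Rz y z n ≤ Real.log n := by
    rw [Rz_apply]; split_ifs
    · exact le_rfl
    · exact Real.log_natCast_nonneg n
  linarith [Lz_le z n]

lemma cG_nonneg (y z : ℕ) (σ : ℝ) (a : ℕ) : 0 ≤ cG y z σ a := mul_nonneg (Gz_nonneg _ _ _) (Real.rpow_nonneg (Nat.cast_nonneg _) _)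

lemma cG_sum (y z : ℕ) (δ : ℝ) (hδ : 0 < δ) : Summable (cG y z (1+δ)) ∧ ∑' a, cG y z (1+δ) a ≤ 4/δ * (1 + 2/δ) :=
  sum_log (fun n => Gz y z n) δ hδ (Gz_nonneg y z) (Gz_le y z)

noncomputable def Cnp : ℝ := ∑' n : ℕ, (if n.Prime then 0 else ArithmeticFunction.vonMangoldt.residueClass (1 : ZMod 1) n) / (n:ℝ)

lemma resC (n : ℕ) : ArithmeticFunction.vonMangoldt.residueClass (1 : ZMod 1) n = ArithmeticFunction.vonMangoldt n := by
  unfold ArithmeticFunction.vonMangoldt.residueClass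
  rw [Set.indicator_of_mem]
  exact Subsingleton.elim _ _

lemma Cnp_nonneg : 0 ≤ Cnp := tsum_nonneg fun n => by
  rw [resC]
  refine div_nonneg ?_ (Nat.cast_nonneg _)
  split_ifs
  · exact le_rfl
  · exact ArithmeticFunction.vonMangoldt_nonneg

lemma Gdiff (y z n : ℕ) (hyz : y ≤ z) (hn : n ≠ 0) : |Gz y z n - ro y n * ArithmeticFunction.vonMangoldt n| ≤ if n.Prime then 0 else ArithmeticFunction.vonMangoldt n := by
  rw [Gz_apply, Lz_apply, Rz_apply, rA_apply _ _ hn]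
  by_cases hp : n.Prime
  · rw [if_pos hp, ArithmeticFunction.vonMangoldt_apply_prime hp]
    have e : ∀ w : ℕ, ro w n = if w < n then 1 else 0 := by
      intro w
      split_ifs with h
      · exact ro_one fun p hp' hpw hd => by
          rw [Nat.prime_dvd_prime_iff_eq hp' hp] at hd; omega
      · exact ro_zero hp (by omega) dvd_rfl
    rw [e, e]
    by_cases h1 : z < n
    · rw [if_pos h1, if_pos (by omega : y < n), if_neg (by omega)]; simp
    · by_cases h2 : y < n
      · rw [if_neg h1, if_pos h2, if_pos ⟨hp, h2, by omega⟩]; simp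
      · rw [if_neg h1, if_neg h2, if_neg (by omega)]; simp
  · rw [if_neg hp, if_neg (fun h => hp h.1), add_zero, ← sub_mul, abs_mul]
    have h2 : 0 ≤ ArithmeticFunction.vonMangoldt n := ArithmeticFunction.vonMangoldt_nonneg
    rw [abs_of_nonneg h2]
    have : |ro z n - ro y n| ≤ 1 := by
      rw [abs_le]; constructor <;> linarith [ro_nonneg z n, ro_nonneg y n, ro_le_one z n, ro_le_one y n]
    nlinarith

lemma PcG (y z : ℕ) (hyz : y ≤ z) (δ : ℝ) (hδ : 0 < δ) (t : ℝ) :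
    ‖Pc (cG y z (1+δ)) t‖ ≤ ‖LSeries (fun n => (ro y n:ℂ)*(ArithmeticFunction.vonMangoldt n:ℂ)) (sp (1+δ) t)‖ + Cnp := by
  set c' : ℕ → ℝ := fun n => (ro y n * ArithmeticFunction.vonMangoldt n) * (n:ℝ)^(-(1+δ)) with hc'
  have h2 : ∀ n : ℕ, 0 ≤ ArithmeticFunction.vonMangoldt n := fun n => ArithmeticFunction.vonMangoldt_nonneg
  have s' := (sum_log (fun n => ro y n * ArithmeticFunction.vonMangoldt n) δ hδ (fun n => mul_nonneg (ro_nonneg _ _) (h2 n)) (fun n => by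
    have h3 := ArithmeticFunction.vonMangoldt_le_log (n := n)
    nlinarith [ro_nonneg y n, ro_le_one y n, h2 n])).1
  have hc0 : ∀ n, 0 ≤ c' n := fun n => mul_nonneg (mul_nonneg (ro_nonneg _ _) (h2 n)) (Real.rpow_nonneg (Nat.cast_nonneg _) _)
  have s1 := (cG_sum y z δ hδ).1
  have e1 : LSeries (fun n => (ro y n:ℂ)*(ArithmeticFunction.vonMangoldt n:ℂ)) (sp (1+δ) t) = Pc c' t := by
    unfold LSeries Pc
    refine tsum_congr fun n => ?_
    by_cases hn : n = 0
    · rw [hn, LSeries.term_zero, hc']; simp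
    · rw [term_sp _ _ _ _ (by omega), hc']; push_cast; ring
  have sA : Summable (fun a : ℕ => (cG y z (1+δ) a : ℂ) * el t a) := Summable.of_norm (by
    simp_rw [Pc_term _ (cG_nonneg y z (1+δ))]; exact s1)
  have sB : Summable (fun a : ℕ => (c' a : ℂ) * el t a) := Summable.of_norm (by
    simp_rw [Pc_term _ hc0]; exact s')
  have hb : ‖Pc (cG y z (1+δ)) t - Pc c' t‖ ≤ Cnp := by
    unfold Pc
    rw [← sA.tsum_sub sB]
    refine tsum_of_norm_bounded (ArithmeticFunction.vonMangoldt.summable_residueClass_non_primes_div (1 : ZMod 1)).hasSum fun n => ?_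
    rw [resC]
    by_cases hn : n = 0
    · rw [hn, hc']; unfold cG; simp
    rw [← sub_mul, norm_mul, el_norm, mul_one, ← Complex.ofReal_sub, Complex.norm_real, Real.norm_eq_abs, hc']
    unfold cG
    beta_reduce
    rw [← sub_mul, abs_mul, div_eq_mul_inv]
    have hn1 : (1:ℝ) ≤ n := by exact_mod_cast Nat.one_le_iff_ne_zero.mpr hn
    refine mul_le_mul (Gdiff y z n hyz hn) ?_ (abs_nonneg _) ?_
    · rw [abs_of_nonneg (Real.rpow_nonneg (by linarith) _), ← Real.rpow_neg_one]
      exact Real.rpow_le_rpow_of_exponent_le hn1 (by linarith)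
    · split_ifs
      · exact le_rfl
      · exact h2 n
  rw [e1]
  have := norm_add_le (Pc c' t) (Pc (cG y z (1+δ)) t - Pc c' t)
  rw [add_sub_cancel] at this
  linarith

end TP

namespace TP
open Finset

lemma Df_R {z k W : ℕ} {x T σ : ℝ} (P : Pt z k W x T σ) (y : ℕ) (hzx : (z:ℝ) ≤ x / 3) : Df W (hd σ x T) (Rz y z) = 0 := by
  unfold Df
  refine sum_eq_zero fun n hn => ?_
  by_cases h : Rz y z n = 0
  · rw [h, zero_mul]
  · rw [mem_Ioc] at hn
    have h1 := Rz_Sp y z n h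
    have h2 := hd_le P n (by omega)
    rw [hp_L P n (by omega) (by linarith)] at h2
    rw [abs_eq_zero.mp (le_antisymm h2 (abs_nonneg _)), mul_zero]

lemma arith1 (S κ s L lW : ℝ) (hS : 1 ≤ S) (hκ : 1 ≤ κ) (hs : 0 ≤ s) (hL : 1 ≤ L) (hlW : lW ≤ κ * L) :
    2 * (S * (2 * (lW * (12000 * s / L)) + 4000 / L)) + S^2 * (lW * (24000 * s / L * S + 216000 / L^2) + 4000 / L * S)
     + 2 * (12000 * s / L * (3 * L * S)) + (24000 * s / L * S + 216000 / L^2) * (3 * L * S^2) ≤ 10^6 * κ * S^3 * (s + 1 / L) := by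
  have hL0 : 0 < L := by linarith
  set i := 1 / L with hi
  have hi0 : 0 < i := by positivity
  have e1 : 12000 * s / L = 12000 * s * i := by rw [hi]; ring
  have e2 : 4000 / L = 4000 * i := by rw [hi]; ring
  have e3 : 24000 * s / L = 24000 * s * i := by rw [hi]; ring
  have e4 : 216000 / L^2 = 216000 * i * i := by rw [hi]; field_simp
  have e5 : i * L = 1 := by rw [hi]; field_simp
  rw [e1, e2, e3, e4]
  have h6 : lW * i ≤ κ := by
    have := mul_le_mul_of_nonneg_right hlW hi0.le
    rw [mul_assoc, mul_comm L, e5] at this; linarith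
  have S2 : S ≤ S^2 := by nlinarith
  have S3 : S^2 ≤ S^3 := by nlinarith [sq_nonneg S]
  have S0 : 0 ≤ S := by linarith
  have k0 : 0 ≤ κ := by linarith
  have b1 : S * s * (lW * i) ≤ κ * S^3 * s := by
    have := mul_le_mul_of_nonneg_left h6 (mul_nonneg S0 hs)
    have h7 := mul_le_mul_of_nonneg_right (S2.trans S3) (mul_nonneg k0 hs)
    linarith
  have b2 : S^3 * s * (lW * i) ≤ κ * S^3 * s := by
    have := mul_le_mul_of_nonneg_left h6 (mul_nonneg (pow_nonneg S0 3) hs)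
    linarith
  have b3 : S^2 * i * (lW * i) ≤ κ * S^3 * i := by
    have := mul_le_mul_of_nonneg_left h6 (mul_nonneg (pow_nonneg S0 2) hi0.le)
    have h7 := mul_le_mul_of_nonneg_right S3 (mul_nonneg k0 hi0.le)
    linarith
  have kS : S^3 ≤ κ * S^3 := le_mul_of_one_le_left (pow_nonneg S0 3) hκ
  have b4 : S * i ≤ κ * S^3 * i := mul_le_mul_of_nonneg_right (by linarith) hi0.le
  have b5 : S^2 * i ≤ κ * S^3 * i := mul_le_mul_of_nonneg_right (by linarith) hi0.le
  have b6 : S^3 * i ≤ κ * S^3 * i := mul_le_mul_of_nonneg_right (by linarith) hi0.le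
  have b7 : S * s ≤ κ * S^3 * s := mul_le_mul_of_nonneg_right (by linarith) hs
  have b8 : S^3 * s ≤ κ * S^3 * s := mul_le_mul_of_nonneg_right (by linarith) hs
  have e : 2 * (S * (2 * (lW * (12000 * s * i)) + 4000 * i)) + S^2 * (lW * (24000 * s * i * S + 216000 * i * i) + 4000 * i * S)
     + 2 * (12000 * s * i * (3 * L * S)) + (24000 * s * i * S + 216000 * i * i) * (3 * L * S^2)
     = 48000 * (S * s * (lW * i)) + 8000 * (S * i) + 24000 * (S^3 * s * (lW * i)) + 216000 * (S^2 * i * (lW * i)) + 4000 * (S^3 * i)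
       + 72000 * (S * s) * (i * L) + 72000 * (S^3 * s) * (i * L) + 648000 * (S^2 * i) * (i * L) := by ring
  rw [e, e5]
  have n1 : 0 ≤ κ * S^3 * s := by positivity
  have n2 : 0 ≤ κ * S^3 * i := by positivity
  linarith

lemma mainDet {z k W : ℕ} {x T δ : ℝ} (P : Pt z k W x T (1+δ)) (hδ : 0 < δ) (y : ℕ) (hyz : y ≤ z) (U H S κ D2 A B P1 : ℝ)
    (hU : 1 ≤ U) (hH0 : 0 ≤ H) (hH : ∀ n ≤ W, |Ez z U n| ≤ H * rA z n)
    (hzx : (z:ℝ) ≤ x / 3) (a1 : adm z k x T (z * U)) (hD2 : 3 * x * (z * (U * U)) ≤ D2^2) (hD20 : 0 ≤ D2) (a2 : adm z k x T D2) (a3 : adm z k U T 1)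
    (hS1 : 1 ≤ S) (hSr : Sn W (rA z) ≤ S) (hSM : Sn W (Mz z U) ≤ S) (hκ : 1 ≤ κ) (hW : Real.log W ≤ κ * Real.log z)
    (hA : 0 < A) (hA1 : A ≤ 1) (hB : 0 < B) (hP1 : 0 ≤ P1) (hP : ∀ t, A ≤ |t| → |t| ≤ B → ‖Pc (cG y z (1+δ)) t‖ ≤ P1) :
    |Df W (hd (1+δ) x T) (Lz z)| ≤ 10^6 * κ * S^3 * (sk k + 1 / Real.log z) +
      (A^3 * (4/δ * (1 + 2/δ) * (H * S)^2) + 2 * P1 * (H^2 * S * (1921 / Real.log z)) + 8 * T^2 / B * (4/δ * (1 + 2/δ) * (H * S)^2)) := by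
  have hL := logz_ge P.hz
  have hs := sk_pos k
  have hz1 : (1:ℝ) ≤ z := by have := P.hz; exact_mod_cast (by omega : 1 ≤ z)
  have hU0 : 0 ≤ U := by linarith
  -- type II
  have cs := cG_sum y z δ hδ
  have t2 := typeII (cG y z (1+δ)) (cG_nonneg y z (1+δ)) cs.1 W (eE z U W (1+δ)) (Real.log x) T A B (4/δ * (1 + 2/δ)) P1 (H * S) (H^2 * S * (1921 / Real.log z)) P.hT hA hA1 hB
    (fun t => (Pc_le _ (cG_nonneg y z (1+δ)) cs.1 t).trans cs.2) hP1 hP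
    (fun t => (Ep_le W _ t).trans ((eE_sum z U W (1+δ) H P.hσ hH).trans (mul_le_mul_of_nonneg_left hSr hH0)))
    (fun τ h1 h2 => (Qbound P U H (by linarith) hH0 hH a3 τ h1 h2).trans (by
      refine mul_le_mul_of_nonneg_right (mul_le_mul_of_nonneg_left hSr (by positivity)) (by positivity)))
  rw [← link P y U T P.hT, ← link P y U 1 le_rfl, ← Df_hd] at t2
  have hMS := Sn_nonneg W (Mz z U)
  have hrS := Sn_nonneg W (rA z)
  have hRR := Sn_Rz y z W P.hz
  have hRn := Sn_nonneg W (Rz y z)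
  have hlW := logW_nonneg P
  have hUz : U ≤ z * U := le_mul_of_one_le_left hU0 hz1
  have j1 := J1 P (Mz z U) (Mz_Sp z U) (adm_mono P (by exact hUz) a1)
  have sMM : Sp (U * U) (Mz z U * Mz z U) := Sp_mul hU0 (Mz_Sp z U) (Mz_Sp z U)
  have SnMM : Sn W (Mz z U * Mz z U) ≤ S^2 := (Sn_mul W _ _).trans (by rw [sq]; exact mul_le_mul hSM hSM hMS (by linarith))
  have hx := P.hx
  have j2 := J2 P (D := U * U) (D2 := D2) ((by
    have : U * U ≤ z * (U * U) := le_mul_of_one_le_left (by positivity) hz1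
    exact mul_le_mul_of_nonneg_left this (by linarith) : 3 * x * (U * U) ≤ 3 * x * (z * (U * U))).trans hD2) hD20 a2 _ sMM
  have i1 := I1 P (Rz y z * Mz z U) (Sp_mul (by linarith) (Rz_Sp y z) (Mz_Sp z U)) a1
  have i2 := I2 P hD2 hD20 a2 (Rz y z * (Mz z U * Mz z U)) (Sp_mul (by linarith) (Rz_Sp y z) sMM)
  have SnRM : Sn W (Rz y z * Mz z U) ≤ 3 * Real.log z * S := (Sn_mul W _ _).trans (mul_le_mul hRR hSM hMS (by linarith))
  have SnRMM : Sn W (Rz y z * (Mz z U * Mz z U)) ≤ 3 * Real.log z * S^2 := (Sn_mul W _ _).trans (mul_le_mul hRR SnMM (Sn_nonneg _ _) (by linarith))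
  have n0 := Sn_nonneg W (Mz z U * Mz z U)
  have hr := Df_R (σ := 1+δ) P y hzx
  have id := GEE y z U W (hd (1+δ) x T)
  rw [hr] at id
  have ar := arith1 S κ (sk k) (Real.log z) (Real.log W) hS1 hκ hs.le hL hW
  generalize sk k = s at *
  generalize Real.log z = L at *
  generalize Real.log (W:ℝ) = lW at *
  have m1 : 0 ≤ 2 * (lW * (12000 * s / L)) + 4000 / L := by positivity
  have J1' := j1.trans (mul_le_mul_of_nonneg_right hSM m1)
  have m2 : 24000 * s / L * Sn W (rA z) + 216000 / L^2 ≤ 24000 * s / L * S + 216000 / L^2 :=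
    add_le_add (mul_le_mul_of_nonneg_left hSr (by positivity)) le_rfl
  have m3 : 0 ≤ 24000 * s / L * Sn W (rA z) + 216000 / L^2 := by positivity
  have m4 : lW * (24000 * s / L * Sn W (rA z) + 216000 / L^2) + 4000 / L * Sn W (rA z) ≤ lW * (24000 * s / L * S + 216000 / L^2) + 4000 / L * S :=
    add_le_add (mul_le_mul_of_nonneg_left m2 hlW) (mul_le_mul_of_nonneg_left hSr (by positivity))
  have J2' := j2.trans (mul_le_mul SnMM m4 (by positivity) (sq_nonneg S))
  have I1' := i1.trans (mul_le_mul_of_nonneg_left SnRM (by positivity))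
  have I2' := i2.trans (mul_le_mul m2 SnRMM (Sn_nonneg _ _) (m3.trans m2))
  generalize Df W (hd (1+δ) x T) (Gz y z * Ez z U * Ez z U) = X1 at *
  generalize Df W (hd (1+δ) x T) (lg (rA z) * Mz z U) = X2 at *
  generalize Df W (hd (1+δ) x T) (lg (rA z) * rA z * (Mz z U * Mz z U)) = X3 at *
  generalize Df W (hd (1+δ) x T) (Rz y z * Mz z U * rA z) = X4 at *
  generalize Df W (hd (1+δ) x T) (Rz y z * (Mz z U * Mz z U) * (rA z * rA z)) = X5 at *
  have fin : |X1 + 2 * X2 - X3 - 0 + 2 * X4 - X5| ≤ |X1| + 2 * |X2| + |X3| + 2 * |X4| + |X5| := by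
    rw [abs_le]
    constructor <;> linarith [neg_abs_le X1, neg_abs_le X2, neg_abs_le X3, neg_abs_le X4, neg_abs_le X5, le_abs_self X1, le_abs_self X2, le_abs_self X3, le_abs_self X4, le_abs_self X5]
  rw [id]
  linarith

end TP

namespace TP
open Finset

lemma theta_win : ∃ x0 : ℝ, 4 ≤ x0 ∧ ∀ x, x0 ≤ x →
    (1/5) * x ≤ Chebyshev.theta (41/25 * x) - Chebyshev.theta (13/20 * x) := by
  have h := (isLittleO_log_rpow_atTop (show (0:ℝ) < 1/2 by norm_num)).bound (show (0:ℝ) < 1/250 by norm_num)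
  obtain ⟨y0, hy0⟩ := Filter.eventually_atTop.mp h
  refine ⟨max 4 y0, le_max_left _ _, fun x hx => ?_⟩
  have hx4 : 4 ≤ x := le_trans (le_max_left _ _) hx
  have hxy : y0 ≤ x := le_trans (le_max_right _ _) hx
  set y : ℝ := 41/25 * x with hy
  have h1 := hy0 y (by linarith)
  have hy4 : 4 ≤ y := by linarith
  have hl : Real.log 2 ≤ Real.log y := Real.log_le_log (by norm_num) (by linarith)
  have hl2 := Real.log_two_gt_d9
  have hl3 := Real.log_two_lt_d9
  rw [Real.norm_of_nonneg (by linarith), Real.norm_of_nonneg (by positivity), ← Real.sqrt_eq_rpow] at h1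
  have hs : 1 ≤ √y := Real.one_le_sqrt.mpr (by linarith)
  have hsq : √y * √y = y := Real.mul_self_sqrt (by linarith)
  have h2 := Chebyshev.theta_ge' (x := y) (by linarith)
  have h3 := Chebyshev.theta_le_log4_mul_x (x := 13/20 * x) (by linarith)
  have h4 : Real.log 4 = 2 * Real.log 2 := by
    rw [show (4:ℝ) = 2^2 by norm_num, Real.log_pow]; norm_num
  have h5 : Real.log (y+2) ≤ 2 * Real.log y := by
    have : 2 * Real.log y = Real.log (y^2) := by rw [Real.log_pow]; norm_num
    rw [this]
    exact Real.log_le_log (by linarith) (by nlinarith)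
  have h6 : √y * Real.log y ≤ 1/250 * y := by
    calc _ ≤ √y * (1/250 * √y) := by gcongr
      _ = 1/250 * (√y * √y) := by ring
      _ = _ := by rw [hsq]
  have h7 : Real.log y ≤ √y * Real.log y := by nlinarith
  rw [h4] at h3
  nlinarith

lemma cheb_low : ∃ x0 : ℝ, 4 ≤ x0 ∧ ∀ x, x0 ≤ x → ∀ z W : ℕ, ∀ δ : ℝ, 0 ≤ δ → δ * Real.log (2*x) ≤ 2 →
    (z:ℝ) ≤ x / 2 → 2 * x ≤ W → 1/200 ≤ Df W (fun n => hh (1+δ) x 1 n) (Lz z) := by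
  obtain ⟨x0, h40, hth⟩ := theta_win
  refine ⟨x0, h40, fun x hx z W δ hδ hδx hz hW => ?_⟩
  have hx4 : 4 ≤ x := le_trans h40 hx
  have h1 := hth x hx
  set F := (Ioc 0 W).filter (fun n : ℕ => n.Prime ∧ 13/20 * x < n ∧ (n:ℝ) ≤ 41/25 * x) with hF
  have h2 : Chebyshev.theta (41/25 * x) - Chebyshev.theta (13/20 * x) ≤ ∑ n ∈ F, Real.log n := by
    unfold Chebyshev.theta
    rw [sub_le_iff_le_add]
    rw [← sum_sdiff (s₁ := (Ioc 0 ⌊13/20 * x⌋₊).filter Nat.Prime) (s₂ := (Ioc 0 ⌊41/25 * x⌋₊).filter Nat.Prime)]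
    · refine add_le_add ?_ le_rfl
      refine sum_le_sum_of_subset_of_nonneg ?_ fun n _ _ => Real.log_natCast_nonneg n
      intro n hn
      simp only [mem_sdiff, mem_filter, mem_Ioc, not_and] at hn
      obtain ⟨⟨⟨a, b⟩, c⟩, d⟩ := hn
      have b' := (Nat.le_floor_iff (by linarith)).mp b
      simp only [hF, mem_filter, mem_Ioc]
      refine ⟨⟨a, ?_⟩, c, ?_, b'⟩
      · have : (n:ℝ) ≤ W := by linarith
        exact_mod_cast this
      · by_contra hc
        exact d ⟨a, Nat.le_floor (by linarith)⟩ c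
    · intro n hn
      simp only [mem_filter, mem_Ioc] at hn ⊢
      refine ⟨⟨hn.1.1, hn.1.2.trans (Nat.floor_le_floor (by linarith))⟩, hn.2⟩
  have h3 : ∀ n ∈ F, Real.log n * (13/100 * (1/2) * (25/41) / x) ≤ Lz z n * hh (1+δ) x 1 n := by
    intro n hn
    simp only [hF, mem_filter, mem_Ioc] at hn
    obtain ⟨⟨hn0, hnW⟩, hp, hn1, hn2⟩ := hn
    have hnR : (0:ℝ) < n := by exact_mod_cast hn0
    have hzn : z < n := by
      have : (z:ℝ) < n := by linarith
      exact_mod_cast this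
    have e : Lz z n = Real.log n := by
      rw [Lz_apply, rA_apply z n (by omega), ro_one, ArithmeticFunction.vonMangoldt_apply_prime hp, one_mul]
      intro q hq hqz hd
      rw [Nat.prime_dvd_prime_iff_eq hq hp] at hd; omega
    rw [e]
    refine mul_le_mul_of_nonneg_left ?_ (Real.log_natCast_nonneg n)
    unfold hh gg
    have t1 : 1/2 ≤ tri (1 * Real.log (n/x)) := by
      have ha : |Real.log (n/x)| ≤ 1/2 := by
        rw [abs_le]
        constructor
        · rw [Real.le_log_iff_exp_le (by positivity), le_div_iff₀ (by linarith)]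
          have : Real.exp (-(1/2)) ≤ 13/20 := by
            have h := Real.exp_one_gt_d9
            have e1 : Real.exp (-(1/2)) * Real.exp (-(1/2)) * Real.exp 1 = 1 := by
              rw [← Real.exp_add, ← Real.exp_add]; norm_num
            by_contra hc
            push Not at hc
            have : (13/20:ℝ) * (13/20) ≤ Real.exp (-(1/2)) * Real.exp (-(1/2)) := by nlinarith
            nlinarith
          nlinarith
        · rw [Real.log_le_iff_le_exp (by positivity), div_le_iff₀ (by linarith)]
          have : 41/25 ≤ Real.exp (1/2) := by
            have h := Real.exp_one_gt_d9
            have e1 : Real.exp (1/2) * Real.exp (1/2) = Real.exp 1 := by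
              rw [← Real.exp_add]; norm_num
            have := Real.exp_pos (1/2)
            by_contra hc
            push Not at hc
            nlinarith
          nlinarith
      rw [one_mul]
      exact le_trans (by linarith) (le_max_right _ _)
    have t2 : 13/100 ≤ (n:ℝ)^(1-(1+δ)) := by
      rw [Real.rpow_def_of_pos hnR]
      have : Real.log n ≤ Real.log (2*x) := Real.log_le_log hnR (by linarith)
      have h5 : -2 ≤ Real.log n * (1-(1+δ)) := by nlinarith
      refine le_trans ?_ (Real.exp_le_exp.mpr h5)
      have h := Real.exp_one_lt_d9
      have e1 : Real.exp (-2) * (Real.exp 1 * Real.exp 1) = 1 := by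
        rw [← Real.exp_add, ← Real.exp_add]; norm_num
      have := Real.exp_pos 1
      have h6 : Real.exp 1 * Real.exp 1 ≤ 7.39 := by nlinarith
      have := Real.exp_pos (-2)
      nlinarith
    have t3 : 25/41 / x ≤ (n:ℝ)⁻¹ := by
      rw [div_le_iff₀ (by linarith), inv_mul_eq_div, le_div_iff₀ hnR]
      linarith
    calc _ = 13/100 * ((25/41/x) * (1 * (1/2))) := by ring
      _ ≤ _ := by gcongr
  calc (1:ℝ)/200 ≤ (1/5 * x) * (13/100 * (1/2) * (25/41) / x) := by
        rw [show (1/5 * x) * (13/100 * (1/2) * (25/41) / x) = 1/5*(13/100 * (1/2) * (25/41)) by field_simp]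
        norm_num
    _ ≤ (∑ n ∈ F, Real.log n) * (13/100 * (1/2) * (25/41) / x) := by
        refine mul_le_mul_of_nonneg_right (by linarith) (by positivity)
    _ = ∑ n ∈ F, Real.log n * (13/100 * (1/2) * (25/41) / x) := by rw [sum_mul]
    _ ≤ ∑ n ∈ F, Lz z n * hh (1+δ) x 1 n := sum_le_sum h3
    _ ≤ _ := by
        refine sum_le_sum_of_subset_of_nonneg (filter_subset _ _) fun n _ _ => ?_
        exact mul_nonneg (Lz_nonneg z n) (hh_nonneg _ _ _ _ zero_le_one (Nat.cast_nonneg n))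

lemma prime_up (X T a : ℝ) (z W : ℕ) (δ : ℝ) (hX : 1 ≤ X) (hT : 0 < T) (hδ : 0 ≤ δ)
    (ha : X / 2 ≤ a) (haT : a ≤ X * Real.exp (-(2/T)))
    (huniq : ∀ p q : ℕ, p.Prime → q.Prime → a ≤ p → (p:ℝ) ≤ X → a ≤ q → (q:ℝ) ≤ X → p = q) :
    Df W (fun n => hh (1+δ) (X * Real.exp (-(1/T))) T n) (Lz z) ≤ 2 * T / X * (3 * √X * Real.log X) := by
  set x := X * Real.exp (-(1/T)) with hx
  have hx0 : 0 < x := by positivity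
  set G := (Ioc 0 ⌊X⌋₊).filter (fun n : ℕ => a ≤ n) with hG
  have h1 : Df W (fun n => hh (1+δ) x T n) (Lz z) ≤ ∑ n ∈ G, 2 * T / X * ArithmeticFunction.vonMangoldt n := by
    unfold Df
    have hnn : ∀ n : ℕ, 0 ≤ ArithmeticFunction.vonMangoldt n := fun n => ArithmeticFunction.vonMangoldt_nonneg
    calc _ ≤ ∑ n ∈ (Ioc 0 W).filter (fun n : ℕ => a ≤ n ∧ (n:ℝ) ≤ X), Lz z n * hh (1+δ) x T n := by
          rw [← sum_filter_add_sum_filter_not (Ioc 0 W) (fun n : ℕ => a ≤ n ∧ (n:ℝ) ≤ X)]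
          rw [add_le_iff_nonpos_right]
          refine le_of_eq (sum_eq_zero fun n hn => ?_)
          simp only [mem_filter, mem_Ioc] at hn
          obtain ⟨⟨hn0, _⟩, hn⟩ := hn
          have hnR : (0:ℝ) < n := by exact_mod_cast hn0
          have : gg x T n = 0 := by
            by_cases h : a ≤ n
            · have h2 : X < n := by
                by_contra hc; exact hn ⟨h, by linarith⟩
              refine gg_zero_high x T n hx0 hT hnR ?_
              rw [hx, mul_assoc, ← Real.exp_add, neg_add_cancel, Real.exp_zero, mul_one]; exact h2.le
            · refine gg_zero_low x T n hx0 hT hnR ?_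
              rw [hx, mul_assoc, ← Real.exp_add]
              rw [show -(1/T) + -(1/T) = -(2/T) by ring]
              linarith
          unfold hh
          simp only [this, mul_zero]
      _ ≤ ∑ n ∈ (Ioc 0 W).filter (fun n : ℕ => a ≤ n ∧ (n:ℝ) ≤ X), 2 * T / X * ArithmeticFunction.vonMangoldt n := by
          refine sum_le_sum fun n hn => ?_
          simp only [mem_filter, mem_Ioc] at hn
          obtain ⟨⟨hn0, _⟩, hn1, hn2⟩ := hn
          have hnR : (1:ℝ) ≤ n := by exact_mod_cast hn0
          have a1 : Lz z n ≤ ArithmeticFunction.vonMangoldt n := by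
            rw [Lz_apply]; nlinarith [rA_le_one z n, hnn n]
          have a2 : hh (1+δ) x T n ≤ 2 * T / X := by
            refine (hh_le _ _ _ _ (by linarith) hT.le hnR).trans ?_
            unfold gg
            have b1 := tri_le_one (T * Real.log (n/x))
            have b0 := tri_nonneg (T * Real.log (n/x))
            have b2 : (n:ℝ)⁻¹ ≤ 2/X := by
              rw [inv_le_comm₀ (by linarith) (by positivity)]
              rw [inv_div]; linarith
            calc _ ≤ 2/X * (T * 1) := by gcongr
              _ = _ := by ring
          calc _ ≤ ArithmeticFunction.vonMangoldt n * (2 * T / X) :=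
                mul_le_mul a1 a2 (hh_nonneg _ _ _ _ hT.le (by linarith)) (hnn n)
            _ = _ := by ring
      _ ≤ _ := by
          refine sum_le_sum_of_subset_of_nonneg ?_ fun n _ _ => by have := hnn n; positivity
          intro n hn
          simp only [mem_filter, mem_Ioc, hG] at hn ⊢
          exact ⟨⟨hn.1.1, Nat.le_floor hn.2.2⟩, hn.2.1⟩
  refine h1.trans ?_
  rw [← mul_sum]
  refine mul_le_mul_of_nonneg_left ?_ (by positivity)
  rw [← sum_filter_add_sum_filter_not G Nat.Prime]
  have hlX : 0 ≤ Real.log X := Real.log_nonneg hX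
  have h2 : ∑ n ∈ G.filter Nat.Prime, ArithmeticFunction.vonMangoldt n ≤ Real.log X := by
    have hc : (G.filter Nat.Prime).card ≤ 1 := by
      rw [card_le_one]
      intro p hp q hq
      simp only [mem_filter, mem_Ioc, hG] at hp hq
      exact huniq p q hp.2 hq.2 hp.1.2 ((Nat.le_floor_iff (by linarith)).mp hp.1.1.2) hq.1.2 ((Nat.le_floor_iff (by linarith)).mp hq.1.1.2)
    calc _ ≤ (G.filter Nat.Prime).card • Real.log X := by
          refine sum_le_card_nsmul _ _ _ fun n hn => ?_
          simp only [mem_filter, mem_Ioc, hG] at hn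
          refine ArithmeticFunction.vonMangoldt_le_log.trans (Real.log_le_log ?_ ((Nat.le_floor_iff (by linarith)).mp hn.1.1.2))
          exact_mod_cast hn.1.1.1
      _ ≤ 1 • Real.log X := by gcongr
      _ = _ := one_smul _ _
  have h3 : ∑ n ∈ G.filter (fun n => ¬ n.Prime), ArithmeticFunction.vonMangoldt n ≤ 2 * √X * Real.log X := by
    refine le_trans ?_ (Chebyshev.psi_sub_theta_le hX)
    rw [Chebyshev.psi_sub_theta_eq_sum_not_prime]
    refine sum_le_sum_of_subset_of_nonneg ?_ fun n _ _ => ArithmeticFunction.vonMangoldt_nonneg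
    exact filter_subset_filter _ (filter_subset _ _)
  have hs : 1 ≤ √X := Real.one_le_sqrt.mpr hX
  nlinarith

end TP

namespace TP
open Finset

lemma root_bd (N : ℕ) (hN : 1 ≤ N) (X : ℝ) (hX : 1 ≤ X) (h : 4 ≤ X^(1/(N:ℝ))) :
    4 ≤ ⌊X^(1/(N:ℝ))⌋₊ ∧ ((⌊X^(1/(N:ℝ))⌋₊ : ℕ) : ℝ)^N ≤ X ∧ X ≤ ((⌊X^(1/(N:ℝ))⌋₊ : ℕ) : ℝ)^(2*N) := by
  have hX0 : 0 ≤ X := by linarith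
  have hN0 : (N:ℝ) ≠ 0 := by positivity
  have e : (X^(1/(N:ℝ)))^N = X := by
    rw [← Real.rpow_natCast, ← Real.rpow_mul hX0, one_div, inv_mul_cancel₀ hN0, Real.rpow_one]
  generalize X^(1/(N:ℝ)) = u at *
  have h1 : ((⌊u⌋₊:ℕ):ℝ) ≤ u := Nat.floor_le (by linarith)
  have h2 : u < ((⌊u⌋₊:ℕ):ℝ) + 1 := Nat.lt_floor_add_one u
  refine ⟨Nat.le_floor (by exact_mod_cast h), ?_, ?_⟩
  · rw [← e]; exact pow_le_pow_left₀ (Nat.cast_nonneg _) h1 N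
  · rw [pow_mul]
    nth_rewrite 1 [← e]
    exact pow_le_pow_left₀ (by linarith) (by nlinarith) N

lemma aux1 (X : ℝ) (h : 36 ≤ X) : 3*X+1 ≤ X^2 := by nlinarith
lemma aux2 (l : ℝ) (h : 1 ≤ l) : 4*l*(1+2*l) ≤ 12*l^2 := by nlinarith
lemma aux3 (X e : ℝ) (h : 0 ≤ X) (he : e ≤ 1) : X * e ≤ X := by nlinarith
lemma aux4 (X e : ℝ) (h : 0 ≤ X) (he : 1/2 ≤ e) : X / 2 ≤ X * e := by nlinarith

lemma aux5 (s X : ℝ) (h : s * s = X) (h6 : 6 ≤ s) : s ≤ X / 6 := by nlinarith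

set_option maxHeartbeats 1000000 in
lemma det2 {X : ℝ} {j M z y R : ℕ} {C : ℝ} (hM : M = 2^j) (hj : 5 ≤ j) (hX : 36 ≤ X) (hz4 : 4 ≤ z) (hzN : (z:ℝ)^(400*M) ≤ X)
    (hz2 : X ≤ (z:ℝ)^(2*(400*M))) (hy4 : 4 ≤ y) (hyz : y ≤ z) (hyN : (y:ℝ)^R ≤ X) (hy2 : X ≤ (y:ℝ)^(2*R)) (hR : 1 ≤ R) (hC : 0 ≤ C)
    (E1 : 1 / Real.log X ≤ sk (M-2)) (E3 : 8 * Real.log X ≤ sk (M-2) * X^((1:ℝ)/100))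
    (hP : ∀ t, 1 / Real.log y ≤ |t| → |t| ≤ (y:ℝ)^(2*R) → ‖Pc (cG y z (1+1/Real.log X)) t‖ ≤ C * Real.log y) (H S : ℝ)
    (hH : H = 2^(1600*M)) (hS : S = Real.exp (12 * ((j+11:ℕ):ℝ))) :
    |Df ⌈3*X⌉₊ (hd (1+1/Real.log X) (X * Real.exp (-(1/(2*X^((1:ℝ)/5))))) (2*X^((1:ℝ)/5))) (Lz z)| ≤
      10^6 * (1600*M) * S^3 * (sk (M-2) + 800*M/Real.log X) +
      ((2*R/Real.log X)^3 * (12 * (Real.log X)^2 * (H*S)^2) + 2 * (C * (Real.log X / R)) * (H^2 * S * (1921 * (800*M/Real.log X)))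
        + 32 * X^((2:ℝ)/5) / X * (12 * (Real.log X)^2 * (H*S)^2)) := by
  have hM32 : 32 ≤ M := by
    rw [hM]; calc 32 = 2^5 := by norm_num
      _ ≤ 2^j := Nat.pow_le_pow_right (by norm_num) hj
  have hX0 : 0 < X := by linarith
  have hX1 : 1 ≤ X := by linarith
  set T := 2*X^((1:ℝ)/5) with hT
  set x := X * Real.exp (-(1/T)) with hx
  set ℓ := Real.log X with hℓ
  clear_value x T ℓ
  have hT2 : 2 ≤ T := by
    have := Real.one_le_rpow hX1 (show (0:ℝ) ≤ 1/5 by norm_num); linarith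
  have hxX : x ≤ X := by
    have h0 : 0 < 1/T := by positivity
    have : Real.exp (-(1/T)) ≤ 1 := Real.exp_le_one_iff.mpr (by linarith)
    rw [hx]; exact aux3 X _ hX0.le this
  have hxX2 : X / 2 ≤ x := by
    have h1 := Real.add_one_le_exp (-(1/T))
    have h2 : 1/T ≤ 1/2 := one_div_le_one_div_of_le (by norm_num) hT2
    rw [hx]; exact aux4 X _ hX0.le (by linarith)
  have hℓ1 : 1 ≤ ℓ := by
    rw [hℓ, Real.le_log_iff_exp_le hX0]; linarith [Real.exp_one_lt_d9]
  have hℓ0 : 0 < ℓ := by linarith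
  have hz1 : (1:ℝ) ≤ z := by exact_mod_cast (by omega : 1 ≤ z)
  have hy1 : (1:ℝ) ≤ y := by exact_mod_cast (by omega : 1 ≤ y)
  have hlz : 1 ≤ Real.log z := logz_ge (by omega)
  have hly : 1 ≤ Real.log y := logz_ge (by omega)
  have hMR : (0:ℝ) < M := by exact_mod_cast (by omega : 0 < M)
  have hRR : (0:ℝ) < R := by exact_mod_cast (by omega : 0 < R)
  have lz2 : ℓ ≤ 800 * M * Real.log z := by
    have := Real.log_le_log hX0 hz2
    rw [Real.log_pow] at this; push_cast at this
    linarith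
  have ly2 : ℓ ≤ 2 * R * Real.log y := by
    have := Real.log_le_log hX0 hy2
    rw [Real.log_pow] at this; push_cast at this
    linarith
  have ly1 : R * Real.log y ≤ ℓ := by
    have := Real.log_le_log (by positivity) hyN
    rw [Real.log_pow] at this
    linarith
  have z100 : (z:ℝ)^(4*M) ≤ X^((1:ℝ)/100) := by
    rw [← Real.rpow_natCast]
    calc (z:ℝ)^((4*M:ℕ):ℝ) = ((z:ℝ)^(400*M))^((1:ℝ)/100) := by
          rw [← Real.rpow_natCast, ← Real.rpow_mul (by linarith)]
          congr 1; push_cast; ring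
      _ ≤ _ := Real.rpow_le_rpow (by positivity) hzN (by norm_num)
  have zle : (z:ℝ) ≤ X^((1:ℝ)/100) := (le_self_pow₀ hz1 (by omega)).trans z100
  have zX : (z:ℝ) ≤ X := (le_self_pow₀ hz1 (by omega)).trans hzN
  have lzℓ : Real.log z ≤ ℓ := by rw [hℓ]; exact Real.log_le_log (by linarith) zX
  have hWlt : ⌈3*X⌉₊ < z^(1600*M) := by
    have h1 : ((⌈3*X⌉₊:ℕ):ℝ) < 3*X+1 := Nat.ceil_lt_add_one (by linarith)
    have h2 : X^2 ≤ (z:ℝ)^(1600*M) := by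
      calc X^2 ≤ ((z:ℝ)^(2*(400*M)))^2 := pow_le_pow_left₀ hX0.le hz2 2
        _ = _ := by rw [← pow_mul]; congr 1; ring
    have h3 : ((⌈3*X⌉₊:ℕ):ℝ) < (z:ℝ)^(1600*M) := lt_of_lt_of_le h1 ((aux1 X hX).trans h2)
    exact_mod_cast h3
  have hW2 : ⌈3*X⌉₊ ≤ z^(2^(j+11)) := by
    refine hWlt.le.trans (Nat.pow_le_pow_right (by omega) ?_)
    rw [pow_add, ← hM]; omega
  have hk : 4*(M-2)+8 = 4*M := by omega
  have hs := sk_pos (M-2)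
  have hW3 : 3*X ≤ ((⌈3*X⌉₊:ℕ):ℝ) := Nat.le_ceil _
  have P : Pt z (M-2) ⌈3*X⌉₊ x T (1+1/ℓ) := by
    refine ⟨by omega, by omega, by linarith, by linarith, by linarith, ?_, ?_⟩
    · have : 0 < 1/ℓ := by positivity
      linarith
    · linarith
  have rp : ∀ a b : ℝ, X^a * X^b = X^(a+b) := fun a b => (Real.rpow_add hX0 a b).symm
  have rm : ∀ a b : ℝ, a ≤ b → X^a ≤ X^b := fun a b h => Real.rpow_le_rpow_of_exponent_le hX1 h
  have rn : ∀ a : ℝ, 0 ≤ X^a := fun a => Real.rpow_nonneg hX0.le a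
  have hadm : ∀ d : ℝ, 0 ≤ d → ∀ b x' : ℝ, d ≤ 2*X^b → X^(b+22/100) ≤ 2*x' → adm z (M-2) x' T d := by
    intro d hd b x' hdb hx'
    unfold adm
    rw [hk]
    calc (z:ℝ)^(4*M) * T * d * Real.log z ≤ X^((1:ℝ)/100) * T * (2*X^b) * ℓ := by
          have := rn ((1:ℝ)/100)
          have t0 : 0 ≤ T := by linarith
          gcongr
      _ = (X^((1:ℝ)/100) * X^((1:ℝ)/5) * X^b) * (8 * ℓ) / 2 := by rw [hT]; ring
      _ ≤ (X^((1:ℝ)/100) * X^((1:ℝ)/5) * X^b) * (sk (M-2) * X^((1:ℝ)/100)) / 2 := by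
          have := rn ((1:ℝ)/100)
          have := rn ((1:ℝ)/5)
          have := rn b
          gcongr
      _ = sk (M-2) * (X^((1:ℝ)/100) * X^((1:ℝ)/5) * X^b * X^((1:ℝ)/100)) / 2 := by ring
      _ = sk (M-2) * X^(b+22/100) / 2 := by
          rw [rp, rp, rp]
          congr 3; ring
      _ ≤ sk (M-2) * x' := by
          have := mul_le_mul_of_nonneg_left hx' hs.le
          linarith
  have hU : 1 ≤ X^((22:ℝ)/100) := Real.one_le_rpow hX1 (by norm_num)
  have hzx : (z:ℝ) ≤ x / 3 := by
    have h1 : X^((1:ℝ)/100) ≤ X^((1:ℝ)/2) := rm _ _ (by norm_num)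
    rw [← Real.sqrt_eq_rpow] at h1
    have h2 : √X ≤ X / 6 := by
      have h3 : √X * √X = X := Real.mul_self_sqrt hX0.le
      have h4 : 6 ≤ √X := by
        rw [Real.le_sqrt (by norm_num) hX0.le]; linarith
      exact aux5 _ X h3 h4
    linarith
  have hX11 : X^(1:ℝ) = X := Real.rpow_one X
  have main := mainDet P (by positivity) y hyz (X^((22:ℝ)/100)) H S (1600*M) (2*X^((725:ℝ)/1000)) (1/Real.log y) ((y:ℝ)^(2*R)) (C * Real.log y)
    hU (by rw [hH]; positivity)
    (fun n hn => by rw [hH]; exact Ez_le z _ hU (1600*M) n (lt_of_le_of_lt hn hWlt))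
    hzx
    (hadm _ (by positivity) (23/100) x (by
        calc (z:ℝ) * X^((22:ℝ)/100) ≤ X^((1:ℝ)/100) * X^((22:ℝ)/100) := mul_le_mul_of_nonneg_right zle (rn _)
          _ = X^((23:ℝ)/100) := by rw [rp]; norm_num
          _ ≤ _ := by linarith [rn ((23:ℝ)/100)]) (by
        have := rm (23/100+22/100) 1 (by norm_num)
        rw [hX11] at this
        exact this.trans (by linarith)))
    (by
      have e : (2*X^((725:ℝ)/1000))^2 = 4 * (X * (X^((1:ℝ)/100) * (X^((22:ℝ)/100) * X^((22:ℝ)/100)))) := by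
        nth_rewrite 2 [← hX11]
        rw [rp, rp, rp, mul_pow, ← Real.rpow_natCast, ← Real.rpow_natCast, ← Real.rpow_mul hX0.le]
        norm_num
      rw [e]
      have hu := rn ((22:ℝ)/100)
      calc 3 * x * (z * (X^((22:ℝ)/100) * X^((22:ℝ)/100))) ≤ 4 * X * (X^((1:ℝ)/100) * (X^((22:ℝ)/100) * X^((22:ℝ)/100))) := by
            refine mul_le_mul (by linarith) (mul_le_mul_of_nonneg_right zle (by positivity)) (by positivity) (by linarith)
        _ = _ := by ring)
    (by positivity)
    (hadm _ (by positivity) (725/1000) x le_rfl (by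
        have := rm (725/1000+22/100) 1 (by norm_num)
        rw [hX11] at this
        exact this.trans (by linarith)))
    (hadm _ (by positivity) 0 _ (by rw [Real.rpow_zero]; norm_num) (by rw [zero_add]; linarith))
    (by rw [hS]; exact Real.one_le_exp (by positivity))
    (by rw [hS]; exact Sn_rA z (j+11) _ (by omega) hW2)
    (by rw [hS]; exact Sn_Mz z (j+11) _ _ (by omega) hW2)
    (by have : (32:ℝ) ≤ M := by exact_mod_cast hM32
        linarith)
    (by
      have h1 : ((⌈3*X⌉₊:ℕ):ℝ) ≤ (z:ℝ)^(1600*M) := by exact_mod_cast hWlt.le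
      have h2 := Real.log_le_log (by linarith) h1
      rw [Real.log_pow] at h2; push_cast at h2; exact h2)
    (by positivity)
    (by rw [div_le_one (by linarith)]; exact hly)
    (by positivity) (by positivity) hP
  refine main.trans ?_
  have q0 : 0 ≤ (H*S)^2 := sq_nonneg _
  have i1 : 1 / Real.log z ≤ 800*M/ℓ := by
    rw [div_le_div_iff₀ (by linarith) hℓ0]; linarith
  have i2 : 4/(1/ℓ) * (1+2/(1/ℓ)) * (H*S)^2 ≤ 12*ℓ^2 * (H*S)^2 := by
    refine mul_le_mul_of_nonneg_right ?_ q0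
    rw [div_div_eq_mul_div, div_div_eq_mul_div, div_one, div_one]
    exact aux2 ℓ hℓ1
  have i3 : 1 / Real.log y ≤ 2*R/ℓ := by
    rw [div_le_div_iff₀ (by linarith) hℓ0]; linarith
  have i4 : Real.log y ≤ ℓ / R := by
    rw [le_div_iff₀ hRR]; linarith
  have i5 : 1921 / Real.log z ≤ 1921 * (800*M/ℓ) := by
    calc 1921 / Real.log z = 1921 * (1/Real.log z) := by ring
      _ ≤ _ := by linarith
  have i6 : 8*T^2/(y:ℝ)^(2*R) ≤ 32 * X^((2:ℝ)/5) / X := by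
    have e : 8*T^2 = 32 * X^((2:ℝ)/5) := by
      rw [hT, mul_pow, ← Real.rpow_natCast, ← Real.rpow_natCast, ← Real.rpow_mul hX0.le]
      norm_num
      ring
    rw [e]
    exact div_le_div_of_nonneg_left (mul_nonneg (by norm_num) (rn _)) hX0 hy2
  have hS0 : 0 ≤ S := by rw [hS]; exact (Real.exp_pos _).le
  have d0 : 0 ≤ 4/(1/ℓ) * (1+2/(1/ℓ)) * (H*S)^2 := mul_nonneg (by positivity) q0
  have ly0 : 0 ≤ 1/Real.log y := by positivity
  refine add_le_add ?_ (add_le_add (add_le_add ?_ ?_) ?_)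
  · refine mul_le_mul_of_nonneg_left (by linarith) (by positivity)
  · exact mul_le_mul (pow_le_pow_left₀ ly0 i3 3) i2 d0 (by positivity)
  · refine mul_le_mul ?_ ?_ ?_ ?_
    · exact mul_le_mul_of_nonneg_left (mul_le_mul_of_nonneg_left i4 hC) (by norm_num)
    · refine mul_le_mul_of_nonneg_left i5 (mul_nonneg (sq_nonneg _) hS0)
    · exact mul_nonneg (mul_nonneg (sq_nonneg _) hS0) (by positivity)
    · positivity
  · exact mul_le_mul i6 i2 d0 (div_nonneg (mul_nonneg (by norm_num) (rn _)) hX0.le)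

end TP

namespace TP
open Finset

lemma choose_j : ∃ j : ℕ, 5 ≤ j ∧ 10^6 * (1600*((2^j:ℕ):ℝ)) * (Real.exp (12 * ((j+11:ℕ):ℝ)))^3 * sk (2^j-2) ≤ 1/2000 := by
  set c : ℝ := 10^6 * 1600 * Real.exp (36*11) * (Real.exp 36 * 16^2) with hc
  have hc0 : 0 < c := by positivity
  have h1 := tendsto_pow_const_mul_const_pow_of_abs_lt_one 73 (r := (1/16:ℝ)) (by rw [abs_of_pos] <;> norm_num)
  have h2 := h1.comp (tendsto_pow_atTop_atTop_of_one_lt (show 1 < (2:ℕ) by norm_num))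
  have h3 := h2.eventually (gt_mem_nhds (show (0:ℝ) < 1/2000/c by positivity))
  obtain ⟨j, hj, hj5⟩ := (h3.and (Filter.eventually_ge_atTop 5)).exists
  refine ⟨j, hj5, ?_⟩
  simp only [Function.comp_apply] at hj
  have e1 : (Real.exp (12 * ((j+11:ℕ):ℝ)))^3 ≤ Real.exp (36*11) * ((2^j:ℕ):ℝ)^72 := by
    have a1 : (Real.exp (12 * ((j+11:ℕ):ℝ)))^3 = Real.exp (36*11) * (Real.exp 36)^j := by
      rw [← Real.exp_nat_mul, ← Real.exp_nat_mul, ← Real.exp_add]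
      congr 1; push_cast; ring
    have a2 : Real.exp 36 ≤ 2^72 := by
      have : Real.exp 1 ≤ 4 := by linarith [Real.exp_one_lt_d9]
      calc Real.exp 36 = (Real.exp 1)^36 := by rw [← Real.exp_nat_mul]; norm_num
        _ ≤ 4^36 := pow_le_pow_left₀ (Real.exp_pos 1).le this _
        _ = 2^72 := by norm_num
    rw [a1]
    refine mul_le_mul_of_nonneg_left ?_ (Real.exp_pos _).le
    calc (Real.exp 36)^j ≤ (2^72)^j := pow_le_pow_left₀ (Real.exp_pos _).le a2 _
      _ = ((2^j:ℕ):ℝ)^72 := by push_cast; rw [← pow_mul, ← pow_mul, mul_comm]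
  have hM : 2 ≤ 2^j := by
    calc 2 = 2^1 := by norm_num
      _ ≤ 2^j := Nat.pow_le_pow_right (by norm_num) (by omega)
  have e2 : sk (2^j-2) = Real.exp 36 * 16^2 * (1/16)^(2^j) := by
    unfold sk
    obtain ⟨r, hr⟩ : ∃ r, 2^j = r + 2 := ⟨2^j-2, by omega⟩
    rw [hr, Nat.add_sub_cancel, pow_add]
    ring
  rw [e2]
  generalize hv : 2^j = v at *
  have p0 : (0:ℝ) < (1/16)^v := by positivity
  calc _ ≤ 10^6 * (1600*(v:ℝ)) * (Real.exp (36*11) * (v:ℝ)^72) * (Real.exp 36 * 16^2 * (1/16)^v) := by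
        refine mul_le_mul_of_nonneg_right (mul_le_mul_of_nonneg_left e1 (by positivity)) (by positivity)
    _ = c * ((v:ℝ)^73 * (1/16)^v) := by rw [hc]; ring
    _ ≤ c * (1/2000/c) := mul_le_mul_of_nonneg_left hj.le hc0.le
    _ = 1/2000 := by field_simp

lemma ev_log (c a : ℝ) (n : ℕ) (ha : 0 < a) : ∀ᶠ X : ℝ in Filter.atTop, c * (Real.log X)^n ≤ X^a := by
  have h := (isLittleO_log_rpow_rpow_atTop (n:ℝ) ha)
  have h2 := (h.const_mul_left c).bound (c := 1) one_pos
  filter_upwards [h2, Filter.eventually_ge_atTop 1] with X hX h1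
  rw [one_mul, Real.norm_of_nonneg (Real.rpow_nonneg (by linarith) _), Real.rpow_natCast] at hX
  exact (le_abs_self _).trans hX

lemma ev_logge (c : ℝ) : ∀ᶠ X : ℝ in Filter.atTop, c ≤ Real.log X := Real.tendsto_log_atTop.eventually_ge_atTop c

lemma fin_num (X ℓ M R C H S q c1 : ℝ) (hX : 1 ≤ X) (hℓ : 1 ≤ ℓ) (hR : 0 < R)
    (hj : 10^6*(1600*M)*S^3*q ≤ 1/2000)
    (f1 : 2000 * (10^6*(1600*M)*S^3*(800*M)) ≤ ℓ)
    (f2 : 2000 * ((2*R)^3 * (12 * (H*S)^2)) ≤ ℓ)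
    (f3 : 2000 * (2*C*(H^2*S*(1921*(800*M)))) ≤ R)
    (hc : c1 = 2000 * (384 * (H*S)^2)) (f4 : c1 * ℓ^2 ≤ X^((3:ℝ)/5)) :
    10^6 * (1600*M) * S^3 * (q + 800*M/ℓ) +
      ((2*R/ℓ)^3 * (12 * ℓ^2 * (H*S)^2) + 2 * (C * (ℓ / R)) * (H^2 * S * (1921 * (800*M/ℓ)))
        + 32 * X^((2:ℝ)/5) / X * (12 * ℓ^2 * (H*S)^2)) ≤ 5/2000 := by
  have hℓ0 : 0 < ℓ := by linarith
  have hX0 : 0 < X := by linarith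
  have g1 : 10^6 * (1600*M) * S^3 * (q + 800*M/ℓ) ≤ 2/2000 := by
    have : 10^6*(1600*M)*S^3*(800*M)/ℓ ≤ 1/2000 := by rw [div_le_iff₀ hℓ0]; linarith
    calc _ = 10^6*(1600*M)*S^3*q + 10^6*(1600*M)*S^3*(800*M)/ℓ := by ring
      _ ≤ _ := by linarith
  have g2 : (2*R/ℓ)^3 * (12 * ℓ^2 * (H*S)^2) ≤ 1/2000 := by
    calc _ = (2*R)^3 * (12 * (H*S)^2)/ℓ := by field_simp
      _ ≤ _ := by rw [div_le_iff₀ hℓ0]; linarith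
  have g3 : 2 * (C * (ℓ / R)) * (H^2 * S * (1921 * (800*M/ℓ))) ≤ 1/2000 := by
    calc _ = 2*C*(H^2*S*(1921*(800*M)))/R := by field_simp
      _ ≤ _ := by rw [div_le_iff₀ hR]; linarith
  have g4 : 32 * X^((2:ℝ)/5) / X * (12 * ℓ^2 * (H*S)^2) ≤ 1/2000 := by
    have e : X^((2:ℝ)/5) * X^((3:ℝ)/5) = X := by
      rw [← Real.rpow_add hX0]; norm_num
    have p : 0 ≤ X^((2:ℝ)/5) := Real.rpow_nonneg hX0.le _
    calc _ = X^((2:ℝ)/5) * (c1 * ℓ^2) / (2000 * X) := by rw [hc]; field_simp; ring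
      _ ≤ X^((2:ℝ)/5) * X^((3:ℝ)/5) / (2000 * X) := by
          refine div_le_div_of_nonneg_right (mul_le_mul_of_nonneg_left f4 p) (by positivity)
      _ = 1/2000 := by rw [e]; field_simp
  linarith

lemma up_num (X : ℝ) (hX : 1 ≤ X) (h : 24000 * (Real.log X)^1 ≤ X^((3:ℝ)/10)) :
    2 * (2*X^((1:ℝ)/5)) / X * (3 * √X * Real.log X) ≤ 1/2000 := by
  have hX0 : 0 < X := by linarith
  rw [Real.sqrt_eq_rpow]
  have e : X^((1:ℝ)/5) * X^((1:ℝ)/2) * X^((3:ℝ)/10) = X := by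
    rw [← Real.rpow_add hX0, ← Real.rpow_add hX0]; norm_num
  have p : 0 ≤ X^((1:ℝ)/5) * X^((1:ℝ)/2) := by positivity
  calc _ = X^((1:ℝ)/5) * X^((1:ℝ)/2) * (24000 * (Real.log X)^1) / (2000*X) := by field_simp; ring
    _ ≤ X^((1:ℝ)/5) * X^((1:ℝ)/2) * X^((3:ℝ)/10) / (2000 * X) := by
          refine div_le_div_of_nonneg_right (mul_le_mul_of_nonneg_left h p) (by positivity)
    _ = 1/2000 := by rw [e]; field_simp

lemma core : ∀ᶠ X : ℝ in Filter.atTop, ¬ (∀ p q : ℕ, p.Prime → q.Prime → X - X^((4:ℝ)/5) ≤ p → (p:ℝ) ≤ X →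
    X - X^((4:ℝ)/5) ≤ q → (q:ℝ) ≤ X → p = q) := by
  obtain ⟨C0, hC0, hC3⟩ := C3
  obtain ⟨x0, hx04, hcheb⟩ := cheb_low
  obtain ⟨j, hj5, hj⟩ := choose_j
  obtain ⟨M, hM⟩ : ∃ M : ℕ, M = 2^j := ⟨_, rfl⟩
  rw [← hM] at hj
  obtain ⟨H, hH⟩ : ∃ H : ℝ, H = 2^(1600*M) := ⟨_, rfl⟩
  obtain ⟨S, hS⟩ : ∃ S : ℝ, S = Real.exp (12 * ((j+11:ℕ):ℝ)) := ⟨_, rfl⟩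
  rw [← hS] at hj
  have hM1 : 1 ≤ M := by rw [hM]; exact Nat.one_le_two_pow
  have hCn := Cnp_nonneg
  obtain ⟨R', hR'⟩ := exists_nat_ge (2000 * (2*(C0+Cnp)*(H^2*S*(1921*(800*(M:ℝ))))))
  obtain ⟨R, hRd⟩ : ∃ R, R = max R' (400*M) := ⟨_, rfl⟩
  have hRN : 400*M ≤ R := by rw [hRd]; exact le_max_right _ _
  have hR1 : 1 ≤ R := by omega
  have hRR : 2000 * (2*(C0+Cnp)*(H^2*S*(1921*(800*(M:ℝ))))) ≤ (R:ℝ) :=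
    hR'.trans (by rw [hRd]; exact_mod_cast le_max_left _ _)
  obtain ⟨y0, hy03, hy0⟩ := hC3 (2*R)
  have hs := sk_pos (M-2)
  have hRp : (0:ℝ) < R := by exact_mod_cast hR1
  have hMp : (0:ℝ) < M := by exact_mod_cast hM1
  filter_upwards [Filter.eventually_ge_atTop 36, Filter.eventually_ge_atTop (2*x0), ev_logge (1/sk (M-2)), ev_logge 1,
    ev_log (8/sk (M-2)) (1/100) 1 (by norm_num), ev_logge (2000 * (10^6*(1600*(M:ℝ))*S^3*(800*M))),
    ev_logge (2000 * ((2*(R:ℝ))^3 * (12 * (H*S)^2))), ev_log (2000 * (384 * (H*S)^2)) (3/5) 2 (by norm_num),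
    ev_log 24000 (3/10) 1 (by norm_num), (tendsto_rpow_atTop (show 0 < 1/(R:ℝ) by positivity)).eventually_ge_atTop (max 4 y0)]
    with X hX36 hXx0 k1 hℓ1 k2 k3 k4 k5 k6 k7 huniq
  have hX1 : 1 ≤ X := by linarith
  have hX0 : 0 < X := by linarith
  have hr : X^(1/(R:ℝ)) ≤ X^(1/((400*M:ℕ):ℝ)) := by
    refine Real.rpow_le_rpow_of_exponent_le hX1 (one_div_le_one_div_of_le ?_ ?_)
    · exact_mod_cast (by omega : 0 < 400*M)
    · exact_mod_cast hRN
  have k8 : 4 ≤ X^(1/(R:ℝ)) := (le_max_left _ _).trans k7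
  have k9 : (y0:ℝ) ≤ X^(1/(R:ℝ)) := (le_max_right _ _).trans k7
  have yy := root_bd R hR1 X hX1 k8
  have zz := root_bd (400*M) (by omega) X hX1 (k8.trans hr)
  have hyz : ⌊X^(1/(R:ℝ))⌋₊ ≤ ⌊X^(1/((400*M:ℕ):ℝ))⌋₊ := Nat.floor_le_floor hr
  have hyy0 : y0 ≤ ⌊X^(1/(R:ℝ))⌋₊ := Nat.le_floor k9
  generalize ⌊X^(1/(R:ℝ))⌋₊ = y at *
  generalize ⌊X^(1/((400*M:ℕ):ℝ))⌋₊ = z at *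
  obtain ⟨hy4, hyN, hy2⟩ := yy
  obtain ⟨hz4, hzN, hz2⟩ := zz
  have hδ : 0 < 1/Real.log X := by positivity
  have d := det2 (C := C0+Cnp) hM hj5 hX36 hz4 hzN hz2 hy4 hyz hyN hy2 hR1 (by linarith)
    (by rw [one_div_le (by linarith) hs]; exact k1)
    (by
      rw [pow_one, div_mul_eq_mul_div, div_le_iff₀ hs] at k2
      linarith)
    (fun t ht1 ht2 => by
      refine (PcG y z hyz _ hδ t).trans ?_
      have h1 := hy0 y hyy0 t ht2 ht1 (1+1/Real.log X) (by linarith)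
      have h2 : 1 ≤ Real.log y := logz_ge (by omega)
      have h3 : Cnp * 1 ≤ Cnp * Real.log y := mul_le_mul_of_nonneg_left h2 hCn
      linarith) H S hH hS
  have f := fin_num X (Real.log X) M R (C0+Cnp) H S (sk (M-2)) _ hX1 hℓ1 hRp hj k3 k4 hRR rfl k5
  have d2 := d.trans f
  have hT2 : 2 ≤ 2*X^((1:ℝ)/5) := by
    have := Real.one_le_rpow hX1 (show (0:ℝ) ≤ 1/5 by norm_num); linarith
  have hX45 : X^((4:ℝ)/5) = X * (1/X^((1:ℝ)/5)) := by
    have e : X^((4:ℝ)/5) * X^((1:ℝ)/5) = X := by rw [← Real.rpow_add hX0]; norm_num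
    have : 0 < X^((1:ℝ)/5) := Real.rpow_pos_of_pos hX0 _
    field_simp
    linarith
  have hX15 : 2 ≤ X^((1:ℝ)/5) := by
    calc (2:ℝ) = (32:ℝ)^((1:ℝ)/5) := by
          rw [show (32:ℝ) = 2^(5:ℝ) by norm_num, ← Real.rpow_mul (by norm_num)]; norm_num
      _ ≤ _ := Real.rpow_le_rpow (by norm_num) (by linarith) (by norm_num)
  have u := prime_up X (2*X^((1:ℝ)/5)) (X - X^((4:ℝ)/5)) z ⌈3*X⌉₊ (1/Real.log X) hX1 (by linarith) hδ.le
    (by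
      rw [hX45]
      have : 1/X^((1:ℝ)/5) ≤ 1/2 := one_div_le_one_div_of_le (by norm_num) hX15
      linarith [mul_le_mul_of_nonneg_left this hX0.le])
    (by
      have h1 := Real.add_one_le_exp (-(2/(2*X^((1:ℝ)/5))))
      have h2 : 2/(2*X^((1:ℝ)/5)) = 1/X^((1:ℝ)/5) := by
        rw [← div_div]; norm_num
      rw [h2] at h1 ⊢
      rw [hX45]
      linarith [mul_le_mul_of_nonneg_left h1 hX0.le]) huniq
  have u2 := u.trans (up_num X hX1 k6)
  generalize hT : 2*X^((1:ℝ)/5) = T at *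
  have hxX : X * Real.exp (-(1/T)) ≤ X := by
    have h0 : 0 < 1/T := by positivity
    exact aux3 X _ hX0.le (Real.exp_le_one_iff.mpr (by linarith))
  have hxX2 : X / 2 ≤ X * Real.exp (-(1/T)) := by
    have h1 := Real.add_one_le_exp (-(1/T))
    have h2 : 1/T ≤ 1/2 := one_div_le_one_div_of_le (by norm_num) hT2
    exact aux4 X _ hX0.le (by linarith)
  have hzx : (z:ℝ) ≤ X / 6 := by
    have hz1 : (1:ℝ) ≤ z := by exact_mod_cast (by omega : 1 ≤ z)
    have h1 : (z:ℝ)^2 ≤ X := (pow_le_pow_right₀ hz1 (by omega)).trans hzN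
    have h2 : (z:ℝ) ≤ √X := Real.le_sqrt_of_sq_le h1
    have h3 : √X * √X = X := Real.mul_self_sqrt hX0.le
    have h4 : 6 ≤ √X := by
        rw [Real.le_sqrt (by norm_num) hX0.le]; linarith
    exact h2.trans (aux5 _ X h3 h4)
  have lo := hcheb (X * Real.exp (-(1/T))) (by linarith) z ⌈3*X⌉₊ (1/Real.log X) hδ.le
    (by
      have h1 : Real.log (2*(X * Real.exp (-(1/T)))) ≤ 2 * Real.log X := by
        have e : 2 * Real.log X = Real.log (X^2) := by rw [Real.log_pow]; norm_num
        rw [e]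
        exact Real.log_le_log (by positivity) (by linarith [aux1 X hX36])
      rw [one_div, inv_mul_le_iff₀ (by linarith)]
      linarith)
    (by linarith) (by linarith [Nat.le_ceil (3*X)])
  rw [Df_hd] at d2
  have := neg_abs_le (Df ⌈3*X⌉₊ (fun n => hh (1+1/Real.log X) (X * Real.exp (-(1/T))) T n) (Lz z) - Df ⌈3*X⌉₊ (fun n => hh (1+1/Real.log X) (X * Real.exp (-(1/T))) 1 n) (Lz z))
  linarith

end TP

theorem two_primes_in_short_interval :
    ∀ᶠ X : ℝ in Filter.atTop, ∃ q₁ q₂ : ℕ, q₁.Prime ∧ q₂.Prime ∧ q₁ ≠ q₂ ∧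
      X - X ^ ((4 : ℝ) / 5) ≤ (q₁ : ℝ) ∧ (q₁ : ℝ) ≤ X ∧
      X - X ^ ((4 : ℝ) / 5) ≤ (q₂ : ℝ) ∧ (q₂ : ℝ) ≤ X := by
  filter_upwards [TP.core] with X hX
  by_contra hc
  apply hX
  intro p q hp hq h1 h2 h3 h4
  by_contra hne
  exact hc ⟨p, q, hp, hq, hne, h1, h2, h3, h4⟩
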